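/- For every p with 1 < p < ∞ there exists a constant C = C(p) > 0 such that for every a ∈ ℝ and every f in the Schwartz class on ℝ, the operator C_a f(x) = sup_{N ∈ ℝ} | p.v. ∫_ℝ f(x−t) e^{i(Nt + at²)} dt/t | satisfies ‖C_a f‖_{L^p(ℝ)} ≤ C ‖f‖_{L^p(ℝ)}; the constant C is uniform in the quadratic coefficient a. -/

import Mathlib

namespace Carl
noncomputable section

def phi (t : ℝ) : ℝ := max 0 (min 1 (2 - 2 * |t|))

lemma phi_nonneg (t : ℝ) : 0 ≤ phi t := le_max_left _ _
lemma phi_le_one (t : ℝ) : phi t ≤ 1 := max_le zero_le_one (min_le_left _ _)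
lemma phi_one {t : ℝ} (h : |t| ≤ 1 / 2) : phi t = 1 := by
  unfold phi
  rw [min_eq_left (by linarith), max_eq_right zero_le_one]
lemma phi_zero {t : ℝ} (h : 1 ≤ |t|) : phi t = 0 := by
  unfold phi
  rw [max_eq_left]
  exact (min_le_right _ _).trans (by linarith)
lemma phi_neg (t : ℝ) : phi (-t) = phi t := by simp [phi]
lemma phi_lip (t u : ℝ) : |phi t - phi u| ≤ 2 * |t - u| := by
  unfold phi
  have h1 := abs_max_sub_max_le_abs (min 1 (2 - 2 * |t|)) (min 1 (2 - 2 * |u|)) 0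
  have h2 := abs_min_sub_min_le_max 1 (2 - 2 * |t|) 1 (2 - 2 * |u|)
  have h3 : |(2 - 2 * |t|) - (2 - 2 * |u|)| ≤ 2 * |t - u| := by
    have : (2 - 2 * |t|) - (2 - 2 * |u|) = 2 * (|u| - |t|) := by ring
    rw [this, abs_mul, abs_two, abs_sub_comm t u]
    have := abs_abs_sub_abs_le u t
    linarith
  rw [max_comm 0, max_comm 0]
  refine h1.trans (h2.trans (max_le ?_ h3))
  simp

def num (t : ℝ) : ℝ := phi t - phi (2 * t)
lemma num_small {t : ℝ} (h : |t| ≤ 1 / 4) : num t = 0 := by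
  unfold num
  rw [phi_one (by linarith), phi_one (by rw [abs_mul, abs_two]; linarith), sub_self]
lemma num_big {t : ℝ} (h : 1 ≤ |t|) : num t = 0 := by
  unfold num
  rw [phi_zero h, phi_zero (by rw [abs_mul, abs_two]; linarith), sub_self]
lemma num_abs (t : ℝ) : |num t| ≤ 1 := by
  unfold num
  rw [abs_le]
  constructor <;> linarith [phi_nonneg t, phi_le_one t, phi_nonneg (2 * t), phi_le_one (2 * t)]
lemma num_lip (t u : ℝ) : |num t - num u| ≤ 6 * |t - u| := by
  unfold num
  have h1 := phi_lip t u
  have h2 := phi_lip (2 * t) (2 * u)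
  rw [← mul_sub, abs_mul, abs_two] at h2
  have : phi t - phi (2 * t) - (phi u - phi (2 * u))
      = (phi t - phi u) - (phi (2 * t) - phi (2 * u)) := by ring
  rw [this]
  exact (abs_sub _ _).trans (by linarith)

def psi (t : ℝ) : ℝ := num t / t
lemma psi_abs (t : ℝ) : |psi t| ≤ 4 := by
  unfold psi
  rcases le_or_gt |t| (1 / 4) with h | h
  · simp [num_small h]
  · rw [abs_div, div_le_iff₀ (by linarith)]
    linarith [num_abs t]
lemma psi_lip_aux (t u : ℝ) (hu : 1 / 4 < |u|) : |psi t - psi u| ≤ 40 * |t - u| := by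
  have hu0 : u ≠ 0 := by rintro rfl; simp at hu; linarith
  have hn := num_lip t u
  unfold psi
  rcases le_or_gt |t| (1 / 4) with h | h
  · rw [num_small h] at hn ⊢
    rw [zero_div, zero_sub, abs_neg, abs_div, div_le_iff₀ (by linarith)]
    rw [zero_sub, abs_neg] at hn
    nlinarith [abs_nonneg (t - u)]
  · have ht0 : t ≠ 0 := by rintro rfl; simp at h; linarith
    have : num t / t - num u / u = (num t - num u) / t + num u * (u - t) / (t * u) := by
      field_simp; ring
    rw [this]
    refine (abs_add_le _ _).trans ?_
    rw [abs_div, abs_div, abs_mul, abs_mul, abs_sub_comm u t]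
    have h1 : |num t - num u| / |t| ≤ 24 * |t - u| := by
      rw [div_le_iff₀ (by linarith)]; nlinarith [abs_nonneg (t - u)]
    have h2 : |num u| * |t - u| / (|t| * |u|) ≤ 16 * |t - u| := by
      rw [div_le_iff₀ (by nlinarith)]
      have : 1 / 16 ≤ |t| * |u| := by nlinarith
      nlinarith [abs_nonneg (t - u), num_abs u,
        mul_le_mul_of_nonneg_right (num_abs u) (abs_nonneg (t - u)),
        mul_le_mul_of_nonneg_right this (abs_nonneg (t - u))]
    linarith
lemma psi_lip (t u : ℝ) : |psi t - psi u| ≤ 40 * |t - u| := by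
  rcases le_or_gt |u| (1 / 4) with h | h
  · rcases le_or_gt |t| (1 / 4) with h' | h'
    · simp [psi, num_small h, num_small h']
    · rw [abs_sub_comm, abs_sub_comm t]; exact psi_lip_aux u t h'
  · exact psi_lip_aux t u h

/-- the scale s kernel on the integers -/
def K (s : ℕ) (t : ℤ) : ℝ := psi (t / 2 ^ s) / 2 ^ s

lemma K_abs (s : ℕ) (t : ℤ) : |K s t| ≤ 4 / 2 ^ s := by
  unfold K
  rw [abs_div, abs_of_pos (by positivity : (0 : ℝ) < 2 ^ s)]
  gcongr
  exact psi_abs _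

lemma K_supp (s : ℕ) (t : ℤ) (h : 2 ^ s ≤ |t|) : K s t = 0 := by
  have h' : (2 : ℝ) ^ s ≤ |(t : ℝ)| := by exact_mod_cast h
  unfold K psi
  rw [num_big]; · simp
  rw [abs_div, abs_of_pos (by positivity : (0 : ℝ) < 2 ^ s), le_div_iff₀ (by positivity)]
  linarith

lemma K_lip (s : ℕ) (t u : ℤ) : |K s t - K s u| ≤ 40 / 4 ^ s * |(t : ℝ) - u| := by
  unfold K
  rw [← sub_div, abs_div, abs_of_pos (by positivity : (0 : ℝ) < 2 ^ s)]
  have h := psi_lip (t / 2 ^ s) (u / 2 ^ s)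
  rw [← sub_div, abs_div, abs_of_pos (by positivity : (0 : ℝ) < 2 ^ s)] at h
  have h4 : (4 : ℝ) ^ s = 2 ^ s * 2 ^ s := by rw [← mul_pow]; norm_num
  calc _ ≤ 40 * (|(t : ℝ) - u| / 2 ^ s) / 2 ^ s := by gcongr
    _ = _ := by rw [h4]; field_simp

lemma K_neg (s : ℕ) (t : ℤ) : K s (-t) = - K s t := by
  unfold K psi num
  push_cast
  rw [neg_div, mul_neg, phi_neg, phi_neg, div_neg, neg_div]

lemma K_zero (t : ℤ) : K 0 t = 0 := by
  rcases eq_or_ne t 0 with h | h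
  · simp [K, psi, h]
  · apply K_supp; simpa using Int.one_le_abs h

lemma K_eq (s : ℕ) (t : ℤ) : K s t = (phi (t / 2 ^ s) - phi (2 * (t / 2 ^ s))) / t := by
  unfold K psi num
  rcases eq_or_ne (t : ℝ) 0 with h | h
  · simp [h]
  · field_simp

/-- telescoping -/
lemma K_sum (a b : ℕ) (h : a ≤ b) (t : ℤ) :
    ∑ s ∈ Finset.Ioc a b, K s t = (phi (t / 2 ^ b) - phi (t / 2 ^ a)) / t := by
  induction b, h using Nat.le_induction with
  | base => simp
  | succ b hb ih =>
    rw [← Finset.insert_Ioc_right_eq_Ioc_add_one (by omega), Finset.sum_insert (by simp), ih, K_eq]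
    have : (2 : ℝ) * (t / 2 ^ (b + 1)) = t / 2 ^ b := by rw [pow_succ]; field_simp
    rw [this, ← add_div]; congr 1; ring

end
end Carl

namespace Carl
noncomputable section
open Finset

/-- uncentered maximal function of `h` restricted to the finite set `Z` -/
def M (Z : Finset ℤ) (h : ℤ → ℝ) (x : ℤ) : ℝ :=
  ⨆ ab : ℕ × ℕ, (∑ y ∈ Z with (x - ab.1 ≤ y ∧ y ≤ x + ab.2), h y) / (ab.1 + ab.2 + 1)

lemma M_bdd (Z : Finset ℤ) (h : ℤ → ℝ) (x : ℤ) :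
    BddAbove (Set.range fun ab : ℕ × ℕ =>
      (∑ y ∈ Z with (x - ab.1 ≤ y ∧ y ≤ x + ab.2), h y) / ((ab.1 : ℝ) + ab.2 + 1)) := by
  refine ⟨∑ y ∈ Z, |h y|, ?_⟩
  rintro _ ⟨ab, rfl⟩
  have h1 : (∑ y ∈ Z with (x - ab.1 ≤ y ∧ y ≤ x + ab.2), h y) ≤ ∑ y ∈ Z, |h y| :=
    (Finset.sum_le_sum fun y _ => le_abs_self (h y)).trans
      (Finset.sum_le_sum_of_subset_of_nonneg (Finset.filter_subset _ _) fun _ _ _ => abs_nonneg _)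
  simp only
  rw [div_le_iff₀ (by positivity)]
  have : 0 ≤ ∑ y ∈ Z, |h y| := Finset.sum_nonneg fun _ _ => abs_nonneg _
  have : (0:ℝ) ≤ ab.1 + ab.2 := by positivity
  nlinarith

lemma le_M {Z : Finset ℤ} {h : ℤ → ℝ} (hh : ∀ y, 0 ≤ h y) {x a b : ℤ} {T : Finset ℤ}
    (hT : T ⊆ Z) (hab : ∀ y ∈ T, a ≤ y ∧ y ≤ b) (hx : a ≤ x) (hx' : x ≤ b) :
    ∑ y ∈ T, h y ≤ ((b : ℝ) - a + 1) * M Z h x := by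
  have h1 := le_ciSup (M_bdd Z h x) ((x - a).toNat, (b - x).toNat)
  change _ ≤ M Z h x at h1
  have e1 : ((x - a).toNat : ℤ) = x - a := Int.toNat_of_nonneg (by omega)
  have e2 : ((b - x).toNat : ℤ) = b - x := Int.toNat_of_nonneg (by omega)
  have e1' : ((x - a).toNat : ℝ) = x - a := by exact_mod_cast e1
  have e2' : ((b - x).toNat : ℝ) = b - x := by exact_mod_cast e2
  simp only [e1, e2, e1', e2'] at h1
  have hpos : (0:ℝ) < (x - a) + (b - x) + 1 := by
    have : (a:ℝ) ≤ x := by exact_mod_cast hx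
    have : (x:ℝ) ≤ b := by exact_mod_cast hx'
    linarith
  rw [div_le_iff₀ hpos] at h1
  calc ∑ y ∈ T, h y ≤ ∑ y ∈ Z with (x - (x - a) ≤ y ∧ y ≤ x + (b - x)), h y := by
        apply Finset.sum_le_sum_of_subset_of_nonneg
        · intro y hy
          have := hab y hy
          simp only [Finset.mem_filter]
          exact ⟨hT hy, by omega, by omega⟩
        · intros; apply hh
    _ ≤ _ := by refine h1.trans (le_of_eq ?_); ring

lemma M_nonneg {Z : Finset ℤ} {h : ℤ → ℝ} (hh : ∀ y, 0 ≤ h y) (x : ℤ) : 0 ≤ M Z h x := by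
  have := le_M (Z := Z) hh (x := x) (a := x) (b := x) (T := ∅) (by simp) (by simp) le_rfl le_rfl
  simpa using this

lemma self_le_M {Z : Finset ℤ} {h : ℤ → ℝ} (hh : ∀ y, 0 ≤ h y) {x : ℤ} (hx : x ∈ Z) :
    h x ≤ M Z h x := by
  have := le_M (Z := Z) hh (x := x) (a := x) (b := x) (T := {x}) (by simpa using hx) (by simp)
    le_rfl le_rfl
  simpa using this

lemma lt_M {Z : Finset ℤ} {h : ℤ → ℝ} {x : ℤ} {l : ℝ} (hl : l < M Z h x) :
    ∃ a b : ℤ, a ≤ x ∧ x ≤ b ∧ l * ((b : ℝ) - a + 1) < ∑ y ∈ Z with (a ≤ y ∧ y ≤ b), h y := by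
  obtain ⟨⟨a, b⟩, hab⟩ := exists_lt_of_lt_ciSup hl
  refine ⟨x - a, x + b, by omega, by omega, ?_⟩
  rw [lt_div_iff₀ (by positivity)] at hab
  refine lt_of_eq_of_lt ?_ hab
  push_cast; ring

lemma M_le_of {Z : Finset ℤ} {h : ℤ → ℝ} {x : ℤ} {l : ℝ}
    (H : ∀ a b : ℤ, a ≤ x → x ≤ b → ∑ y ∈ Z with (a ≤ y ∧ y ≤ b), h y ≤ l * ((b : ℝ) - a + 1)) :
    M Z h x ≤ l := by
  by_contra hc
  obtain ⟨a, b, h1, h2, h3⟩ := lt_M (not_le.mp hc)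
  linarith [H a b h1 h2]

lemma card_Icc_real {a b : ℤ} (h : a ≤ b + 1) : ((Finset.Icc a b).card : ℝ) = b - a + 1 := by
  rw [Int.card_Icc]
  have : ((b + 1 - a).toNat : ℤ) = b + 1 - a := Int.toNat_of_nonneg (by omega)
  have : ((b + 1 - a).toNat : ℝ) = b + 1 - a := by exact_mod_cast this
  rw [this]; ring

lemma M_weak {Z : Finset ℤ} {h : ℤ → ℝ} (hh : ∀ y, 0 ≤ h y) {l : ℝ} (hl : 0 ≤ l) (A : Finset ℤ)
    (hA : ∀ x ∈ A, l < M Z h x) : l * A.card ≤ 5 * ∑ y ∈ Z, h y := by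
  classical
  choose! a b h1 h2 h3 using fun x (hx : x ∈ A) => lt_M (hA x hx)
  obtain ⟨R, hR⟩ : ∃ R : ℝ, ∀ x ∈ A, ((b x : ℝ) - a x + 1) ≤ R := by
    rcases A.eq_empty_or_nonempty with h | h
    · exact ⟨0, by simp [h]⟩
    · exact ⟨A.sup' h fun x => ((b x : ℝ) - a x + 1), fun x hx =>
        Finset.le_sup' (fun x => ((b x : ℝ) - a x + 1)) hx⟩
  obtain ⟨u, hu, hdis, hcov⟩ := Vitali.exists_disjoint_subfamily_covering_enlargement
    (fun x => Set.Icc (a x) (b x)) (A : Set ℤ) (fun x => (b x : ℝ) - a x + 1) 2 (by norm_num)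
    (fun x hx => by
      have : (a x : ℝ) ≤ b x := by exact_mod_cast (h1 x hx).trans (h2 x hx)
      linarith) R hR (fun x hx => ⟨x, h1 x hx, h2 x hx⟩)
  have huf : u.Finite := A.finite_toSet.subset hu
  lift u to Finset ℤ using huf
  have hu' : u ⊆ A := by exact_mod_cast hu
  have hsub : A ⊆ u.biUnion fun x => Finset.Icc (a x - 2 * (b x - a x + 1)) (b x + 2 * (b x - a x + 1)) := by
    intro x hx
    obtain ⟨z, hz, ⟨w, hw1, hw2⟩, hle⟩ := hcov x hx
    have hle' : (b x - a x + 1) ≤ 2 * (b z - a z + 1) := by exact_mod_cast hle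
    rw [Finset.mem_biUnion]
    refine ⟨z, hz, ?_⟩
    have := h1 x hx
    have := h2 x hx
    simp only [Set.mem_Icc] at hw1 hw2
    rw [Finset.mem_Icc]; constructor <;> omega
  have hcard : (A.card : ℝ) ≤ ∑ x ∈ u, 5 * ((b x : ℝ) - a x + 1) := by
    calc (A.card : ℝ) ≤ ((u.biUnion fun x => Finset.Icc (a x - 2 * (b x - a x + 1)) (b x + 2 * (b x - a x + 1))).card : ℝ) := by
          exact_mod_cast Finset.card_le_card hsub
      _ ≤ ∑ x ∈ u, ((Finset.Icc (a x - 2 * (b x - a x + 1)) (b x + 2 * (b x - a x + 1))).card : ℝ) := by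
          exact_mod_cast Finset.card_biUnion_le
      _ ≤ _ := by
          apply Finset.sum_le_sum
          intro x hx
          have := (h1 x (hu' hx)).trans (h2 x (hu' hx))
          rw [card_Icc_real (by omega)]
          push_cast
          have : (a x : ℝ) ≤ b x := by exact_mod_cast this
          linarith
  calc l * A.card ≤ l * ∑ x ∈ u, 5 * ((b x : ℝ) - a x + 1) := by gcongr
    _ = 5 * ∑ x ∈ u, l * ((b x : ℝ) - a x + 1) := by rw [Finset.mul_sum, Finset.mul_sum]; congr 1; ext; ring
    _ ≤ 5 * ∑ x ∈ u, ∑ y ∈ Z with (a x ≤ y ∧ y ≤ b x), h y := by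
        gcongr with x hx
        exact (h3 x (hu' hx)).le
    _ = 5 * ∑ y ∈ u.biUnion (fun x => Z.filter fun y => (a x ≤ y ∧ y ≤ b x)), h y := by
        rw [Finset.sum_biUnion]
        intro x hx z hz hxz
        rw [Function.onFun, Finset.disjoint_left]
        intro y hy hy'
        simp only [Finset.mem_filter] at hy hy'
        exact Set.disjoint_left.mp (hdis hx hz hxz) hy.2 hy'.2
    _ ≤ _ := by
        refine mul_le_mul_of_nonneg_left ?_ (by norm_num)
        apply Finset.sum_le_sum_of_subset_of_nonneg
        · intro y; simp only [Finset.mem_biUnion, Finset.mem_filter]; rintro ⟨_, _, h, _⟩; exact h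
        · intros; apply hh

lemma geomZ {r B : ℝ} (hr : 1 < r) (hB : 0 ≤ B) (T : Finset ℤ) (hT : ∀ k ∈ T, r ^ k ≤ B) :
    ∑ k ∈ T, r ^ k ≤ B * (1 - r⁻¹)⁻¹ := by
  have hr0 : 0 < r := by linarith
  have hi : r⁻¹ < 1 := inv_lt_one_of_one_lt₀ hr
  rcases T.eq_empty_or_nonempty with h | h
  · simp only [h, sum_empty]
    have : 0 < 1 - r⁻¹ := by linarith
    positivity
  · set m := T.max' h
    have hm : r ^ m ≤ B := hT m (T.max'_mem h)
    have e : ∀ k ∈ T, r ^ k = r ^ m * (r⁻¹) ^ ((m - k).toNat) := by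
      intro k hk
      have : k ≤ m := T.le_max' k hk
      rw [← zpow_natCast, Int.toNat_of_nonneg (by omega), inv_zpow', ← zpow_add₀ hr0.ne']
      congr 1; ring
    rw [Finset.sum_congr rfl e, ← Finset.mul_sum]
    have hinj : Set.InjOn (fun k : ℤ => (m - k).toNat) T := by
      intro k hk k' hk' hkk
      have : k ≤ m := T.le_max' k hk
      have : k' ≤ m := T.le_max' k' hk'
      simp only at hkk
      omega
    have hs : ∑ k ∈ T, (r⁻¹) ^ ((m - k).toNat) ≤ (1 - r⁻¹)⁻¹ := by
      rw [← Finset.sum_image (f := fun j => (r⁻¹) ^ j) hinj, ← tsum_geometric_of_lt_one (by positivity) hi]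
      exact (summable_geometric_of_lt_one (by positivity) hi).sum_le_tsum _ (fun _ _ => by positivity)
    have : 0 ≤ ∑ k ∈ T, (r⁻¹) ^ ((m - k).toNat) := by positivity
    exact mul_le_mul hm hs this hB

lemma geom_up {B : ℝ} (hB : 0 ≤ B) (T : Finset ℕ) (hT : ∀ k ∈ T, (2:ℝ) ^ k ≤ B) :
    ∑ k ∈ T, (2:ℝ) ^ k ≤ 2 * B := by
  have := geomZ (r := 2) (by norm_num) hB (T.map ⟨fun n : ℕ => (n:ℤ), Nat.cast_injective⟩)
    (by simpa using hT)
  rw [Finset.sum_map] at this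
  simp only [Function.Embedding.coeFn_mk, zpow_natCast] at this
  norm_num at this ⊢; linarith

lemma geom_down {B : ℝ} (hB : 0 ≤ B) (T : Finset ℕ) (hT : ∀ k ∈ T, 1 / (2:ℝ) ^ k ≤ B) :
    ∑ k ∈ T, 1 / (2:ℝ) ^ k ≤ 2 * B := by
  have := geomZ (r := 2) (by norm_num) hB (T.image fun n : ℕ => -(n:ℤ))
    (by intro k hk; obtain ⟨n, hn, rfl⟩ := Finset.mem_image.mp hk
        have := hT n hn; rw [zpow_neg, zpow_natCast, ← one_div]; exact this)
  rw [Finset.sum_image (fun a _ b _ h => by simpa using h)] at this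
  simp only [zpow_neg, zpow_natCast, ← one_div] at this
  norm_num at this ⊢; linarith

lemma zpow_rpow {b : ℝ} (hb : 0 < b) (k : ℤ) (p : ℝ) : (b ^ k) ^ p = (b ^ p) ^ k := by
  rw [← Real.rpow_intCast, ← Real.rpow_intCast, ← Real.rpow_mul hb.le, ← Real.rpow_mul hb.le, mul_comm]

lemma layer_up {b p : ℝ} (hb : 1 < b) (hp : 0 < p) (A : Finset ℤ) (v : ℤ → ℝ) (hv : ∀ x, 0 ≤ v x) :
    ∃ T : Finset ℤ, ∑ x ∈ A, v x ^ p ≤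
      b ^ p * ∑ k ∈ T, (b ^ k) ^ p * ((A.filter fun x => b ^ k < v x).card : ℝ) := by
  classical
  have hb0 : 0 < b := by linarith
  have : ∀ x, ∃ k : ℤ, 0 < v x → b ^ k < v x ∧ v x ≤ b ^ (k + 1) := by
    intro x
    by_cases h : 0 < v x
    · obtain ⟨k, hk⟩ := exists_mem_Ioc_zpow h hb
      exact ⟨k, fun _ => hk⟩
    · exact ⟨0, fun h' => absurd h' h⟩
  choose k hk using this
  refine ⟨A.image k, ?_⟩
  have e : ∀ j : ℤ, ((A.filter fun x => b ^ j < v x).card : ℝ) = ∑ x ∈ A, if b ^ j < v x then (1:ℝ) else 0 := by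
    intro j; simp
  simp_rw [e, Finset.mul_sum]
  rw [Finset.sum_comm]
  gcongr with x hx
  rcases (hv x).eq_or_lt with h | h
  · rw [← h, Real.zero_rpow hp.ne']
    apply Finset.sum_nonneg
    intro j hj
    split_ifs <;> positivity
  · obtain ⟨h1, h2⟩ := hk x h
    have : v x ^ p ≤ b ^ p * ((b ^ (k x)) ^ p * if b ^ (k x) < v x then (1:ℝ) else 0) := by
      rw [if_pos h1, mul_one, ← Real.mul_rpow hb0.le (by positivity)]
      refine Real.rpow_le_rpow h.le (h2.trans (le_of_eq ?_)) hp.le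
      rw [zpow_add_one₀ hb0.ne', mul_comm]
    refine this.trans ?_
    exact Finset.single_le_sum (f := fun j => b ^ p * ((b ^ j) ^ p * if b ^ j < v x then (1:ℝ) else 0))
      (fun j _ => by split_ifs <;> positivity) (Finset.mem_image_of_mem k hx)

lemma layer_down_pt {b p : ℝ} (hb : 1 < b) (hp : 0 < p) {v : ℝ} (hv : 0 ≤ v) (T : Finset ℤ)
    (hT : ∀ k ∈ T, b ^ k ≤ v) : ∑ k ∈ T, (b ^ k) ^ p ≤ (1 - (b ^ p)⁻¹)⁻¹ * v ^ p := by
  have hb0 : 0 < b := by linarith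
  have := geomZ (r := b ^ p) (B := v ^ p) (Real.one_lt_rpow hb hp) (by positivity) T (fun k hk => by
    rw [← zpow_rpow hb0]
    exact Real.rpow_le_rpow (by positivity) (hT k hk) hp.le)
  simp_rw [zpow_rpow hb0]
  linarith

lemma layer_down {b p : ℝ} (hb : 1 < b) (hp : 0 < p) (A : Finset ℤ) (v : ℤ → ℝ) (hv : ∀ x, 0 ≤ v x)
    (T : Finset ℤ) : ∑ k ∈ T, (b ^ k) ^ p * ((A.filter fun x => b ^ k < v x).card : ℝ)
      ≤ (1 - (b ^ p)⁻¹)⁻¹ * ∑ x ∈ A, v x ^ p := by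
  classical
  have e : ∀ j : ℤ, ((A.filter fun x => b ^ j < v x).card : ℝ) = ∑ x ∈ A, if b ^ j < v x then (1:ℝ) else 0 := by
    intro j; simp
  simp_rw [e, Finset.mul_sum]
  rw [Finset.sum_comm]
  gcongr with x hx
  simp only [mul_ite, mul_one, mul_zero]
  rw [← Finset.sum_filter]
  exact layer_down_pt hb hp (hv x) _ (by simp; intro k _ h; exact h.le)

lemma M_weak' {Z : Finset ℤ} {h : ℤ → ℝ} (hh : ∀ y, 0 ≤ h y) {l : ℝ} (hl : 0 < l) (A : Finset ℤ)
    (hA : ∀ x ∈ A, l < M Z h x) : l * A.card ≤ 10 * ∑ y ∈ Z with l / 2 < h y, h y := by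
  have := M_weak (Z := Z) (h := fun y => if l / 2 < h y then h y else 0)
    (fun y => by split_ifs <;> simp [hh]) (l := l / 2) (by linarith) A ?_
  · rw [← Finset.sum_filter] at this; linarith
  intro x hx
  by_contra hc
  push Not at hc
  have : M Z h x ≤ l := by
    apply M_le_of
    intro a b ha hb
    have h1 := le_M (Z := Z) (h := fun y => if l / 2 < h y then h y else 0)
      (fun y => by split_ifs <;> simp [hh]) (x := x) (a := a) (b := b)
      (T := Z.filter fun y => a ≤ y ∧ y ≤ b) (Finset.filter_subset _ _)
      (fun y hy => (Finset.mem_filter.mp hy).2) ha hb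
    have hab : (0:ℝ) ≤ b - a + 1 := by
      have : (a:ℝ) ≤ b := by exact_mod_cast ha.trans hb
      linarith
    have h2 : ∑ y ∈ Z with (a ≤ y ∧ y ≤ b), h y ≤ ∑ y ∈ Z with (a ≤ y ∧ y ≤ b), ((if l / 2 < h y then h y else 0) + l / 2) := by
      apply Finset.sum_le_sum
      intro y _
      split_ifs with hy
      · linarith
      · linarith
    rw [Finset.sum_add_distrib, Finset.sum_const, nsmul_eq_mul] at h2
    have h3 : ((Z.filter fun y => a ≤ y ∧ y ≤ b).card : ℝ) ≤ b - a + 1 := by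
      rw [← card_Icc_real (by omega)]
      exact_mod_cast Finset.card_le_card (fun y hy => by simp at hy ⊢; omega)
    nlinarith [mul_le_mul_of_nonneg_left hc hab]
  linarith [hA x hx]

theorem M_strong (p : ℝ) (hp : 1 < p) : ∃ C : ℝ, 0 < C ∧ ∀ (Z : Finset ℤ) (h : ℤ → ℝ),
    (∀ y, 0 ≤ h y) → ∀ A : Finset ℤ, ∑ x ∈ A, M Z h x ^ p ≤ C * ∑ y ∈ Z, h y ^ p := by
  have h2 : (1:ℝ) < 2 ^ (p - 1) := Real.one_lt_rpow (by norm_num) (by linarith)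
  have h2' : 0 < 1 - ((2:ℝ) ^ (p - 1))⁻¹ := by
    have := inv_lt_one_of_one_lt₀ h2; linarith
  refine ⟨2 ^ p * (10 * ((1 - ((2:ℝ) ^ (p - 1))⁻¹)⁻¹ * 2 ^ (p - 1))), by positivity, ?_⟩
  intro Z h hh A
  obtain ⟨T, hT⟩ := layer_up (b := 2) (by norm_num) (by linarith : 0 < p) A (M Z h) (fun x => M_nonneg hh x)
  refine hT.trans ?_
  rw [mul_assoc]
  gcongr
  calc ∑ k ∈ T, ((2:ℝ) ^ k) ^ p * ((A.filter fun x => (2:ℝ) ^ k < M Z h x).card : ℝ)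
      ≤ ∑ k ∈ T, ((2:ℝ) ^ k) ^ (p - 1) * (10 * ∑ y ∈ Z with (2:ℝ) ^ k / 2 < h y, h y) := by
        refine Finset.sum_le_sum fun k hk => ?_
        have hk0 : (0:ℝ) < 2 ^ k := by positivity
        have := M_weak' (Z := Z) hh hk0 (A.filter fun x => (2:ℝ) ^ k < M Z h x)
          (fun x hx => (Finset.mem_filter.mp hx).2)
        have e : ((2:ℝ) ^ k) ^ p = ((2:ℝ) ^ k) ^ (p - 1) * 2 ^ k := by
          rw [← Real.rpow_add_one hk0.ne']; congr 1; ring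
        rw [e, mul_assoc]
        gcongr
    _ = 10 * ∑ y ∈ Z, h y * ∑ k ∈ T with (2:ℝ) ^ k / 2 < h y, ((2:ℝ) ^ k) ^ (p - 1) := by
        simp_rw [Finset.sum_filter, Finset.mul_sum]
        rw [Finset.sum_comm]
        refine Finset.sum_congr rfl fun y _ => Finset.sum_congr rfl fun k _ => ?_
        split_ifs <;> ring
    _ ≤ 10 * ∑ y ∈ Z, h y * ((1 - ((2:ℝ) ^ (p - 1))⁻¹)⁻¹ * (2 * h y) ^ (p - 1)) := by
        gcongr with y hy
        · exact hh y
        · apply layer_down_pt (by norm_num) (by linarith) (by linarith [hh y])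
          intro k hk
          have := (Finset.mem_filter.mp hk).2
          linarith
    _ = _ := by
        rw [mul_assoc, Finset.mul_sum (a := (1 - ((2:ℝ) ^ (p - 1))⁻¹)⁻¹ * 2 ^ (p - 1))]
        congr 1
        refine Finset.sum_congr rfl fun y _ => ?_
        rw [Real.mul_rpow (by norm_num) (hh y)]
        rcases (hh y).eq_or_lt with h0 | h0
        · rw [← h0, Real.zero_rpow (by linarith : p ≠ 0)]; ring
        · have : h y ^ p = h y ^ (p - 1) * h y := by
            rw [← Real.rpow_add_one h0.ne']; congr 1; ring
          rw [this]; ring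

end
end Carl

namespace Carl
noncomputable section
open Finset

def ee (θ : ℝ) : ℂ := Complex.exp (θ * Complex.I)

@[simp] lemma norm_ee (θ : ℝ) : ‖ee θ‖ = 1 := Complex.norm_exp_ofReal_mul_I θ
lemma ee_add (a b : ℝ) : ee (a + b) = ee a * ee b := by
  unfold ee; rw [← Complex.exp_add]; push_cast; ring_nf
@[simp] lemma ee_zero : ee 0 = 1 := by simp [ee]
lemma conj_ee (a : ℝ) : (starRingEnd ℂ) (ee a) = ee (-a) := by
  unfold ee; rw [← Complex.exp_conj]; simp
lemma ee_neg_mul (a : ℝ) : ee (-a) * ee a = 1 := by rw [← ee_add]; simp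
lemma ee_sub_one (a : ℝ) : ‖ee a - 1‖ = 2 * |Real.sin (a / 2)| := by
  unfold ee
  rw [mul_comm, Complex.norm_exp_I_mul_ofReal_sub_one]
  simp
lemma ee_sub_one_le (a : ℝ) : ‖ee a - 1‖ ≤ |a| := by
  rw [ee_sub_one]
  have := Real.abs_sin_le_abs (x := a / 2)
  rw [abs_div, abs_two] at this
  linarith
lemma ee_sub_le (a b : ℝ) : ‖ee a - ee b‖ ≤ |a - b| := by
  have : ee a - ee b = ee b * (ee (a - b) - 1) := by
    rw [mul_sub, ← ee_add]; simp
  rw [this, norm_mul, norm_ee, one_mul]; exact ee_sub_one_le _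
lemma le_ee_sub_one {a : ℝ} (h : |a| ≤ Real.pi) : |a| / 2 ≤ ‖ee a - 1‖ := by
  rw [ee_sub_one]
  have h1 := Real.mul_abs_le_abs_sin (x := a / 2) (by rw [abs_div, abs_two]; linarith)
  rw [abs_div, abs_two] at h1
  have h2 : 1 / 2 ≤ 2 / Real.pi := by
    rw [div_le_div_iff₀ (by norm_num) Real.pi_pos]; linarith [Real.pi_lt_four]
  nlinarith [abs_nonneg a]

/-- sums of functions supported in a window -/
lemma sum_window {E : Type*} [AddCommMonoid E] (Φ : ℤ → E) (W W' : Finset ℤ)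
    (h : ∀ y, Φ y ≠ 0 → y ∈ W) (h' : ∀ y, Φ y ≠ 0 → y ∈ W') : ∑ y ∈ W, Φ y = ∑ y ∈ W', Φ y := by
  classical
  rw [← Finset.sum_filter_ne_zero, ← Finset.sum_filter_ne_zero (s := W')]
  congr 1
  ext y
  simp only [mem_filter]
  exact ⟨fun hy => ⟨h' y hy.2, hy.2⟩, fun hy => ⟨h y hy.2, hy.2⟩⟩

lemma sum_shift {E : Type*} [AddCommMonoid E] (Φ : ℤ → E) (a b c : ℤ) :
    ∑ y ∈ Icc (a + c) (b + c), Φ (y - c) = ∑ y ∈ Icc a b, Φ y := by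
  refine Finset.sum_nbij' (fun y => y - c) (fun y => y + c) ?_ ?_ ?_ ?_ ?_ <;> simp <;> omega

lemma SBP {Φ : ℤ → ℂ} {θ V : ℝ} (hθ : θ ≠ 0) (hθ' : |θ| ≤ Real.pi) (x : ℤ) (r : ℕ)
    (hs : ∀ y, (r : ℤ) ≤ |y - x| → Φ y = 0) (hV : ∀ y, ‖Φ y - Φ (y - 1)‖ ≤ V) (W : Finset ℤ)
    (hW : ∀ y, |y - x| < r → y ∈ W) : ‖∑ y ∈ W, Φ y * ee (θ * y)‖ ≤ 4 * r * V / |θ| := by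
  have hθ0 : 0 < |θ| := abs_pos.mpr hθ
  have hne : ∀ y, Φ y * ee (θ * y) ≠ 0 → |y - x| < r := by
    intro y hy; by_contra hc; rw [hs y (by omega)] at hy; simp at hy
  rw [sum_window (fun y => Φ y * ee (θ * y)) W (Icc (x - r + 1) (x + r)) (fun y hy => hW y (hne y hy))
    (fun y hy => by have := abs_lt.mp (hne y hy); rw [mem_Icc]; omega)]
  set Sg := ∑ y ∈ Icc (x - r + 1) (x + r), Φ y * ee (θ * y) with hSg
  have e1 : ∑ y ∈ Icc (x - r + 1) (x + r), Φ (y - 1) * ee (θ * y) = ee θ * Sg := by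
    have : ∀ y : ℤ, Φ (y - 1) * ee (θ * y) = ee θ * (Φ (y - 1) * ee (θ * ((y - 1 : ℤ) : ℝ))) := by
      intro y
      have : θ * (y : ℝ) = θ + θ * ((y - 1 : ℤ) : ℝ) := by push_cast; ring
      rw [this, ee_add]; ring
    rw [Finset.sum_congr rfl fun y _ => this y, ← Finset.mul_sum]
    congr 1
    have := sum_shift (fun y => Φ y * ee (θ * y)) (x - r) (x + r - 1) 1
    simp only [sub_add_cancel] at this
    rw [this, hSg]
    apply sum_window
    · intro y hy; have := abs_lt.mp (hne y hy); rw [mem_Icc]; omega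
    · intro y hy; have := abs_lt.mp (hne y hy); rw [mem_Icc]; omega
  have e2 : ∑ y ∈ Icc (x - r + 1) (x + r), (Φ y - Φ (y - 1)) * ee (θ * y) = -(ee θ - 1) * Sg := by
    simp_rw [sub_mul]
    rw [Finset.sum_sub_distrib, e1, ← hSg]; ring
  have h1 : ‖∑ y ∈ Icc (x - r + 1) (x + r), (Φ y - Φ (y - 1)) * ee (θ * y)‖ ≤ 2 * r * V := by
    refine (norm_sum_le_of_le (f := _) _ (n := fun _ => V) (fun y _ => ?_)).trans ?_
    · rw [norm_mul, norm_ee, mul_one]; exact hV y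
    · rw [sum_const, nsmul_eq_mul, card_Icc_real (by omega)]
      push_cast; apply le_of_eq; ring
  rw [e2, norm_mul, norm_neg] at h1
  have h2 := le_ee_sub_one hθ'
  rw [le_div_iff₀ hθ0]
  nlinarith [norm_nonneg Sg, mul_le_mul_of_nonneg_right h2 (norm_nonneg Sg)]

lemma K_sum_zero (s : ℕ) (x : ℤ) (W : Finset ℤ) (hW : ∀ y, |y - x| < 2 ^ s → y ∈ W) :
    ∑ y ∈ W, K s (x - y) = 0 := by
  have hne : ∀ y, K s (x - y) ≠ 0 → |y - x| < 2 ^ s := by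
    intro y hy; by_contra hc; exact hy (K_supp _ _ (by rw [abs_sub_comm]; omega))
  rw [sum_window (fun y => K s (x - y)) W (Icc (x - 2 ^ s) (x + 2 ^ s)) (fun y hy => hW y (hne y hy))
    (fun y hy => by have := abs_lt.mp (hne y hy); rw [mem_Icc]; omega)]
  have : ∑ y ∈ Icc (x - 2 ^ s) (x + 2 ^ s), K s (x - y) = ∑ y ∈ Icc (x - 2 ^ s) (x + 2 ^ s), - K s (x - y) := by
    refine Finset.sum_nbij' (fun y => 2 * x - y) (fun y => 2 * x - y) ?_ ?_ ?_ ?_ ?_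
    · intro y hy; simp only [mem_Icc] at hy ⊢; omega
    · intro y hy; simp only [mem_Icc] at hy ⊢; omega
    · intro y _; ring
    · intro y _; ring
    · intro y _; rw [← K_neg]; congr 1; ring
  rw [Finset.sum_neg_distrib] at this
  linarith

lemma Khat_le (s : ℕ) (θ : ℝ) (hθ : |θ| ≤ Real.pi) (W : Finset ℤ) (hW : ∀ y, |y| < 2 ^ s → y ∈ W) :
    ‖∑ t ∈ W, (K s t : ℂ) * ee (θ * t)‖ ≤ 12 * (2 ^ s * |θ|) := by
  have h0 : ∑ t ∈ W, K s t = 0 := by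
    have h := K_sum_zero s 0 W (by simpa using hW)
    simp only [zero_sub, K_neg, Finset.sum_neg_distrib] at h
    linarith
  have h0' : ∑ t ∈ W, (K s t : ℂ) = 0 := by exact_mod_cast congrArg (fun r : ℝ => (r : ℂ)) h0
  have e : ∑ t ∈ W, (K s t : ℂ) * ee (θ * t) = ∑ t ∈ W, (K s t : ℂ) * (ee (θ * t) - 1) := by
    simp_rw [mul_sub]; rw [Finset.sum_sub_distrib]; simp [h0']
  have hne : ∀ y, (K s y : ℂ) * (ee (θ * y) - 1) ≠ 0 → |y| < 2 ^ s := by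
    intro y hy; by_contra hc; rw [K_supp _ _ (by omega)] at hy; simp at hy
  rw [e, sum_window (fun t : ℤ => (K s t : ℂ) * (ee (θ * t) - 1)) W (Icc (- 2 ^ s) (2 ^ s))
    (fun y hy => hW y (hne y hy)) (fun y hy => by have := abs_lt.mp (hne y hy); rw [mem_Icc]; omega)]
  refine (norm_sum_le_of_le (f := _) _ (n := fun _ => 4 * |θ|) (fun y hy => ?_)).trans ?_
  · rw [norm_mul, Complex.norm_real, Real.norm_eq_abs]
    have h1 := K_abs s y
    have h2 := ee_sub_one_le (θ * y)
    have h3 : |(y : ℝ)| ≤ 2 ^ s := by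
      rw [mem_Icc] at hy
      have : |y| ≤ 2 ^ s := abs_le.mpr ⟨by omega, by omega⟩
      exact_mod_cast this
    calc |K s y| * ‖ee (θ * y) - 1‖ ≤ 4 / 2 ^ s * (|θ| * 2 ^ s) := by
          rw [abs_mul] at h2
          refine mul_le_mul h1 (h2.trans (by gcongr)) (norm_nonneg _) (by positivity)
      _ = _ := by field_simp
  · rw [sum_const, nsmul_eq_mul, card_Icc_real (by have : (0:ℤ) < 2 ^ s := by positivity
                                                   omega)]
    push_cast
    have : (1:ℝ) ≤ 2 ^ s := one_le_pow₀ (by norm_num)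
    nlinarith [abs_nonneg θ, mul_le_mul_of_nonneg_right this (abs_nonneg θ)]

lemma Khat_le' (s : ℕ) (θ : ℝ) (h0 : θ ≠ 0) (hθ : |θ| ≤ Real.pi) (W : Finset ℤ) (hW : ∀ y, |y| < 2 ^ s → y ∈ W) :
    ‖∑ t ∈ W, (K s t : ℂ) * ee (θ * t)‖ ≤ 160 * (1 / 2 ^ s / |θ|) := by
  have := SBP (Φ := fun t => (K s t : ℂ)) (V := 40 / 4 ^ s) h0 hθ 0 (2 ^ s)
    (fun y hy => by rw [K_supp s y (by simpa using hy)]; simp)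
    (fun y => by
      have := K_lip s y (y - 1)
      rw [← Complex.ofReal_sub, Complex.norm_real, Real.norm_eq_abs]
      refine this.trans (le_of_eq ?_)
      push_cast; simp) W (by simpa using hW)
  refine this.trans (le_of_eq ?_)
  have h4 : (4 : ℝ) ^ s = 2 ^ s * 2 ^ s := by rw [← mul_pow]; norm_num
  push_cast; rw [h4]
  have : 0 < |θ| := abs_pos.mpr h0
  field_simp; norm_num

lemma khat_bound (T : Finset ℕ) (θ : ℝ) (hθ : |θ| ≤ Real.pi) (W : Finset ℤ)
    (hW : ∀ s ∈ T, ∀ y, |y| < 2 ^ s → y ∈ W) :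
    ‖∑ t ∈ W, ((∑ s ∈ T, K s t : ℝ) : ℂ) * ee (θ * t)‖ ≤ 350 := by
  have e : ∑ t ∈ W, ((∑ s ∈ T, K s t : ℝ) : ℂ) * ee (θ * t) = ∑ s ∈ T, ∑ t ∈ W, (K s t : ℂ) * ee (θ * t) := by
    rw [Finset.sum_comm]
    refine Finset.sum_congr rfl fun t _ => ?_
    push_cast; rw [Finset.sum_mul]
  rw [e]
  rcases eq_or_ne θ 0 with h0 | h0
  · refine (norm_sum_le_of_le _ (n := fun _ => 0) (fun s hs => ?_)).trans (by simp)
    have := Khat_le s θ hθ W (hW s hs)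
    simpa [h0] using this
  have hp : 0 < |θ| := abs_pos.mpr h0
  rw [← Finset.sum_filter_add_sum_filter_not T (fun s => (2:ℝ) ^ s * |θ| ≤ 1)]
  refine (norm_add_le _ _).trans ?_
  have h1 : ‖∑ s ∈ T with (2:ℝ) ^ s * |θ| ≤ 1, ∑ t ∈ W, (K s t : ℂ) * ee (θ * t)‖ ≤ 24 := by
    refine (norm_sum_le_of_le _ (fun s hs => Khat_le s θ hθ W (hW s (mem_filter.mp hs).1))).trans ?_
    rw [← Finset.mul_sum, ← Finset.sum_mul]
    have := geom_up (B := 1 / |θ|) (by positivity) (T.filter fun s => (2:ℝ) ^ s * |θ| ≤ 1)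
      (fun k hk => by rw [le_div_iff₀ hp]; exact (mem_filter.mp hk).2)
    have := mul_le_mul_of_nonneg_right this hp.le
    rw [mul_assoc 2, one_div, inv_mul_cancel₀ hp.ne'] at this
    linarith
  have h2 : ‖∑ s ∈ T with ¬ (2:ℝ) ^ s * |θ| ≤ 1, ∑ t ∈ W, (K s t : ℂ) * ee (θ * t)‖ ≤ 320 := by
    refine (norm_sum_le_of_le _ (fun s hs => Khat_le' s θ h0 hθ W (hW s (mem_filter.mp hs).1))).trans ?_
    rw [← Finset.mul_sum, ← Finset.sum_div]
    have := geom_down (B := |θ|) (by positivity) (T.filter fun s => ¬ (2:ℝ) ^ s * |θ| ≤ 1)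
      (fun k hk => by
        have := (mem_filter.mp hk).2
        rw [div_le_iff₀ (by positivity)]; linarith)
    have : (∑ k ∈ T with ¬ (2:ℝ) ^ k * |θ| ≤ 1, 1 / (2:ℝ) ^ k) / |θ| ≤ 2 := by
      rw [div_le_iff₀ hp]; exact this
    linarith
  linarith

open MeasureTheory in
lemma ee_cont : Continuous ee := by unfold ee; fun_prop

lemma ee_int (n : ℤ) : ∫ θ in (-Real.pi)..Real.pi, ee (θ * n) = if n = 0 then (2 * Real.pi : ℂ) else 0 := by
  split_ifs with h
  · subst h; simp; norm_cast; ring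
  · have hn : (n : ℂ) * Complex.I ≠ 0 := by simp [h]
    have := integral_exp_mul_complex (a := -Real.pi) (b := Real.pi) hn
    have e : (fun θ : ℝ => ee (θ * n)) = fun θ : ℝ => Complex.exp (n * Complex.I * θ) := by
      ext θ; unfold ee; push_cast; ring_nf
    rw [e, this]
    have : Complex.exp (n * Complex.I * (Real.pi : ℝ)) = Complex.exp (n * Complex.I * ((-Real.pi : ℝ) : ℂ)) := by
      rw [Complex.exp_eq_exp_iff_exists_int]
      exact ⟨n, by push_cast; ring⟩
    rw [this]; simp

lemma parseval (X : Finset ℤ) (c : ℤ → ℂ) :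
    ∫ θ in (-Real.pi)..Real.pi, ‖∑ x ∈ X, c x * ee (θ * x)‖ ^ 2 = 2 * Real.pi * ∑ x ∈ X, ‖c x‖ ^ 2 := by
  have key : ∫ θ in (-Real.pi)..Real.pi, ((‖∑ x ∈ X, c x * ee (θ * x)‖ ^ 2 : ℝ) : ℂ)
      = ((2 * Real.pi * ∑ x ∈ X, ‖c x‖ ^ 2 : ℝ) : ℂ) := by
    have e : ∀ θ : ℝ, ((‖∑ x ∈ X, c x * ee (θ * x)‖ ^ 2 : ℝ) : ℂ) =
        ∑ x ∈ X, ∑ y ∈ X, (c x * (starRingEnd ℂ) (c y)) * ee (θ * ((x - y : ℤ) : ℝ)) := by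
      intro θ
      push_cast
      rw [← Complex.mul_conj', map_sum, Finset.sum_mul_sum]
      refine Finset.sum_congr rfl fun x _ => Finset.sum_congr rfl fun y _ => ?_
      have : θ * ((x:ℝ) - y) = θ * x + -(θ * y) := by ring
      rw [map_mul, conj_ee, this, ee_add]; ring
    simp_rw [e]
    have hc : ∀ n : ℤ, Continuous fun θ : ℝ => ee (θ * n) := fun n => ee_cont.comp (by fun_prop)
    rw [intervalIntegral.integral_finsetSum]
    swap
    · intro x _
      apply Continuous.intervalIntegrable
      refine continuous_finsetSum _ fun y _ => continuous_const.mul (hc _)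
    have : ∀ x ∈ X, ∫ θ in (-Real.pi)..Real.pi, ∑ y ∈ X, (c x * (starRingEnd ℂ) (c y)) * ee (θ * ((x - y : ℤ) : ℝ)) = 2 * Real.pi * ‖c x‖ ^ 2 := by
      intro x hx
      rw [intervalIntegral.integral_finsetSum]
      swap
      · intro y _
        exact (continuous_const.mul (hc _)).intervalIntegrable _ _
      simp_rw [intervalIntegral.integral_const_mul, ee_int]
      rw [Finset.sum_eq_single x]
      · rw [sub_self, if_pos rfl, Complex.mul_conj']; ring
      · intro y _ hy; rw [if_neg (by omega)]; simp
      · intro h; exact absurd hx h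
    rw [Finset.sum_congr rfl this]
    push_cast
    rw [Finset.mul_sum]
  rw [intervalIntegral.integral_ofReal] at key
  exact_mod_cast key

/-- the truncated Hilbert transform kernels are bounded on l^2 -/
lemma H_L2 (T : Finset ℕ) (Z A : Finset ℤ) (f : ℤ → ℂ) :
    ∑ x ∈ A, ‖∑ y ∈ Z, ((∑ s ∈ T, K s (x - y) : ℝ) : ℂ) * f y‖ ^ 2 ≤ 350 ^ 2 * ∑ y ∈ Z, ‖f y‖ ^ 2 := by
  classical
  obtain ⟨b, hb⟩ : ∃ b : ℕ, ∀ s ∈ T, s ≤ b := ⟨T.sup id, fun s hs => Finset.le_sup (f := id) hs⟩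
  set W : Finset ℤ := Icc (-2 ^ b) (2 ^ b)
  set X : Finset ℤ := A ∪ (Z ×ˢ W).image (fun q => q.1 + q.2) with hX
  set k : ℤ → ℝ := fun t => ∑ s ∈ T, K s t
  have hk : ∀ t, k t ≠ 0 → t ∈ W := by
    intro t ht
    by_contra hc
    apply ht
    refine Finset.sum_eq_zero fun s hs => K_supp _ _ ?_
    by_contra h2
    have : (2:ℤ) ^ s ≤ 2 ^ b := pow_le_pow_right₀ (by norm_num) (hb s hs)
    have := abs_lt.mp (not_le.mp h2)
    exact hc (by rw [mem_Icc]; omega)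
  set h : ℤ → ℂ := fun x => ∑ y ∈ Z, (k (x - y) : ℂ) * f y
  have hA : ∑ x ∈ A, ‖h x‖ ^ 2 ≤ ∑ x ∈ X, ‖h x‖ ^ 2 :=
    Finset.sum_le_sum_of_subset_of_nonneg subset_union_left (fun _ _ _ => by positivity)
  refine hA.trans ?_
  have hprod : ∀ θ : ℝ, ∑ x ∈ X, h x * ee (θ * x) =
      (∑ t ∈ W, (k t : ℂ) * ee (θ * t)) * ∑ y ∈ Z, f y * ee (θ * y) := by
    intro θ
    rw [Finset.mul_sum]
    simp_rw [h, Finset.sum_mul]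
    rw [Finset.sum_comm]
    refine Finset.sum_congr rfl fun y hy => ?_
    have h1 : ∀ x : ℤ, (k (x - y) : ℂ) * f y * ee (θ * x) =
        (fun t : ℤ => (k t : ℂ) * ee (θ * t) * (f y * ee (θ * y))) (x - y) := by
      intro x
      have : θ * (x : ℝ) = θ * ((x - y : ℤ) : ℝ) + θ * y := by push_cast; ring
      simp only
      rw [this, ee_add]; ring
    have h2 := sum_shift (fun t : ℤ => (k t : ℂ) * ee (θ * t) * (f y * ee (θ * y))) (-2 ^ b) (2 ^ b) y
    change _ = ∑ t ∈ W, _ at h2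
    rw [← h2, Finset.sum_congr rfl fun x _ => h1 x]
    apply sum_window
    · intro x hx
      have : x - y ∈ W := hk _ (by rintro hc; simp [hc] at hx)
      rw [hX, mem_union, mem_image]
      right
      exact ⟨(y, x - y), by simp [hy, this], by simp⟩
    · intro x hx
      have : x - y ∈ W := hk _ (by rintro hc; simp [hc] at hx)
      rw [mem_Icc] at this ⊢; omega
  have hW : ∀ s ∈ T, ∀ y : ℤ, |y| < 2 ^ s → y ∈ W := by
    intro s hs y hy
    have : (2:ℤ) ^ s ≤ 2 ^ b := pow_le_pow_right₀ (by norm_num) (hb s hs)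
    have := abs_lt.mp hy
    rw [mem_Icc]; omega
  have hcont : ∀ (X : Finset ℤ) (c : ℤ → ℂ), Continuous fun θ : ℝ => ‖∑ x ∈ X, c x * ee (θ * x)‖ ^ 2 := by
    intro X c
    refine ((continuous_finsetSum _ fun x _ => continuous_const.mul (ee_cont.comp (by fun_prop))).norm).pow 2
  have hintg : ∫ θ in (-Real.pi)..Real.pi, ‖∑ x ∈ X, h x * ee (θ * x)‖ ^ 2 ≤
      ∫ θ in (-Real.pi)..Real.pi, 350 ^ 2 * ‖∑ y ∈ Z, f y * ee (θ * y)‖ ^ 2 := by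
    apply intervalIntegral.integral_mono_on (by linarith [Real.pi_pos])
    · exact (hcont _ _).intervalIntegrable _ _
    · exact (continuous_const.mul (hcont _ _)).intervalIntegrable _ _
    · intro θ hθ
      rw [hprod, norm_mul, mul_pow]
      have := khat_bound T θ (abs_le.mpr ⟨hθ.1, hθ.2⟩) W hW
      gcongr
  rw [intervalIntegral.integral_const_mul, parseval, parseval] at hintg
  have := Real.pi_pos
  nlinarith [hintg]

end
end Carl

namespace Carl
noncomputable section
open Finset

/-- families of kernels at scales `1..S` -/
structure CZ (S : ℕ) (X : Finset ℤ) (κ : ℕ → ℤ → ℤ → ℂ) (B : ℝ) : Prop where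
  size : ∀ s x y, ‖κ s x y‖ ≤ B / 2 ^ s
  supp : ∀ s x y, (2:ℤ) ^ s ≤ |x - y| → κ s x y = 0
  lip : ∀ s x y y', ‖κ s x y - κ s x y'‖ ≤ B / 4 ^ s * |(y:ℝ) - y'|
  canc : ∀ x ∈ X, ∀ W : Finset ℤ, (∀ y, |y - x| < 2 ^ S → y ∈ W) →
    ∑ s ∈ Icc 1 S, ‖∑ y ∈ W, κ s x y‖ ≤ B

lemma four_pow (s : ℕ) : (4 : ℝ) ^ s = 2 ^ s * 2 ^ s := by rw [← mul_pow]; norm_num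

lemma two_pow_cast (s : ℕ) : (((2:ℤ) ^ s : ℤ) : ℝ) = 2 ^ s := by push_cast; rfl

lemma one_le_two_pow' (s : ℕ) : (1:ℝ) ≤ 2 ^ s := one_le_pow₀ (by norm_num)

def hs (X : Finset ℤ) (κ : ℕ → ℤ → ℤ → ℂ) (g : ℤ → ℂ) (s : ℕ) (y : ℤ) : ℂ := ∑ x ∈ X, κ s x y * g x

/-- window sums vs maximal function -/
lemma win_le_M {Z : Finset ℤ} {h : ℤ → ℝ} (hh : ∀ y, 0 ≤ h y) (z : ℤ) (c s : ℕ) (T : Finset ℤ)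
    (hT : T ⊆ Z) (hw : ∀ y ∈ T, |y - z| ≤ c * 2 ^ s) :
    ∑ y ∈ T, h y ≤ (2 * c + 1) * 2 ^ s * M Z h z := by
  have hp : (0:ℤ) ≤ c * 2 ^ s := by positivity
  have := le_M (Z := Z) hh (x := z) (a := z - c * 2 ^ s) (b := z + c * 2 ^ s) hT
    (fun y hy => by have := abs_le.mp (hw y hy); omega) (by omega) (by omega)
  refine this.trans ?_
  have h1 := M_nonneg (Z := Z) hh z
  have h2 := one_le_two_pow' s
  gcongr
  push_cast
  linarith

lemma CZ.B_nonneg {S : ℕ} {X : Finset ℤ} {κ : ℕ → ℤ → ℤ → ℂ} {B : ℝ} (H : CZ S X κ B) : 0 ≤ B := by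
  have := (norm_nonneg _).trans (H.size 0 0 0)
  simpa using this

lemma hs_lip {S : ℕ} {X : Finset ℤ} {κ : ℕ → ℤ → ℤ → ℂ} {B : ℝ} (H : CZ S X κ B) (g : ℤ → ℂ)
    (a : ℕ) (y y' z : ℤ) (hy : |y - z| ≤ 2 * 2 ^ a) (hy' : |y' - z| ≤ 2 * 2 ^ a) :
    ‖∑ s ∈ Icc a S, (hs X κ g s y - hs X κ g s y')‖ ≤
      14 * B * |(y:ℝ) - y'| / 2 ^ a * M X (fun x => ‖g x‖) z := by
  classical
  have hB := H.B_nonneg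
  have hM := M_nonneg (Z := X) (h := fun x => ‖g x‖) (fun x => norm_nonneg _) z
  have key : ∀ s ∈ Icc a S, ‖hs X κ g s y - hs X κ g s y'‖ ≤
      7 * B * |(y:ℝ) - y'| * M X (fun x => ‖g x‖) z * (1 / 2 ^ s) := by
    intro s hsa
    have has : a ≤ s := (mem_Icc.mp hsa).1
    have h2 : (2:ℤ) ^ a ≤ 2 ^ s := pow_le_pow_right₀ (by norm_num) has
    unfold hs
    rw [← Finset.sum_sub_distrib]
    have e : ∑ x ∈ X, (κ s x y * g x - κ s x y' * g x) =
        ∑ x ∈ X with |x - z| ≤ (3:ℕ) * 2 ^ s, (κ s x y * g x - κ s x y' * g x) := by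
      symm
      apply Finset.sum_filter_of_ne
      intro x _ hx
      by_contra hc
      apply hx
      push_cast at hc
      rw [H.supp s x y, H.supp s x y']; · simp
      all_goals (by_contra h3; push Not at h3; have := abs_lt.mp h3; have := abs_le.mp hy; have := abs_le.mp hy'; apply hc; rw [abs_le]; constructor <;> omega)
    rw [e]
    refine (norm_sum_le_of_le _ (n := fun x => B / 4 ^ s * |(y:ℝ) - y'| * ‖g x‖) (fun x _ => ?_)).trans ?_
    · rw [← sub_mul, norm_mul]
      gcongr
      exact H.lip s x y y'
    · rw [← Finset.mul_sum]
      have := win_le_M (Z := X) (h := fun x => ‖g x‖) (fun x => norm_nonneg _) z 3 s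
        (X.filter fun x => |x - z| ≤ (3:ℕ) * 2 ^ s) (filter_subset _ _) (fun x hx => (mem_filter.mp hx).2)
      calc _ ≤ B / 4 ^ s * |(y:ℝ) - y'| * ((2 * (3:ℕ) + 1) * 2 ^ s * M X (fun x => ‖g x‖) z) := by gcongr
        _ = _ := by rw [four_pow]; push_cast; field_simp; ring
  refine (norm_sum_le_of_le _ key).trans ?_
  rw [← Finset.mul_sum]
  have hg := geom_down (B := 1 / 2 ^ a) (by positivity) (Icc a S) (fun k hk => by
    have := (mem_Icc.mp hk).1
    gcongr; norm_num)
  calc _ ≤ 7 * B * |(y:ℝ) - y'| * M X (fun x => ‖g x‖) z * (2 * (1 / 2 ^ a)) := by gcongr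
    _ = _ := by field_simp; ring

def tent (a : ℕ) (y0 y : ℤ) : ℝ := max 0 (1 - |(y:ℝ) - y0| / 2 ^ a)
lemma tent_nonneg (a : ℕ) (y0 y : ℤ) : 0 ≤ tent a y0 y := le_max_left _ _
lemma tent_le (a : ℕ) (y0 y : ℤ) : tent a y0 y ≤ 1 := by
  have : 0 ≤ |(y:ℝ) - y0| / 2 ^ a := by positivity
  exact max_le (zero_le_one : (0:ℝ) ≤ 1) (by linarith)
lemma tent_zero (a : ℕ) (y0 y : ℤ) (h : (2:ℤ) ^ a ≤ |y - y0|) : tent a y0 y = 0 := by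
  have h' : (2:ℝ) ^ a ≤ |(y:ℝ) - y0| := by exact_mod_cast h
  apply max_eq_left
  have : 1 ≤ |(y:ℝ) - y0| / 2 ^ a := by rw [le_div_iff₀ (by positivity)]; linarith
  linarith
lemma tent_lip (a : ℕ) (y0 y y' : ℤ) : |tent a y0 y - tent a y0 y'| ≤ |(y:ℝ) - y'| / 2 ^ a := by
  unfold tent
  rw [max_comm 0, max_comm 0]
  refine (abs_max_sub_max_le_abs _ _ _).trans ?_
  have : 1 - |(y:ℝ) - y0| / 2 ^ a - (1 - |(y':ℝ) - y0| / 2 ^ a) = (|(y':ℝ) - y0| - |(y:ℝ) - y0|) / 2 ^ a := by ring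
  rw [this, abs_div, abs_of_pos (by positivity : (0:ℝ) < 2 ^ a)]
  refine div_le_div_of_nonneg_right ?_ (by positivity)
  have h1 : |(|(y':ℝ) - y0| - |(y:ℝ) - y0|)| ≤ |((y':ℝ) - y0) - ((y:ℝ) - y0)| := abs_abs_sub_abs_le_abs_sub _ _
  have h2 : ((y':ℝ) - y0) - ((y:ℝ) - y0) = -((y:ℝ) - y') := by ring
  rw [h2, abs_neg] at h1
  exact h1

lemma tent_sum (a : ℕ) (ha : 1 ≤ a) (y0 : ℤ) :
    (2:ℝ) ^ a / 2 ≤ ∑ y ∈ Icc (y0 - 2 ^ a) (y0 + 2 ^ a), tent a y0 y := by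
  obtain ⟨b, rfl⟩ : ∃ b, a = b + 1 := ⟨a - 1, by omega⟩
  have hp : (0:ℤ) < 2 ^ b := by positivity
  calc (2:ℝ) ^ (b + 1) / 2 ≤ ∑ y ∈ Icc (y0 - 2 ^ b) (y0 + 2 ^ b), (1 / 2 : ℝ) := by
        rw [sum_const, nsmul_eq_mul, card_Icc_real (by omega)]
        push_cast; rw [pow_succ]; linarith
    _ ≤ ∑ y ∈ Icc (y0 - 2 ^ b) (y0 + 2 ^ b), tent (b + 1) y0 y := by
        apply Finset.sum_le_sum
        intro y hy
        rw [mem_Icc] at hy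
        have h1 : |y - y0| ≤ 2 ^ b := abs_le.mpr ⟨by omega, by omega⟩
        have h2 : |(y:ℝ) - y0| ≤ 2 ^ b := by exact_mod_cast h1
        refine le_trans ?_ (le_max_right _ _)
        have : |(y:ℝ) - y0| / 2 ^ (b + 1) ≤ 1 / 2 := by
          rw [div_le_iff₀ (by positivity), pow_succ]; linarith
        linarith
    _ ≤ _ := by
        apply Finset.sum_le_sum_of_subset_of_nonneg
        · apply Icc_subset_Icc <;> rw [pow_succ] <;> omega
        · intros; apply tent_nonneg

lemma cotlar {S : ℕ} {X : Finset ℤ} {κ : ℕ → ℤ → ℤ → ℂ} {B : ℝ} (H : CZ S X κ B) (g : ℤ → ℂ)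
    (Z : Finset ℤ) (hZ : ∀ x ∈ X, ∀ y, |y - x| < 2 ^ S → y ∈ Z) (a : ℕ) (ha : 1 ≤ a) (y0 : ℤ) :
    ‖∑ s ∈ Icc a S, hs X κ g s y0‖ ≤ 84 * B * M X (fun x => ‖g x‖) y0
      + 6 * M Z (fun y => ‖∑ s ∈ Icc 1 S, hs X κ g s y‖) y0 := by
  classical
  have hB := H.B_nonneg
  set Mg := M X (fun x => ‖g x‖) y0 with hMg
  set MH := M Z (fun y => ‖∑ s ∈ Icc 1 S, hs X κ g s y‖) y0 with hMH
  have hM : 0 ≤ Mg := M_nonneg (fun x => norm_nonneg _) y0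
  have hMH0 : 0 ≤ MH := M_nonneg (fun x => norm_nonneg _) y0
  rcases lt_or_ge S a with hSa | hSa
  · rw [Icc_eq_empty (by omega)]; simp; positivity
  set V := Icc (y0 - 2 ^ a) (y0 + 2 ^ a) with hV
  set w := tent a y0 with hw
  set W0 := ∑ y ∈ V, w y with hW0
  have hW0' : (2:ℝ) ^ a / 2 ≤ W0 := tent_sum a ha y0
  have hpos : (0:ℝ) < 2 ^ a := by positivity
  have hVM : ∀ y ∈ V, |y - y0| ≤ 2 ^ a := by
    intro y hy; rw [hV, mem_Icc] at hy; rw [abs_le]; omega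
  -- decomposition
  have hdec : (W0 : ℂ) * ∑ s ∈ Icc a S, hs X κ g s y0 =
      ∑ y ∈ V, (w y : ℂ) * (∑ s ∈ Icc a S, (hs X κ g s y0 - hs X κ g s y))
      + ∑ y ∈ V, (w y : ℂ) * (∑ s ∈ Icc 1 S, hs X κ g s y)
      - ∑ y ∈ V, (w y : ℂ) * (∑ s ∈ Ico 1 a, hs X κ g s y) := by
    rw [hW0]; push_cast; rw [Finset.sum_mul, ← Finset.sum_add_distrib, ← Finset.sum_sub_distrib]
    refine Finset.sum_congr rfl fun y _ => ?_
    have : ∑ s ∈ Icc 1 S, hs X κ g s y = ∑ s ∈ Ico 1 a, hs X κ g s y + ∑ s ∈ Icc a S, hs X κ g s y := by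
      rw [← Finset.sum_union]
      · congr 1; ext s; simp only [mem_Icc, mem_union, mem_Ico]; omega
      · rw [Finset.disjoint_left]; intro s; simp only [mem_Icc, mem_Ico]; omega
    rw [this, Finset.sum_sub_distrib]; ring
  have t1 : ‖∑ y ∈ V, (w y : ℂ) * (∑ s ∈ Icc a S, (hs X κ g s y0 - hs X κ g s y))‖ ≤ W0 * (14 * B * Mg) := by
    rw [hW0, Finset.sum_mul]
    refine norm_sum_le_of_le _ fun y hy => ?_
    rw [norm_mul, Complex.norm_real, Real.norm_eq_abs, abs_of_nonneg (tent_nonneg _ _ _)]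
    have h0 : (0:ℤ) < 2 ^ a := by positivity
    have h0' := hVM y hy
    have h1 := hs_lip H g a y0 y y0 (by simp) (by linarith)
    refine mul_le_mul_of_nonneg_left (h1.trans ?_) (tent_nonneg _ _ _)
    have h2 : |(y0:ℝ) - y| ≤ 2 ^ a := by rw [abs_sub_comm]; exact_mod_cast hVM y hy
    calc 14 * B * |(y0:ℝ) - y| / 2 ^ a * Mg ≤ 14 * B * 2 ^ a / 2 ^ a * Mg := by gcongr
      _ = _ := by field_simp
  have t2 : ‖∑ y ∈ V, (w y : ℂ) * (∑ s ∈ Icc 1 S, hs X κ g s y)‖ ≤ 3 * 2 ^ a * MH := by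
    have e : ∑ y ∈ V, (w y : ℂ) * (∑ s ∈ Icc 1 S, hs X κ g s y) =
        ∑ y ∈ V with y ∈ Z, (w y : ℂ) * (∑ s ∈ Icc 1 S, hs X κ g s y) := by
      symm
      apply Finset.sum_filter_of_ne
      intro y _ hy
      by_contra hc
      apply hy
      rw [Finset.sum_eq_zero, mul_zero]
      intro s hs'
      refine Finset.sum_eq_zero fun x hx => ?_
      rw [H.supp, zero_mul]
      by_contra h3
      apply hc
      refine hZ x hx y ?_
      rw [abs_sub_comm]
      have : (2:ℤ) ^ s ≤ 2 ^ S := pow_le_pow_right₀ (by norm_num) (mem_Icc.mp hs').2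
      omega
    rw [e]
    refine (norm_sum_le_of_le _ (n := fun y => ‖∑ s ∈ Icc 1 S, hs X κ g s y‖) fun y hy => ?_).trans ?_
    · rw [norm_mul, Complex.norm_real, Real.norm_eq_abs, abs_of_nonneg (tent_nonneg _ _ _)]
      exact mul_le_of_le_one_left (norm_nonneg _) (tent_le _ _ _)
    · have := win_le_M (Z := Z) (h := fun y => ‖∑ s ∈ Icc 1 S, hs X κ g s y‖) (fun x => norm_nonneg _) y0 1 a
        (V.filter fun y => y ∈ Z) (fun y hy => (mem_filter.mp hy).2)
        (fun y hy => by simpa using hVM y (mem_filter.mp hy).1)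
      refine this.trans (le_of_eq ?_)
      push_cast; ring
  have t3 : ‖∑ y ∈ V, (w y : ℂ) * (∑ s ∈ Ico 1 a, hs X κ g s y)‖ ≤ 35 * 2 ^ a * B * Mg := by
    have e : ∑ y ∈ V, (w y : ℂ) * (∑ s ∈ Ico 1 a, hs X κ g s y) =
        ∑ x ∈ X with |x - y0| ≤ (2:ℕ) * 2 ^ a, g x * ∑ s ∈ Ico 1 a, ∑ y ∈ V, (w y : ℂ) * κ s x y := by
      have e1 : ∑ y ∈ V, (w y : ℂ) * (∑ s ∈ Ico 1 a, hs X κ g s y) =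
        ∑ x ∈ X, g x * ∑ s ∈ Ico 1 a, ∑ y ∈ V, (w y : ℂ) * κ s x y := by
        unfold hs
        simp_rw [Finset.mul_sum]
        rw [Finset.sum_congr rfl fun y _ => Finset.sum_comm, Finset.sum_comm]
        refine Finset.sum_congr rfl fun x _ => ?_
        rw [Finset.sum_comm]
        refine Finset.sum_congr rfl fun s _ => Finset.sum_congr rfl fun y _ => ?_
        ring
      rw [e1]
      symm
      apply Finset.sum_filter_of_ne
      intro x _ hx
      by_contra hc
      apply hx
      rw [Finset.sum_eq_zero, mul_zero]
      intro s hs'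
      refine Finset.sum_eq_zero fun y hy => ?_
      rw [H.supp, mul_zero]
      by_contra h3
      apply hc
      have : (2:ℤ) ^ s ≤ 2 ^ a := pow_le_pow_right₀ (by norm_num) (mem_Ico.mp hs').2.le
      have := abs_le.mp (hVM y hy)
      have := abs_lt.mp (not_le.mp h3)
      push_cast
      rw [abs_le]; omega
    rw [e]
    refine (norm_sum_le_of_le _ (n := fun x => 7 * B * ‖g x‖) fun x hx => ?_).trans ?_
    · rw [norm_mul, mul_comm]
      refine mul_le_mul_of_nonneg_right ?_ (norm_nonneg _)
      have hxX : x ∈ X := (mem_filter.mp hx).1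
      set U := V ∪ Icc (x - 2 ^ S) (x + 2 ^ S) with hU
      have hUw : ∀ y, |y - x| < 2 ^ S → y ∈ U := by
        intro y hy; have := abs_lt.mp hy
        rw [hU, mem_union]; right; rw [mem_Icc]; omega
      have hVU : ∀ s, ∑ y ∈ V, (w y : ℂ) * κ s x y = ∑ y ∈ U, (w y : ℂ) * κ s x y := by
        intro s
        apply Finset.sum_subset subset_union_left
        intro y _ hy
        rw [hw, tent_zero]; · simp
        by_contra h3
        have := abs_lt.mp (not_le.mp h3)
        apply hy; rw [hV, mem_Icc]; omega
      have hb : ∀ s ∈ Ico 1 a, ‖∑ y ∈ V, (w y : ℂ) * κ s x y‖ ≤ ‖∑ y ∈ U, κ s x y‖ + 3 * B / 2 ^ a * 2 ^ s := by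
        intro s hs'
        rw [hVU]
        have e2 : ∑ y ∈ U, (w y : ℂ) * κ s x y = (w x : ℂ) * ∑ y ∈ U, κ s x y + ∑ y ∈ U, ((w y : ℂ) - w x) * κ s x y := by
          rw [Finset.mul_sum, ← Finset.sum_add_distrib]
          refine Finset.sum_congr rfl fun y _ => ?_
          ring
        rw [e2]
        refine (norm_add_le _ _).trans (add_le_add ?_ ?_)
        · rw [norm_mul, Complex.norm_real, Real.norm_eq_abs, abs_of_nonneg (tent_nonneg _ _ _)]
          exact mul_le_of_le_one_left (norm_nonneg _) (tent_le _ _ _)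
        · have e3 : ∑ y ∈ U, ((w y : ℂ) - w x) * κ s x y = ∑ y ∈ Icc (x - 2 ^ s) (x + 2 ^ s), ((w y : ℂ) - w x) * κ s x y := by
            have hn : ∀ y, ((w y : ℂ) - w x) * κ s x y ≠ 0 → |y - x| < 2 ^ s := by
              intro y hy
              by_contra hc
              apply hy
              rw [H.supp, mul_zero]; rw [abs_sub_comm]; omega
            apply sum_window
            · intro y hy
              apply hUw
              have : (2:ℤ) ^ s ≤ 2 ^ S := pow_le_pow_right₀ (by norm_num) ((mem_Ico.mp hs').2.le.trans hSa)
              linarith [hn y hy]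
            · intro y hy
              have := abs_lt.mp (hn y hy)
              rw [mem_Icc]; omega
          rw [e3]
          refine (norm_sum_le_of_le _ (n := fun _ => 2 ^ s / 2 ^ a * (B / 2 ^ s)) fun y hy => ?_).trans ?_
          · rw [norm_mul]
            refine mul_le_mul ?_ (H.size s x y) (norm_nonneg _) (by positivity)
            rw [← Complex.ofReal_sub, Complex.norm_real, Real.norm_eq_abs]
            refine (tent_lip a y0 y x).trans ?_
            gcongr
            rw [mem_Icc] at hy
            have : |y - x| ≤ 2 ^ s := abs_le.mpr ⟨by omega, by omega⟩
            exact_mod_cast this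
          · rw [sum_const, nsmul_eq_mul, card_Icc_real (by have : (0:ℤ) < 2 ^ s := by positivity
                                                           omega)]
            push_cast
            have e4 : (2:ℝ) ^ s / 2 ^ a * (B / 2 ^ s) = B / 2 ^ a := by field_simp
            rw [e4]
            have := one_le_two_pow' s
            have h5 : 0 ≤ B / 2 ^ a := by positivity
            calc _ = B / 2 ^ a * (2 * 2 ^ s + 1) := by ring
              _ ≤ B / 2 ^ a * (3 * 2 ^ s) := by gcongr; linarith
              _ = _ := by ring
      refine (norm_sum_le_of_le _ hb).trans ?_
      rw [Finset.sum_add_distrib, ← Finset.mul_sum]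
      have c1 : ∑ s ∈ Ico 1 a, ‖∑ y ∈ U, κ s x y‖ ≤ B := by
        refine le_trans ?_ (H.canc x hxX U hUw)
        apply Finset.sum_le_sum_of_subset_of_nonneg
        · intro s; simp only [mem_Ico, mem_Icc]; omega
        · intros; positivity
      have c2 := geom_up (B := 2 ^ a) (by positivity) (Ico 1 a) (fun k hk => by
        have := (mem_Ico.mp hk).2.le
        gcongr; norm_num)
      have c3 : 3 * B / 2 ^ a * ∑ s ∈ Ico 1 a, (2:ℝ) ^ s ≤ 3 * B / 2 ^ a * (2 * 2 ^ a) := by gcongr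
      have c4 : 3 * B / 2 ^ a * (2 * 2 ^ a) = 6 * B := by field_simp; ring
      linarith
    · rw [← Finset.mul_sum]
      have := win_le_M (Z := X) (h := fun x => ‖g x‖) (fun x => norm_nonneg _) y0 2 a
        (X.filter fun x => |x - y0| ≤ (2:ℕ) * 2 ^ a) (filter_subset _ _) (fun x hx => (mem_filter.mp hx).2)
      calc _ ≤ 7 * B * ((2 * (2:ℕ) + 1) * 2 ^ a * Mg) := by gcongr
        _ = _ := by push_cast; ring
  have htot : W0 * ‖∑ s ∈ Icc a S, hs X κ g s y0‖ ≤ W0 * (14 * B * Mg) + 3 * 2 ^ a * MH + 35 * 2 ^ a * B * Mg := by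
    have hW00 : 0 ≤ W0 := by linarith
    have : W0 * ‖∑ s ∈ Icc a S, hs X κ g s y0‖ = ‖(W0 : ℂ) * ∑ s ∈ Icc a S, hs X κ g s y0‖ := by
      rw [norm_mul, Complex.norm_real, Real.norm_eq_abs, abs_of_nonneg hW00]
    rw [this, hdec]
    refine (norm_sub_le _ _).trans (add_le_add ((norm_add_le _ _).trans (add_le_add t1 t2)) t3)
  have hW00 : 0 < W0 := by linarith
  refine le_of_mul_le_mul_left (htot.trans ?_) hW00
  have q1 : 3 * 2 ^ a * MH ≤ W0 * (6 * MH) := by nlinarith [mul_le_mul_of_nonneg_right hW0' hMH0]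
  have q2 : 35 * 2 ^ a * B * Mg ≤ W0 * (70 * (B * Mg)) := by
    nlinarith [mul_le_mul_of_nonneg_right hW0' (mul_nonneg hB hM)]
  have q3 : 0 ≤ W0 * (B * Mg) := by positivity
  nlinarith

end
end Carl

namespace Carl
noncomputable section
open Finset

/-- square version of the maximal inequality -/
lemma M_sq : ∃ C : ℝ, 0 < C ∧ ∀ (Z : Finset ℤ) (h : ℤ → ℝ), (∀ y, 0 ≤ h y) → ∀ A : Finset ℤ,
    ∑ x ∈ A, M Z h x ^ 2 ≤ C * ∑ y ∈ Z, h y ^ 2 := by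
  obtain ⟨C, hC, H⟩ := M_strong 2 (by norm_num)
  refine ⟨C, hC, fun Z h hh A => ?_⟩
  have := H Z h hh A
  simpa [Real.rpow_two] using this

lemma sq_add_le (a b : ℝ) : (a + b) ^ 2 ≤ 2 * a ^ 2 + 2 * b ^ 2 := by nlinarith [sq_nonneg (a - b)]

lemma sq_add3_le (a b c : ℝ) : (a + b + c) ^ 2 ≤ 3 * (a ^ 2 + b ^ 2 + c ^ 2) := by
  nlinarith [sq_nonneg (a - b), sq_nonneg (b - c), sq_nonneg (a - c)]

lemma CZ_K (S : ℕ) (X : Finset ℤ) : CZ S X (fun s x y => (K s (y - x) : ℂ)) 40 where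
  size s x y := by
    rw [Complex.norm_real, Real.norm_eq_abs]
    refine (K_abs _ _).trans ?_
    gcongr; norm_num
  supp s x y h := by rw [K_supp _ _ (by rw [abs_sub_comm]; exact h)]; simp
  lip s x y y' := by
    rw [← Complex.ofReal_sub, Complex.norm_real, Real.norm_eq_abs]
    refine (K_lip _ _ _).trans (le_of_eq ?_)
    push_cast; congr 2; ring
  canc x hx W hW := by
    rw [Finset.sum_eq_zero]; · norm_num
    intro s hs
    have := K_sum_zero s x W (fun y hy => hW y (hy.trans_le (pow_le_pow_right₀ (by norm_num) (mem_Icc.mp hs).2)))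
    rw [← Complex.ofReal_sum]
    have h2 : ∑ y ∈ W, K s (y - x) = - ∑ y ∈ W, K s (x - y) := by
      rw [← Finset.sum_neg_distrib]
      refine Finset.sum_congr rfl fun y _ => ?_
      rw [← K_neg]; congr 1; ring
    rw [h2, this]; simp

/-- nbhd of a finset -/
def nb (X : Finset ℤ) (r : ℤ) : Finset ℤ := X.biUnion fun x => Icc (x - r) (x + r)

lemma mem_nb {X : Finset ℤ} {r : ℤ} {x y : ℤ} (hx : x ∈ X) (h : |y - x| ≤ r) : y ∈ nb X r := by
  rw [nb, mem_biUnion]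
  refine ⟨x, hx, ?_⟩
  have := abs_le.mp h
  rw [mem_Icc]; omega

lemma cotlar_int {S : ℕ} {X : Finset ℤ} {κ : ℕ → ℤ → ℤ → ℂ} {B : ℝ} (H : CZ S X κ B) (g : ℤ → ℂ)
    (a b : ℕ) (ha : 1 ≤ a) (hb : b ≤ S) (y0 : ℤ) :
    ‖∑ s ∈ Icc a b, hs X κ g s y0‖ ≤ 2 * (84 * B * M X (fun x => ‖g x‖) y0
      + 6 * M (nb X (2 ^ S)) (fun y => ‖∑ s ∈ Icc 1 S, hs X κ g s y‖) y0) := by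
  have hZ : ∀ x ∈ X, ∀ y, |y - x| < 2 ^ S → y ∈ nb X (2 ^ S) := fun x hx y hy => mem_nb hx hy.le
  have h1 := cotlar H g _ hZ a ha y0
  have h2 := cotlar H g _ hZ (b + 1) (by omega) y0
  have h3 : 0 ≤ 84 * B * M X (fun x => ‖g x‖) y0
      + 6 * M (nb X (2 ^ S)) (fun y => ‖∑ s ∈ Icc 1 S, hs X κ g s y‖) y0 := (norm_nonneg _).trans h1
  rcases lt_or_ge b a with hba | hba
  · rw [Icc_eq_empty (by omega)]; simp only [sum_empty, norm_zero]; linarith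
  have e : ∑ s ∈ Icc a S, hs X κ g s y0 = ∑ s ∈ Icc a b, hs X κ g s y0 + ∑ s ∈ Icc (b+1) S, hs X κ g s y0 := by
    rw [← Finset.sum_union]
    · congr 1; ext s; simp only [mem_Icc, mem_union]; omega
    · rw [Finset.disjoint_left]; intro s; simp only [mem_Icc]; omega
  rw [← sub_eq_iff_eq_add] at e
  rw [← e]
  refine (norm_sub_le _ _).trans ?_
  linarith

/-- general maximal truncation bound -/
lemma cotlar_L2 : ∃ C : ℝ, 0 < C ∧ ∀ (S : ℕ) (X : Finset ℤ) (κ : ℕ → ℤ → ℤ → ℂ) (B D : ℝ), CZ S X κ B →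
    ∀ g : ℤ → ℂ, (∀ A : Finset ℤ, ∑ y ∈ A, ‖∑ s ∈ Icc 1 S, hs X κ g s y‖ ^ 2 ≤ D * ∑ x ∈ X, ‖g x‖ ^ 2) →
    ∃ Hs : ℤ → ℝ, (∀ z, 0 ≤ Hs z) ∧
      (∀ z a b, 1 ≤ a → b ≤ S → ‖∑ s ∈ Icc a b, hs X κ g s z‖ ≤ Hs z) ∧
      ∀ A : Finset ℤ, ∑ z ∈ A, Hs z ^ 2 ≤ C * (B ^ 2 + D) * ∑ x ∈ X, ‖g x‖ ^ 2 := by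
  obtain ⟨C, hC, HM⟩ := M_sq
  refine ⟨60000 * C, by positivity, fun S X κ B D H g hD => ?_⟩
  refine ⟨fun z => 2 * (84 * B * M X (fun x => ‖g x‖) z
      + 6 * M (nb X (2 ^ S)) (fun y => ‖∑ s ∈ Icc 1 S, hs X κ g s y‖) z), fun z => ?_, fun z a b ha hb =>
      cotlar_int H g a b ha hb z, fun A => ?_⟩
  · have := H.B_nonneg
    have := M_nonneg (Z := X) (h := fun x => ‖g x‖) (fun x => norm_nonneg _) z
    have := M_nonneg (Z := nb X (2 ^ S)) (h := fun y => ‖∑ s ∈ Icc 1 S, hs X κ g s y‖) (fun x => norm_nonneg _) z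
    positivity
  · have h1 := HM X (fun x => ‖g x‖) (fun x => norm_nonneg _) A
    have h2 := HM (nb X (2 ^ S)) (fun y => ‖∑ s ∈ Icc 1 S, hs X κ g s y‖) (fun x => norm_nonneg _) A
    have h3 := hD (nb X (2 ^ S))
    have h0 : 0 ≤ ∑ x ∈ X, ‖g x‖ ^ 2 := Finset.sum_nonneg fun _ _ => by positivity
    calc _ ≤ ∑ z ∈ A, (8 * 84 ^ 2 * B ^ 2 * M X (fun x => ‖g x‖) z ^ 2
          + 8 * 36 * M (nb X (2 ^ S)) (fun y => ‖∑ s ∈ Icc 1 S, hs X κ g s y‖) z ^ 2) := by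
          refine Finset.sum_le_sum fun z _ => ?_
          have := sq_add_le (84 * B * M X (fun x => ‖g x‖) z) (6 * M (nb X (2 ^ S)) (fun y => ‖∑ s ∈ Icc 1 S, hs X κ g s y‖) z)
          nlinarith
      _ = 8 * 84 ^ 2 * B ^ 2 * ∑ z ∈ A, M X (fun x => ‖g x‖) z ^ 2
          + 8 * 36 * ∑ z ∈ A, M (nb X (2 ^ S)) (fun y => ‖∑ s ∈ Icc 1 S, hs X κ g s y‖) z ^ 2 := by
          rw [Finset.sum_add_distrib, ← Finset.mul_sum, ← Finset.mul_sum]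
      _ ≤ 8 * 84 ^ 2 * B ^ 2 * (C * ∑ x ∈ X, ‖g x‖ ^ 2) + 8 * 36 * (C * (D * ∑ x ∈ X, ‖g x‖ ^ 2)) := by
          refine add_le_add (mul_le_mul_of_nonneg_left h1 (by positivity)) (mul_le_mul_of_nonneg_left (h2.trans ?_) (by positivity))
          exact mul_le_mul_of_nonneg_left h3 hC.le
      _ ≤ _ := by
          have hDg : 0 ≤ D * ∑ x ∈ X, ‖g x‖ ^ 2 := (Finset.sum_nonneg fun _ _ => by positivity).trans h3
          have q1 : 0 ≤ C * (D * ∑ x ∈ X, ‖g x‖ ^ 2) := by positivity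
          have q2 : 0 ≤ C * (B ^ 2 * ∑ x ∈ X, ‖g x‖ ^ 2) := by positivity
          nlinarith

lemma Hstar : ∃ C : ℝ, 0 < C ∧ ∀ (S : ℕ) (Z : Finset ℤ) (f : ℤ → ℂ), ∃ Hs : ℤ → ℝ, (∀ z, 0 ≤ Hs z) ∧
      (∀ z a b, 1 ≤ a → b ≤ S → ‖∑ s ∈ Icc a b, ∑ y ∈ Z, (K s (z - y) : ℂ) * f y‖ ≤ Hs z) ∧
      ∀ A : Finset ℤ, ∑ z ∈ A, Hs z ^ 2 ≤ C * ∑ y ∈ Z, ‖f y‖ ^ 2 := by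
  obtain ⟨C, hC, H⟩ := cotlar_L2
  refine ⟨C * (40 ^ 2 + 350 ^ 2), by positivity, fun S Z f => ?_⟩
  refine H S Z _ 40 (350 ^ 2) (CZ_K S Z) f (fun A => ?_)
  refine le_trans (le_of_eq ?_) (H_L2 (Icc 1 S) Z A f)
  refine Finset.sum_congr rfl fun x _ => ?_
  congr 2
  unfold hs
  rw [Finset.sum_comm]
  refine Finset.sum_congr rfl fun y _ => ?_
  push_cast
  rw [Finset.sum_mul]

/-- `L²` duality for kernels -/
lemma dual_bd {G Z : Finset ℤ} {k : ℤ → ℤ → ℂ} {C : ℝ} (hC : 0 ≤ C)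
    (H : ∀ f : ℤ → ℂ, ∑ x ∈ G, ‖∑ y ∈ Z, k x y * f y‖ ^ 2 ≤ C * ∑ y ∈ Z, ‖f y‖ ^ 2) (g : ℤ → ℂ) :
    ∑ y ∈ Z, ‖∑ x ∈ G, (starRingEnd ℂ) (k x y) * g x‖ ^ 2 ≤ C * ∑ x ∈ G, ‖g x‖ ^ 2 := by
  set h : ℤ → ℂ := fun y => ∑ x ∈ G, (starRingEnd ℂ) (k x y) * g x with hh
  set P := ∑ y ∈ Z, ‖h y‖ ^ 2 with hP
  have e : (P : ℂ) = ∑ x ∈ G, (starRingEnd ℂ) (∑ y ∈ Z, k x y * h y) * g x := by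
    rw [hP]; push_cast
    simp_rw [map_sum, Finset.sum_mul]
    rw [Finset.sum_comm]
    refine Finset.sum_congr rfl fun y _ => ?_
    have : ((‖h y‖ : ℂ)) ^ 2 = (starRingEnd ℂ) (h y) * h y := by
      rw [← Complex.normSq_eq_conj_mul_self, Complex.normSq_eq_norm_sq]; push_cast; rfl
    rw [this]
    conv_lhs => rw [hh]
    simp only []
    rw [Finset.mul_sum]
    refine Finset.sum_congr rfl fun x _ => ?_
    rw [map_mul]; ring
  have hP0 : 0 ≤ P := Finset.sum_nonneg fun _ _ => by positivity
  have h1 : P ≤ ∑ x ∈ G, ‖∑ y ∈ Z, k x y * h y‖ * ‖g x‖ := by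
    have : P = ‖(P : ℂ)‖ := by rw [Complex.norm_real, Real.norm_eq_abs, abs_of_nonneg hP0]
    rw [this, e]
    refine norm_sum_le_of_le _ fun x _ => ?_
    rw [norm_mul, RCLike.norm_conj]
  have h2 := Finset.sum_mul_sq_le_sq_mul_sq G (fun x => ‖∑ y ∈ Z, k x y * h y‖) (fun x => ‖g x‖)
  have h3 := H h
  have h4 : P ^ 2 ≤ (C * P) * ∑ x ∈ G, ‖g x‖ ^ 2 := by
    refine (pow_le_pow_left₀ hP0 h1 2).trans (h2.trans ?_)
    exact mul_le_mul_of_nonneg_right h3 (Finset.sum_nonneg fun _ _ => by positivity)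
  rcases hP0.eq_or_lt with h5 | h5
  · rw [← h5]; exact mul_nonneg hC (Finset.sum_nonneg fun _ _ => by positivity)
  · nlinarith

end
end Carl

namespace Carl
noncomputable section
open Finset

/-- dyadic interval of scale `k` containing `x` -/
def II (k : ℕ) (x : ℤ) : Finset ℤ := Icc (x / 2 ^ k * 2 ^ k) (x / 2 ^ k * 2 ^ k + 2 ^ k - 1)

lemma mem_II {k : ℕ} {x z : ℤ} : z ∈ II k x ↔ z / 2 ^ k = x / 2 ^ k := by
  have hp : (0:ℤ) < 2 ^ k := by positivity
  rw [II, mem_Icc]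
  constructor
  · rintro ⟨h1, h2⟩
    apply le_antisymm
    · rw [← Int.lt_add_one_iff, Int.ediv_lt_iff_lt_mul hp]; linarith
    · rwa [Int.le_ediv_iff_mul_le hp]
  · intro h
    rw [← h]
    have := Int.emod_add_mul_ediv z (2 ^ k)
    have := Int.emod_nonneg z hp.ne'
    have := Int.emod_lt_of_pos z hp
    constructor <;> nlinarith

lemma self_mem_II (k : ℕ) (x : ℤ) : x ∈ II k x := mem_II.mpr rfl

lemma card_II (k : ℕ) (x : ℤ) : ((II k x).card : ℝ) = 2 ^ k := by
  have hp : (0:ℤ) < 2 ^ k := by positivity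
  rw [II, card_Icc_real (by omega)]; push_cast; ring

lemma dy_mono {k l : ℕ} {x y : ℤ} (h : x / 2 ^ k = y / 2 ^ k) (hkl : k ≤ l) : x / 2 ^ l = y / 2 ^ l := by
  obtain ⟨d, rfl⟩ := Nat.exists_eq_add_of_le hkl
  rw [pow_add, ← Int.ediv_ediv_of_nonneg (by positivity), ← Int.ediv_ediv_of_nonneg (by positivity), h]

lemma dy_dist {k : ℕ} {x y : ℤ} (h : x / 2 ^ k = y / 2 ^ k) : |x - y| < 2 ^ k := by
  have h1 := mem_II.mpr h
  have h2 := self_mem_II k y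
  rw [II, mem_Icc] at h1 h2
  rw [abs_lt]; omega

lemma II_congr {k : ℕ} {x y : ℤ} (h : x / 2 ^ k = y / 2 ^ k) : II k x = II k y := by
  unfold II; rw [h]

/-- transfer of sums through a sparse family -/
lemma transfer {X : Finset ℤ} {τ : ℤ → ℕ} {η : ℝ}
    (same : ∀ x ∈ X, ∀ x' ∈ X, x' / 2 ^ τ x = x / 2 ^ τ x → τ x' = τ x)
    (dens : ∀ x ∈ X, ((X.filter fun x' => x' / 2 ^ τ x = x / 2 ^ τ x).card : ℝ) ≤ η * 2 ^ τ x)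
    (Φ Ψ : ℤ → ℝ) (hΨ : ∀ z, 0 ≤ Ψ z) (h : ∀ x ∈ X, ∀ z, z / 2 ^ τ x = x / 2 ^ τ x → Φ x ≤ Ψ z) :
    ∑ x ∈ X, Φ x ≤ η * ∑ z ∈ X.biUnion (fun x => II (τ x) x), Ψ z := by
  classical
  set Zb := X.biUnion (fun x => II (τ x) x) with hZb
  have h1 : ∀ x ∈ X, Φ x ≤ ∑ z ∈ Zb, if z / 2 ^ τ x = x / 2 ^ τ x then Ψ z * (1 / 2 ^ τ x) else 0 := by
    intro x hx
    have h2 : ∑ z ∈ II (τ x) x, Φ x * (1 / 2 ^ τ x) = Φ x := by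
      rw [sum_const, nsmul_eq_mul, card_II]; field_simp
    rw [← h2, ← Finset.sum_filter]
    calc _ ≤ ∑ z ∈ II (τ x) x, Ψ z * (1 / 2 ^ τ x) :=
          Finset.sum_le_sum fun z hz => mul_le_mul_of_nonneg_right (h x hx z (mem_II.mp hz)) (by positivity)
      _ ≤ _ := by
          apply Finset.sum_le_sum_of_subset_of_nonneg
          · intro z hz
            rw [mem_filter, hZb, mem_biUnion]
            exact ⟨⟨x, hx, hz⟩, mem_II.mp hz⟩
          · intro z _ _
            have := hΨ z; positivity
  refine (Finset.sum_le_sum h1).trans ?_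
  rw [Finset.sum_comm, Finset.mul_sum]
  refine Finset.sum_le_sum fun z hz => ?_
  obtain ⟨x0, hx0, hz0⟩ := mem_biUnion.mp hz
  rw [mem_II] at hz0
  rw [← Finset.sum_filter]
  have hsub : (X.filter fun x => z / 2 ^ τ x = x / 2 ^ τ x) ⊆ X.filter fun x' => x' / 2 ^ τ x0 = x0 / 2 ^ τ x0 := by
    intro x hx
    rw [mem_filter] at hx ⊢
    refine ⟨hx.1, ?_⟩
    rcases le_total (τ x) (τ x0) with hl | hl
    · rw [← dy_mono hx.2 hl, hz0]
    · have h3 : x0 / 2 ^ τ x = x / 2 ^ τ x := by rw [← dy_mono hz0 hl, hx.2]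
      have h4 := same x hx.1 x0 hx0 h3
      rw [h4, h3]
  have heq : ∀ x ∈ X.filter (fun x => z / 2 ^ τ x = x / 2 ^ τ x), Ψ z * (1 / 2 ^ τ x) = Ψ z * (1 / 2 ^ τ x0) := by
    intro x hx
    have := hsub hx
    rw [mem_filter] at this
    rw [same x0 hx0 x this.1 this.2]
  rw [Finset.sum_congr rfl heq, sum_const, nsmul_eq_mul]
  have h5 : ((X.filter fun x => z / 2 ^ τ x = x / 2 ^ τ x).card : ℝ) ≤ η * 2 ^ τ x0 := by
    refine le_trans ?_ (dens x0 hx0)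
    exact_mod_cast Finset.card_le_card hsub
  have h6 := hΨ z
  calc _ ≤ (η * 2 ^ τ x0) * (Ψ z * (1 / 2 ^ τ x0)) := mul_le_mul_of_nonneg_right h5 (by positivity)
    _ = _ := by field_simp

/-- dyadic partition and averages -/
def EJ {E : Type*} [AddCommMonoid E] (υ : ℤ → ℕ) (F : Finset ℤ) (g : ℤ → E) (y : ℤ) : E :=
  ∑ y' ∈ F with y' / 2 ^ υ y = y / 2 ^ υ y, g y'

/-- dyadic partition predicate -/
def DyP (υ : ℤ → ℕ) : Prop := ∀ y y', y' / 2 ^ υ y = y / 2 ^ υ y → υ y' = υ y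

lemma DyP.symm' {υ : ℤ → ℕ} (h : DyP υ) {y y' : ℤ} (hy : y' / 2 ^ υ y = y / 2 ^ υ y) :
    y / 2 ^ υ y' = y' / 2 ^ υ y' := by rw [h y y' hy, hy]

/-- the hull of `F` -/
def hull (υ : ℤ → ℕ) (F : Finset ℤ) : Finset ℤ := F.biUnion fun y => II (υ y) y

lemma mem_hull {υ : ℤ → ℕ} (h : DyP υ) {F : Finset ℤ} {y y' : ℤ} (hy' : y' ∈ F) (hy : y' / 2 ^ υ y = y / 2 ^ υ y) :
    y ∈ hull υ F := by
  rw [hull, mem_biUnion]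
  exact ⟨y', hy', mem_II.mpr (h.symm' hy)⟩

/-- sum interchange for averages -/
lemma EJ_swap {k : Type*} [Field k] {υ : ℤ → ℕ} (h : DyP υ) (F : Finset ℤ) (g w : ℤ → k) :
    ∑ y ∈ hull υ F, w y * (EJ υ F g y / 2 ^ υ y) = ∑ y ∈ F, (∑ z ∈ II (υ y) y, w z) / 2 ^ υ y * g y := by
  classical
  unfold EJ
  simp_rw [Finset.sum_filter, Finset.sum_div, Finset.mul_sum, Finset.sum_mul]
  rw [Finset.sum_comm]
  refine Finset.sum_congr rfl fun y hy => ?_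
  have : ∀ x ∈ hull υ F, w x * ((if y / 2 ^ υ x = x / 2 ^ υ x then g y else 0) / 2 ^ υ x) =
      if x ∈ II (υ y) y then w x / 2 ^ υ y * g y else 0 := by
    intro x _
    by_cases hx : y / 2 ^ υ x = x / 2 ^ υ x
    · rw [if_pos hx, if_pos (mem_II.mpr (h.symm' hx)), h x y hx]; ring
    · rw [if_neg hx, if_neg]; · simp
      intro hm; exact hx (h.symm' (mem_II.mp hm))
  rw [Finset.sum_congr rfl this, Finset.sum_ite_mem]
  congr 1
  rw [Finset.inter_eq_right]
  intro z hz
  rw [hull, mem_biUnion]; exact ⟨y, hy, hz⟩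

lemma EJ_L2 {υ : ℤ → ℕ} (h : DyP υ) (F : Finset ℤ) (g : ℤ → ℂ) {δ : ℝ} (hδ : 0 ≤ δ)
    (hF : ∀ y, ((F.filter fun y' => y' / 2 ^ υ y = y / 2 ^ υ y).card : ℝ) ≤ δ * 2 ^ υ y) (A : Finset ℤ) :
    ∑ y ∈ A, (EJ υ F (fun y => ‖g y‖) y / 2 ^ υ y) ^ 2 ≤ δ * ∑ y ∈ F, ‖g y‖ ^ 2 := by
  classical
  have h1 : ∀ y, (EJ υ F (fun y => ‖g y‖) y / 2 ^ υ y) ^ 2 ≤ δ * ∑ y' ∈ F, if y' / 2 ^ υ y = y / 2 ^ υ y then ‖g y'‖ ^ 2 / 2 ^ υ y else 0 := by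
    intro y
    rw [← Finset.sum_filter, ← Finset.sum_div]
    have := Finset.sum_mul_sq_le_sq_mul_sq (F.filter fun y' => y' / 2 ^ υ y = y / 2 ^ υ y) (fun _ => (1:ℝ)) (fun y' => ‖g y'‖)
    simp only [one_mul, one_pow, sum_const, nsmul_eq_mul, mul_one] at this
    rw [div_pow]
    unfold EJ
    have h2 : 0 ≤ ∑ y' ∈ F with y' / 2 ^ υ y = y / 2 ^ υ y, ‖g y'‖ ^ 2 := Finset.sum_nonneg fun _ _ => by positivity
    calc _ ≤ ((δ * 2 ^ υ y) * ∑ y' ∈ F with y' / 2 ^ υ y = y / 2 ^ υ y, ‖g y'‖ ^ 2) / (2 ^ υ y) ^ 2 := by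
          refine div_le_div_of_nonneg_right (this.trans ?_) (by positivity)
          exact mul_le_mul_of_nonneg_right (hF y) h2
      _ = _ := by field_simp
  refine (Finset.sum_le_sum fun y _ => h1 y).trans ?_
  rw [← Finset.mul_sum, Finset.sum_comm]
  refine mul_le_mul_of_nonneg_left (Finset.sum_le_sum fun y' _ => ?_) hδ
  rw [← Finset.sum_filter]
  calc _ ≤ ∑ y ∈ II (υ y') y', ‖g y'‖ ^ 2 / 2 ^ υ y' := by
        have e : ∀ y ∈ A.filter (fun y => y' / 2 ^ υ y = y / 2 ^ υ y), ‖g y'‖ ^ 2 / 2 ^ υ y = ‖g y'‖ ^ 2 / 2 ^ υ y' := by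
          intro y hy; rw [h y y' (mem_filter.mp hy).2]
        rw [Finset.sum_congr rfl e]
        apply Finset.sum_le_sum_of_subset_of_nonneg
        · intro y hy
          exact mem_II.mpr (h.symm' (mem_filter.mp hy).2)
        · intros; positivity
    _ = _ := by rw [sum_const, nsmul_eq_mul, card_II]; field_simp

end
end Carl

namespace Carl
noncomputable section
open Finset

/-- the auxiliary averaging operator -/
def AA (S : ℕ) (Z : Finset ℤ) (υ : ℤ → ℕ) (h : ℤ → ℝ) (z : ℤ) : ℝ :=
  ∑ s ∈ Icc 1 S, 1 / 4 ^ s * ∑ y ∈ Z with (|y - z| ≤ (17:ℕ) * 2 ^ s ∧ υ y ≤ s + 3), 2 ^ υ y * h y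

lemma AA_nonneg (S : ℕ) (Z : Finset ℤ) (υ : ℤ → ℕ) {h : ℤ → ℝ} (hh : ∀ y, 0 ≤ h y) (z : ℤ) : 0 ≤ AA S Z υ h z := by
  unfold AA
  refine Finset.sum_nonneg fun s _ => mul_nonneg (by positivity) (Finset.sum_nonneg fun y _ => ?_)
  have := hh y; positivity

lemma AA_L2 : ∃ C : ℝ, 0 < C ∧ ∀ (S : ℕ) (Z : Finset ℤ) (υ : ℤ → ℕ) (h : ℤ → ℝ), (∀ y, 0 ≤ h y) → ∀ A : Finset ℤ,
    ∑ z ∈ A, AA S Z υ h z ^ 2 ≤ C * ∑ y ∈ Z, h y ^ 2 := by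
  obtain ⟨C, hC, HM⟩ := M_sq
  refine ⟨560 ^ 2 * C, by positivity, fun S Z υ h hh A => ?_⟩
  have hA0 := AA_nonneg S Z υ hh
  set P := ∑ z ∈ A, AA S Z υ h z ^ 2 with hP
  have h1 : P ≤ ∑ y ∈ Z, 560 * (h y * M A (AA S Z υ h) y) := by
    have e : P = ∑ y ∈ Z, h y * (2 ^ υ y * ∑ s ∈ Icc 1 S with υ y ≤ s + 3, 1 / 4 ^ s *
        ∑ z ∈ A with |z - y| ≤ (17:ℕ) * 2 ^ s, AA S Z υ h z) := by
      rw [hP]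
      simp_rw [pow_two]
      conv_lhs => enter [2, z]; rw [show AA S Z υ h z * AA S Z υ h z = AA S Z υ h z *
        ∑ s ∈ Icc 1 S, 1 / 4 ^ s * ∑ y ∈ Z with (|y - z| ≤ (17:ℕ) * 2 ^ s ∧ υ y ≤ s + 3), 2 ^ υ y * h y from rfl]
      simp_rw [Finset.sum_filter, Finset.mul_sum]
      rw [Finset.sum_comm' (t' := Icc 1 S) (s' := fun _ => A) (by simp [and_comm])]
      rw [Finset.sum_congr rfl fun s _ => Finset.sum_comm, Finset.sum_comm]
      refine Finset.sum_congr rfl fun y _ => Finset.sum_congr rfl fun s _ => ?_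
      by_cases hs : υ y ≤ s + 3
      · simp only [hs, and_true, if_true]
        rw [Finset.mul_sum, Finset.mul_sum]
        apply Finset.sum_congr rfl
        intro z _
        rw [abs_sub_comm]
        split_ifs <;> ring
      · simp [hs]
    rw [e]
    refine Finset.sum_le_sum fun y _ => ?_
    have hM := M_nonneg (Z := A) hA0 y
    have h2 : ∀ s ∈ (Icc 1 S).filter (fun s => υ y ≤ s + 3), 1 / 4 ^ s *
        ∑ z ∈ A with |z - y| ≤ (17:ℕ) * 2 ^ s, AA S Z υ h z ≤ 35 * M A (AA S Z υ h) y * (1 / 2 ^ s) := by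
      intro s _
      have := win_le_M (Z := A) hA0 y 17 s (A.filter fun z => |z - y| ≤ (17:ℕ) * 2 ^ s) (filter_subset _ _)
        (fun z hz => (mem_filter.mp hz).2)
      calc _ ≤ 1 / 4 ^ s * ((2 * (17:ℕ) + 1) * 2 ^ s * M A (AA S Z υ h) y) := mul_le_mul_of_nonneg_left this (by positivity)
        _ = _ := by rw [four_pow]; push_cast; field_simp; ring
    have h3 := Finset.sum_le_sum h2
    rw [← Finset.mul_sum] at h3
    have h4 := geom_down (B := 8 / 2 ^ υ y) (by positivity) ((Icc 1 S).filter (fun s => υ y ≤ s + 3)) (fun s hs => by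
      have := (mem_filter.mp hs).2
      rw [div_le_div_iff₀ (by positivity) (by positivity)]
      calc (1:ℝ) * 2 ^ υ y ≤ 1 * 2 ^ (s + 3) := by gcongr; norm_num
        _ = _ := by rw [pow_add]; norm_num; ring)
    calc _ ≤ h y * (2 ^ υ y * (35 * M A (AA S Z υ h) y * (2 * (8 / 2 ^ υ y)))) := by
          refine mul_le_mul_of_nonneg_left (mul_le_mul_of_nonneg_left (h3.trans ?_) (by positivity)) (hh y)
          exact mul_le_mul_of_nonneg_left h4 (by positivity)
      _ = _ := by field_simp; ring
  rw [← Finset.mul_sum] at h1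
  have h2 := Finset.sum_mul_sq_le_sq_mul_sq Z h (M A (AA S Z υ h))
  have h3 := HM A (AA S Z υ h) hA0 Z
  rw [← hP] at h3
  have hP0 : 0 ≤ P := Finset.sum_nonneg fun _ _ => by positivity
  have hQ0 : 0 ≤ ∑ y ∈ Z, h y ^ 2 := Finset.sum_nonneg fun _ _ => by positivity
  have h4 : P ^ 2 ≤ 560 ^ 2 * ((∑ y ∈ Z, h y ^ 2) * (C * P)) := by
    refine (pow_le_pow_left₀ hP0 h1 2).trans ?_
    rw [mul_pow]
    refine mul_le_mul_of_nonneg_left (h2.trans ?_) (by positivity)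
    exact mul_le_mul_of_nonneg_left h3 hQ0
  rcases hP0.eq_or_lt with h5 | h5
  · rw [← h5]; positivity
  · nlinarith

/-- window lemma -/
lemma window_EJ {υ : ℤ → ℕ} (h : DyP υ) (F : Finset ℤ) (g : ℤ → ℝ) (hg : ∀ y, 0 ≤ g y) (ω : ℕ → ℝ) (hω : ∀ n, 0 ≤ ω n)
    (z : ℤ) (m s : ℕ) :
    ∑ y ∈ F with (|y - z| ≤ (m:ℕ) * 2 ^ s ∧ υ y ≤ s + 3), ω (υ y) * g y ≤
    ∑ y ∈ hull υ F with (|y - z| ≤ ((m + 8 : ℕ) : ℤ) * 2 ^ s ∧ υ y ≤ s + 3), ω (υ y) * (EJ υ F g y / 2 ^ υ y) := by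
  classical
  rw [Finset.sum_filter, Finset.sum_filter]
  have e := EJ_swap h F g (fun y => if (|y - z| ≤ ((m + 8 : ℕ) : ℤ) * 2 ^ s ∧ υ y ≤ s + 3) then ω (υ y) else 0)
  simp only [ite_mul, zero_mul] at e
  rw [e]
  refine Finset.sum_le_sum fun y _ => ?_
  split_ifs with hy
  · refine mul_le_mul_of_nonneg_right ?_ (hg y)
    have : ∀ x ∈ II (υ y) y, (if (|x - z| ≤ ((m + 8 : ℕ) : ℤ) * 2 ^ s ∧ υ x ≤ s + 3) then ω (υ x) else 0) = ω (υ y) := by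
      intro x hx
      have hx' := mem_II.mp hx
      have h1 := h y x hx'
      rw [h1, if_pos]
      refine ⟨?_, hy.2⟩
      have h2 := abs_lt.mp (dy_dist hx')
      have h3 := abs_le.mp hy.1
      have h4 : (2:ℤ) ^ υ y ≤ 2 ^ (s + 3) := pow_le_pow_right₀ (by norm_num) hy.2
      rw [pow_add] at h4
      push_cast
      rw [abs_le]; constructor <;> linarith
    rw [Finset.sum_congr rfl this, sum_const, nsmul_eq_mul, card_II]
    rw [mul_div_cancel_left₀ _ (by positivity)]
  · refine mul_nonneg (div_nonneg (Finset.sum_nonneg fun x _ => ?_) (by positivity)) (hg y)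
    split_ifs
    · exact hω _
    · exact le_rfl

/-- a tree -/
structure TreeD (S : ℕ) (X : Finset ℤ) (N : ℤ → ℝ) (A : ℤ → Finset ℕ) (c : ℝ) : Prop where
  int : ∀ x ∈ X, ∃ a b, 1 ≤ a ∧ a ≤ b ∧ b ≤ S ∧ A x = Icc a b
  freq : ∀ x ∈ X, ∀ s ∈ A x, |N x - c| ≤ 3 / 2 ^ s

/-- kernel -/
def ker (N : ℤ → ℝ) (A : ℤ → Finset ℕ) (x y : ℤ) : ℂ := (∑ s ∈ A x, (K s (x - y) : ℂ)) * ee (N x * y)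

lemma norm_sum_window {F : Finset ℤ} {g : ℤ → ℂ} {h : ℤ → ℝ} (P : ℤ → Prop) [DecidablePred P]
    (h0 : ∀ y ∈ F, ¬ P y → g y = 0) (hb : ∀ y ∈ F, P y → ‖g y‖ ≤ h y) : ‖∑ y ∈ F, g y‖ ≤ ∑ y ∈ F with P y, h y := by
  rw [Finset.sum_filter]
  refine norm_sum_le_of_le _ fun y hy => ?_
  split_ifs with hp
  · exact hb y hy hp
  · rw [h0 y hy hp]; simp

lemma tree_pt {S : ℕ} {X : Finset ℤ} {N : ℤ → ℝ} {A : ℤ → Finset ℕ} {c : ℝ} (H : TreeD S X N A c)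
    {υ : ℤ → ℕ} (hD : DyP υ) (F : Finset ℤ) (f : ℤ → ℂ) (Hs : ℤ → ℝ)
    (hHs : ∀ z a b, 1 ≤ a → b ≤ S → ‖∑ s ∈ Icc a b, ∑ y ∈ hull υ F, (K s (z - y) : ℂ) *
      (EJ υ F (fun y => ee (c * y) * f y) y / 2 ^ υ y)‖ ≤ Hs z)
    (x : ℤ) (hx : x ∈ X) (τ : ℕ) (hτ : ∀ s ∈ A x, τ < s)
    (hυ : ∀ s ∈ A x, ∀ y, |x - y| ≤ 4 * 2 ^ s → υ y ≤ s + 3)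
    (z : ℤ) (hz : z / 2 ^ τ = x / 2 ^ τ) :
    ‖∑ y ∈ F, ker N A x y * f y‖ ≤ Hs z + 2184 * M (hull υ F) (fun y => EJ υ F (fun y => ‖f y‖) y / 2 ^ υ y) z
      + 40 * AA S (hull υ F) υ (fun y => EJ υ F (fun y => ‖f y‖) y / 2 ^ υ y) z := by
  classical
  obtain ⟨a, b, ha, hab, hbS, hA⟩ := H.int x hx
  set b' : ℤ → ℝ := fun y => EJ υ F (fun y => ‖f y‖) y / 2 ^ υ y with hb'
  have hb'0 : ∀ y, 0 ≤ b' y := fun y => div_nonneg (Finset.sum_nonneg fun _ _ => norm_nonneg _) (by positivity)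
  set Mb := M (hull υ F) b' z with hMb
  have hMb0 : 0 ≤ Mb := M_nonneg hb'0 z
  set ft : ℤ → ℂ := fun y => ee (c * y) * f y with hft
  have hftn : ∀ y, ‖ft y‖ = ‖f y‖ := fun y => by rw [hft]; simp
  set θ := N x - c with hθ
  have hbA : b ∈ A x := by rw [hA, mem_Icc]; omega
  have hθb : |θ| ≤ 3 / 2 ^ b := H.freq x hx b hbA
  have hzx := dy_dist hz
  -- the window bound
  have hwin : ∀ s, ∑ y ∈ F with (|y - z| ≤ (2:ℕ) * 2 ^ s ∧ υ y ≤ s + 3), ‖f y‖ ≤ 21 * 2 ^ s * Mb := by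
    intro s
    have h1 := window_EJ hD F (fun y => ‖f y‖) (fun y => norm_nonneg _) (fun _ => 1) (fun _ => zero_le_one) z 2 s
    simp only [one_mul] at h1
    refine h1.trans ?_
    have h2 := win_le_M (Z := hull υ F) hb'0 z 10 s
      ((hull υ F).filter fun y => (|y - z| ≤ ((2 + 8 : ℕ) : ℤ) * 2 ^ s ∧ υ y ≤ s + 3)) (filter_subset _ _)
      (fun y hy => (mem_filter.mp hy).2.1)
    refine h2.trans (le_of_eq ?_)
    push_cast; rw [hMb]; ring
  have hpw : ∀ s ∈ A x, |x - z| < 2 ^ s := by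
    intro s hs
    rw [abs_sub_comm]
    exact hzx.trans_le (pow_le_pow_right₀ (by norm_num) (hτ s hs).le)
  -- decomposition
  have edec : ∑ y ∈ F, ker N A x y * f y = ee (θ * x) * (
      ∑ s ∈ A x, ∑ y ∈ F, (K s (x - y) : ℂ) * (ee (θ * (y - x)) - 1) * ft y
      + ∑ s ∈ A x, ∑ y ∈ F, ((K s (x - y) : ℂ) - K s (z - y)) * ft y
      + ∑ s ∈ A x, ∑ y ∈ F, ((K s (z - y) : ℂ) - (∑ w ∈ II (υ y) y, (K s (z - w) : ℂ)) / 2 ^ υ y) * ft y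
      + ∑ s ∈ A x, ∑ y ∈ hull υ F, (K s (z - y) : ℂ) * (EJ υ F ft y / 2 ^ υ y)) := by
    rw [← Finset.sum_add_distrib, ← Finset.sum_add_distrib, ← Finset.sum_add_distrib, Finset.mul_sum]
    have : ∀ s ∈ A x, ee (θ * x) * (∑ y ∈ F, (K s (x - y) : ℂ) * (ee (θ * (y - x)) - 1) * ft y
      + ∑ y ∈ F, ((K s (x - y) : ℂ) - K s (z - y)) * ft y
      + ∑ y ∈ F, ((K s (z - y) : ℂ) - (∑ w ∈ II (υ y) y, (K s (z - w) : ℂ)) / 2 ^ υ y) * ft y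
      + ∑ y ∈ hull υ F, (K s (z - y) : ℂ) * (EJ υ F ft y / 2 ^ υ y)) = ∑ y ∈ F, (K s (x - y) : ℂ) * ee (N x * y) * f y := by
      intro s _
      rw [EJ_swap hD F ft (fun y => (K s (z - y) : ℂ)), ← Finset.sum_add_distrib, ← Finset.sum_add_distrib, ← Finset.sum_add_distrib, Finset.mul_sum]
      refine Finset.sum_congr rfl fun y _ => ?_
      have e1 : ee (N x * y) = ee (θ * x) * ee (θ * (y - x)) * ee (c * y) := by
        rw [← ee_add, ← ee_add]; congr 1; rw [hθ]; ring
      rw [e1, hft]; ring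
    rw [Finset.sum_congr rfl this, Finset.sum_comm]
    refine Finset.sum_congr rfl fun y _ => ?_
    rw [ker, Finset.sum_mul, Finset.sum_mul]
  have t1 : ‖∑ s ∈ A x, ∑ y ∈ F, (K s (x - y) : ℂ) * (ee (θ * (y - x)) - 1) * ft y‖ ≤ 504 * Mb := by
    have h1 : ∀ s ∈ A x, ‖∑ y ∈ F, (K s (x - y) : ℂ) * (ee (θ * (y - x)) - 1) * ft y‖ ≤ 252 / 2 ^ b * Mb * 2 ^ s := by
      intro s hs
      have hzs := abs_lt.mp (hpw s hs)
      refine (norm_sum_window (fun y => |y - z| ≤ (2:ℕ) * 2 ^ s ∧ υ y ≤ s + 3) (h := fun y => 12 / 2 ^ b * ‖f y‖) ?_ ?_).trans ?_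
      · intro y _ hy
        rw [K_supp]; · simp
        by_contra hc
        apply hy
        have hc' := abs_lt.mp (not_le.mp hc)
        refine ⟨by rw [abs_le]; push_cast; omega, hυ s hs y ?_⟩
        linarith [not_le.mp hc]
      · intro y _ _
        rw [norm_mul, norm_mul, hftn, Complex.norm_real, Real.norm_eq_abs]
        refine mul_le_mul_of_nonneg_right ?_ (norm_nonneg _)
        by_cases hc : (2:ℤ) ^ s ≤ |x - y|
        · rw [K_supp _ _ hc]; simp; positivity
        have hc' : |(x:ℝ) - y| ≤ 2 ^ s := by exact_mod_cast (not_le.mp hc).le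
        calc |K s (x - y)| * ‖ee (θ * (y - x)) - 1‖ ≤ 4 / 2 ^ s * (3 / 2 ^ b * 2 ^ s) := by
              refine mul_le_mul (K_abs _ _) ((ee_sub_one_le _).trans ?_) (norm_nonneg _) (by positivity)
              rw [abs_mul]
              refine mul_le_mul hθb (by rwa [abs_sub_comm]) (abs_nonneg _) (by positivity)
          _ = _ := by field_simp; ring
      · rw [← Finset.mul_sum]
        calc _ ≤ 12 / 2 ^ b * (21 * 2 ^ s * Mb) := mul_le_mul_of_nonneg_left (hwin s) (by positivity)
          _ = _ := by ring
    refine (norm_sum_le_of_le _ h1).trans ?_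
    rw [← Finset.mul_sum]
    have h2 := geom_up (B := 2 ^ b) (by positivity) (A x) (fun k hk => by
      rw [hA, mem_Icc] at hk
      exact pow_le_pow_right₀ (by norm_num) hk.2)
    calc _ ≤ 252 / 2 ^ b * Mb * (2 * 2 ^ b) := mul_le_mul_of_nonneg_left h2 (by positivity)
      _ = _ := by field_simp; ring
  have t2 : ‖∑ s ∈ A x, ∑ y ∈ F, ((K s (x - y) : ℂ) - K s (z - y)) * ft y‖ ≤ 1680 * Mb := by
    have h1 : ∀ s ∈ A x, ‖∑ y ∈ F, ((K s (x - y) : ℂ) - K s (z - y)) * ft y‖ ≤ 840 * 2 ^ τ * Mb * (1 / 2 ^ s) := by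
      intro s hs
      have hzs := abs_lt.mp (hpw s hs)
      refine (norm_sum_window (fun y => |y - z| ≤ (2:ℕ) * 2 ^ s ∧ υ y ≤ s + 3) (h := fun y => 40 / 4 ^ s * 2 ^ τ * ‖f y‖) ?_ ?_).trans ?_
      · intro y _ hy
        have hcc : ¬ (|x - y| < 2 ^ s ∨ |z - y| < 2 ^ s) := by
          intro hc
          apply hy
          have : |y - z| ≤ 2 * 2 ^ s ∧ |x - y| ≤ 4 * 2 ^ s := by
            rcases hc with hc | hc <;> have := abs_lt.mp hc <;> rw [abs_le, abs_le] <;> omega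
          refine ⟨by push_cast; exact this.1, hυ s hs y this.2⟩
        push Not at hcc
        rw [K_supp _ _ hcc.1, K_supp _ _ hcc.2]; simp
      · intro y _ _
        rw [norm_mul, hftn, ← Complex.ofReal_sub, Complex.norm_real, Real.norm_eq_abs]
        refine mul_le_mul_of_nonneg_right ((K_lip _ _ _).trans ?_) (norm_nonneg _)
        refine mul_le_mul_of_nonneg_left ?_ (by positivity)
        have : |((x - y : ℤ) : ℝ) - ((z - y : ℤ) : ℝ)| = |(z:ℝ) - x| := by
          rw [abs_sub_comm]; push_cast; congr 1; ring
        rw [this]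
        exact_mod_cast hzx.le
      · rw [← Finset.mul_sum]
        calc _ ≤ 40 / 4 ^ s * 2 ^ τ * (21 * 2 ^ s * Mb) := mul_le_mul_of_nonneg_left (hwin s) (by positivity)
          _ = _ := by rw [four_pow]; field_simp; ring
    refine (norm_sum_le_of_le _ h1).trans ?_
    rw [← Finset.mul_sum]
    have h2 := geom_down (B := 1 / 2 ^ τ) (by positivity) (A x) (fun k hk => by
      have := (hτ k hk).le
      gcongr; norm_num)
    calc _ ≤ 840 * 2 ^ τ * Mb * (2 * (1 / 2 ^ τ)) := mul_le_mul_of_nonneg_left h2 (by positivity)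
      _ = _ := by field_simp; ring
  have t3 : ‖∑ s ∈ A x, ∑ y ∈ F, ((K s (z - y) : ℂ) - (∑ w ∈ II (υ y) y, (K s (z - w) : ℂ)) / 2 ^ υ y) * ft y‖ ≤
      40 * AA S (hull υ F) υ b' z := by
    have h1 : ∀ s ∈ A x, ‖∑ y ∈ F, ((K s (z - y) : ℂ) - (∑ w ∈ II (υ y) y, (K s (z - w) : ℂ)) / 2 ^ υ y) * ft y‖ ≤
        40 * (1 / 4 ^ s * ∑ y ∈ hull υ F with (|y - z| ≤ (17:ℕ) * 2 ^ s ∧ υ y ≤ s + 3), 2 ^ υ y * b' y) := by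
      intro s hs
      have hzs := abs_lt.mp (hpw s hs)
      refine (norm_sum_window (fun y => |y - z| ≤ (9:ℕ) * 2 ^ s ∧ υ y ≤ s + 3) (h := fun y => 40 / 4 ^ s * (2 ^ υ y * ‖f y‖)) ?_ ?_).trans ?_
      · intro y _ hy
        have hcc : ∀ w ∈ II (υ y) y, (2:ℤ) ^ s ≤ |z - w| := by
          intro w hw
          by_contra hc
          apply hy
          have hw' := mem_II.mp hw
          have hυw := hD y w hw'
          have hc' := abs_lt.mp (not_le.mp hc)
          have hυ3 : υ w ≤ s + 3 := hυ s hs w (by rw [abs_le]; omega)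
          rw [hυw] at hυ3
          have h4 : (2:ℤ) ^ υ y ≤ 2 ^ (s + 3) := pow_le_pow_right₀ (by norm_num) hυ3
          rw [pow_add] at h4
          have h2 := abs_lt.mp (dy_dist hw')
          refine ⟨?_, hυ3⟩
          push_cast
          rw [abs_le]; omega
        rw [Finset.sum_eq_zero (fun w hw => by rw [K_supp _ _ (hcc w hw)]; simp), K_supp _ _ (hcc y (self_mem_II _ _))]
        simp
      · intro y _ _
        rw [norm_mul, hftn, ← mul_assoc]
        refine mul_le_mul_of_nonneg_right ?_ (norm_nonneg _)
        have e1 : (K s (z - y) : ℂ) - (∑ w ∈ II (υ y) y, (K s (z - w) : ℂ)) / 2 ^ υ y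
            = (∑ w ∈ II (υ y) y, ((K s (z - y) : ℂ) - K s (z - w))) / 2 ^ υ y := by
          rw [Finset.sum_sub_distrib, sum_const, nsmul_eq_mul]
          have : ((II (υ y) y).card : ℂ) = 2 ^ υ y := by
            have := card_II (υ y) y
            exact_mod_cast this
          rw [this]; field_simp
        rw [e1, norm_div, norm_pow, Complex.norm_two, div_le_iff₀ (by positivity)]
        refine (norm_sum_le_of_le _ (n := fun _ => 40 / 4 ^ s * 2 ^ υ y) fun w hw => ?_).trans (le_of_eq ?_)
        · rw [← Complex.ofReal_sub, Complex.norm_real, Real.norm_eq_abs]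
          refine (K_lip _ _ _).trans (mul_le_mul_of_nonneg_left ?_ (by positivity))
          have : |((z - y : ℤ) : ℝ) - ((z - w : ℤ) : ℝ)| = |(w:ℝ) - y| := by
            push_cast; congr 1; ring
          rw [this]
          exact_mod_cast (dy_dist (mem_II.mp hw)).le
        · rw [sum_const, nsmul_eq_mul, card_II]; ring
      · rw [← Finset.mul_sum]
        have h2 := window_EJ hD F (fun y => ‖f y‖) (fun y => norm_nonneg _) (fun n => 2 ^ n) (fun _ => by positivity) z 9 s
        calc _ ≤ 40 / 4 ^ s * ∑ y ∈ hull υ F with (|y - z| ≤ (17:ℕ) * 2 ^ s ∧ υ y ≤ s + 3), 2 ^ υ y * b' y :=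
              mul_le_mul_of_nonneg_left h2 (by positivity)
          _ = _ := by ring
    refine (norm_sum_le_of_le _ h1).trans ?_
    rw [← Finset.mul_sum]
    refine mul_le_mul_of_nonneg_left ?_ (by norm_num)
    unfold AA
    apply Finset.sum_le_sum_of_subset_of_nonneg
    · intro s hs
      rw [hA] at hs; rw [mem_Icc] at hs ⊢; omega
    · intro s _ _
      refine mul_nonneg (by positivity) (Finset.sum_nonneg fun y _ => mul_nonneg (by positivity) (hb'0 y))
  have t4 := hHs z a b ha hbS
  rw [← hA] at t4
  rw [edec, norm_mul, norm_ee, one_mul]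
  refine (norm_add_le _ _).trans ((add_le_add ((norm_add_le _ _).trans (add_le_add ((norm_add_le _ _).trans (add_le_add t1 t2)) t3)) t4).trans ?_)
  linarith

lemma norm_EJ_le (υ : ℤ → ℕ) (F : Finset ℤ) (f g : ℤ → ℂ) (h : ∀ y, ‖f y‖ = ‖g y‖) (y : ℤ) :
    ‖EJ υ F f y / 2 ^ υ y‖ ≤ EJ υ F (fun y => ‖g y‖) y / 2 ^ υ y := by
  rw [norm_div, norm_pow, Complex.norm_two]
  refine div_le_div_of_nonneg_right ?_ (by positivity)
  unfold EJ
  refine norm_sum_le_of_le _ fun y _ => (h y).le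

/-- the single tree estimate -/
lemma tree_est : ∃ C : ℝ, 0 < C ∧ ∀ (S : ℕ) (X : Finset ℤ) (N : ℤ → ℝ) (A : ℤ → Finset ℕ) (c : ℝ),
    TreeD S X N A c → ∀ (τ υ : ℤ → ℕ) (η δ : ℝ) (F : Finset ℤ), DyP υ → 0 ≤ δ → 0 ≤ η →
    (∀ x ∈ X, ∀ s ∈ A x, τ x < s) →
    (∀ x ∈ X, ∀ x' ∈ X, x' / 2 ^ τ x = x / 2 ^ τ x → τ x' = τ x) →
    (∀ x ∈ X, ((X.filter fun x' => x' / 2 ^ τ x = x / 2 ^ τ x).card : ℝ) ≤ η * 2 ^ τ x) →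
    (∀ x ∈ X, ∀ s ∈ A x, ∀ y, |x - y| ≤ 4 * 2 ^ s → υ y ≤ s + 3) →
    (∀ y, ((F.filter fun y' => y' / 2 ^ υ y = y / 2 ^ υ y).card : ℝ) ≤ δ * 2 ^ υ y) →
    ∀ f : ℤ → ℂ, ∑ x ∈ X, ‖∑ y ∈ F, ker N A x y * f y‖ ^ 2 ≤ C * (η * δ) * ∑ y ∈ F, ‖f y‖ ^ 2 := by
  obtain ⟨C1, hC1, H1⟩ := Hstar
  obtain ⟨C2, hC2, H2⟩ := M_sq
  obtain ⟨C3, hC3, H3⟩ := AA_L2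
  refine ⟨3 * (C1 + 2184 ^ 2 * C2 + 40 ^ 2 * C3), by positivity, ?_⟩
  intro S X N A c H τ υ η δ F hD hδ hη h1 h2 h3 h4 h5 f
  set b' : ℤ → ℝ := fun y => EJ υ F (fun y => ‖f y‖) y / 2 ^ υ y with hb'
  have hb'0 : ∀ y, 0 ≤ b' y := fun y => div_nonneg (Finset.sum_nonneg fun _ _ => norm_nonneg _) (by positivity)
  obtain ⟨Hs, hs0, hs1, hs2⟩ := H1 S (hull υ F) (fun y => EJ υ F (fun y => ee (c * y) * f y) y / 2 ^ υ y)
  have key := transfer h2 h3 (fun x => ‖∑ y ∈ F, ker N A x y * f y‖ ^ 2)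
    (fun z => (Hs z + 2184 * M (hull υ F) b' z + 40 * AA S (hull υ F) υ b' z) ^ 2) (fun z => sq_nonneg _)
    (fun x hx z hz => by
      refine pow_le_pow_left₀ (norm_nonneg _) ?_ 2
      exact tree_pt H hD F f Hs hs1 x hx (τ x) (h1 x hx) (h4 x hx) z hz)
  refine key.trans ?_
  set Zb := X.biUnion (fun x => II (τ x) x)
  have q0 := EJ_L2 hD F f hδ h5 (hull υ F)
  change ∑ y ∈ hull υ F, b' y ^ 2 ≤ _ at q0
  have q1 := hs2 Zb
  have q1' : ∑ y ∈ hull υ F, ‖EJ υ F (fun y => ee (c * y) * f y) y / 2 ^ υ y‖ ^ 2 ≤ ∑ y ∈ hull υ F, b' y ^ 2 :=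
    Finset.sum_le_sum fun y _ => pow_le_pow_left₀ (norm_nonneg _) (norm_EJ_le υ F _ f (fun y => by simp) y) 2
  have q2 := H2 (hull υ F) b' hb'0 Zb
  have q3 := H3 S (hull υ F) υ b' hb'0 Zb
  set Q := ∑ y ∈ hull υ F, b' y ^ 2
  have : ∑ z ∈ Zb, (Hs z + 2184 * M (hull υ F) b' z + 40 * AA S (hull υ F) υ b' z) ^ 2 ≤
      3 * (C1 + 2184 ^ 2 * C2 + 40 ^ 2 * C3) * Q := by
    calc _ ≤ ∑ z ∈ Zb, 3 * (Hs z ^ 2 + 2184 ^ 2 * M (hull υ F) b' z ^ 2 + 40 ^ 2 * AA S (hull υ F) υ b' z ^ 2) := by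
          refine Finset.sum_le_sum fun z _ => (sq_add3_le _ _ _).trans (le_of_eq ?_)
          ring
      _ = 3 * (∑ z ∈ Zb, Hs z ^ 2 + 2184 ^ 2 * ∑ z ∈ Zb, M (hull υ F) b' z ^ 2 + 40 ^ 2 * ∑ z ∈ Zb, AA S (hull υ F) υ b' z ^ 2) := by
          rw [← Finset.mul_sum, Finset.sum_add_distrib, Finset.sum_add_distrib, ← Finset.mul_sum, ← Finset.mul_sum]
      _ ≤ _ := by
          have := mul_le_mul_of_nonneg_left q1' hC1.le
          nlinarith
  calc _ ≤ η * (3 * (C1 + 2184 ^ 2 * C2 + 40 ^ 2 * C3) * (δ * ∑ y ∈ F, ‖f y‖ ^ 2)) := by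
        refine mul_le_mul_of_nonneg_left (this.trans ?_) hη
        exact mul_le_mul_of_nonneg_left q0 (by positivity)
    _ = _ := by ring

/-- unweighted tree bound -/
lemma tree_one : ∃ C : ℝ, 0 < C ∧ ∀ (S : ℕ) (X : Finset ℤ) (N : ℤ → ℝ) (A : ℤ → Finset ℕ) (c : ℝ),
    TreeD S X N A c → ∀ (F : Finset ℤ) (f : ℤ → ℂ),
    ∑ x ∈ X, ‖∑ y ∈ F, ker N A x y * f y‖ ^ 2 ≤ C * ∑ y ∈ F, ‖f y‖ ^ 2 := by
  obtain ⟨C, hC, H⟩ := tree_est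
  refine ⟨C, hC, fun S X N A c HT F f => ?_⟩
  have hcard : ∀ (B : Finset ℤ) (x : ℤ), ((B.filter fun x' => x' / 2 ^ 0 = x / 2 ^ 0).card : ℝ) ≤ 1 * 2 ^ 0 := by
    intro B x
    have : (B.filter fun x' => x' / 2 ^ 0 = x / 2 ^ 0) ⊆ {x} := by
      intro y hy
      have := (mem_filter.mp hy).2
      simpa using this
    have := Finset.card_le_card this
    simp only [card_singleton] at this
    norm_num
    exact_mod_cast (by simpa using this)
  have := H S X N A c HT (fun _ => 0) (fun _ => 0) 1 1 F (fun _ _ _ => rfl) zero_le_one zero_le_one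
    (fun x hx s hs => by
      obtain ⟨a, b, ha, hab, hb, e⟩ := HT.int x hx
      rw [e, mem_Icc] at hs; omega) (fun _ _ _ _ _ => rfl) (fun x _ => hcard X x) (fun _ _ _ _ _ _ => Nat.zero_le _)
      (fun y => hcard F y) f
  simpa using this

end
end Carl

namespace Carl
noncomputable section
open Finset

/-- scale `s` part of the adjoint -/
def ts (X : Finset ℤ) (N : ℤ → ℝ) (A : ℤ → Finset ℕ) (g : ℤ → ℂ) (s : ℕ) (y : ℤ) : ℂ :=
  ∑ x ∈ X with s ∈ A x, (K s (x - y) : ℂ) * ee (-(N x * y)) * g x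

/-- the demodulated adjoint kernel -/
def kap (X : Finset ℤ) (N : ℤ → ℝ) (A : ℤ → Finset ℕ) (c : ℝ) (s : ℕ) (x y : ℤ) : ℂ :=
  if x ∈ X ∧ s ∈ A x then (K s (x - y) : ℂ) * ee (-((N x - c) * (y - x))) else 0

lemma mod_lip (s : ℕ) (x y y' : ℤ) (θ : ℝ) (hθ : |θ| ≤ 3 / 2 ^ s) :
    ‖(K s (x - y) : ℂ) * ee (-(θ * (y - x))) - (K s (x - y') : ℂ) * ee (-(θ * (y' - x)))‖ ≤ 52 / 4 ^ s * |(y:ℝ) - y'| := by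
  have e : (K s (x - y) : ℂ) * ee (-(θ * (y - x))) - (K s (x - y') : ℂ) * ee (-(θ * (y' - x))) =
      ((K s (x - y) : ℂ) - K s (x - y')) * ee (-(θ * (y - x))) + (K s (x - y') : ℂ) * (ee (-(θ * (y - x))) - ee (-(θ * (y' - x)))) := by ring
  rw [e]
  have h1 : ‖((K s (x - y) : ℂ) - K s (x - y')) * ee (-(θ * (y - x)))‖ ≤ 40 / 4 ^ s * |(y:ℝ) - y'| := by
    rw [norm_mul, norm_ee, mul_one, ← Complex.ofReal_sub, Complex.norm_real, Real.norm_eq_abs]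
    refine (K_lip _ _ _).trans (le_of_eq ?_)
    rw [abs_sub_comm]; push_cast; congr 2; ring
  have h2 : ‖(K s (x - y') : ℂ) * (ee (-(θ * (y - x))) - ee (-(θ * (y' - x))))‖ ≤ 4 / 2 ^ s * (3 / 2 ^ s * |(y:ℝ) - y'|) := by
    rw [norm_mul, Complex.norm_real, Real.norm_eq_abs]
    refine mul_le_mul (K_abs _ _) ((ee_sub_le _ _).trans ?_) (norm_nonneg _) (by positivity)
    have : -(θ * ((y:ℝ) - x)) - -(θ * ((y':ℝ) - x)) = -(θ * ((y:ℝ) - y')) := by ring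
    rw [this, abs_neg, abs_mul]
    exact mul_le_mul_of_nonneg_right hθ (abs_nonneg _)
  refine (norm_add_le _ _).trans ((add_le_add h1 h2).trans (le_of_eq ?_))
  rw [four_pow]; field_simp; ring

lemma CZ_tree {S : ℕ} {X : Finset ℤ} {N : ℤ → ℝ} {A : ℤ → Finset ℕ} {c : ℝ} (H : TreeD S X N A c) :
    CZ S X (kap X N A c) 72 where
  size s x y := by
    unfold kap
    split_ifs
    · rw [norm_mul, norm_ee, mul_one, Complex.norm_real, Real.norm_eq_abs]
      refine (K_abs _ _).trans ?_
      gcongr; norm_num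
    · simp; positivity
  supp s x y h := by unfold kap; rw [K_supp _ _ h]; simp
  lip s x y y' := by
    unfold kap
    split_ifs with hx
    · refine (mod_lip s x y y' _ (H.freq x hx.1 s hx.2)).trans ?_
      gcongr; norm_num
    · simp
  canc x hx W hW := by
    obtain ⟨a, b, ha, hab, hb, hA⟩ := H.int x hx
    have hθ := H.freq x hx b (by rw [hA, mem_Icc]; omega)
    have h1 : ∀ s ∈ Icc 1 S, ‖∑ y ∈ W, kap X N A c s x y‖ ≤ if s ∈ A x then 36 / 2 ^ b * 2 ^ s else 0 := by
      intro s hsS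
      unfold kap
      by_cases hs : s ∈ A x
      · rw [if_pos hs]
        have hSs : (2:ℤ) ^ s ≤ 2 ^ S := pow_le_pow_right₀ (by norm_num) (mem_Icc.mp hsS).2
        have h0 := K_sum_zero s x W (fun y hy => hW y (by linarith))
        simp only [hx, hs, and_self, if_true]
        have e : ∑ y ∈ W, (K s (x - y) : ℂ) * ee (-((N x - c) * (y - x))) =
            ∑ y ∈ W, (K s (x - y) : ℂ) * (ee (-((N x - c) * (y - x))) - 1) := by
          simp_rw [mul_sub, mul_one]
          rw [Finset.sum_sub_distrib, ← Complex.ofReal_sum, h0]; simp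
        rw [e]
        have hn : ∀ y, (K s (x - y) : ℂ) * (ee (-((N x - c) * (y - x))) - 1) ≠ 0 → |y - x| < 2 ^ s := by
          intro y hy; by_contra hc; apply hy
          rw [K_supp]; · simp
          rw [abs_sub_comm]; omega
        rw [sum_window _ W (Ioo (x - 2 ^ s) (x + 2 ^ s)) (fun y hy => hW y (by linarith [hn y hy]))
          (fun y hy => by have := abs_lt.mp (hn y hy); rw [mem_Ioo]; omega)]
        refine (norm_sum_le_of_le _ (n := fun _ => 12 / 2 ^ b) fun y hy => ?_).trans ?_
        · rw [mem_Ioo] at hy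
          rw [norm_mul, Complex.norm_real, Real.norm_eq_abs]
          have hyx : |y - x| ≤ 2 ^ s := by rw [abs_le]; omega
          have hyx' : |(y:ℝ) - x| ≤ 2 ^ s := by exact_mod_cast hyx
          calc |K s (x - y)| * ‖ee (-((N x - c) * (y - x))) - 1‖ ≤ 4 / 2 ^ s * (3 / 2 ^ b * 2 ^ s) := by
                refine mul_le_mul (K_abs _ _) ((ee_sub_one_le _).trans ?_) (norm_nonneg _) (by positivity)
                rw [abs_neg, abs_mul]
                exact mul_le_mul hθ hyx' (abs_nonneg _) (by positivity)
            _ = _ := by field_simp; ring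
        · rw [sum_const, nsmul_eq_mul, Int.card_Ioo]
          have : ((x + 2 ^ s - (x - 2 ^ s) - 1).toNat : ℝ) ≤ 3 * 2 ^ s := by
            have h3 : ((x + 2 ^ s - (x - 2 ^ s) - 1).toNat : ℤ) ≤ 3 * 2 ^ s := by
              have : (0:ℤ) < 2 ^ s := by positivity
              omega
            exact_mod_cast h3
          calc _ ≤ 3 * 2 ^ s * (12 / 2 ^ b) := mul_le_mul_of_nonneg_right this (by positivity)
            _ = _ := by ring
      · simp [hs]
    refine (Finset.sum_le_sum h1).trans ?_
    rw [← Finset.sum_filter, ← Finset.mul_sum]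
    have h2 := geom_up (B := 2 ^ b) (by positivity) ((Icc 1 S).filter fun s => s ∈ A x) (fun k hk => by
      have := (mem_filter.mp hk).2
      rw [hA, mem_Icc] at this
      exact pow_le_pow_right₀ (by norm_num) this.2)
    calc _ ≤ 36 / 2 ^ b * (2 * 2 ^ b) := mul_le_mul_of_nonneg_left h2 (by positivity)
      _ = _ := by field_simp; norm_num

/-- domination of adjoint truncations -/
structure Dom (S : ℕ) (X : Finset ℤ) (N : ℤ → ℝ) (A : ℤ → Finset ℕ) (c : ℝ) (g : ℤ → ℂ) (Sg : ℤ → ℝ) : Prop where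
  nn : ∀ y, 0 ≤ Sg y
  tr : ∀ y a b, 1 ≤ a → b ≤ S → ‖∑ s ∈ Icc a b, ts X N A g s y‖ ≤ Sg y
  lip : ∀ (a : ℕ) (y y' z : ℤ), |y - z| ≤ 2 * 2 ^ a → |y' - z| ≤ 2 * 2 ^ a →
    ‖ee (c * y) * ∑ s ∈ Icc a S, ts X N A g s y - ee (c * y') * ∑ s ∈ Icc a S, ts X N A g s y'‖ ≤
      1008 * |(y:ℝ) - y'| / 2 ^ a * Sg z

lemma hs_kap (X : Finset ℤ) (N : ℤ → ℝ) (A : ℤ → Finset ℕ) (c : ℝ) (g : ℤ → ℂ) (s : ℕ) (y : ℤ) :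
    hs X (kap X N A c) (fun x => ee (-((N x - c) * x)) * g x) s y = ee (c * y) * ts X N A g s y := by
  unfold hs ts kap
  rw [Finset.sum_filter, Finset.mul_sum]
  refine Finset.sum_congr rfl fun x hx => ?_
  by_cases hs : s ∈ A x
  · simp only [hx, hs, and_self, if_true]
    have : ee (-((N x - c) * (y - x))) * ee (-((N x - c) * x)) = ee (c * y) * ee (-(N x * y)) := by
      rw [← ee_add, ← ee_add]; congr 1; ring
    linear_combination (K s (x - y) : ℂ) * g x * this
  · simp [hs]

lemma sum_ts {S : ℕ} {X : Finset ℤ} {N : ℤ → ℝ} {A : ℤ → Finset ℕ} {c : ℝ} (H : TreeD S X N A c) (g : ℤ → ℂ) (y : ℤ) :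
    ∑ s ∈ Icc 1 S, ts X N A g s y = ∑ x ∈ X, (starRingEnd ℂ) (ker N A x y) * g x := by
  unfold ts ker
  simp_rw [Finset.sum_filter]
  rw [Finset.sum_comm]
  refine Finset.sum_congr rfl fun x hx => ?_
  rw [← Finset.sum_filter, map_mul, conj_ee, map_sum, Finset.sum_mul, Finset.sum_mul]
  obtain ⟨a, b, ha, hab, hb, hA⟩ := H.int x hx
  have : (Icc 1 S).filter (fun s => s ∈ A x) = A x := by
    ext s; rw [mem_filter, hA, mem_Icc, mem_Icc]; omega
  rw [this]
  refine Finset.sum_congr rfl fun s _ => ?_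
  rw [Complex.conj_ofReal]

lemma tree_dom : ∃ C : ℝ, 0 < C ∧ ∀ (S : ℕ) (X : Finset ℤ) (N : ℤ → ℝ) (A : ℤ → Finset ℕ) (c : ℝ),
    TreeD S X N A c → ∀ g : ℤ → ℂ, ∃ Sg : ℤ → ℝ, Dom S X N A c g Sg ∧
      ∀ B : Finset ℤ, ∑ y ∈ B, Sg y ^ 2 ≤ C * ∑ x ∈ X, ‖g x‖ ^ 2 := by
  obtain ⟨C1, hC1, H1⟩ := tree_one
  obtain ⟨C2, hC2, H2⟩ := cotlar_L2
  obtain ⟨C3, hC3, H3⟩ := M_sq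
  refine ⟨2 * (C2 * (72 ^ 2 + C1)) + 2 * C3, by positivity, fun S X N A c H g => ?_⟩
  set gt : ℤ → ℂ := fun x => ee (-((N x - c) * x)) * g x with hgt
  have hgn : ∀ x, ‖gt x‖ = ‖g x‖ := fun x => by rw [hgt]; simp
  have HC := CZ_tree H
  obtain ⟨Hs, h0, h1, h2⟩ := H2 S X _ 72 C1 HC gt (fun B => by
    have := dual_bd hC1.le (fun f => H1 S X N A c H B f) g
    simp_rw [hgn]
    refine le_trans (le_of_eq (Finset.sum_congr rfl fun y _ => ?_)) this
    rw [← sum_ts H]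
    simp_rw [hgt, hs_kap]
    rw [← Finset.mul_sum, norm_mul, norm_ee, one_mul])
  simp_rw [hgn] at h2
  have hM := fun y => M_nonneg (Z := X) (h := fun x => ‖g x‖) (fun x => norm_nonneg _) y
  refine ⟨fun y => Hs y + M X (fun x => ‖g x‖) y, ⟨fun y => add_nonneg (h0 y) (hM y), ?_, ?_⟩, ?_⟩
  · intro y a b ha hb
    have := h1 y a b ha hb
    simp_rw [hgt, hs_kap] at this
    rw [← Finset.mul_sum, norm_mul, norm_ee, one_mul] at this
    linarith [hM y]
  · intro a y y' z hy hy'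
    have := hs_lip HC gt a y y' z hy hy'
    simp_rw [hgn] at this
    simp_rw [hgt, hs_kap] at this
    rw [Finset.sum_sub_distrib, ← Finset.mul_sum, ← Finset.mul_sum] at this
    refine this.trans ?_
    have e : (14 * 72 : ℝ) = 1008 := by norm_num
    rw [e]
    refine mul_le_mul_of_nonneg_left ?_ (by positivity)
    linarith [h0 z]
  · intro B
    have a1 := h2 B
    have a2 := H3 X (fun x => ‖g x‖) (fun x => norm_nonneg _) B
    calc _ ≤ ∑ y ∈ B, (2 * Hs y ^ 2 + 2 * M X (fun x => ‖g x‖) y ^ 2) := Finset.sum_le_sum fun y _ => sq_add_le _ _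
      _ = 2 * ∑ y ∈ B, Hs y ^ 2 + 2 * ∑ y ∈ B, M X (fun x => ‖g x‖) y ^ 2 := by
        rw [Finset.sum_add_distrib, Finset.mul_sum, Finset.mul_sum]
      _ ≤ _ := by linarith

/-- the oscillatory pairing of a single atom with a truncated adjoint -/
lemma pair_atom {S : ℕ} {X : Finset ℤ} {N : ℤ → ℝ} {A : ℤ → Finset ℕ} {c : ℝ} {g : ℤ → ℂ} {Sg : ℤ → ℝ}
    (HD : Dom S X N A c g Sg) (c' : ℝ) (hc : c' - c ≠ 0) (hc' : |c' - c| ≤ Real.pi) (x : ℤ) (ν : ℝ) (s a : ℕ) (hs1 : 1 ≤ s) (hsa : s ≤ a)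
    (hν : |ν - c'| ≤ 3 / 2 ^ s) (Y : Finset ℤ) (hY : ∀ y, |y - x| < 2 ^ s → y ∈ Y) :
    ‖∑ y ∈ Y, (K s (x - y) : ℂ) * ee (ν * y) * ∑ r ∈ Icc a S, ts X N A g r y‖ ≤
      900000 * (1 / 2 ^ s) / |c' - c| * Sg x := by
  set Hd : ℤ → ℂ := fun y => ee (c * y) * ∑ r ∈ Icc a S, ts X N A g r y with hHd
  set θ := c' - ν with hθ
  have hθ' : |θ| ≤ 3 / 2 ^ s := by rw [hθ, abs_sub_comm]; exact hν
  set Φ : ℤ → ℂ := fun y => (K s (x - y) : ℂ) * ee (-(θ * (y - x))) * Hd y with hΦ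
  have e : ∑ y ∈ Y, (K s (x - y) : ℂ) * ee (ν * y) * ∑ r ∈ Icc a S, ts X N A g r y =
      ee (-(θ * x)) * ∑ y ∈ Y, Φ y * ee ((c' - c) * y) := by
    rw [Finset.mul_sum]
    refine Finset.sum_congr rfl fun y _ => ?_
    rw [hΦ, hHd]
    have : ee (ν * y) = ee (-(θ * x)) * ee (-(θ * (y - x))) * ee (c * y) * ee ((c' - c) * y) := by
      rw [← ee_add, ← ee_add, ← ee_add]; congr 1; rw [hθ]; ring
    rw [this]; ring
  rw [e, norm_mul, norm_ee, one_mul]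
  have h2a : (2:ℤ) ^ s ≤ 2 ^ a := pow_le_pow_right₀ (by norm_num) hsa
  have h2aR : (2:ℝ) ^ s ≤ 2 ^ a := pow_le_pow_right₀ (by norm_num) hsa
  have hSx := HD.nn x
  have hHl : ∀ y y', |y - x| ≤ 2 * 2 ^ s → |y' - x| ≤ 2 * 2 ^ s → ‖Hd y - Hd y'‖ ≤ 1008 * |(y:ℝ) - y'| / 2 ^ s * Sg x := by
    intro y y' hy hy'
    refine (HD.lip a y y' x (by linarith) (by linarith)).trans ?_
    gcongr
  have hHb : ∀ y, |y - x| ≤ 2 * 2 ^ s → ‖Hd y‖ ≤ 2017 * Sg x := by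
    intro y hy
    have h1 := hHl y x hy (by simp)
    have h2 : ‖Hd x‖ ≤ Sg x := by
      rw [hHd]; simp only []; rw [norm_mul, norm_ee, one_mul]; exact HD.tr x a S (by omega) le_rfl
    have h3 : ‖Hd y‖ ≤ ‖Hd y - Hd x‖ + ‖Hd x‖ := by
      have := norm_add_le (Hd y - Hd x) (Hd x); simpa using this
    have h4 : |(y:ℝ) - x| ≤ 2 * 2 ^ s := by exact_mod_cast hy
    have h5 : 1008 * |(y:ℝ) - x| / 2 ^ s * Sg x ≤ 2016 * Sg x := by
      refine mul_le_mul_of_nonneg_right ?_ hSx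
      rw [div_le_iff₀ (by positivity)]; linarith
    linarith
  have h1s : (1:ℤ) ≤ 2 ^ s := one_le_pow₀ (by norm_num)
  have hsup : ∀ y, (2:ℤ) ^ s ≤ |y - x| → Φ y = 0 := by
    intro y hy; rw [hΦ]; simp only []; rw [K_supp]; · simp
    rw [abs_sub_comm]; exact hy
  have hV : ∀ y, ‖Φ y - Φ (y - 1)‖ ≤ 110000 / 4 ^ s * Sg x := by
    intro y
    by_cases hy : |y - x| ≤ 2 ^ s
    · have hy0 := abs_le.mp hy
      have hy1 : |y - 1 - x| ≤ 2 * 2 ^ s := by rw [abs_le]; omega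
      have hy2 : |y - x| ≤ 2 * 2 ^ s := by linarith
      have e2 : Φ y - Φ (y - 1) = ((K s (x - y) : ℂ) * ee (-(θ * (y - x))) - (K s (x - (y - 1)) : ℂ) * ee (-(θ * ((y - 1 : ℤ) - x)))) * Hd y
          + (K s (x - (y - 1)) : ℂ) * ee (-(θ * ((y - 1 : ℤ) - x))) * (Hd y - Hd (y - 1)) := by
        rw [hΦ]; ring
      have hd : |(y:ℝ) - ((y - 1 : ℤ) : ℝ)| = 1 := by push_cast; simp
      rw [e2]
      have b1 := mod_lip s x y (y - 1) θ hθ'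
      have b2 := hHb y hy2
      have b3 := hHl y (y - 1) hy2 hy1
      have b4 : ‖(K s (x - (y - 1)) : ℂ) * ee (-(θ * ((y - 1 : ℤ) - x)))‖ ≤ 4 / 2 ^ s := by
        rw [norm_mul, norm_ee, mul_one, Complex.norm_real, Real.norm_eq_abs]
        exact K_abs s (x - (y - 1))
      rw [hd] at b1 b3
      refine (norm_add_le _ _).trans ((add_le_add (norm_mul_le _ _) (norm_mul_le _ _)).trans ?_)
      calc _ ≤ 52 / 4 ^ s * 1 * (2017 * Sg x) + 4 / 2 ^ s * (1008 * 1 / 2 ^ s * Sg x) :=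
            add_le_add (mul_le_mul b1 b2 (norm_nonneg _) (by positivity)) (mul_le_mul b4 b3 (norm_nonneg _) (by positivity))
        _ = 108916 / 4 ^ s * Sg x := by rw [four_pow]; field_simp; ring
        _ ≤ _ := by gcongr; norm_num
    · rw [hsup y (by omega), hsup (y - 1)]
      · simp; positivity
      · have := not_le.mp hy
        have h3 := lt_abs.mp this
        rw [le_abs]; omega
  have := SBP hc hc' x (2 ^ s) (fun y hy => hsup y (by exact_mod_cast hy)) hV Y (fun y hy => hY y (by exact_mod_cast hy))
  refine this.trans ?_
  push_cast
  rw [four_pow]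
  have : 4 * 2 ^ s * (110000 / (2 ^ s * 2 ^ s) * Sg x) / |c' - c| = 440000 * (1 / 2 ^ s) / |c' - c| * Sg x := by
    have : (2:ℝ)^s ≠ 0 := by positivity
    field_simp; ring
  rw [this]
  gcongr
  norm_num

end
end Carl

namespace Carl
noncomputable section
open Finset

lemma pair_half {S : ℕ} {X X' : Finset ℤ} {N : ℤ → ℝ} {A : ℤ → Finset ℕ} {c c' : ℝ} {g g' : ℤ → ℂ} {Sg : ℤ → ℝ}
    (HD : Dom S X N A c g Sg) (H' : TreeD S X' N A c') (hc' : |c' - c| ≤ Real.pi) (e : ℕ)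
    (J : Finset ℤ) {D : ℝ} (hD : 0 < D)
    (h : ∀ x' ∈ X', ∀ s' ∈ A x', ∀ x ∈ X, ∀ s ∈ A x, s' ≤ s → |x - x'| < 2 ^ s + 2 ^ s' → x' ∈ J ∧ D ≤ 2 ^ s' * |c' - c|)
    (Y : Finset ℤ) (hY : ∀ x ∈ X', ∀ y, |y - x| < 2 ^ S → y ∈ Y) :
    ‖∑ y ∈ Y, ∑ s' ∈ Icc 1 S, (starRingEnd ℂ) (ts X' N A g' s' y) * ∑ s ∈ Icc (s' + e) S, ts X N A g s y‖ ≤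
      1800000 / D * ∑ x ∈ X' with x ∈ J, ‖g' x‖ * Sg x := by
  classical
  have e1 : ∑ y ∈ Y, ∑ s' ∈ Icc 1 S, (starRingEnd ℂ) (ts X' N A g' s' y) * ∑ s ∈ Icc (s' + e) S, ts X N A g s y =
      ∑ x ∈ X', (starRingEnd ℂ) (g' x) * ∑ s' ∈ A x, ∑ y ∈ Y, (K s' (x - y) : ℂ) * ee (N x * y) * ∑ s ∈ Icc (s' + e) S, ts X N A g s y := by
    rw [Finset.sum_comm]
    have : ∀ s' ∈ Icc 1 S, ∑ y ∈ Y, (starRingEnd ℂ) (ts X' N A g' s' y) * ∑ s ∈ Icc (s' + e) S, ts X N A g s y =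
        ∑ x ∈ X', if s' ∈ A x then (starRingEnd ℂ) (g' x) * ∑ y ∈ Y, (K s' (x - y) : ℂ) * ee (N x * y) * ∑ s ∈ Icc (s' + e) S, ts X N A g s y else 0 := by
      intro s' _
      rw [← Finset.sum_filter]
      simp_rw [Finset.mul_sum Y]
      rw [Finset.sum_comm]
      refine Finset.sum_congr rfl fun y _ => ?_
      conv_lhs => rw [ts]
      rw [map_sum, Finset.sum_mul]
      refine Finset.sum_congr rfl fun x _ => ?_
      rw [map_mul, map_mul, conj_ee, Complex.conj_ofReal, neg_neg]
      ring
    rw [Finset.sum_congr rfl this, Finset.sum_comm]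
    refine Finset.sum_congr rfl fun x hx => ?_
    rw [← Finset.sum_filter, Finset.mul_sum]
    obtain ⟨a, b, ha, hab, hb, hA⟩ := H'.int x hx
    congr 1
    ext s; rw [mem_filter, hA, mem_Icc, mem_Icc]; omega
  rw [e1, Finset.sum_filter, Finset.mul_sum]
  refine norm_sum_le_of_le _ fun x' hx' => ?_
  rw [norm_mul, RCLike.norm_conj]
  -- the inner sums
  have key : ∀ s' ∈ A x', ‖∑ y ∈ Y, (K s' (x' - y) : ℂ) * ee (N x' * y) * ∑ s ∈ Icc (s' + e) S, ts X N A g s y‖ ≤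
      if (x' ∈ J ∧ D ≤ 2 ^ s' * |c' - c|) then 900000 * (1 / 2 ^ s') / |c' - c| * Sg x' else 0 := by
    intro s' hs'
    obtain ⟨a, b, ha, hab, hb, hA⟩ := H'.int x' hx'
    have hs1 : 1 ≤ s' ∧ s' ≤ S := by rw [hA, mem_Icc] at hs'; omega
    have hsS : (2:ℤ) ^ s' ≤ 2 ^ S := pow_le_pow_right₀ (by norm_num) hs1.2
    split_ifs with hq
    · have hcc : c' - c ≠ 0 := by
        intro h0; rw [h0] at hq; simp at hq; linarith
      exact pair_atom HD c' hcc hc' x' (N x') s' (s' + e) hs1.1 (by omega) (H'.freq x' hx' s' hs') Y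
        (fun y hy => hY x' hx' y (by linarith))
    · rw [Finset.sum_eq_zero]; · simp
      intro y _
      by_cases hk : (2:ℤ) ^ s' ≤ |x' - y|
      · rw [K_supp _ _ hk]; simp
      rw [Finset.sum_eq_zero, mul_zero]
      intro s hs
      unfold ts
      refine Finset.sum_eq_zero fun x hx => ?_
      rw [mem_filter] at hx
      rw [K_supp]; · simp
      by_contra hk2
      apply hq
      refine h x' hx' s' hs' x hx.1 s hx.2 (by rw [mem_Icc] at hs; omega) ?_
      have h1 := abs_lt.mp (not_le.mp hk)
      have h2 := abs_lt.mp (not_le.mp hk2)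
      rw [abs_lt]; constructor <;> linarith
  have h2 := norm_sum_le_of_le _ key
  split_ifs with hJ
  · simp only [hJ, true_and] at h2
    rw [← Finset.sum_filter] at h2
    have h3 : ∑ s' ∈ A x' with D ≤ 2 ^ s' * |c' - c|, 900000 * (1 / 2 ^ s') / |c' - c| * Sg x' ≤ 1800000 / D * Sg x' := by
      rcases eq_or_ne (c' - c) 0 with h0 | h0
      · rw [h0]; simp
        have := HD.nn x'
        positivity
      have hp : 0 < |c' - c| := abs_pos.mpr h0
      have := geom_down (B := |c' - c| / D) (by positivity) ((A x').filter fun s' => D ≤ 2 ^ s' * |c' - c|) (fun s' hs' => by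
        have := (mem_filter.mp hs').2
        rw [div_le_div_iff₀ (by positivity) hD]; linarith)
      rw [← Finset.sum_mul]
      refine mul_le_mul_of_nonneg_right ?_ (HD.nn x')
      rw [← Finset.sum_div, ← Finset.mul_sum]
      calc _ ≤ 900000 * (2 * (|c' - c| / D)) / |c' - c| := by gcongr
        _ = _ := by field_simp; norm_num
    calc _ ≤ ‖g' x'‖ * (1800000 / D * Sg x') := mul_le_mul_of_nonneg_left (h2.trans h3) (norm_nonneg _)
      _ = _ := by ring
  · simp only [hJ, false_and, if_false, sum_const_zero] at h2
    rw [le_antisymm h2 (norm_nonneg _)]; simp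

/-- forests -/
structure Forest {ι : Type*} (S : ℕ) (U : Finset ι) (X : ι → Finset ℤ) (N : ℤ → ℝ) (A : ℤ → Finset ℕ) (c : ι → ℝ)
    (I : ι → Finset ℤ) (η D O : ℝ) : Prop where
  tree : ∀ u ∈ U, TreeD S (X u) N A (c u)
  disj : ∀ u ∈ U, ∀ u' ∈ U, u ≠ u' → Disjoint (X u) (X u')
  supp : ∀ u ∈ U, ∀ x ∈ X u, ∀ s ∈ A x, ∀ y, |y - x| ≤ 8 * 2 ^ s → y ∈ I u
  cc : ∀ u ∈ U, ∀ u' ∈ U, |c u' - c u| ≤ Real.pi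
  sep : ∀ u ∈ U, ∀ u' ∈ U, u ≠ u' → ∀ x' ∈ X u', ∀ s' ∈ A x', ∀ x ∈ X u, ∀ s ∈ A x, s' ≤ s →
    |x - x'| < 2 ^ s + 2 ^ s' → D ≤ 2 ^ s' * |c u' - c u|
  ov : ∀ y, ((U.filter fun u => y ∈ I u).card : ℝ) ≤ O
  eta : 0 ≤ η
  dpos : 0 < D
  tau : ∀ u ∈ U, ∃ τ : ℤ → ℕ, (∀ x ∈ X u, ∀ s ∈ A x, τ x < s) ∧
    (∀ x ∈ X u, ∀ x' ∈ X u, x' / 2 ^ τ x = x / 2 ^ τ x → τ x' = τ x) ∧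
    (∀ x ∈ X u, (((X u).filter fun x' => x' / 2 ^ τ x = x / 2 ^ τ x).card : ℝ) ≤ η * 2 ^ τ x)

lemma dual_bd' {G Z : Finset ℤ} {k : ℤ → ℤ → ℂ} {C : ℝ} (hC : 0 ≤ C)
    (H : ∀ g : ℤ → ℂ, ∑ y ∈ Z, ‖∑ x ∈ G, (starRingEnd ℂ) (k x y) * g x‖ ^ 2 ≤ C * ∑ x ∈ G, ‖g x‖ ^ 2) (f : ℤ → ℂ) :
    ∑ x ∈ G, ‖∑ y ∈ Z, k x y * f y‖ ^ 2 ≤ C * ∑ y ∈ Z, ‖f y‖ ^ 2 := by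
  have := dual_bd (G := Z) (Z := G) (k := fun y x => (starRingEnd ℂ) (k x y)) hC H f
  simpa using this

lemma sq_sum_norm {ι : Type*} (U : Finset ι) (Y : Finset ℤ) (t : ι → ℤ → ℂ) :
    ∑ y ∈ Y, ‖∑ u ∈ U, t u y‖ ^ 2 ≤ ∑ u ∈ U, ∑ u' ∈ U, ‖∑ y ∈ Y, t u y * (starRingEnd ℂ) (t u' y)‖ := by
  have e : ((∑ y ∈ Y, ‖∑ u ∈ U, t u y‖ ^ 2 : ℝ) : ℂ) = ∑ u ∈ U, ∑ u' ∈ U, ∑ y ∈ Y, t u y * (starRingEnd ℂ) (t u' y) := by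
    push_cast
    rw [Finset.sum_congr rfl fun u _ => Finset.sum_comm, Finset.sum_comm]
    refine Finset.sum_congr rfl fun y _ => ?_
    have : ((‖∑ u ∈ U, t u y‖ : ℂ)) ^ 2 = (∑ u ∈ U, t u y) * (starRingEnd ℂ) (∑ u ∈ U, t u y) := by
      rw [Complex.mul_conj, Complex.normSq_eq_norm_sq]; push_cast; rfl
    rw [this, map_sum, Finset.sum_mul]
    refine Finset.sum_congr rfl fun u _ => ?_
    rw [Finset.mul_sum]
  have h0 : 0 ≤ ∑ y ∈ Y, ‖∑ u ∈ U, t u y‖ ^ 2 := Finset.sum_nonneg fun _ _ => by positivity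
  rw [← abs_of_nonneg h0, ← Real.norm_eq_abs, ← Complex.norm_real, e]
  refine norm_sum_le_of_le _ fun u _ => norm_sum_le_of_le _ fun u' _ => le_rfl

section forest
variable {ι : Type*} [DecidableEq ι] {S : ℕ} {U : Finset ι} {X : ι → Finset ℤ} {N : ℤ → ℝ} {A : ℤ → Finset ℕ} {c : ι → ℝ}
    {I : ι → Finset ℤ} {η D O : ℝ}

lemma Forest.sumX (H : Forest S U X N A c I η D O) {E : Type*} [AddCommMonoid E] (Φ : ℤ → E) :
    ∑ x ∈ U.biUnion X, Φ x = ∑ u ∈ U, ∑ x ∈ X u, Φ x :=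
  Finset.sum_biUnion fun u hu u' hu' hne => H.disj u hu u' hu' hne

lemma Forest.pairs (H : Forest S U X N A c I η D O) (g : ℤ → ℂ) (Sg : ι → ℤ → ℝ)
    (hS : ∀ u ∈ U, Dom S (X u) N A (c u) g (Sg u)) (Y : Finset ℤ)
    (hY : ∀ u ∈ U, ∀ x ∈ X u, ∀ y, |y - x| < 2 ^ S → y ∈ Y) (u : ι) (hu : u ∈ U) (u' : ι) (hu' : u' ∈ U) (hne : u ≠ u') :
    ‖∑ y ∈ Y, (∑ s ∈ Icc 1 S, ts (X u) N A g s y) * (starRingEnd ℂ) (∑ s ∈ Icc 1 S, ts (X u') N A g s y)‖ ≤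
    1800000 / D * ∑ x ∈ X u' with x ∈ I u, ‖g x‖ * Sg u x + 1800000 / D * ∑ x ∈ X u with x ∈ I u', ‖g x‖ * Sg u' x := by
  have hJ : ∀ v ∈ U, ∀ v' ∈ U, v ≠ v' → ∀ x' ∈ X v', ∀ s' ∈ A x', ∀ x ∈ X v, ∀ s ∈ A x, s' ≤ s → |x - x'| < 2 ^ s + 2 ^ s' →
      x' ∈ I v ∧ D ≤ 2 ^ s' * |c v' - c v| := by
    intro v hv v' hv' hvv x' hx' s' hs' x hx s hs hss hd
    refine ⟨H.supp v hv x hx s hs x' ?_, H.sep v hv v' hv' hvv x' hx' s' hs' x hx s hs hss hd⟩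
    have : (2:ℤ) ^ s' ≤ 2 ^ s := pow_le_pow_right₀ (by norm_num) hss
    have h0 : (0:ℤ) < 2 ^ s := by positivity
    rw [abs_sub_comm]; linarith
  have h1 := pair_half (g' := g) (hS u hu) (H.tree u' hu') (H.cc u hu u' hu') 0 (I u) H.dpos (hJ u hu u' hu' hne) Y (hY u' hu')
  have h2 := pair_half (g' := g) (hS u' hu') (H.tree u hu) (H.cc u' hu' u hu) 1 (I u') H.dpos (hJ u' hu' u hu hne.symm) Y (hY u hu)
  refine le_trans ?_ (add_le_add h1 h2)
  rw [← RCLike.norm_conj (K := ℂ) (∑ y ∈ Y, ∑ s' ∈ Icc 1 S, (starRingEnd ℂ) (ts (X u) N A g s' y) * ∑ s ∈ Icc (s' + 1) S, ts (X u') N A g s y)]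
  refine le_trans (le_of_eq ?_) (norm_add_le _ _)
  congr 1
  rw [map_sum, ← Finset.sum_add_distrib]
  refine Finset.sum_congr rfl fun y _ => ?_
  simp only [map_sum, map_mul, Complex.conj_conj, add_zero]
  set p := fun s => ts (X u) N A g s y
  set q := fun s => (starRingEnd ℂ) (ts (X u') N A g s y)
  change (∑ s ∈ Icc 1 S, p s) * ∑ s ∈ Icc 1 S, q s = ∑ s ∈ Icc 1 S, q s * ∑ r ∈ Icc s S, p r + ∑ s ∈ Icc 1 S, p s * ∑ r ∈ Icc (s + 1) S, q r
  rw [Finset.sum_mul_sum]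
  have e1 : ∑ s ∈ Icc 1 S, q s * ∑ r ∈ Icc s S, p r = ∑ r ∈ Icc 1 S, ∑ s ∈ Icc 1 S, if s ≤ r then p r * q s else 0 := by
    rw [Finset.sum_comm]
    refine Finset.sum_congr rfl fun s hs => ?_
    rw [← Finset.sum_filter, Finset.mul_sum]
    refine Finset.sum_congr ?_ fun r _ => mul_comm _ _
    ext r; simp only [mem_filter, mem_Icc] at hs ⊢; omega
  have e2 : ∑ s ∈ Icc 1 S, p s * ∑ r ∈ Icc (s + 1) S, q r = ∑ r ∈ Icc 1 S, ∑ s ∈ Icc 1 S, if s ≤ r then 0 else p r * q s := by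
    refine Finset.sum_congr rfl fun r hr => ?_
    rw [Finset.mul_sum]
    simp_rw [← ite_not (p := _ ≤ _)]
    rw [← Finset.sum_filter]
    refine Finset.sum_congr ?_ fun r _ => rfl
    ext s; simp only [mem_filter, mem_Icc] at hr ⊢; omega
  rw [e1, e2, ← Finset.sum_add_distrib]
  refine Finset.sum_congr rfl fun r _ => ?_
  rw [← Finset.sum_add_distrib]
  refine Finset.sum_congr rfl fun s _ => ?_
  split_ifs <;> simp

end forest
end
end Carl

namespace Carl
noncomputable section
open Finset

lemma card_zero_scale (B : Finset ℤ) (x : ℤ) : ((B.filter fun x' => x' / 2 ^ 0 = x / 2 ^ 0).card : ℝ) ≤ 1 * 2 ^ 0 := by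
  have : (B.filter fun x' => x' / 2 ^ 0 = x / 2 ^ 0) ⊆ {x} := by
    intro y hy
    have := (mem_filter.mp hy).2
    simpa using this
  have := Finset.card_le_card this
  simp only [card_singleton] at this
  norm_num
  exact_mod_cast (by simpa using this)

section forest
variable {ι : Type*} [DecidableEq ι] {S : ℕ} {U : Finset ι} {X : ι → Finset ℤ} {N : ℤ → ℝ} {A : ℤ → Finset ℕ} {c : ι → ℝ}
    {I : ι → Finset ℤ} {η D O : ℝ}

lemma forest_offdiag (H : Forest S U X N A c I η D O) {C2 : ℝ} (g : ℤ → ℂ) (Sg : ι → ℤ → ℝ)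
    (hS : ∀ u ∈ U, ∀ B : Finset ℤ, ∑ y ∈ B, Sg u y ^ 2 ≤ C2 * ∑ x ∈ X u, ‖g x‖ ^ 2) :
    2 * ∑ u ∈ U, ∑ u' ∈ U, ∑ x ∈ X u' with x ∈ I u, ‖g x‖ * Sg u x ≤ (O + C2) * ∑ x ∈ U.biUnion X, ‖g x‖ ^ 2 := by
  have e : ∀ u ∈ U, ∑ u' ∈ U, ∑ x ∈ X u' with x ∈ I u, ‖g x‖ * Sg u x = ∑ x ∈ U.biUnion X, if x ∈ I u then ‖g x‖ * Sg u x else 0 := by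
    intro u hu
    rw [H.sumX]
    exact Finset.sum_congr rfl fun u' _ => by rw [Finset.sum_filter]
  rw [Finset.sum_congr rfl e, Finset.mul_sum]
  have h1 : ∀ u ∈ U, 2 * ∑ x ∈ U.biUnion X, (if x ∈ I u then ‖g x‖ * Sg u x else 0) ≤
      ∑ x ∈ U.biUnion X, (if x ∈ I u then 1 else 0) * ‖g x‖ ^ 2 + C2 * ∑ x ∈ X u, ‖g x‖ ^ 2 := by
    intro u hu
    refine le_trans ?_ (add_le_add_right (hS u hu (U.biUnion X)) _)
    rw [← Finset.sum_add_distrib, Finset.mul_sum]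
    refine Finset.sum_le_sum fun x _ => ?_
    split_ifs
    · nlinarith [sq_nonneg (‖g x‖ - Sg u x)]
    · nlinarith [sq_nonneg (Sg u x)]
  refine (Finset.sum_le_sum h1).trans ?_
  rw [Finset.sum_add_distrib, ← Finset.mul_sum, ← H.sumX (fun x => ‖g x‖ ^ 2), add_mul]
  refine add_le_add_left ?_ _
  rw [Finset.sum_comm, Finset.mul_sum]
  refine Finset.sum_le_sum fun x _ => ?_
  rw [← Finset.sum_mul]
  refine mul_le_mul_of_nonneg_right ?_ (by positivity)
  rw [Finset.sum_boole]
  exact H.ov x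

end forest

lemma forest_a : ∃ C : ℝ, 0 < C ∧ ∀ {ι : Type} [DecidableEq ι] {S : ℕ} {U : Finset ι} {X : ι → Finset ℤ} {N : ℤ → ℝ}
    {A : ℤ → Finset ℕ} {c : ι → ℝ} {I : ι → Finset ℤ} {η D O : ℝ}, Forest S U X N A c I η D O →
    ∀ (F : Finset ℤ) (f : ℤ → ℂ), ∑ x ∈ U.biUnion X, ‖∑ y ∈ F, ker N A x y * f y‖ ^ 2 ≤
      C * (η + (1 + O) / D) * ∑ y ∈ F, ‖f y‖ ^ 2 := by
  obtain ⟨C1, hC1, H1⟩ := tree_est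
  obtain ⟨C2, hC2, H2⟩ := tree_dom
  refine ⟨C1 + 1800000 * (1 + C2), by positivity, ?_⟩
  intro ι _ S U X N A c I η D O H F f
  have hO : 0 ≤ O := (Nat.cast_nonneg _).trans (H.ov 0)
  have hD := H.dpos
  have hη := H.eta
  set G := U.biUnion X with hG
  set Y := F ∪ nb G (2 ^ S) with hY
  have hYm : ∀ u ∈ U, ∀ x ∈ X u, ∀ y, |y - x| < 2 ^ S → y ∈ Y := by
    intro u hu x hx y hy
    exact mem_union_right _ (mem_nb (mem_biUnion.mpr ⟨u, hu, hx⟩) hy.le)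
  have dual : ∀ g : ℤ → ℂ, ∑ y ∈ Y, ‖∑ x ∈ G, (starRingEnd ℂ) (ker N A x y) * g x‖ ^ 2 ≤
      (C1 * η + 1800000 / D * (O + C2)) * ∑ x ∈ G, ‖g x‖ ^ 2 := by
    intro g
    have : ∀ u, ∃ Sg : ℤ → ℝ, u ∈ U → Dom S (X u) N A (c u) g Sg ∧
      ∀ B : Finset ℤ, ∑ y ∈ B, Sg y ^ 2 ≤ C2 * ∑ x ∈ X u, ‖g x‖ ^ 2 := by
      intro u
      by_cases hu : u ∈ U
      · obtain ⟨Sg, h⟩ := H2 S (X u) N A (c u) (H.tree u hu) g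
        exact ⟨Sg, fun _ => h⟩
      · exact ⟨fun _ => 0, fun h => absurd h hu⟩
    choose Sg hSg using this
    have e : ∀ y ∈ Y, ‖∑ x ∈ G, (starRingEnd ℂ) (ker N A x y) * g x‖ ^ 2 = ‖∑ u ∈ U, ∑ s ∈ Icc 1 S, ts (X u) N A g s y‖ ^ 2 := by
      intro y _
      rw [hG, H.sumX]
      congr 2
      exact Finset.sum_congr rfl fun u hu => (sum_ts (H.tree u hu) g y).symm
    rw [Finset.sum_congr rfl e]
    refine (sq_sum_norm U Y fun u y => ∑ s ∈ Icc 1 S, ts (X u) N A g s y).trans ?_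
    set a : ι → ι → ℝ := fun u u' => ∑ x ∈ X u' with x ∈ I u, ‖g x‖ * Sg u x with ha
    have ha0 : ∀ u ∈ U, ∀ u', 0 ≤ a u u' := fun u hu u' => Finset.sum_nonneg fun x _ =>
      mul_nonneg (norm_nonneg _) ((hSg u hu).1.nn x)
    have hk : (0:ℝ) ≤ 1800000 / D := by positivity
    have main : ∀ u ∈ U, ∀ u' ∈ U, ‖∑ y ∈ Y, (∑ s ∈ Icc 1 S, ts (X u) N A g s y) * (starRingEnd ℂ) (∑ s ∈ Icc 1 S, ts (X u') N A g s y)‖ ≤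
        (if u = u' then C1 * η * ∑ x ∈ X u, ‖g x‖ ^ 2 else 0) + (1800000 / D * a u u' + 1800000 / D * a u' u) := by
      intro u hu u' hu'
      by_cases h : u = u'
      · subst h
        rw [if_pos rfl]
        have hn : 0 ≤ 1800000 / D * a u u + 1800000 / D * a u u := by
          have := mul_nonneg hk (ha0 u hu u); linarith
        refine le_trans ?_ (le_add_of_nonneg_right hn)
        obtain ⟨τ, t1, t2, t3⟩ := H.tau u hu
        have := dual_bd (G := X u) (Z := Y) (k := ker N A) (C := C1 * (η * 1)) (by positivity)
          (H1 S (X u) N A (c u) (H.tree u hu) τ (fun _ => 0) η 1 Y (fun _ _ _ => rfl) zero_le_one hη t1 t2 t3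
          (fun _ _ _ _ _ _ => Nat.zero_le _) (fun y => card_zero_scale Y y)) g
        rw [mul_one] at this
        refine le_trans (norm_sum_le_of_le _ fun y _ => le_of_eq ?_) this
        rw [norm_mul, RCLike.norm_conj, sum_ts (H.tree u hu)]; ring
      · rw [if_neg h, zero_add]
        exact H.pairs g Sg (fun u hu => (hSg u hu).1) Y hYm u hu u' hu' h
    refine (Finset.sum_le_sum fun u hu => Finset.sum_le_sum fun u' hu' => main u hu u' hu').trans ?_
    have off := forest_offdiag H g Sg (fun u hu => (hSg u hu).2)
    have e1 : ∑ u ∈ U, ∑ u' ∈ U, ((if u = u' then C1 * η * ∑ x ∈ X u, ‖g x‖ ^ 2 else 0) + (1800000 / D * a u u' + 1800000 / D * a u' u))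
        = C1 * η * ∑ x ∈ G, ‖g x‖ ^ 2 + 1800000 / D * (2 * ∑ u ∈ U, ∑ u' ∈ U, a u u') := by
      simp_rw [Finset.sum_add_distrib]
      have : ∑ u ∈ U, ∑ u' ∈ U, 1800000 / D * a u' u = ∑ u ∈ U, ∑ u' ∈ U, 1800000 / D * a u u' := Finset.sum_comm
      rw [this]
      simp_rw [Finset.sum_ite_eq]
      rw [hG, H.sumX]
      have : ∑ u ∈ U, (if u ∈ U then C1 * η * ∑ x ∈ X u, ‖g x‖ ^ 2 else 0) = ∑ u ∈ U, C1 * η * ∑ x ∈ X u, ‖g x‖ ^ 2 :=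
        Finset.sum_congr rfl fun u hu => if_pos hu
      rw [this]; simp only [← Finset.mul_sum]; ring
    rw [e1, add_mul, mul_assoc (1800000 / D)]
    exact add_le_add_right (mul_le_mul_of_nonneg_left off hk) _
  have hcst : 0 ≤ C1 * η + 1800000 / D * (O + C2) := by positivity
  have := dual_bd' hcst dual (fun y => if y ∈ F then f y else 0)
  have e1 : ∀ x, ∑ y ∈ Y, ker N A x y * (if y ∈ F then f y else 0) = ∑ y ∈ F, ker N A x y * f y := by
    intro x
    rw [← Finset.sum_subset (subset_union_left : F ⊆ Y) (fun y _ hy => by rw [if_neg hy, mul_zero])]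
    exact Finset.sum_congr rfl fun y hy => by rw [if_pos hy]
  have e2 : ∑ y ∈ Y, ‖(if y ∈ F then f y else 0)‖ ^ 2 = ∑ y ∈ F, ‖f y‖ ^ 2 := by
    rw [← Finset.sum_subset (subset_union_left : F ⊆ Y) (fun y _ hy => by rw [if_neg hy]; simp)]
    exact Finset.sum_congr rfl fun y hy => by rw [if_pos hy]
  simp_rw [e1, e2] at this
  refine this.trans (mul_le_mul_of_nonneg_right ?_ (Finset.sum_nonneg fun _ _ => by positivity))
  have h1 : 0 ≤ (1 + O) / D := by positivity
  have e3 : 1800000 / D * (O + C2) ≤ 1800000 * (1 + C2) * ((1 + O) / D) := by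
    rw [div_mul_eq_mul_div, mul_div_assoc', mul_assoc 1800000]
    refine div_le_div_of_nonneg_right ?_ hD.le
    have : 0 ≤ C2 * O := by positivity
    nlinarith
  have h2 : 0 ≤ C1 * ((1 + O) / D) := by positivity
  have h3 : 0 ≤ 1800000 * (1 + C2) * η := by positivity
  nlinarith

lemma forest_b : ∃ C : ℝ, 0 < C ∧ ∀ {ι : Type} [DecidableEq ι] {S : ℕ} {U : Finset ι} {X : ι → Finset ℤ} {N : ℤ → ℝ}
    {A : ℤ → Finset ℕ} {c : ι → ℝ} {I : ι → Finset ℤ} {η D O : ℝ}, Forest S U X N A c I η D O →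
    ∀ (F : Finset ℤ) (δ : ℝ), 0 ≤ δ → (∀ u ∈ U, ∃ υ : ℤ → ℕ, DyP υ ∧
    (∀ x ∈ X u, ∀ s ∈ A x, ∀ y, |x - y| ≤ 4 * 2 ^ s → υ y ≤ s + 3) ∧
    (∀ y, ((F.filter fun y' => y' / 2 ^ υ y = y / 2 ^ υ y).card : ℝ) ≤ δ * 2 ^ υ y)) →
    ∀ (f : ℤ → ℂ), ∑ x ∈ U.biUnion X, ‖∑ y ∈ F, ker N A x y * f y‖ ^ 2 ≤
      C * (O * η * δ) * ∑ y ∈ F, ‖f y‖ ^ 2 := by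
  obtain ⟨C1, hC1, H1⟩ := tree_est
  refine ⟨C1, hC1, ?_⟩
  intro ι _ S U X N A c I η D O H F δ hδ hυ f
  have hO : 0 ≤ O := (Nat.cast_nonneg _).trans (H.ov 0)
  have hη := H.eta
  refine dual_bd' (by positivity) (fun g => ?_) f
  have hsup : ∀ u ∈ U, ∀ y, y ∉ I u → ∑ x ∈ X u, (starRingEnd ℂ) (ker N A x y) * g x = 0 := by
    intro u hu y hy
    refine Finset.sum_eq_zero fun x hx => ?_
    have : ker N A x y = 0 := by
      unfold ker
      rw [Finset.sum_eq_zero, zero_mul]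
      intro s hs
      rw [K_supp, Complex.ofReal_zero]
      by_contra hlt
      push Not at hlt
      refine hy (H.supp u hu x hx s hs y ?_)
      have h0 : (0:ℤ) < 2 ^ s := by positivity
      rw [abs_sub_comm]; linarith
    rw [this]; simp
  have h1 : ∀ y ∈ F, ‖∑ x ∈ U.biUnion X, (starRingEnd ℂ) (ker N A x y) * g x‖ ^ 2 ≤
      O * ∑ u ∈ U, ‖∑ x ∈ X u, (starRingEnd ℂ) (ker N A x y) * g x‖ ^ 2 := by
    intro y _
    rw [H.sumX, ← Finset.sum_filter_of_ne (p := fun u => y ∈ I u) (fun u hu h => by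
      by_contra hy; exact h (hsup u hu y hy))]
    refine (pow_le_pow_left₀ (norm_nonneg _) (norm_sum_le _ _) 2).trans ?_
    refine (sq_sum_le_card_mul_sum_sq).trans ?_
    refine mul_le_mul (H.ov y) ?_ (Finset.sum_nonneg fun _ _ => by positivity) hO
    exact Finset.sum_le_sum_of_subset_of_nonneg (filter_subset _ _) fun _ _ _ => by positivity
  refine (Finset.sum_le_sum h1).trans ?_
  rw [← Finset.mul_sum, Finset.sum_comm, H.sumX]
  have h2 : ∀ u ∈ U, ∑ y ∈ F, ‖∑ x ∈ X u, (starRingEnd ℂ) (ker N A x y) * g x‖ ^ 2 ≤ C1 * (η * δ) * ∑ x ∈ X u, ‖g x‖ ^ 2 := by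
    intro u hu
    obtain ⟨τ, t1, t2, t3⟩ := H.tau u hu
    obtain ⟨υ, s1, s2, s3⟩ := hυ u hu
    exact dual_bd (by positivity) (H1 S (X u) N A (c u) (H.tree u hu) τ υ η δ F s1 hδ hη t1 t2 t3 s2 s3) g
  refine (mul_le_mul_of_nonneg_left (Finset.sum_le_sum h2) hO).trans (le_of_eq ?_)
  rw [← Finset.mul_sum]; ring

end
end Carl

namespace Carl
noncomputable section
open Finset

abbrev Tile := ℕ × ℤ × ℤ

/-- the tile of scale `s` containing `(x, N x)` -/
def tl (N : ℤ → ℝ) (x : ℤ) (s : ℕ) : Tile := (s, x / 2 ^ s, ⌊N x * 2 ^ s⌋)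
/-- centre of the frequency interval -/
def cen (p : Tile) : ℝ := (p.2.2 + 1 / 2) / 2 ^ p.1
/-- containment of spatial intervals -/
def sub (p q : Tile) : Prop := p.1 ≤ q.1 ∧ p.2.1 / 2 ^ (q.1 - p.1) = q.2.1
/-- mass set of a tile -/
def Eb (G : Finset ℤ) (N : ℤ → ℝ) (q : Tile) : Finset ℤ := G.filter fun x => tl N x q.1 = q
/-- density at most `2^{-n}` -/
def Dn (G : Finset ℤ) (N : ℤ → ℝ) (n : ℕ) (p : Tile) : Prop :=
  ∀ q, sub p q → ((Eb G N q).card : ℝ) * 2 ^ n ≤ 2 ^ q.1 * max 1 (|cen p - cen q| * 2 ^ p.1)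

lemma ediv_pow_add (x : ℤ) (s t : ℕ) : x / 2 ^ s / 2 ^ t = x / 2 ^ (s + t) := by
  rw [Int.ediv_ediv_of_nonneg (by positivity), pow_add]

lemma ediv_pow_le (x : ℤ) {s t : ℕ} (h : s ≤ t) : x / 2 ^ s / 2 ^ (t - s) = x / 2 ^ t := by
  rw [ediv_pow_add]; congr 2; omega

lemma sub_tl {N : ℤ → ℝ} {x : ℤ} {s : ℕ} {q : Tile} : sub (tl N x s) q ↔ s ≤ q.1 ∧ x / 2 ^ q.1 = q.2.1 := by
  unfold sub tl
  constructor
  · rintro ⟨h1, h2⟩; exact ⟨h1, by rw [← h2]; exact (ediv_pow_le x h1).symm⟩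
  · rintro ⟨h1, h2⟩; exact ⟨h1, by rw [← h2]; exact (ediv_pow_le x h1)⟩

lemma cen_near (N : ℤ → ℝ) (x : ℤ) (s : ℕ) : |N x - cen (tl N x s)| ≤ 1 / 2 / 2 ^ s := by
  have h2 : (0:ℝ) < 2 ^ s := by positivity
  have h3 := Int.floor_le (N x * 2 ^ s)
  have h4 := Int.lt_floor_add_one (N x * 2 ^ s)
  have e : N x - cen (tl N x s) = (N x * 2 ^ s - (⌊N x * 2 ^ s⌋ + 1 / 2)) / 2 ^ s := by
    unfold cen tl; field_simp
  rw [e, abs_div, abs_of_pos h2]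
  refine div_le_div_of_nonneg_right ?_ h2.le
  rw [abs_le]; constructor <;> linarith

lemma dens_count {G : Finset ℤ} {N : ℤ → ℝ} {n : ℕ} {Λ c : ℝ} (hΛ : 1 ≤ Λ) {x x'' : ℤ} {t s : ℕ} (hst : s ≤ t)
    (hx : x'' / 2 ^ t = x / 2 ^ t) (hD : Dn G N n (tl N x'' s)) (hN : |N x'' - c| ≤ Λ / 2 ^ s) :
    ((G.filter fun x' => x' / 2 ^ t = x / 2 ^ t ∧ |N x' - c| ≤ Λ / 2 ^ t).card : ℝ) ≤ 12 * Λ ^ 2 / 2 ^ n * 2 ^ t := by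
  set Q : Finset ℤ := Icc ⌊c * 2 ^ t - Λ⌋ ⌊c * 2 ^ t + Λ⌋ with hQ
  have h2t : (0:ℝ) < 2 ^ t := by positivity
  have h2s : (0:ℝ) < 2 ^ s := by positivity
  have hst' : (2:ℝ) ^ s ≤ 2 ^ t := pow_le_pow_right₀ (by norm_num) hst
  have hcov : (G.filter fun x' => x' / 2 ^ t = x / 2 ^ t ∧ |N x' - c| ≤ Λ / 2 ^ t) ⊆
      Q.biUnion fun l => (Eb G N (t, x / 2 ^ t, l)).filter fun x' => |N x' - c| ≤ Λ / 2 ^ t := by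
    intro x' hx'
    rw [mem_filter] at hx'
    obtain ⟨hG, h1, h2⟩ := hx'
    rw [mem_biUnion]
    refine ⟨⌊N x' * 2 ^ t⌋, ?_, ?_⟩
    · rw [le_div_iff₀ h2t, ← abs_of_pos h2t, ← abs_mul, abs_le] at h2
      rw [hQ, mem_Icc]
      exact ⟨Int.floor_le_floor (by linarith [h2.1]), Int.floor_le_floor (by linarith [h2.2])⟩
    · rw [mem_filter, Eb, mem_filter]
      refine ⟨⟨hG, ?_⟩, h2⟩
      unfold tl; rw [h1]
  have hone : ∀ l ∈ Q, (((Eb G N (t, x / 2 ^ t, l)).filter fun x' => |N x' - c| ≤ Λ / 2 ^ t).card : ℝ) ≤ (1 + 2 * Λ) / 2 ^ n * 2 ^ t := by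
    intro l _
    rcases ((Eb G N (t, x / 2 ^ t, l)).filter fun x' => |N x' - c| ≤ Λ / 2 ^ t).eq_empty_or_nonempty with h | ⟨x', hx'⟩
    · rw [h]; simp; positivity
    · rw [mem_filter, Eb, mem_filter] at hx'
      obtain ⟨⟨hG, h1⟩, h2⟩ := hx'
      have h3 := hD (t, x / 2 ^ t, l) (sub_tl.mpr ⟨hst, hx⟩)
      have h4 : |cen (tl N x'' s) - cen (t, x / 2 ^ t, l)| * 2 ^ s ≤ 1 + 2 * Λ := by
        have a1 := cen_near N x'' s
        have a2 := cen_near N x' t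
        simp only [] at h1
        rw [h1] at a2
        have a3 : Λ / 2 ^ t ≤ Λ / 2 ^ s := div_le_div_of_nonneg_left (by linarith) h2s hst'
        have a4 : (1 / 2 : ℝ) / 2 ^ t ≤ 1 / 2 / 2 ^ s := div_le_div_of_nonneg_left (by norm_num) h2s hst'
        rw [← le_div_iff₀ h2s]
        have e : (1 + 2 * Λ) / 2 ^ s = 1 / 2 / 2 ^ s + 1 / 2 / 2 ^ s + Λ / 2 ^ s + Λ / 2 ^ s := by ring
        rw [e]
        rw [abs_le] at a1 a2 hN h2 ⊢
        constructor <;> linarith [a1.1, a1.2, a2.1, a2.2, hN.1, hN.2, h2.1, h2.2]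
      have h5 : max 1 (|cen (tl N x'' s) - cen (t, x / 2 ^ t, l)| * 2 ^ (tl N x'' s).1) ≤ 1 + 2 * Λ := max_le (by linarith) h4
      have h6 := h3.trans (mul_le_mul_of_nonneg_left h5 (by positivity))
      rw [div_mul_eq_mul_div, le_div_iff₀ (by positivity)]
      have h7 : (((Eb G N (t, x / 2 ^ t, l)).filter fun x' => |N x' - c| ≤ Λ / 2 ^ t).card : ℝ) ≤ (Eb G N (t, x / 2 ^ t, l)).card := by
        exact_mod_cast card_le_card (filter_subset _ _)
      have h8 := mul_le_mul_of_nonneg_right h7 (by positivity : (0:ℝ) ≤ 2 ^ n)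
      simp only [] at h6
      linarith
  have hQc : (Q.card : ℝ) ≤ 2 * Λ + 2 := by
    rw [hQ]
    have h1 := Int.floor_le (c * 2 ^ t + Λ)
    have h2 := Int.lt_floor_add_one (c * 2 ^ t - Λ)
    have h3 : ⌊c * 2 ^ t - Λ⌋ ≤ ⌊c * 2 ^ t + Λ⌋ + 1 := by
      have := Int.floor_le_floor (show c * 2 ^ t - Λ ≤ c * 2 ^ t + Λ by linarith); omega
    rw [card_Icc_real h3]; linarith
  have h1 : ((G.filter fun x' => x' / 2 ^ t = x / 2 ^ t ∧ |N x' - c| ≤ Λ / 2 ^ t).card : ℝ) ≤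
      ∑ l ∈ Q, (((Eb G N (t, x / 2 ^ t, l)).filter fun x' => |N x' - c| ≤ Λ / 2 ^ t).card : ℝ) := by
    exact_mod_cast (card_le_card hcov).trans card_biUnion_le
  refine h1.trans ((Finset.sum_le_card_nsmul _ _ _ hone).trans ?_)
  rw [nsmul_eq_mul]
  have h9 : (2 * Λ + 2) * (1 + 2 * Λ) ≤ 12 * Λ ^ 2 := by nlinarith
  calc (Q.card : ℝ) * ((1 + 2 * Λ) / 2 ^ n * 2 ^ t) ≤ (2 * Λ + 2) * ((1 + 2 * Λ) / 2 ^ n * 2 ^ t) :=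
        mul_le_mul_of_nonneg_right hQc (by positivity)
    _ = (2 * Λ + 2) * (1 + 2 * Λ) * (1 / 2 ^ n * 2 ^ t) := by ring
    _ ≤ 12 * Λ ^ 2 * (1 / 2 ^ n * 2 ^ t) := mul_le_mul_of_nonneg_right h9 (by positivity)
    _ = _ := by ring

lemma tau_exists {G X : Finset ℤ} {N : ℤ → ℝ} {A : ℤ → Finset ℕ} {n : ℕ} {Λ c : ℝ} (hΛ : 1 ≤ Λ) (hX : X ⊆ G)
    (hA : ∀ x ∈ X, (A x).Nonempty) (hA1 : ∀ x ∈ X, ∀ s ∈ A x, 1 ≤ s)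
    (hD : ∀ x ∈ X, ∀ s ∈ A x, Dn G N n (tl N x s)) (hN : ∀ x ∈ X, ∀ s ∈ A x, |N x - c| ≤ Λ / 2 ^ s) :
    ∃ τ : ℤ → ℕ, (∀ x ∈ X, ∀ s ∈ A x, τ x < s) ∧
    (∀ x ∈ X, ∀ x' ∈ X, x' / 2 ^ τ x = x / 2 ^ τ x → τ x' = τ x) ∧
    (∀ x ∈ X, ((X.filter fun x' => x' / 2 ^ τ x = x / 2 ^ τ x).card : ℝ) ≤ 24 * Λ ^ 2 / 2 ^ n * 2 ^ τ x) := by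
  classical
  set P : ℤ → ℕ → Prop := fun x t => 1 ≤ t ∧ ∃ x'' ∈ X, ∃ s ∈ A x'', s ≤ t ∧ x'' / 2 ^ t = x / 2 ^ t with hP
  have hex : ∀ x ∈ X, ∀ s ∈ A x, P x s := fun x hx s hs => ⟨hA1 x hx s hs, x, hx, s, hs, le_rfl, rfl⟩
  have : ∀ x, ∃ t, x ∈ X → P x t ∧ ∀ t', P x t' → t ≤ t' := by
    intro x
    by_cases hx : x ∈ X
    · obtain ⟨s, hs⟩ := hA x hx
      have h : ∃ t, P x t := ⟨s, hex x hx s hs⟩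
      exact ⟨Nat.find h, fun _ => ⟨Nat.find_spec h, fun t' ht' => Nat.find_min' h ht'⟩⟩
    · exact ⟨0, fun h => absurd h hx⟩
  choose t ht using this
  have hmono : ∀ x t t', t ≤ t' → P x t → P x t' := by
    rintro x t t' htt ⟨h1, x'', hx'', s, hs, hst, e⟩
    exact ⟨h1.trans htt, x'', hx'', s, hs, hst.trans htt, dy_mono e htt⟩
  have hcong : ∀ x x' t, x' / 2 ^ t = x / 2 ^ t → P x t → P x' t := by
    rintro x x' t e ⟨h1, x'', hx'', s, hs, hst, e'⟩
    exact ⟨h1, x'', hx'', s, hs, hst, e'.trans e.symm⟩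
  have hsame : ∀ x ∈ X, ∀ x' ∈ X, x' / 2 ^ (t x - 1) = x / 2 ^ (t x - 1) → t x' = t x := by
    intro x hx x' hx' e
    have e1 : x' / 2 ^ t x = x / 2 ^ t x := dy_mono e (Nat.sub_le _ _)
    have h1 : t x' ≤ t x := (ht x' hx').2 _ (hcong x x' _ e1 (ht x hx).1)
    by_contra hne
    have h2 : t x' ≤ t x - 1 := by omega
    have h3 := hmono x' _ _ h2 (ht x' hx').1
    have h4 := hcong x' x _ e.symm h3
    have h5 := (ht x hx).2 _ h4
    have := (ht x hx).1.1
    omega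
  refine ⟨fun x => t x - 1, ?_, ?_, ?_⟩
  · intro x hx s hs
    have h1 := (ht x hx).2 s (hex x hx s hs)
    have := (ht x hx).1.1
    simp only []; omega
  · intro x hx x' hx' e
    simp only []; rw [hsame x hx x' hx' e]
  · intro x hx
    simp only []
    obtain ⟨h1, x'', hx'', s, hs, hst, e⟩ := (ht x hx).1
    have h2 := dens_count hΛ hst e (hD x'' hx'' s hs) (hN x'' hx'' s hs)
    have h3 : (X.filter fun x' => x' / 2 ^ (t x - 1) = x / 2 ^ (t x - 1)) ⊆
        (G.filter fun x' => x' / 2 ^ t x = x / 2 ^ t x ∧ |N x' - c| ≤ Λ / 2 ^ t x) := by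
      intro x' hx'
      rw [mem_filter] at hx' ⊢
      refine ⟨hX hx'.1, dy_mono hx'.2 (Nat.sub_le _ _), ?_⟩
      obtain ⟨s', hs'⟩ := hA x' hx'.1
      have h4 := (ht x' hx'.1).2 s' (hex x' hx'.1 s' hs')
      rw [hsame x hx x' hx'.1 hx'.2] at h4
      refine (hN x' hx'.1 s' hs').trans ?_
      exact div_le_div_of_nonneg_left (by linarith) (by positivity) (pow_le_pow_right₀ (by norm_num) h4)
    have h5 : ((X.filter fun x' => x' / 2 ^ (t x - 1) = x / 2 ^ (t x - 1)).card : ℝ) ≤ _ := Nat.cast_le.mpr (card_le_card h3)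
    refine h5.trans (h2.trans (le_of_eq ?_))
    have : (2:ℝ) ^ t x = 2 ^ (t x - 1) * 2 := by rw [← pow_succ]; congr 1; omega
    rw [this]; ring

end
end Carl

namespace Carl
noncomputable section
open Finset

lemma hol2 {T : Finset ℤ} {v : ℤ → ℝ} (hv : ∀ y, 0 ≤ v y) {r α w m : ℝ} (hr : 1 < r) (hα : 0 ≤ α) (hw : 0 ≤ w) (hm : 0 ≤ m)
    (h1 : (T.card : ℝ) ≤ α * w) (h2 : ∑ y ∈ T, v y ^ r ≤ w * m) : ∑ y ∈ T, v y ≤ w * (α ^ (1 - 1 / r) * m ^ (1 / r)) := by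
  have hr0 : 0 < r := by linarith
  have h3 := Real.rpow_sum_le_const_mul_sum_rpow T v hr.le
  simp_rw [abs_of_nonneg (hv _)] at h3
  have hS : 0 ≤ ∑ y ∈ T, v y := Finset.sum_nonneg fun y _ => hv y
  rw [← Real.rpow_le_rpow_iff hS (by positivity) hr0]
  refine h3.trans ?_
  have h4 : (T.card : ℝ) ^ (r - 1) ≤ (α * w) ^ (r - 1) := Real.rpow_le_rpow (by positivity) h1 (by linarith)
  refine (mul_le_mul h4 h2 (Finset.sum_nonneg fun y _ => Real.rpow_nonneg (hv y) _) (by positivity)).trans (le_of_eq ?_)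
  rw [Real.mul_rpow hα hw, Real.mul_rpow hw (by positivity), Real.mul_rpow (by positivity) (by positivity), ← Real.rpow_mul hα,
    ← Real.rpow_mul hm]
  have e1 : (1 - 1 / r) * r = r - 1 := by field_simp
  have e2 : 1 / r * r = 1 := by field_simp
  rw [e1, e2, Real.rpow_one]
  have e3 : w ^ r = w ^ (r - 1) * w := by
    rcases hw.eq_or_lt with h | h
    · rw [← h, Real.zero_rpow hr0.ne']; simp
    · rw [← Real.rpow_add_one h.ne']; congr 1; ring
  rw [e3]; ring

lemma anti_pair {s s' : ℕ} (hss : s' ≤ s) {θ : ℝ} (hθ : |θ| ≤ Real.pi) (x x' : ℤ) (Y : Finset ℤ)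
    (hY : ∀ y, |y - x'| < 2 ^ s' → y ∈ Y) :
    ‖∑ y ∈ Y, (K s (x - y) : ℂ) * (K s' (x' - y) : ℂ) * ee (θ * y)‖ ≤ 64 / 2 ^ s ∧
    ∀ Λ : ℝ, 1 ≤ Λ → Λ ≤ 2 ^ s' * |θ| →
    ‖∑ y ∈ Y, (K s (x - y) : ℂ) * (K s' (x' - y) : ℂ) * ee (θ * y)‖ ≤ 1280 / Λ / 2 ^ s := by
  have hst' : (2:ℝ) ^ s' ≤ 2 ^ s := pow_le_pow_right₀ (by norm_num) hss
  have h1s : (1:ℝ) ≤ 2 ^ s' := one_le_pow₀ (by norm_num)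
  have nK : ∀ s (t : ℤ), ‖(K s t : ℂ)‖ ≤ 4 / 2 ^ s := fun s t => by
    rw [Complex.norm_real, Real.norm_eq_abs]; exact K_abs s t
  constructor
  · have h1 : ‖∑ y ∈ Y, (K s (x - y) : ℂ) * (K s' (x' - y) : ℂ) * ee (θ * y)‖ ≤ ∑ y ∈ Y with |y - x'| < 2 ^ s', (16 / (2 ^ s * 2 ^ s') : ℝ) := by
      refine norm_sum_window (fun y => |y - x'| < 2 ^ s') (fun y _ hy => ?_) (fun y _ _ => ?_)
      · rw [K_supp s' (t := x' - y)]; · simp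
        push Not at hy; rw [abs_sub_comm]; exact hy
      · rw [norm_mul, norm_mul, norm_ee, mul_one]
        refine (mul_le_mul (nK s _) (nK s' _) (norm_nonneg _) (by positivity)).trans (le_of_eq ?_)
        field_simp; norm_num
    refine h1.trans ?_
    rw [Finset.sum_const, nsmul_eq_mul]
    have h2 : ((Y.filter fun y => |y - x'| < 2 ^ s').card : ℝ) ≤ 3 * 2 ^ s' := by
      have : (Y.filter fun y => |y - x'| < 2 ^ s') ⊆ Icc (x' - 2 ^ s') (x' + 2 ^ s') := by
        intro y hy
        have := abs_lt.mp (mem_filter.mp hy).2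
        rw [mem_Icc]; omega
      have h3 : ((Y.filter fun y => |y - x'| < 2 ^ s').card : ℝ) ≤ _ := Nat.cast_le.mpr (card_le_card this)
      refine h3.trans ?_
      have h0 : (0:ℤ) < 2 ^ s' := by positivity
      rw [card_Icc_real (by linarith)]; push_cast; linarith
    refine (mul_le_mul_of_nonneg_right h2 (by positivity)).trans ?_
    have : 3 * 2 ^ s' * (16 / (2 ^ s * 2 ^ s')) = (48 : ℝ) / 2 ^ s := by field_simp; norm_num
    rw [this]; exact div_le_div_of_nonneg_right (by norm_num) (by positivity)
  · intro Λ hΛ hΛ'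
    have hθ0 : θ ≠ 0 := by rintro rfl; simp at hΛ'; linarith
    have hθp : 0 < |θ| := abs_pos.mpr hθ0
    have h2r : ((2 ^ s' : ℕ) : ℤ) = 2 ^ s' := by push_cast; rfl
    have key := SBP (Φ := fun y => (K s (x - y) : ℂ) * (K s' (x' - y) : ℂ)) (V := 320 / (2 ^ s * 4 ^ s')) hθ0 hθ x' (2 ^ s')
      (fun y hy => by
        rw [h2r] at hy
        rw [K_supp s' (t := x' - y)]; · simp
        rw [abs_sub_comm]; exact hy)
      (fun y => by
        have e : (K s (x - y) : ℂ) * (K s' (x' - y) : ℂ) - (K s (x - (y - 1)) : ℂ) * (K s' (x' - (y - 1)) : ℂ) =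
          ((K s (x - y) - K s (x - (y - 1)) : ℝ) : ℂ) * (K s' (x' - y) : ℂ) + (K s (x - (y - 1)) : ℂ) * ((K s' (x' - y) - K s' (x' - (y - 1)) : ℝ) : ℂ) := by
          push_cast; ring
        have hl : ∀ s (x : ℤ), ‖((K s (x - y) - K s (x - (y - 1)) : ℝ) : ℂ)‖ ≤ 40 / 4 ^ s := by
          intro s x
          rw [Complex.norm_real, Real.norm_eq_abs]
          have := K_lip s (x - y) (x - (y - 1))
          refine this.trans (le_of_eq ?_)
          push_cast
          have : (x:ℝ) - y - (x - (y - 1)) = -1 := by ring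
          rw [this]; simp
        rw [e]
        refine (norm_add_le _ _).trans ((add_le_add (norm_mul_le _ _) (norm_mul_le _ _)).trans ?_)
        refine (add_le_add (mul_le_mul (hl s x) (nK s' _) (norm_nonneg _) (by positivity))
          (mul_le_mul (nK s _) (hl s' x') (norm_nonneg _) (by positivity))).trans ?_
        have e4 : (4:ℝ) ^ s = 2 ^ s * 2 ^ s := by rw [← mul_pow]; norm_num
        have e4' : (4:ℝ) ^ s' = 2 ^ s' * 2 ^ s' := by rw [← mul_pow]; norm_num
        have : (40:ℝ) / 4 ^ s * (4 / 2 ^ s') ≤ 160 / (2 ^ s * 4 ^ s') := by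
          rw [div_mul_div_comm, e4, e4']
          have := mul_le_mul_of_nonneg_left hst' (by positivity : (0:ℝ) ≤ 2 ^ s * 2 ^ s')
          have e5 : (40:ℝ) * 4 = 160 := by norm_num
          rw [e5]
          exact div_le_div_of_nonneg_left (by norm_num) (by positivity) (by linarith)
        have h2 : (4:ℝ) / 2 ^ s * (40 / 4 ^ s') = 160 / (2 ^ s * 4 ^ s') := by field_simp; norm_num
        rw [h2]
        have h3 : (320:ℝ) / (2 ^ s * 4 ^ s') = 160 / (2 ^ s * 4 ^ s') + 160 / (2 ^ s * 4 ^ s') := by ring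
        rw [h3]; linarith)
      Y (fun y hy => hY y (by rwa [h2r] at hy))
    refine key.trans ?_
    have e4' : (4:ℝ) ^ s' = 2 ^ s' * 2 ^ s' := by rw [← mul_pow]; norm_num
    have : 4 * ((2 ^ s' : ℕ) : ℝ) * (320 / (2 ^ s * 4 ^ s')) / |θ| = 1280 / (2 ^ s' * |θ|) / 2 ^ s := by
      push_cast; rw [e4']; field_simp; norm_num
    rw [this]
    exact div_le_div_of_nonneg_right (div_le_div_of_nonneg_left (by norm_num) (by linarith) hΛ') (by positivity)

/-- the near set -/
def near (X : Finset ℤ) (N : ℤ → ℝ) (s : ℤ → ℕ) (Λ : ℝ) (x : ℤ) : Finset ℤ :=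
  X.filter fun x' => s x' ≤ s x ∧ |x' - x| ≤ 2 * 2 ^ s x ∧ |N x' - N x| ≤ Λ / 2 ^ s x'

lemma near_card {G X : Finset ℤ} {N : ℤ → ℝ} {s : ℤ → ℕ} {n : ℕ} {Λ : ℝ} (hΛ : 1 ≤ Λ) (hX : X ⊆ G)
    (hs1 : ∀ x ∈ X, 1 ≤ s x) (hD : ∀ x ∈ X, Dn G N n (tl N x (s x))) (x : ℤ) :
    ((near X N s Λ x).card : ℝ) ≤ 24 * Λ ^ 2 / 2 ^ n * (7 * 2 ^ s x) := by
  have hsub : near X N s Λ x ⊆ X := filter_subset _ _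
  obtain ⟨τ, t1, t2, t3⟩ := tau_exists (G := G) (X := near X N s Λ x) (N := N) (A := fun x => {s x}) (n := n) (c := N x) hΛ
    (hsub.trans hX) (fun _ _ => singleton_nonempty _) (fun x' hx' s' hs' => by rw [mem_singleton.mp hs']; exact hs1 x' (hsub hx'))
    (fun x' hx' s' hs' => by rw [mem_singleton.mp hs']; exact hD x' (hsub hx'))
    (fun x' hx' s' hs' => by rw [mem_singleton.mp hs']; exact (mem_filter.mp hx').2.2.2)
  have h1 := transfer t2 t3 (fun _ => 1) (fun _ => 1) (fun _ => zero_le_one) (fun _ _ _ _ => le_rfl)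
  simp only [sum_const, nsmul_eq_mul, mul_one] at h1
  refine h1.trans (mul_le_mul_of_nonneg_left ?_ (by positivity))
  have h0 : (1:ℤ) ≤ 2 ^ s x := one_le_pow₀ (by norm_num)
  have h0' : (1:ℝ) ≤ 2 ^ s x := one_le_pow₀ (by norm_num)
  have hc : ((near X N s Λ x).biUnion fun x => II (τ x) x) ⊆ Icc (x - 3 * 2 ^ s x) (x + 3 * 2 ^ s x) := by
    intro z hz
    rw [mem_biUnion] at hz
    obtain ⟨x', hx', hz⟩ := hz
    rw [mem_II] at hz
    have h2 := abs_lt.mp (dy_dist hz)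
    have h3 := t1 x' hx' (s x') (mem_singleton_self _)
    obtain ⟨-, h4, h5, -⟩ := mem_filter.mp hx'
    have h6 : (2:ℤ) ^ τ x' ≤ 2 ^ s x := pow_le_pow_right₀ (by norm_num) (by omega)
    have h7 := abs_le.mp h5
    rw [mem_Icc]; constructor <;> linarith [h2.1, h2.2, h7.1, h7.2]
  have h2 : (((near X N s Λ x).biUnion fun x => II (τ x) x).card : ℝ) ≤ _ := Nat.cast_le.mpr (card_le_card hc)
  refine h2.trans ?_
  rw [card_Icc_real (by linarith)]; push_cast; linarith

lemma anti_sum {X : Finset ℤ} (b : ℤ → ℤ → ℝ) (s : ℤ → ℕ) (P : ℤ → ℤ → ℝ)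
    (hP : ∀ x ∈ X, ∀ x' ∈ X, s x' ≤ s x → P x x' ≤ b x x' ∧ P x' x ≤ b x x') (hb : ∀ x x', 0 ≤ b x x') :
    ∑ x ∈ X, ∑ x' ∈ X, P x x' ≤ 2 * ∑ x ∈ X, ∑ x' ∈ X with s x' ≤ s x, b x x' := by
  have h : ∀ x ∈ X, ∀ x' ∈ X, P x x' ≤ (if s x' ≤ s x then b x x' else 0) + (if s x ≤ s x' then b x' x else 0) := by
    intro x hx x' hx'
    have h1 : 0 ≤ if s x' ≤ s x then b x x' else 0 := by split_ifs <;> simp [hb]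
    have h2 : 0 ≤ if s x ≤ s x' then b x' x else 0 := by split_ifs <;> simp [hb]
    rcases le_total (s x') (s x) with h | h
    · rw [if_pos h]; have := (hP x hx x' hx' h).1; linarith
    · rw [if_pos h]; have := (hP x' hx' x hx h).2; linarith
  refine (Finset.sum_le_sum fun x hx => Finset.sum_le_sum fun x' hx' => h x hx x' hx').trans (le_of_eq ?_)
  simp_rw [Finset.sum_add_distrib]
  have : ∑ x ∈ X, ∑ x' ∈ X, (if s x ≤ s x' then b x' x else 0) = ∑ x ∈ X, ∑ x' ∈ X, (if s x' ≤ s x then b x x' else 0) :=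
    Finset.sum_comm
  rw [this]; simp_rw [Finset.sum_filter]; ring

lemma anti_a' : ∃ C : ℝ, 0 < C ∧ ∀ (G X : Finset ℤ) (N : ℤ → ℝ) (s : ℤ → ℕ) (n : ℕ) (Λ : ℝ), 1 ≤ Λ → X ⊆ G →
    (∀ x ∈ X, 1 ≤ s x) → (∀ x ∈ X, |N x| ≤ 1) → (∀ x ∈ X, Dn G N n (tl N x (s x))) → ∀ (F : Finset ℤ) (f : ℤ → ℂ),
    ∑ x ∈ X, ‖∑ y ∈ F, ker N (fun x => {s x}) x y * f y‖ ^ 2 ≤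
      C * (1 / Λ + (24 * Λ ^ 2 / 2 ^ n) ^ (1 - 1 / (3 / 2) : ℝ)) * ∑ y ∈ F, ‖f y‖ ^ 2 := by
  obtain ⟨C1, hC1, H1⟩ := M_sq
  obtain ⟨C2, hC2, H2⟩ := M_strong (4 / 3) (by norm_num)
  refine ⟨6400 * (1 + C1) + 448 * (1 + C2), by positivity, ?_⟩
  intro G X N s n Λ hΛ hX hs1 hN hD F f
  set η := 24 * Λ ^ 2 / 2 ^ n with hη
  have hη0 : 0 ≤ η := by positivity
  set e3 := η ^ (1 - 1 / (3 / 2) : ℝ) with he3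
  have he30 : 0 ≤ e3 := by positivity
  set S := X.sup s with hS
  set Y := F ∪ nb X (2 ^ S) with hY
  have hYm : ∀ x ∈ X, ∀ y, |y - x| < 2 ^ s x → y ∈ Y := by
    intro x hx y hy
    refine mem_union_right _ (mem_nb hx (hy.le.trans ?_))
    exact pow_le_pow_right₀ (by norm_num) (Finset.le_sup hx)
  have dual : ∀ g : ℤ → ℂ, ∑ y ∈ Y, ‖∑ x ∈ X, (starRingEnd ℂ) (ker N (fun x => {s x}) x y) * g x‖ ^ 2 ≤
      (6400 * (1 + C1) / Λ + 448 * (1 + C2) * e3) * ∑ x ∈ X, ‖g x‖ ^ 2 := by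
    intro g
    refine (sq_sum_norm X Y fun x y => (starRingEnd ℂ) (ker N (fun x => {s x}) x y) * g x).trans ?_
    set b : ℤ → ℤ → ℝ := fun x x' => ‖g x‖ * ((if |x' - x| ≤ 2 * 2 ^ s x then 1280 / Λ / 2 ^ s x * ‖g x'‖ else 0) +
      if x' ∈ near X N s Λ x then 64 / 2 ^ s x * ‖g x'‖ else 0) with hb
    have hb0 : ∀ x x', 0 ≤ b x x' := by
      intro x x'
      refine mul_nonneg (norm_nonneg _) (add_nonneg ?_ ?_) <;> split_ifs <;> positivity
    have hPP : ∀ x x', ‖∑ y ∈ Y, (starRingEnd ℂ) (ker N (fun x => {s x}) x y) * g x * (starRingEnd ℂ) ((starRingEnd ℂ) (ker N (fun x => {s x}) x' y) * g x')‖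
        = ‖g x‖ * ‖g x'‖ * ‖∑ y ∈ Y, (K (s x) (x - y) : ℂ) * (K (s x') (x' - y) : ℂ) * ee ((N x' - N x) * y)‖ := by
      intro x x'
      have : ∑ y ∈ Y, (starRingEnd ℂ) (ker N (fun x => {s x}) x y) * g x * (starRingEnd ℂ) ((starRingEnd ℂ) (ker N (fun x => {s x}) x' y) * g x')
          = g x * (starRingEnd ℂ) (g x') * ∑ y ∈ Y, (K (s x) (x - y) : ℂ) * (K (s x') (x' - y) : ℂ) * ee ((N x' - N x) * y) := by
        rw [Finset.mul_sum]
        refine Finset.sum_congr rfl fun y _ => ?_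
        unfold ker
        have : ee ((N x' - N x) * y) = ee (-(N x * y)) * ee (N x' * y) := by rw [← ee_add]; congr 1; ring
        simp only [sum_singleton, map_mul, conj_ee, Complex.conj_ofReal, Complex.conj_conj]
        rw [this]
        have h2 : (starRingEnd ℂ) (ee (-(N x' * y))) = ee (N x' * y) := by rw [conj_ee, neg_neg]
        simp only [neg_neg]; ring
      rw [this, norm_mul, norm_mul, RCLike.norm_conj]
    have hsym : ∀ x x', ‖∑ y ∈ Y, (K (s x) (x - y) : ℂ) * (K (s x') (x' - y) : ℂ) * ee ((N x' - N x) * y)‖ =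
        ‖∑ y ∈ Y, (K (s x') (x' - y) : ℂ) * (K (s x) (x - y) : ℂ) * ee ((N x - N x') * y)‖ := by
      intro x x'
      rw [← RCLike.norm_conj, map_sum]
      congr 1
      refine Finset.sum_congr rfl fun y _ => ?_
      simp only [map_mul, conj_ee, Complex.conj_ofReal]
      rw [mul_comm (K (s x) (x - y) : ℂ)]; congr 2; ring
    have hβ : ∀ x ∈ X, ∀ x' ∈ X, s x' ≤ s x → ‖g x‖ * ‖g x'‖ * ‖∑ y ∈ Y, (K (s x) (x - y) : ℂ) * (K (s x') (x' - y) : ℂ) * ee ((N x' - N x) * y)‖ ≤ b x x' := by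
      intro x hx x' hx' hss
      have hθ : |N x' - N x| ≤ Real.pi := by
        have h1 := abs_le.mp (hN x hx)
        have h2 := abs_le.mp (hN x' hx')
        have := Real.pi_gt_three
        rw [abs_le]; constructor <;> linarith
      obtain ⟨p1, p2⟩ := anti_pair hss hθ x x' Y (hYm x' hx')
      rw [hb, mul_assoc]
      refine mul_le_mul_of_nonneg_left ?_ (norm_nonneg _)
      by_cases hd : |x' - x| ≤ 2 * 2 ^ s x
      · rw [if_pos hd]
        by_cases hn : |N x' - N x| ≤ Λ / 2 ^ s x'
        · have : x' ∈ near X N s Λ x := mem_filter.mpr ⟨hx', hss, hd, hn⟩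
          rw [if_pos this]
          have h2 := mul_le_mul_of_nonneg_left p1 (norm_nonneg (g x'))
          have h3 : 0 ≤ 1280 / Λ / 2 ^ s x * ‖g x'‖ := by positivity
          linarith
        · push Not at hn
          rw [div_lt_iff₀ (by positivity)] at hn
          have h2 := mul_le_mul_of_nonneg_left (p2 Λ hΛ (by linarith)) (norm_nonneg (g x'))
          have h3 : (0:ℝ) ≤ if x' ∈ near X N s Λ x then 64 / 2 ^ s x * ‖g x'‖ else 0 := by split_ifs <;> positivity
          linarith
      · have hz : ∑ y ∈ Y, (K (s x) (x - y) : ℂ) * (K (s x') (x' - y) : ℂ) * ee ((N x' - N x) * y) = 0 := by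
          refine Finset.sum_eq_zero fun y _ => ?_
          by_cases h1 : (2:ℤ) ^ s x ≤ |x - y|
          · rw [K_supp _ _ h1]; simp
          · by_cases h2 : (2:ℤ) ^ s x' ≤ |x' - y|
            · rw [K_supp _ _ h2]; simp
            · exfalso
              push Not at h1 h2 hd
              have h3 : (2:ℤ) ^ s x' ≤ 2 ^ s x := pow_le_pow_right₀ (by norm_num) hss
              have := abs_sub_le x' y x
              rw [abs_sub_comm y x] at this
              linarith
        rw [hz, norm_zero, mul_zero]
        have := hb0 x x'
        refine add_nonneg ?_ ?_ <;> split_ifs <;> positivity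
    refine (anti_sum b s _ (fun x hx x' hx' hss => ?_) hb0).trans ?_
    · constructor
      · rw [hPP]; exact hβ x hx x' hx' hss
      · rw [hPP, hsym, mul_comm ‖g x'‖]; exact hβ x hx x' hx' hss
    set v : ℤ → ℝ := fun y => ‖g y‖ with hv
    set h : ℤ → ℝ := fun y => v y ^ (3 / 2 : ℝ) with hh
    have hv0 : ∀ y, 0 ≤ v y := fun y => norm_nonneg _
    have hh0 : ∀ y, 0 ≤ h y := fun y => by positivity
    have inner : ∀ x ∈ X, 2 * ∑ x' ∈ X with s x' ≤ s x, b x x' ≤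
        6400 / Λ * (v x ^ 2 + M X v x ^ 2) + 448 * e3 * (v x ^ 2 + M X h x ^ (4 / 3 : ℝ)) := by
      intro x hx
      have m1 := M_nonneg hv0 x (Z := X)
      have m2 := M_nonneg hh0 x (Z := X)
      have b1 : ∑ x' ∈ X with s x' ≤ s x, (if |x' - x| ≤ 2 * 2 ^ s x then 1280 / Λ / 2 ^ s x * ‖g x'‖ else 0) ≤ 6400 / Λ * M X v x := by
        rw [← Finset.sum_filter, ← Finset.mul_sum]
        have := win_le_M hv0 x 2 (s x) (Z := X) (((X.filter fun x' => s x' ≤ s x)).filter fun x' => |x' - x| ≤ 2 * 2 ^ s x)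
          ((filter_subset _ _).trans (filter_subset _ _)) (fun y hy => by exact_mod_cast (mem_filter.mp hy).2)
        refine (mul_le_mul_of_nonneg_left this (by positivity)).trans (le_of_eq ?_)
        push_cast; field_simp; ring
      have b2 : ∑ x' ∈ X with s x' ≤ s x, (if x' ∈ near X N s Λ x then 64 / 2 ^ s x * ‖g x'‖ else 0) ≤ 448 * e3 * M X h x ^ (1 / (3 / 2) : ℝ) := by
        rw [← Finset.sum_filter, ← Finset.mul_sum]
        have hsub : ((X.filter fun x' => s x' ≤ s x).filter fun x' => x' ∈ near X N s Λ x) ⊆ near X N s Λ x :=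
          fun y hy => (mem_filter.mp hy).2
        have c1 := near_card hΛ hX hs1 hD x
        have c2 := win_le_M hh0 x 2 (s x) (Z := X) (near X N s Λ x) (filter_subset _ _)
          (fun y hy => by exact_mod_cast (mem_filter.mp hy).2.2.1)
        have c3 := hol2 (T := near X N s Λ x) hv0 (r := 3 / 2) (α := η) (w := 7 * 2 ^ s x) (m := M X h x) (by norm_num) hη0 (by positivity) m2 c1
          (c2.trans (by push_cast; nlinarith [mul_nonneg (by positivity : (0:ℝ) ≤ 2 ^ s x) m2]))
        have c4 : ∑ y ∈ ((X.filter fun x' => s x' ≤ s x).filter fun x' => x' ∈ near X N s Λ x), ‖g y‖ ≤ ∑ y ∈ near X N s Λ x, v y :=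
          Finset.sum_le_sum_of_subset_of_nonneg hsub fun _ _ _ => norm_nonneg _
        refine (mul_le_mul_of_nonneg_left (c4.trans c3) (by positivity)).trans (le_of_eq ?_)
        rw [← he3]; field_simp; ring
      have b3 : ∑ x' ∈ X with s x' ≤ s x, b x x' ≤ v x * (6400 / Λ * M X v x + 448 * e3 * M X h x ^ (1 / (3 / 2) : ℝ)) := by
        rw [hb]; simp only []
        rw [← Finset.mul_sum, Finset.sum_add_distrib]
        exact mul_le_mul_of_nonneg_left (add_le_add b1 b2) (norm_nonneg _)
      have b4 : M X h x ^ (4 / 3 : ℝ) = (M X h x ^ (1 / (3 / 2) : ℝ)) ^ 2 := by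
        rw [← Real.rpow_natCast, ← Real.rpow_mul m2]; norm_num
      rw [b4]
      set P := M X h x ^ (1 / (3 / 2) : ℝ)
      have q1 : 0 ≤ 6400 / Λ * (v x - M X v x) ^ 2 := by positivity
      have q2 : 0 ≤ 448 * e3 * (v x - P) ^ 2 := by positivity
      nlinarith
    rw [Finset.mul_sum]
    refine (Finset.sum_le_sum inner).trans ?_
    rw [Finset.sum_add_distrib, ← Finset.mul_sum, ← Finset.mul_sum, Finset.sum_add_distrib, Finset.sum_add_distrib]
    have k1 := H1 X v hv0 X
    have k2 := H2 X h hh0 X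
    have k3 : ∑ y ∈ X, h y ^ (4 / 3 : ℝ) = ∑ y ∈ X, v y ^ 2 := by
      refine Finset.sum_congr rfl fun y _ => ?_
      rw [hh]; simp only []
      rw [← Real.rpow_mul (hv0 y), ← Real.rpow_natCast]; norm_num
    rw [k3] at k2
    have k4 : 0 ≤ 6400 / Λ := by positivity
    have k5 := mul_le_mul_of_nonneg_left k1 k4
    have k6 := mul_le_mul_of_nonneg_left k2 (by positivity : 0 ≤ 448 * e3)
    have : (6400 * (1 + C1) / Λ + 448 * (1 + C2) * e3) * ∑ x ∈ X, ‖g x‖ ^ 2 = 6400 / Λ * (∑ y ∈ X, v y ^ 2) + 6400 / Λ * (C1 * ∑ y ∈ X, v y ^ 2)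
      + 448 * e3 * (∑ y ∈ X, v y ^ 2) + 448 * e3 * (C2 * ∑ y ∈ X, v y ^ 2) := by rw [hv]; ring
    rw [this, mul_add, mul_add]; linarith
  have := dual_bd' (by positivity) dual (fun y => if y ∈ F then f y else 0)
  have e1 : ∀ x, ∑ y ∈ Y, ker N (fun x => {s x}) x y * (if y ∈ F then f y else 0) = ∑ y ∈ F, ker N (fun x => {s x}) x y * f y := by
    intro x
    rw [← Finset.sum_subset (subset_union_left : F ⊆ Y) (fun y _ hy => by rw [if_neg hy, mul_zero])]
    exact Finset.sum_congr rfl fun y hy => by rw [if_pos hy]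
  have e2 : ∑ y ∈ Y, ‖(if y ∈ F then f y else 0)‖ ^ 2 = ∑ y ∈ F, ‖f y‖ ^ 2 := by
    rw [← Finset.sum_subset (subset_union_left : F ⊆ Y) (fun y _ hy => by rw [if_neg hy]; simp)]
    exact Finset.sum_congr rfl fun y hy => by rw [if_pos hy]
  simp_rw [e1, e2] at this
  refine this.trans (mul_le_mul_of_nonneg_right ?_ (Finset.sum_nonneg fun _ _ => by positivity))
  have h1 : 0 ≤ 1 / Λ := by positivity
  have h2 : 6400 * (1 + C1) / Λ = 6400 * (1 + C1) * (1 / Λ) := by ring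
  have h3 : 0 ≤ 6400 * (1 + C1) * e3 := by positivity
  have h4 : 0 ≤ 448 * (1 + C2) * (1 / Λ) := by positivity
  rw [h2]; nlinarith

end
end Carl

namespace Carl
noncomputable section
open Finset

lemma anti_a : ∃ C : ℝ, 0 < C ∧ ∀ (G X : Finset ℤ) (N : ℤ → ℝ) (s : ℤ → ℕ) (n : ℕ), X ⊆ G →
    (∀ x ∈ X, 1 ≤ s x) → (∀ x ∈ X, |N x| ≤ 1) → (∀ x ∈ X, Dn G N n (tl N x (s x))) → ∀ (F : Finset ℤ) (f : ℤ → ℂ),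
    ∑ x ∈ X, ‖∑ y ∈ F, ker N (fun x => {s x}) x y * f y‖ ^ 2 ≤
      C * (2:ℝ) ^ (-(n:ℝ) / 6) * ∑ y ∈ F, ‖f y‖ ^ 2 := by
  obtain ⟨C, hC, H⟩ := anti_a'
  refine ⟨C * 25, by positivity, ?_⟩
  intro G X N s n hX hs1 hN hD F f
  have hn : (0:ℝ) ≤ n := Nat.cast_nonneg n
  have h1 := H G X N s n ((2:ℝ) ^ ((n:ℝ) / 4)) (Real.one_le_rpow (by norm_num) (by positivity)) hX hs1 hN hD F f
  refine h1.trans (mul_le_mul_of_nonneg_right ?_ (Finset.sum_nonneg fun _ _ => by positivity))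
  rw [mul_assoc]
  refine mul_le_mul_of_nonneg_left ?_ hC.le
  have e1 : 1 / (2:ℝ) ^ ((n:ℝ) / 4) = 2 ^ (-((n:ℝ) / 4)) := by rw [Real.rpow_neg (by norm_num), one_div]
  have e2 : 24 * ((2:ℝ) ^ ((n:ℝ) / 4)) ^ 2 / 2 ^ n = 24 * 2 ^ (-(n:ℝ) / 2) := by
    rw [← Real.rpow_natCast, ← Real.rpow_mul (by norm_num), ← Real.rpow_natCast 2 n, mul_div_assoc, ← Real.rpow_sub (by norm_num)]
    congr 2; push_cast; ring
  rw [e1, e2, Real.mul_rpow (by norm_num) (by positivity), ← Real.rpow_mul (by norm_num)]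
  have e3 : -(n:ℝ) / 2 * (1 - 1 / (3 / 2)) = -(n:ℝ) / 6 := by ring
  rw [e3]
  have e4 : (2:ℝ) ^ (-((n:ℝ) / 4)) ≤ 2 ^ (-(n:ℝ) / 6) := Real.rpow_le_rpow_of_exponent_le (by norm_num) (by linarith)
  have e5 : (24:ℝ) ^ (1 - 1 / (3 / 2) : ℝ) ≤ 24 := by
    conv_rhs => rw [← Real.rpow_one 24]
    exact Real.rpow_le_rpow_of_exponent_le (by norm_num) (by norm_num)
  have e6 : (0:ℝ) < 2 ^ (-(n:ℝ) / 6) := by positivity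
  nlinarith

lemma anti_b (κ : ℝ) (hκ : 0 < κ) (hκ1 : κ < 1) : ∃ C : ℝ, 0 < C ∧ ∀ (X : Finset ℤ) (N : ℤ → ℝ) (s : ℤ → ℕ) (F : Finset ℤ) (δ : ℝ), 0 ≤ δ →
    (∀ x ∈ X, ∀ ρ : ℕ, ((F.filter fun y => |y - x| ≤ ρ).card : ℝ) ≤ δ * (2 * ρ + 1)) → ∀ (f : ℤ → ℂ),
    ∑ x ∈ X, ‖∑ y ∈ F, ker N (fun x => {s x}) x y * f y‖ ^ 2 ≤
      C * δ ^ (1 - κ) * ∑ y ∈ F, ‖f y‖ ^ 2 := by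
  obtain ⟨C, hC, H⟩ := M_strong (1 + κ) (by linarith)
  refine ⟨144 * C, by positivity, ?_⟩
  intro X N s F δ hδ hF f
  set r := 2 / (1 + κ) with hr
  have hr1 : 1 < r := by rw [hr, lt_div_iff₀ (by linarith)]; linarith
  set v : ℤ → ℝ := fun y => ‖f y‖ with hv
  set h : ℤ → ℝ := fun y => v y ^ r with hh
  have hv0 : ∀ y, 0 ≤ v y := fun y => norm_nonneg _
  have hh0 : ∀ y, 0 ≤ h y := fun y => by positivity
  have main : ∀ x ∈ X, ‖∑ y ∈ F, ker N (fun x => {s x}) x y * f y‖ ^ 2 ≤ 144 * δ ^ (1 - κ) * M F h x ^ (1 + κ) := by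
    intro x hx
    have m2 := M_nonneg hh0 x (Z := F)
    have h2 : (1:ℝ) ≤ 2 ^ s x := one_le_pow₀ (by norm_num)
    set T := F.filter fun y => |y - x| ≤ ((2 ^ s x : ℕ) : ℤ) with hT
    have b1 : ‖∑ y ∈ F, ker N (fun x => {s x}) x y * f y‖ ≤ ∑ y ∈ T, 4 / 2 ^ s x * v y := by
      refine norm_sum_window (fun y => |y - x| ≤ ((2 ^ s x : ℕ) : ℤ)) (fun y _ hy => ?_) (fun y _ _ => ?_)
      · push_cast at hy
        push Not at hy
        unfold ker
        rw [sum_singleton, K_supp]; · simp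
        rw [abs_sub_comm]; exact hy.le
      · unfold ker
        rw [sum_singleton, norm_mul, norm_mul, norm_ee, mul_one, Complex.norm_real, Real.norm_eq_abs]
        exact mul_le_mul_of_nonneg_right (K_abs _ _) (norm_nonneg _)
    have c1 := hF x hx (2 ^ s x)
    have c2 := win_le_M hh0 x 1 (s x) (Z := F) T (filter_subset _ _) (fun y hy => by
      have := (mem_filter.mp hy).2; push_cast at this ⊢; linarith)
    have c3 := hol2 (T := T) hv0 (r := r) (α := δ) (w := 3 * 2 ^ s x) (m := M F h x) hr1 hδ (by positivity) m2
      (c1.trans (mul_le_mul_of_nonneg_left (by push_cast; linarith) hδ)) (c2.trans (le_of_eq (by push_cast; ring)))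
    have b2 : ‖∑ y ∈ F, ker N (fun x => {s x}) x y * f y‖ ≤ 12 * (δ ^ (1 - 1 / r) * M F h x ^ (1 / r)) := by
      refine b1.trans ?_
      rw [← Finset.mul_sum]
      refine (mul_le_mul_of_nonneg_left c3 (by positivity)).trans (le_of_eq ?_)
      field_simp; ring
    refine (pow_le_pow_left₀ (norm_nonneg _) b2 2).trans (le_of_eq ?_)
    rw [mul_pow, mul_pow, ← Real.rpow_natCast (δ ^ _), ← Real.rpow_natCast (M F h x ^ _), ← Real.rpow_mul hδ, ← Real.rpow_mul m2]
    have e1 : (1 - 1 / r) * (2:ℕ) = 1 - κ := by rw [hr]; push_cast; field_simp; ring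
    have e2 : 1 / r * (2:ℕ) = 1 + κ := by rw [hr]; push_cast; field_simp
    rw [e1, e2]; ring
  refine (Finset.sum_le_sum main).trans ?_
  rw [← Finset.mul_sum]
  have := H F h hh0 X
  refine (mul_le_mul_of_nonneg_left this (by positivity)).trans (le_of_eq ?_)
  have k3 : ∑ y ∈ F, h y ^ (1 + κ) = ∑ y ∈ F, v y ^ 2 := by
    refine Finset.sum_congr rfl fun y _ => ?_
    rw [hh]; simp only []
    rw [← Real.rpow_mul (hv0 y), ← Real.rpow_natCast]
    congr 1; rw [hr]; push_cast; field_simp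
  rw [k3]; ring

end
end Carl

namespace Carl
noncomputable section
open Finset

/-- tile order -/
def le (p q : Tile) : Prop := p.1 ≤ q.1 ∧ p.2.1 / 2 ^ (q.1 - p.1) = q.2.1 ∧ q.2.2 / 2 ^ (q.1 - p.1) = p.2.2

lemma le.sub {p q : Tile} (h : le p q) : sub p q := ⟨h.1, h.2.1⟩

lemma sub_refl (p : Tile) : sub p p := ⟨le_rfl, by simp⟩

lemma sub_trans {p q r : Tile} (h : sub p q) (h' : sub q r) : sub p r := by
  obtain ⟨h1, h2⟩ := h
  obtain ⟨k1, k2⟩ := h'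
  refine ⟨h1.trans k1, ?_⟩
  rw [← k2, ← h2, ediv_pow_add]
  congr 2; omega

lemma le_refl' (p : Tile) : le p p := ⟨le_rfl, by simp, by simp⟩

lemma le_trans' {p q r : Tile} (h : le p q) (h' : le q r) : le p r := by
  obtain ⟨h1, h2, h3⟩ := h
  obtain ⟨k1, k2, k3⟩ := h'
  refine ⟨h1.trans k1, (sub_trans ⟨h1, h2⟩ ⟨k1, k2⟩).2, ?_⟩
  rw [← h3, ← k3, ediv_pow_add]
  congr 2; omega

lemma le_eq {p q : Tile} (h : le p q) (e : p.1 = q.1) : p = q := by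
  obtain ⟨h1, h2, h3⟩ := h
  rw [e] at h2 h3
  simp at h2 h3
  exact Prod.ext e (Prod.ext h2 h3.symm)

lemma le_lt {p q : Tile} (h : le p q) (e : p ≠ q) : p.1 < q.1 :=
  lt_of_le_of_ne h.1 fun h' => e (le_eq h h')

lemma tl_le (N : ℤ → ℝ) (x : ℤ) {s t : ℕ} (h : s ≤ t) : le (tl N x s) (tl N x t) := by
  refine ⟨h, ediv_pow_le x h, ?_⟩
  change ⌊N x * 2 ^ t⌋ / 2 ^ (t - s) = ⌊N x * 2 ^ s⌋
  have e : N x * 2 ^ s = (N x * 2 ^ t) / ((2 ^ (t - s) : ℕ) : ℝ) := by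
    have : (2:ℝ) ^ t = 2 ^ s * 2 ^ (t - s) := by rw [← pow_add]; congr 1; omega
    rw [this]; push_cast; field_simp
  rw [e, Int.floor_div_natCast]
  push_cast; rfl

lemma le_cen {p q : Tile} (h : le p q) : |cen p - cen q| ≤ 1 / 2 / 2 ^ p.1 := by
  obtain ⟨h1, h2, h3⟩ := h
  obtain ⟨d, hd⟩ := Nat.exists_eq_add_of_le h1
  have hd' : q.1 - p.1 = d := by omega
  rw [hd'] at h3
  have hp : (0:ℝ) < 2 ^ p.1 := by positivity
  have h2d : (0:ℝ) < 2 ^ d := by positivity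
  have a1 : p.2.2 * 2 ^ d ≤ q.2.2 := by rw [← h3]; exact Int.ediv_mul_le _ (by positivity)
  have a2 : q.2.2 + 1 ≤ (p.2.2 + 1) * 2 ^ d := by
    rw [← h3]; exact Int.lt_ediv_add_one_mul_self _ (by positivity)
  have b1 : (p.2.2 : ℝ) * 2 ^ d ≤ q.2.2 := by exact_mod_cast a1
  have b2 : (q.2.2 : ℝ) + 1 ≤ (p.2.2 + 1) * 2 ^ d := by exact_mod_cast a2
  have e : cen p - cen q = ((p.2.2 + 1 / 2) * 2 ^ d - (q.2.2 + 1 / 2)) / 2 ^ d / 2 ^ p.1 := by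
    unfold cen; rw [hd, pow_add]; field_simp
  rw [e, abs_div, abs_of_pos hp]
  refine div_le_div_of_nonneg_right ?_ hp.le
  rw [abs_div, abs_of_pos h2d, div_le_iff₀ h2d, abs_le]
  constructor <;> nlinarith

lemma w_mono {p q : Tile} (h : p.1 ≤ q.1) : (1:ℝ) / 2 ^ q.1 ≤ 1 / 2 ^ p.1 :=
  div_le_div_of_nonneg_left zero_le_one (by positivity) (pow_le_pow_right₀ (by norm_num) h)

lemma w_add {a b d : ℕ} (h : a + d ≤ b) : (2:ℝ) ^ d * (1 / 2 ^ b) ≤ 1 / 2 ^ a := by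
  rw [mul_one_div, div_le_div_iff₀ (by positivity) (by positivity), one_mul, ← pow_add]
  exact pow_le_pow_right₀ (by norm_num) (by omega)

lemma Dn_mono {G : Finset ℤ} {N : ℤ → ℝ} {n : ℕ} {p p' : Tile} (h : le p p') (hD : Dn G N n p) : Dn G N n p' := by
  by_cases e : p = p'
  · rwa [← e]
  have hs := le_lt h e
  intro q hq
  refine (hD q (sub_trans h.sub hq)).trans (mul_le_mul_of_nonneg_left (max_le (le_max_left _ _) ?_) (by positivity))
  have h1 := le_cen h
  have h2 : (2:ℝ) ^ p.1 * 2 ≤ 2 ^ p'.1 := by rw [← pow_succ]; exact pow_le_pow_right₀ (by norm_num) hs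
  have hp : (0:ℝ) < 2 ^ p.1 := by positivity
  rw [le_div_iff₀ hp] at h1
  have h3 := abs_sub_le (cen p) (cen p') (cen q)
  set u := |cen p' - cen q|
  have hu : 0 ≤ u := abs_nonneg _
  have h4 : |cen p - cen q| * 2 ^ p.1 ≤ 1 / 2 + u * 2 ^ p.1 := by nlinarith
  have h5 : u * 2 ^ p.1 ≤ (u * 2 ^ p'.1) / 2 := by nlinarith
  have h6 := le_max_left 1 (u * 2 ^ p'.1)
  have h7 := le_max_right 1 (u * 2 ^ p'.1)
  linarith

open Classical in
/-- remove maximal elements -/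
def up (Q : Finset Tile) : Finset Tile := Q.filter fun p => ∃ p' ∈ Q, le p p' ∧ p ≠ p'
open Classical in
/-- remove minimal elements -/
def dn (Q : Finset Tile) : Finset Tile := Q.filter fun p => ∃ p' ∈ Q, le p' p ∧ p' ≠ p

lemma mem_up {Q : Finset Tile} {p : Tile} : p ∈ up Q ↔ p ∈ Q ∧ ∃ p' ∈ Q, le p p' ∧ p ≠ p' := by
  classical
  unfold up; rw [mem_filter]
lemma mem_dn {Q : Finset Tile} {p : Tile} : p ∈ dn Q ↔ p ∈ Q ∧ ∃ p' ∈ Q, le p' p ∧ p' ≠ p := by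
  classical
  unfold dn; rw [mem_filter]
lemma up_sub (Q : Finset Tile) : up Q ⊆ Q := fun _ h => (mem_up.mp h).1
lemma dn_sub (Q : Finset Tile) : dn Q ⊆ Q := fun _ h => (mem_dn.mp h).1
lemma up_iter_sub (Q : Finset Tile) (i : ℕ) : up^[i] Q ⊆ Q := by
  induction i with
  | zero => exact Finset.Subset.refl _
  | succ i ih => rw [Function.iterate_succ_apply']; exact (up_sub _).trans ih
lemma dn_iter_sub (Q : Finset Tile) (i : ℕ) : dn^[i] Q ⊆ Q := by
  induction i with
  | zero => exact Finset.Subset.refl _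
  | succ i ih => rw [Function.iterate_succ_apply']; exact (dn_sub _).trans ih

lemma up_iter {Q : Finset Tile} {i : ℕ} {p : Tile} (h : p ∈ up^[i] Q) : ∃ v ∈ Q, le p v ∧ p.1 + i ≤ v.1 := by
  induction i generalizing p with
  | zero => exact ⟨p, h, le_refl' p, le_rfl⟩
  | succ i ih =>
    rw [Function.iterate_succ_apply'] at h
    obtain ⟨p', h1, h2, h3⟩ := (mem_up.mp h).2
    obtain ⟨v, k1, k2, k3⟩ := ih h1
    have := le_lt h2 h3
    exact ⟨v, k1, le_trans' h2 k2, by omega⟩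

lemma dn_iter {Q : Finset Tile} {i : ℕ} {p : Tile} (h : p ∈ dn^[i] Q) : ∃ v ∈ Q, le v p ∧ v.1 + i ≤ p.1 := by
  induction i generalizing p with
  | zero => exact ⟨p, h, le_refl' p, le_rfl⟩
  | succ i ih =>
    rw [Function.iterate_succ_apply'] at h
    obtain ⟨p', h1, h2, h3⟩ := (mem_dn.mp h).2
    obtain ⟨v, k1, k2, k3⟩ := ih h1
    have := le_lt h2 h3
    exact ⟨v, k1, le_trans' k2 h2, by omega⟩

/-- convexity along points -/
def Cv (G : Finset ℤ) (N : ℤ → ℝ) (Q : Finset Tile) : Prop :=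
  ∀ x ∈ G, ∀ s1 s2 s3, s1 ≤ s2 → s2 ≤ s3 → tl N x s1 ∈ Q → tl N x s3 ∈ Q → tl N x s2 ∈ Q

lemma tl_ne {N : ℤ → ℝ} {x : ℤ} {s : ℕ} {p : Tile} (h : s ≠ p.1) : tl N x s ≠ p := fun e => h (by rw [← e]; rfl)

lemma Cv_up {G : Finset ℤ} {N : ℤ → ℝ} {Q : Finset Tile} (h : Cv G N Q) : Cv G N (up Q) := by
  intro x hx s1 s2 s3 h12 h23 k1 k3
  have := h x hx s1 s2 s3 h12 h23 (up_sub _ k1) (up_sub _ k3)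
  obtain ⟨p', a1, a2, a3⟩ := (mem_up.mp k3).2
  have : (s3 : ℕ) < p'.1 := le_lt a2 a3
  exact mem_up.mpr ⟨‹_›, p', a1, le_trans' (tl_le N x h23) a2, tl_ne (by omega)⟩

lemma Cv_dn {G : Finset ℤ} {N : ℤ → ℝ} {Q : Finset Tile} (h : Cv G N Q) : Cv G N (dn Q) := by
  intro x hx s1 s2 s3 h12 h23 k1 k3
  have := h x hx s1 s2 s3 h12 h23 (dn_sub _ k1) (dn_sub _ k3)
  obtain ⟨p', a1, a2, a3⟩ := (mem_dn.mp k1).2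
  have : p'.1 < s1 := le_lt a2 a3
  exact mem_dn.mpr ⟨‹_›, p', a1, le_trans' a2 (tl_le N x h12), fun e => by
    exact (tl_ne (N := N) (x := x) (s := s2) (p := p') (by omega)) e.symm⟩

lemma Cv_up_iter {G : Finset ℤ} {N : ℤ → ℝ} {Q : Finset Tile} (h : Cv G N Q) (i : ℕ) : Cv G N (up^[i] Q) := by
  induction i with
  | zero => exact h
  | succ i ih => rw [Function.iterate_succ_apply']; exact Cv_up ih
lemma Cv_dn_iter {G : Finset ℤ} {N : ℤ → ℝ} {Q : Finset Tile} (h : Cv G N Q) (i : ℕ) : Cv G N (dn^[i] Q) := by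
  induction i with
  | zero => exact h
  | succ i ih => rw [Function.iterate_succ_apply']; exact Cv_dn ih

/-- antichain along points -/
def Ac (N : ℤ → ℝ) (Q : Finset Tile) : Prop := ∀ x s t, tl N x s ∈ Q → tl N x t ∈ Q → s = t

lemma Ac_up (N : ℤ → ℝ) (Q : Finset Tile) : Ac N (Q \ up Q) := by
  have : ∀ x s t, s < t → tl N x s ∈ Q \ up Q → tl N x t ∈ Q \ up Q → False := by
    intro x s t hst h1 h2
    rw [mem_sdiff] at h1 h2
    exact h1.2 (mem_up.mpr ⟨h1.1, _, h2.1, tl_le N x hst.le, tl_ne (by exact hst.ne)⟩)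
  intro x s t h1 h2
  rcases lt_trichotomy s t with h | h | h
  · exact (this x s t h h1 h2).elim
  · exact h
  · exact (this x t s h h2 h1).elim

lemma Ac_dn (N : ℤ → ℝ) (Q : Finset Tile) : Ac N (Q \ dn Q) := by
  have : ∀ x s t, s < t → tl N x s ∈ Q \ dn Q → tl N x t ∈ Q \ dn Q → False := by
    intro x s t hst h1 h2
    rw [mem_sdiff] at h1 h2
    exact h2.2 (mem_dn.mpr ⟨h2.1, _, h1.1, tl_le N x hst.le, tl_ne (by exact hst.ne)⟩)
  intro x s t h1 h2
  rcases lt_trichotomy s t with h | h | h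
  · exact (this x s t h h1 h2).elim
  · exact h
  · exact (this x t s h h2 h1).elim

/-- all tiles -/
def PP (G : Finset ℤ) (N : ℤ → ℝ) (S : ℕ) : Finset Tile := (G ×ˢ Icc 1 S).image fun z => tl N z.1 z.2
lemma mem_PP {G : Finset ℤ} {N : ℤ → ℝ} {S : ℕ} {p : Tile} : p ∈ PP G N S ↔ ∃ x ∈ G, ∃ s, 1 ≤ s ∧ s ≤ S ∧ tl N x s = p := by
  unfold PP
  simp only [mem_image, mem_product, mem_Icc, Prod.exists]
  constructor
  · rintro ⟨x, s, ⟨h1, h2, h3⟩, e⟩; exact ⟨x, h1, s, h2, h3, e⟩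
  · rintro ⟨x, h1, s, h2, h3, e⟩; exact ⟨x, s, ⟨h1, h2, h3⟩, e⟩

open Classical in
/-- density level `n` -/
def Pn (G : Finset ℤ) (N : ℤ → ℝ) (S n : ℕ) : Finset Tile := (PP G N S).filter fun p => Dn G N n p ∧ ¬ Dn G N (n + 1) p

lemma mem_Pn {G : Finset ℤ} {N : ℤ → ℝ} {S n : ℕ} {p : Tile} :
    p ∈ Pn G N S n ↔ p ∈ PP G N S ∧ Dn G N n p ∧ ¬ Dn G N (n + 1) p := by
  classical
  unfold Pn; rw [mem_filter]

lemma tl_scale {N : ℤ → ℝ} {x y : ℤ} {s t : ℕ} (h : tl N x s = tl N y t) : s = t := congrArg (fun p : Tile => p.1) h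

lemma Cv_Pn (G : Finset ℤ) (N : ℤ → ℝ) (S n : ℕ) : Cv G N (Pn G N S n) := by
  intro x hx s1 s2 s3 h12 h23 k1 k3
  obtain ⟨a1, a2, a3⟩ := mem_Pn.mp k1
  obtain ⟨b1, b2, b3⟩ := mem_Pn.mp k3
  obtain ⟨y, _, s, c1, c2, c3⟩ := mem_PP.mp a1
  obtain ⟨y', _, s', d1, d2, d3⟩ := mem_PP.mp b1
  have e1 := tl_scale c3
  have e2 := tl_scale d3
  refine mem_Pn.mpr ⟨mem_PP.mpr ⟨x, hx, s2, by omega, by omega, rfl⟩, Dn_mono (tl_le N x h12) a2, fun h => b3 (Dn_mono (tl_le N x h23) h)⟩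

lemma Dn_zero (G : Finset ℤ) (N : ℤ → ℝ) (p : Tile) : Dn G N 0 p := by
  intro q _
  have : ((Eb G N q).card : ℝ) ≤ 2 ^ q.1 := by
    have h : Eb G N q ⊆ II q.1 (q.2.1 * 2 ^ q.1) := by
      intro x hx
      rw [mem_II, Int.mul_ediv_cancel _ (by positivity)]
      have := (mem_filter.mp hx).2
      rw [← this]; rfl
    rw [← card_II q.1 (q.2.1 * 2 ^ q.1)]
    exact_mod_cast card_le_card h
  rw [pow_zero, mul_one]
  refine this.trans ?_
  have h1 := le_max_left 1 (|cen p - cen q| * 2 ^ p.1)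
  nlinarith [show (0:ℝ) < 2 ^ q.1 by positivity]

lemma Dn_le {G : Finset ℤ} {N : ℤ → ℝ} {x : ℤ} (hx : x ∈ G) {s n : ℕ} (h : Dn G N n (tl N x s)) : n ≤ s := by
  have h1 := h (tl N x s) (sub_refl _)
  rw [sub_self, abs_zero, zero_mul] at h1
  have h2 : (1:ℝ) ≤ (Eb G N (tl N x s)).card := by
    have : x ∈ Eb G N (tl N x s) := by unfold Eb; exact mem_filter.mpr ⟨hx, rfl⟩
    exact_mod_cast card_pos.mpr ⟨x, this⟩
  have h3 : max (1:ℝ) 0 = 1 := by norm_num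
  rw [h3, mul_one] at h1
  have h4 : (2:ℝ) ^ n ≤ 2 ^ s := by
    have : (0:ℝ) < 2 ^ n := by positivity
    change _ ≤ (2:ℝ) ^ s at h1
    nlinarith
  exact (pow_le_pow_iff_right₀ (by norm_num : (1:ℝ) < 2)).mp h4

lemma exists_Pn {G : Finset ℤ} {N : ℤ → ℝ} {S : ℕ} {x : ℤ} (hx : x ∈ G) {s : ℕ} (h1 : 1 ≤ s) (h2 : s ≤ S) :
    ∃ n, n ≤ S ∧ tl N x s ∈ Pn G N S n := by
  classical
  have hb : ∀ n, Dn G N n (tl N x s) → n ≤ s := fun n => Dn_le hx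
  set n := Nat.findGreatest (fun n => Dn G N n (tl N x s)) s with hn
  have hD : Dn G N n (tl N x s) := Nat.findGreatest_spec (P := fun n => Dn G N n (tl N x s)) (Nat.zero_le s) (Dn_zero G N _)
  refine ⟨n, (hb n hD).trans h2, mem_Pn.mpr ⟨mem_PP.mpr ⟨x, hx, s, h1, h2, rfl⟩, hD, fun h => ?_⟩⟩
  have := Nat.le_findGreatest (P := fun n => Dn G N n (tl N x s)) (hb _ h) h
  omega

lemma Dn_anti {G : Finset ℤ} {N : ℤ → ℝ} {n m : ℕ} (h : n ≤ m) {p : Tile} (hD : Dn G N m p) : Dn G N n p := by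
  intro q hq
  refine le_trans (mul_le_mul_of_nonneg_left (pow_le_pow_right₀ (by norm_num) h) (by positivity)) (hD q hq)

lemma Pn_disj {G : Finset ℤ} {N : ℤ → ℝ} {S n m : ℕ} {p : Tile} (h1 : p ∈ Pn G N S n) (h2 : p ∈ Pn G N S m) : n = m := by
  obtain ⟨-, a, b⟩ := mem_Pn.mp h1
  obtain ⟨-, c, d⟩ := mem_Pn.mp h2
  rcases lt_trichotomy n m with h | h | h
  · exact (b (Dn_anti h c)).elim
  · exact h
  · exact (d (Dn_anti h a)).elim

end
end Carl

namespace Carl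
noncomputable section
open Finset

/-- spatial interval of a tile -/
def Ib (p : Tile) : Finset ℤ := II p.1 (p.2.1 * 2 ^ p.1)
lemma mem_Ib {p : Tile} {y : ℤ} : y ∈ Ib p ↔ y / 2 ^ p.1 = p.2.1 := by
  rw [Ib, mem_II, Int.mul_ediv_cancel _ (by positivity)]
lemma card_Ib (p : Tile) : ((Ib p).card : ℝ) = 2 ^ p.1 := card_II _ _
lemma sub_Ib {p q : Tile} (h : sub p q) {y : ℤ} (hy : y ∈ Ib p) : y ∈ Ib q := by
  rw [mem_Ib] at *
  rw [← h.2, ← hy, ediv_pow_le _ h.1]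
lemma sub_of_mem {p q : Tile} (h : p.1 ≤ q.1) {y : ℤ} (hp : y ∈ Ib p) (hq : y ∈ Ib q) : sub p q := by
  rw [mem_Ib] at *
  exact ⟨h, by rw [← hp, ← hq, ediv_pow_le _ h]⟩
lemma Ib_nonempty (p : Tile) : ∃ y, y ∈ Ib p := ⟨_, self_mem_II _ _⟩
lemma mem_Ib_tl (N : ℤ → ℝ) (x : ℤ) (s : ℕ) : x ∈ Ib (tl N x s) := mem_Ib.mpr rfl

lemma mem_Eb {G : Finset ℤ} {N : ℤ → ℝ} {q : Tile} {x : ℤ} : x ∈ Eb G N q ↔ x ∈ G ∧ tl N x q.1 = q := by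
  unfold Eb; rw [mem_filter]
lemma Eb_Ib {G : Finset ℤ} {N : ℤ → ℝ} {q : Tile} : Eb G N q ⊆ Ib q := by
  intro x hx
  have := mem_Ib_tl N x q.1
  rwa [(mem_Eb.mp hx).2] at this
lemma card_Eb (G : Finset ℤ) (N : ℤ → ℝ) (q : Tile) : ((Eb G N q).card : ℝ) ≤ 2 ^ q.1 := by
  rw [← card_Ib q]; exact_mod_cast card_le_card Eb_Ib

/-- frequency width -/
def w (p : Tile) : ℝ := 1 / 2 ^ p.1
lemma w_pos (p : Tile) : 0 < w p := by unfold w; positivity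
lemma w_le {p q : Tile} (h : p.1 ≤ q.1) : w q ≤ w p := w_mono h
lemma w_le' {p q : Tile} {d : ℕ} (h : p.1 + d ≤ q.1) : 2 ^ d * w q ≤ w p := w_add h
lemma w_lt {p q : Tile} (h : p.1 < q.1) : 2 * w q ≤ w p := by simpa using w_le' (d := 1) h
lemma le_cen' {p q : Tile} (h : le p q) : |cen p - cen q| ≤ w p / 2 := by
  have := le_cen h
  unfold w; calc _ ≤ _ := this
    _ = _ := by ring

/-- heavy tiles -/
def HH (G : Finset ℤ) (N : ℤ → ℝ) (n : ℕ) : Finset Tile :=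
  ((G ×ˢ range (n + 2 + G.card)).image fun z => tl N z.1 z.2).filter fun m => (2:ℝ) ^ m.1 < 2 ^ (n + 1) * (Eb G N m).card

lemma mem_HH {G : Finset ℤ} {N : ℤ → ℝ} {n : ℕ} {m : Tile} :
    m ∈ HH G N n ↔ (2:ℝ) ^ m.1 < 2 ^ (n + 1) * (Eb G N m).card := by
  unfold HH
  rw [mem_filter]
  refine ⟨fun h => h.2, fun h => ⟨?_, h⟩⟩
  have hne : (Eb G N m).Nonempty := by
    rw [← card_pos, Nat.pos_iff_ne_zero]
    intro h0
    rw [h0] at h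
    have : (0:ℝ) < 2 ^ m.1 := by positivity
    simp at h
    linarith
  obtain ⟨x, hx⟩ := hne
  have hx := mem_Eb.mp hx
  refine mem_image.mpr ⟨(x, m.1), mem_product.mpr ⟨hx.1, mem_range.mpr ?_⟩, hx.2⟩
  have h1 : (Eb G N m).card ≤ G.card := card_le_card (filter_subset _ _)
  have h2 : G.card < 2 ^ G.card := Nat.lt_two_pow_self
  have h3 : (2:ℝ) ^ m.1 < 2 ^ (n + 1) * 2 ^ G.card := by
    refine h.trans_le (mul_le_mul_of_nonneg_left ?_ (by positivity))
    exact_mod_cast h1.trans h2.le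
  rw [← pow_add] at h3
  have := (pow_lt_pow_iff_right₀ (by norm_num : (1:ℝ) < 2)).mp h3
  change m.1 < _
  omega

open Classical in
/-- maximal heavy tiles -/
def MM (G : Finset ℤ) (N : ℤ → ℝ) (n : ℕ) : Finset Tile := (HH G N n).filter fun m => ∀ q ∈ HH G N n, le m q → m = q

lemma mem_MM {G : Finset ℤ} {N : ℤ → ℝ} {n : ℕ} {m : Tile} :
    m ∈ MM G N n ↔ m ∈ HH G N n ∧ ∀ q ∈ HH G N n, le m q → m = q := by
  classical
  unfold MM; rw [mem_filter]

lemma MM_exists {G : Finset ℤ} {N : ℤ → ℝ} {n : ℕ} {q : Tile} (h : q ∈ HH G N n) : ∃ m ∈ MM G N n, le q m := by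
  classical
  obtain ⟨m, hm, hmax⟩ := exists_max_image ((HH G N n).filter fun m => le q m) (fun m => m.1)
    ⟨q, mem_filter.mpr ⟨h, le_refl' q⟩⟩
  rw [mem_filter] at hm
  refine ⟨m, mem_MM.mpr ⟨hm.1, fun r hr hmr => ?_⟩, hm.2⟩
  have := hmax r (mem_filter.mpr ⟨hr, le_trans' hm.2 hmr⟩)
  exact le_eq hmr (le_antisymm hmr.1 this)

lemma MM_sum (G : Finset ℤ) (N : ℤ → ℝ) (n : ℕ) : ∑ m ∈ MM G N n, (2:ℝ) ^ m.1 ≤ 2 ^ (n + 1) * G.card := by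
  classical
  have hd : ∀ m ∈ MM G N n, ∀ m' ∈ MM G N n, m ≠ m' → Disjoint (Eb G N m) (Eb G N m') := by
    intro m hm m' hm' hne
    rw [disjoint_left]
    intro x hx hx'
    have e1 := (mem_Eb.mp hx).2
    have e2 := (mem_Eb.mp hx').2
    rcases le_total m.1 m'.1 with h | h
    · have := tl_le N x h
      rw [e1, e2] at this
      exact hne ((mem_MM.mp hm).2 _ (mem_MM.mp hm').1 this)
    · have := tl_le N x h
      rw [e1, e2] at this
      exact hne ((mem_MM.mp hm').2 _ (mem_MM.mp hm).1 this).symm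
  have h1 : ∑ m ∈ MM G N n, (Eb G N m).card ≤ G.card := by
    rw [← card_biUnion hd]
    exact card_le_card (biUnion_subset.mpr fun m _ => filter_subset _ _)
  calc ∑ m ∈ MM G N n, (2:ℝ) ^ m.1 ≤ ∑ m ∈ MM G N n, 2 ^ (n + 1) * ((Eb G N m).card : ℝ) :=
        Finset.sum_le_sum fun m hm => (mem_HH.mp (mem_MM.mp hm).1).le
    _ = 2 ^ (n + 1) * ((∑ m ∈ MM G N n, (Eb G N m).card : ℕ) : ℝ) := by rw [← Finset.mul_sum]; push_cast; rfl
    _ ≤ _ := mul_le_mul_of_nonneg_left (by exact_mod_cast h1) (by positivity)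

/-- fuzzy order -/
def fuz (l : ℝ) (p q : Tile) : Prop := sub p q ∧ |cen p - cen q| ≤ l * w p

lemma heavy {G : Finset ℤ} {N : ℤ → ℝ} {S n : ℕ} {p : Tile} (h : p ∈ up^[n + 1] (Pn G N S n)) :
    ∃ m ∈ MM G N n, fuz 2 p m := by
  obtain ⟨v, hv, hpv, hs⟩ := up_iter h
  have hD := (mem_Pn.mp hv).2.2
  unfold Dn at hD
  push Not at hD
  obtain ⟨q, hvq, hq⟩ := hD
  have hE := card_Eb G N q
  have h2 : (0:ℝ) < 2 ^ q.1 := by positivity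
  have hn : (0:ℝ) < 2 ^ (n + 1) := by positivity
  have m1 := le_max_left 1 (|cen v - cen q| * 2 ^ v.1)
  have m2 := le_max_right 1 (|cen v - cen q| * 2 ^ v.1)
  obtain ⟨m, hm, hqm⟩ := MM_exists (G := G) (N := N) (n := n) (q := q) (mem_HH.mpr (by nlinarith))
  have h3 : |cen v - cen q| * 2 ^ v.1 ≤ 2 ^ (n + 1) := by
    refine m2.trans (le_of_mul_le_mul_left ?_ h2)
    nlinarith
  have h4 : |cen v - cen q| ≤ 2 ^ (n + 1) * w v := by
    unfold w; rw [mul_one_div, le_div_iff₀ (by positivity)]; exact h3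
  have h5 := w_le' hs
  have h6 := le_cen' hpv
  have h7 := le_cen' hqm
  have h8 := w_le (p := p) (q := q) (hpv.1.trans hvq.1)
  refine ⟨m, hm, sub_trans hpv.sub (sub_trans hvq hqm.sub), ?_⟩
  have t1 := abs_sub_le (cen p) (cen v) (cen m)
  have t2 := abs_sub_le (cen v) (cen q) (cen m)
  linarith

open Classical in
/-- the set of heavy tiles counted by `Bc` -/
def BS (G : Finset ℤ) (N : ℤ → ℝ) (n : ℕ) (p : Tile) : Finset Tile := (MM G N n).filter fun m => fuz 100 p m
lemma mem_BS {G : Finset ℤ} {N : ℤ → ℝ} {n : ℕ} {p m : Tile} : m ∈ BS G N n p ↔ m ∈ MM G N n ∧ fuz 100 p m := by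
  classical
  unfold BS; rw [mem_filter]

lemma BS_mono {G : Finset ℤ} {N : ℤ → ℝ} {n : ℕ} {p q : Tile} (h : fuz 10 p q) (hs : p.1 < q.1) : BS G N n q ⊆ BS G N n p := by
  intro m hm
  obtain ⟨h1, h2, h3⟩ := mem_BS.mp hm
  refine mem_BS.mpr ⟨h1, sub_trans h.1 h2, ?_⟩
  have := h.2
  have t1 := abs_sub_le (cen p) (cen q) (cen m)
  have := w_lt hs
  linarith [w_pos p]

lemma le_fuz {p q : Tile} (h : le p q) : fuz 10 p q := ⟨h.sub, by have := le_cen' h; linarith [w_pos p]⟩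

/-- tiles of density level `n` and multiplicity level `j` -/
def Pj (G : Finset ℤ) (N : ℤ → ℝ) (S n j : ℕ) : Finset Tile :=
  (up^[n + 1] (Pn G N S n)).filter fun p => 2 ^ j ≤ (BS G N n p).card ∧ (BS G N n p).card < 2 ^ (j + 1)
lemma mem_Pj {G : Finset ℤ} {N : ℤ → ℝ} {S n j : ℕ} {p : Tile} : p ∈ Pj G N S n j ↔
    p ∈ up^[n + 1] (Pn G N S n) ∧ 2 ^ j ≤ (BS G N n p).card ∧ (BS G N n p).card < 2 ^ (j + 1) := by
  unfold Pj; rw [mem_filter]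

lemma Cv_Pj (G : Finset ℤ) (N : ℤ → ℝ) (S n j : ℕ) : Cv G N (Pj G N S n j) := by
  intro x hx s1 s2 s3 h12 h23 k1 k3
  rcases h12.eq_or_lt with rfl | h12
  · exact k1
  rcases h23.eq_or_lt with rfl | h23
  · exact k3
  obtain ⟨a1, a2, a3⟩ := mem_Pj.mp k1
  obtain ⟨b1, b2, b3⟩ := mem_Pj.mp k3
  refine mem_Pj.mpr ⟨Cv_up_iter (Cv_Pn G N S n) (n + 1) x hx s1 s2 s3 h12.le h23.le a1 b1, ?_, ?_⟩
  · exact b2.trans (card_le_card (BS_mono (le_fuz (tl_le N x h23.le)) h23))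
  · exact (card_le_card (BS_mono (le_fuz (tl_le N x h12.le)) h12)).trans_lt a3

lemma Pj_Pn {G : Finset ℤ} {N : ℤ → ℝ} {S n j : ℕ} {p : Tile} (h : p ∈ Pj G N S n j) : p ∈ Pn G N S n :=
  up_iter_sub _ _ (mem_Pj.mp h).1

lemma Pn_scale {G : Finset ℤ} {N : ℤ → ℝ} {S n : ℕ} {p : Tile} (h : p ∈ Pn G N S n) : 1 ≤ p.1 ∧ p.1 ≤ S := by
  obtain ⟨x, _, s, h1, h2, rfl⟩ := mem_PP.mp (mem_Pn.mp h).1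
  exact ⟨h1, h2⟩

lemma Pj_scale {G : Finset ℤ} {N : ℤ → ℝ} {S n j : ℕ} {p : Tile} (h : p ∈ Pj G N S n j) : 1 ≤ p.1 ∧ p.1 ≤ S := Pn_scale (Pj_Pn h)

/-- multiplicity function -/
def mult (G : Finset ℤ) (N : ℤ → ℝ) (n : ℕ) (x : ℤ) : ℕ := ((MM G N n).filter fun m => x ∈ Ib m).card

lemma exists_Pj {G : Finset ℤ} {N : ℤ → ℝ} {S n : ℕ} {p : Tile} (h : p ∈ up^[n + 1] (Pn G N S n)) {x : ℤ} (hx : x ∈ Ib p)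
    {J : ℕ} (hJ : mult G N n x < 2 ^ J) : ∃ j < J, p ∈ Pj G N S n j := by
  obtain ⟨m, hm, hf⟩ := heavy h
  have h0 : (BS G N n p).card ≠ 0 := by
    have : m ∈ BS G N n p := mem_BS.mpr ⟨hm, hf.1, by linarith [hf.2, w_pos p]⟩
    exact (card_pos.mpr ⟨m, this⟩).ne'
  have h1 : (BS G N n p).card < 2 ^ J := by
    refine (card_le_card ?_).trans_lt hJ
    intro m hm
    obtain ⟨a, b⟩ := mem_BS.mp hm
    exact mem_filter.mpr ⟨a, sub_Ib b.1 hx⟩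
  refine ⟨Nat.log 2 (BS G N n p).card, Nat.log_lt_of_lt_pow h0 h1, mem_Pj.mpr ⟨h, ?_, ?_⟩⟩
  · exact Nat.pow_log_le_self 2 h0
  · exact Nat.lt_pow_succ_log_self (by norm_num) _

lemma Pj_disj {G : Finset ℤ} {N : ℤ → ℝ} {S n j j' : ℕ} {p : Tile} (h : p ∈ Pj G N S n j) (h' : p ∈ Pj G N S n j') : j = j' := by
  obtain ⟨-, a2, a3⟩ := mem_Pj.mp h
  obtain ⟨-, b2, b3⟩ := mem_Pj.mp h'
  have h1 := (Nat.pow_lt_pow_iff_right (by norm_num : 1 < 2)).mp (a2.trans_lt b3)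
  have h2 := (Nat.pow_lt_pow_iff_right (by norm_num : 1 < 2)).mp (b2.trans_lt a3)
  omega

/-- top tiles -/
def Top (Q V : Finset Tile) : Prop := V ⊆ Q ∧ (∀ u ∈ V, ∀ p ∈ Q, sub u p → u.1 < p.1 → 200 * w u < |cen u - cen p|) ∧
  (∀ u ∈ V, ∀ u' ∈ V, sub u u' → u.1 = u'.1 → |cen u - cen u'| ≤ 200 * w u → u = u') ∧
  (∀ v ∈ Q, ∃ u ∈ V, sub v u ∧ |cen v - cen u| ≤ 600 * w v)

lemma Top_exists (Q : Finset Tile) : ∃ V, Top Q V := by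
  classical
  set U := Q.filter fun u => ∀ p ∈ Q, sub u p → u.1 < p.1 → 200 * w u < |cen u - cen p| with hU
  obtain ⟨PV, hPV⟩ : ∃ PV : Finset Tile → Prop, ∀ V, PV V ↔ ∀ u ∈ V, ∀ u' ∈ V, sub u u' → u.1 = u'.1 →
    |cen u - cen u'| ≤ 200 * w u → u = u' := ⟨_, fun _ => Iff.rfl⟩
  obtain ⟨V, hV, hmax⟩ := exists_max_image (U.powerset.filter fun V => PV V) card
    ⟨∅, mem_filter.mpr ⟨empty_mem_powerset _, (hPV _).mpr (by simp)⟩⟩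
  rw [mem_filter, mem_powerset, hPV] at hV
  have key : ∀ u ∈ U, ∃ u' ∈ V, sub u u' ∧ |cen u - cen u'| ≤ 200 * w u := by
    intro u hu
    by_contra! hcon
    have huV : u ∉ V := fun h => by
      have := hcon u h (sub_refl u)
      rw [sub_self, abs_zero] at this
      linarith [w_pos u]
    have := hmax (insert u V) (by
      rw [mem_filter, mem_powerset, hPV]
      refine ⟨insert_subset hu hV.1, ?_⟩
      intro a ha b hb hab he hc
      rcases mem_insert.mp ha with rfl | ha' <;> rcases mem_insert.mp hb with rfl | hb'
      · rfl
      · exact absurd hc (not_le.mpr (hcon b hb' hab))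
      · exfalso
        have hs : sub b a := by
          obtain ⟨y, hy⟩ := Ib_nonempty a
          exact sub_of_mem he.ge (sub_Ib hab hy) hy
        have := hcon a ha' hs
        rw [abs_sub_comm] at this
        have hw : w a = w b := by unfold w; rw [he]
        linarith
      · exact hV.2 a ha' b hb' hab he hc)
    rw [card_insert_of_notMem huV] at this
    omega
  have climb : ∀ d : ℕ, ∀ v ∈ Q, Q.sup (fun p => p.1) - v.1 ≤ d → ∃ u ∈ U, sub v u ∧ |cen v - cen u| ≤ 400 * w v := by
    intro d
    induction d with
    | zero =>
      intro v hv hd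
      refine ⟨v, mem_filter.mpr ⟨hv, fun p hp _ hs => ?_⟩, sub_refl v, by rw [sub_self, abs_zero]; linarith [w_pos v]⟩
      have := Finset.le_sup (f := fun p : Tile => p.1) hp
      omega
    | succ d ih =>
      intro v hv hd
      by_cases h : v ∈ U
      · exact ⟨v, h, sub_refl v, by rw [sub_self, abs_zero]; linarith [w_pos v]⟩
      · rw [hU, mem_filter] at h
        push Not at h
        obtain ⟨p, hp, h1, h2, h3⟩ := h hv
        obtain ⟨u, hu, k1, k2⟩ := ih p hp (by omega)
        refine ⟨u, hu, sub_trans h1 k1, ?_⟩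
        have t1 := abs_sub_le (cen v) (cen p) (cen u)
        have := w_lt h2
        linarith
  refine ⟨V, fun u hu => (mem_filter.mp (hV.1 hu)).1, fun u hu => (mem_filter.mp (hV.1 hu)).2, hV.2, ?_⟩
  intro v hv
  obtain ⟨u, hu, h1, h2⟩ := climb _ v hv le_rfl
  obtain ⟨u', hu', k1, k2⟩ := key u hu
  refine ⟨u', hu', sub_trans h1 k1, ?_⟩
  have t1 := abs_sub_le (cen v) (cen u) (cen u')
  have := w_le h1.1
  linarith

/-- uniqueness -/
lemma Top_inj {G : Finset ℤ} {N : ℤ → ℝ} {S n j : ℕ} {V : Finset Tile} (hV : Top (Pj G N S n j) V) {u u' m : Tile}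
    (hu : u ∈ V) (hu' : u' ∈ V) {y : ℤ} (hy : y ∈ Ib u) (hy' : y ∈ Ib u') (h : fuz 100 u m) (h' : fuz 100 u' m) : u = u' := by
  wlog hs : u.1 ≤ u'.1 generalizing u u'
  · exact (this hu' hu hy' hy h' h (by omega)).symm
  obtain ⟨v1, v2, v3, -⟩ := hV
  have t1 := abs_sub_le (cen u) (cen m) (cen u')
  have h2 := h'.2
  rw [abs_sub_comm] at h2
  have := w_le hs
  have hsub := sub_of_mem hs hy hy'
  have hc : |cen u - cen u'| ≤ 200 * w u := by linarith [h.2]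
  rcases hs.eq_or_lt with e | e
  · exact v3 u hu u' hu' hsub e hc
  · exact absurd hc (not_le.mpr (v2 u hu u' (v1 hu') hsub e))

lemma Top_uniq {G : Finset ℤ} {N : ℤ → ℝ} {S n j : ℕ} {V : Finset Tile} (hV : Top (Pj G N S n j) V) {p u u' : Tile}
    (hp : p ∈ Pj G N S n j) (hu : u ∈ V) (hu' : u' ∈ V) (h : fuz 10 p u) (h' : fuz 10 p u') (hs : p.1 < u.1) (hs' : p.1 < u'.1) :
    u = u' := by
  have a1 := BS_mono (G := G) (N := N) (n := n) h hs
  have a2 := BS_mono (G := G) (N := N) (n := n) h' hs'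
  have b := (mem_Pj.mp (hV.1 hu)).2.1
  have b' := (mem_Pj.mp (hV.1 hu')).2.1
  have c := (mem_Pj.mp hp).2.2
  have : ¬ Disjoint (BS G N n u) (BS G N n u') := by
    classical
    intro hd
    have := card_le_card (union_subset a1 a2)
    rw [card_union_of_disjoint hd] at this
    rw [pow_succ] at c
    omega
  rw [not_disjoint_iff] at this
  obtain ⟨m, m1, m2⟩ := this
  obtain ⟨y, hy⟩ := Ib_nonempty p
  exact Top_inj hV hu hu' (sub_Ib h.1 hy) (sub_Ib h'.1 hy) (mem_BS.mp m1).2 (mem_BS.mp m2).2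

lemma Top_BS {G : Finset ℤ} {N : ℤ → ℝ} {S n j : ℕ} {V : Finset Tile} (hV : Top (Pj G N S n j) V) {u : Tile} (hu : u ∈ V) :
    ∃ m ∈ MM G N n, fuz 100 u m := by
  have b := (mem_Pj.mp (hV.1 hu)).2.1
  have : 0 < (BS G N n u).card := lt_of_lt_of_le (by positivity) b
  obtain ⟨m, hm⟩ := card_pos.mp this
  exact ⟨m, mem_BS.mp hm⟩

lemma Top_mult {G : Finset ℤ} {N : ℤ → ℝ} {S n j : ℕ} {V : Finset Tile} (hV : Top (Pj G N S n j) V) (y : ℤ) :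
    (V.filter fun u => y ∈ Ib u).card ≤ mult G N n y := by
  classical
  have : ∀ u, ∃ m, u ∈ V → m ∈ MM G N n ∧ fuz 100 u m := by
    intro u
    by_cases hu : u ∈ V
    · obtain ⟨m, h⟩ := Top_BS hV hu
      exact ⟨m, fun _ => h⟩
    · exact ⟨u, fun h => absurd h hu⟩
  choose μ hμ using this
  refine card_le_card_of_injOn μ ?_ ?_
  · intro u hu
    obtain ⟨h1, h2⟩ := mem_filter.mp hu
    exact mem_filter.mpr ⟨(hμ u h1).1, sub_Ib (hμ u h1).2.1 h2⟩
  · intro u hu u' hu' e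
    obtain ⟨h1, h2⟩ := mem_filter.mp hu
    obtain ⟨k1, k2⟩ := mem_filter.mp hu'
    have := (hμ u' k1).2
    rw [← e] at this
    exact Top_inj hV h1 k1 h2 k2 (hμ u h1).2 this

lemma Top_sum {G : Finset ℤ} {N : ℤ → ℝ} {S n j : ℕ} {V : Finset Tile} (hV : Top (Pj G N S n j) V) :
    ∑ u ∈ V, (2:ℝ) ^ u.1 ≤ 2 ^ (n + 1) * G.card := by
  classical
  refine le_trans ?_ (MM_sum G N n)
  have h1 : ∀ Q : Finset Tile, ∀ Z : Finset ℤ, (∀ u ∈ Q, Ib u ⊆ Z) → ∑ u ∈ Q, (2:ℝ) ^ u.1 = ∑ y ∈ Z, ((Q.filter fun u => y ∈ Ib u).card : ℝ) := by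
    intro Q Z hZ
    have : ∀ u ∈ Q, (2:ℝ) ^ u.1 = ∑ y ∈ Z, if y ∈ Ib u then 1 else 0 := by
      intro u hu
      rw [← card_Ib u, Finset.sum_boole]
      congr 2
      ext y
      exact ⟨fun h => mem_filter.mpr ⟨hZ u hu h, h⟩, fun h => (mem_filter.mp h).2⟩
    rw [Finset.sum_congr rfl this, Finset.sum_comm]
    exact Finset.sum_congr rfl fun y _ => by rw [Finset.sum_boole]
  set Z := V.biUnion Ib ∪ (MM G N n).biUnion Ib with hZ
  rw [h1 V Z fun u hu => (subset_biUnion_of_mem Ib hu).trans subset_union_left,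
    h1 (MM G N n) Z fun u hu => (subset_biUnion_of_mem Ib hu).trans subset_union_right]
  exact Finset.sum_le_sum fun y _ => by exact_mod_cast Top_mult hV y

end
end Carl

namespace Carl
noncomputable section
open Finset

/-- first depth -/
def r1 (n : ℕ) : ℕ := 3 * n + 15
/-- second depth -/
def r2 (n : ℕ) : ℕ := 4 * n + 10
/-- multiplicity threshold -/
def Tn (n : ℕ) : ℕ := 2 ^ (n + 1) * 64 * (n + 1) ^ 2

lemma Tn_le (n : ℕ) : Tn n ≤ 2 ^ (3 * n + 7) := by
  have h : n + 1 ≤ 2 ^ n := Nat.lt_two_pow_self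
  have h2 : (n + 1) ^ 2 ≤ (2 ^ n) ^ 2 := Nat.pow_le_pow_left h 2
  calc Tn n ≤ 2 ^ (n + 1) * 64 * (2 ^ n) ^ 2 := Nat.mul_le_mul_left _ h2
    _ = 2 ^ (3 * n + 7) := by
      rw [← pow_mul, show (64:ℕ) = 2 ^ 6 by norm_num, ← pow_add, ← pow_add]; congr 1; ring

/-- top tiles of level `(n, j)` -/
def Vt (G : Finset ℤ) (N : ℤ → ℝ) (S n j : ℕ) : Finset Tile := Classical.choose (Top_exists (Pj G N S n j))
lemma Vt_top (G : Finset ℤ) (N : ℤ → ℝ) (S n j : ℕ) : Top (Pj G N S n j) (Vt G N S n j) :=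
  Classical.choose_spec (Top_exists (Pj G N S n j))

open Classical in
/-- boundary points -/
def bd (n : ℕ) (u : Tile) : Finset ℤ := (Ib u).filter fun x => r1 n ≤ u.1 ∧ ∃ y, y ∉ Ib u ∧ |y - x| ≤ 8 * 2 ^ (u.1 - r1 n)

lemma card_bd (n : ℕ) (u : Tile) : ((bd n u).card : ℝ) ≤ 16 / 2 ^ r1 n * 2 ^ u.1 := by
  classical
  by_cases h : r1 n ≤ u.1
  · set L := u.2.1 * 2 ^ u.1 with hL
    set W : ℤ := 2 ^ u.1 with hW
    set d : ℤ := 8 * 2 ^ (u.1 - r1 n) with hd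
    have hd0 : 0 < d := by positivity
    have hI : ∀ y, y ∈ Ib u ↔ L ≤ y ∧ y ≤ L + W - 1 := by
      intro y
      rw [Ib, II, mem_Icc, Int.mul_ediv_cancel _ (by positivity)]
    have hs : bd n u ⊆ Icc L (L + d - 1) ∪ Icc (L + W - d) (L + W - 1) := by
      intro x hx
      rw [bd, mem_filter, hI] at hx
      obtain ⟨⟨h1, h2⟩, -, y, hy, hyx⟩ := hx
      rw [hI] at hy
      rw [abs_le] at hyx
      rw [mem_union, mem_Icc, mem_Icc]
      by_cases h3 : L ≤ y
      · have : L + W - 1 < y := by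
          by_contra h4
          exact hy ⟨h3, by omega⟩
        right; constructor <;> omega
      · left; constructor <;> omega
    have hc : (bd n u).card ≤ (d.toNat) + d.toNat := by
      refine (card_le_card hs).trans ((card_union_le _ _).trans ?_)
      rw [Int.card_Icc, Int.card_Icc]
      apply le_of_eq; congr 2 <;> ring
    have hc' : ((bd n u).card : ℝ) ≤ 2 * (d : ℝ) := by
      have h5 : ((d.toNat : ℤ)) = d := Int.toNat_of_nonneg hd0.le
      have h6 : ((d.toNat : ℝ)) = (d : ℝ) := by exact_mod_cast h5
      calc ((bd n u).card : ℝ) ≤ ((d.toNat + d.toNat : ℕ) : ℝ) := by exact_mod_cast hc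
        _ = _ := by push_cast; rw [h6]; ring
    refine hc'.trans (le_of_eq ?_)
    have : (2:ℝ) ^ u.1 = 2 ^ (r1 n) * 2 ^ (u.1 - r1 n) := by rw [← pow_add]; congr 1; omega
    rw [hd, this]; push_cast; field_simp; ring
  · have : bd n u = ∅ := by
      rw [bd, filter_eq_empty_iff]
      exact fun x _ hx => h hx.1
    rw [this]; simp

/-- exceptional set -/
def Ex (G : Finset ℤ) (N : ℤ → ℝ) (S n : ℕ) : Finset ℤ :=
  (G.filter fun x => Tn n ≤ mult G N n x) ∪ (range (3 * n + 8)).biUnion fun j => (Vt G N S n j).biUnion (bd n)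

lemma card_Ex (G : Finset ℤ) (N : ℤ → ℝ) (S n : ℕ) :
    ((Ex G N S n).card : ℝ) ≤ G.card * (1 / (64 * ((n:ℝ) + 1) ^ 2) + 1 / (128 * 2 ^ n)) := by
  have hG : (0:ℝ) ≤ G.card := Nat.cast_nonneg _
  have h1 : (((G.filter fun x => Tn n ≤ mult G N n x)).card : ℝ) ≤ G.card * (1 / (64 * ((n:ℝ) + 1) ^ 2)) := by
    set A := G.filter fun x => Tn n ≤ mult G N n x with hA
    have k1 : (Tn n : ℝ) * A.card ≤ 2 ^ (n + 1) * G.card := by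
      calc (Tn n : ℝ) * A.card = ∑ x ∈ A, (Tn n : ℝ) := by rw [Finset.sum_const, nsmul_eq_mul, mul_comm]
        _ ≤ ∑ x ∈ A, (mult G N n x : ℝ) := Finset.sum_le_sum fun x hx => by exact_mod_cast (mem_filter.mp hx).2
        _ = ∑ x ∈ A, ∑ m ∈ MM G N n, (if x ∈ Ib m then (1:ℝ) else 0) := by
          refine Finset.sum_congr rfl fun x _ => ?_
          rw [Finset.sum_boole]; rfl
        _ = ∑ m ∈ MM G N n, ∑ x ∈ A, (if x ∈ Ib m then (1:ℝ) else 0) := Finset.sum_comm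
        _ ≤ ∑ m ∈ MM G N n, (2:ℝ) ^ m.1 := by
          refine Finset.sum_le_sum fun m _ => ?_
          rw [Finset.sum_boole, ← card_Ib m]
          exact_mod_cast card_le_card fun x hx => (mem_filter.mp hx).2
        _ ≤ _ := MM_sum G N n
    have k2 : (Tn n : ℝ) = 2 ^ (n + 1) * (64 * ((n:ℝ) + 1) ^ 2) := by unfold Tn; push_cast; ring
    rw [k2, mul_assoc] at k1
    have k3 := le_of_mul_le_mul_left k1 (by positivity)
    rw [mul_one_div, le_div_iff₀ (by positivity), mul_comm]
    exact k3
  have h2 : (((range (3 * n + 8)).biUnion fun j => (Vt G N S n j).biUnion (bd n)).card : ℝ) ≤ G.card * (1 / (128 * 2 ^ n)) := by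
    have k1 : ∀ j, (((Vt G N S n j).biUnion (bd n)).card : ℝ) ≤ 16 / 2 ^ r1 n * (2 ^ (n + 1) * G.card) := by
      intro j
      calc (((Vt G N S n j).biUnion (bd n)).card : ℝ) ≤ ∑ u ∈ Vt G N S n j, ((bd n u).card : ℝ) := by
            exact_mod_cast card_biUnion_le
        _ ≤ ∑ u ∈ Vt G N S n j, 16 / 2 ^ r1 n * 2 ^ u.1 := Finset.sum_le_sum fun u _ => card_bd n u
        _ = 16 / 2 ^ r1 n * ∑ u ∈ Vt G N S n j, (2:ℝ) ^ u.1 := by rw [Finset.mul_sum]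
        _ ≤ _ := mul_le_mul_of_nonneg_left (Top_sum (Vt_top G N S n j)) (by positivity)
    calc _ ≤ ∑ j ∈ range (3 * n + 8), (((Vt G N S n j).biUnion (bd n)).card : ℝ) := by exact_mod_cast card_biUnion_le
      _ ≤ ∑ j ∈ range (3 * n + 8), 16 / 2 ^ r1 n * (2 ^ (n + 1) * (G.card : ℝ)) := Finset.sum_le_sum fun j _ => k1 j
      _ = G.card * ((3 * n + 8) * (16 / 2 ^ r1 n * 2 ^ (n + 1))) := by
        rw [Finset.sum_const, card_range, nsmul_eq_mul]; push_cast; ring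
      _ ≤ _ := mul_le_mul_of_nonneg_left ?_ hG
    have e : (2:ℝ) ^ r1 n = 2 ^ n * 2 ^ n * 2 ^ n * 32768 := by
      unfold r1; rw [show 3 * n + 15 = n + n + n + 15 by ring, pow_add, pow_add, pow_add]; norm_num
    have hn : (n:ℝ) + 1 ≤ 2 ^ n := by exact_mod_cast (Nat.lt_two_pow_self : n < 2 ^ n)
    rw [e, pow_succ]
    set t := (2:ℝ) ^ n
    have ht : 0 < t := by positivity
    have e2 : (3 * (n:ℝ) + 8) * (16 / (t * t * t * 32768) * (t * 2)) = (3 * n + 8) / (t * t * 1024) := by field_simp; norm_num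
    rw [e2, div_le_div_iff₀ (by positivity) (by positivity)]
    nlinarith [mul_pos ht ht]
  have h3 : ((Ex G N S n).card : ℝ) ≤ ((G.filter fun x => Tn n ≤ mult G N n x).card : ℝ) +
      (((range (3 * n + 8)).biUnion fun j => (Vt G N S n j).biUnion (bd n)).card : ℝ) := by
    exact_mod_cast card_union_le _ _
  rw [mul_add]
  linarith

/-- selected scales -/
def sel (N : ℤ → ℝ) (Q : Finset Tile) (a b : ℤ → ℕ) (x : ℤ) : Finset ℕ := (Icc (a x) (b x)).filter fun s => tl N x s ∈ Q
lemma mem_sel {N : ℤ → ℝ} {Q : Finset Tile} {a b : ℤ → ℕ} {x : ℤ} {s : ℕ} :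
    s ∈ sel N Q a b x ↔ (a x ≤ s ∧ s ≤ b x) ∧ tl N x s ∈ Q := by
  unfold sel; rw [mem_filter, mem_Icc]

/-- forest part -/
def Qf (G : Finset ℤ) (N : ℤ → ℝ) (S n j : ℕ) : Finset Tile := dn^[r2 n] (up^[r1 n] (Pj G N S n j))

/-- membership in the tree with top `u` -/
def Tm (n : ℕ) (u p : Tile) : Prop := sub p u ∧ |cen p - cen u| ≤ 2 * w p ∧ p.1 + r1 n ≤ u.1

lemma Tm_exists {G : Finset ℤ} {N : ℤ → ℝ} {S n j : ℕ} {p : Tile} (h : p ∈ up^[r1 n] (Pj G N S n j)) :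
    ∃ u ∈ Vt G N S n j, Tm n u p := by
  obtain ⟨v, hv, hpv, hs⟩ := up_iter h
  obtain ⟨u, hu, h1, h2⟩ := (Vt_top G N S n j).2.2.2 v hv
  refine ⟨u, hu, sub_trans hpv.sub h1, ?_, hs.trans h1.1⟩
  have a1 := le_cen' hpv
  have a2 := w_le' (d := 15) (p := p) (q := v) (by unfold r1 at hs; omega)
  have t := abs_sub_le (cen p) (cen v) (cen u)
  norm_num at a2
  linarith [w_pos p]

lemma Tm_fuz {n : ℕ} {u p q : Tile} (h : Tm n u q) (hpq : le p q) : fuz 10 p u ∧ p.1 < u.1 := by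
  obtain ⟨h1, h2, h3⟩ := h
  have h4 := hpq.1
  refine ⟨⟨sub_trans hpq.sub h1, ?_⟩, by unfold r1 at h3; omega⟩
  have t := abs_sub_le (cen p) (cen q) (cen u)
  have := le_cen' hpq
  have := w_le hpq.1
  linarith [w_pos p]

lemma Tm_eq {G : Finset ℤ} {N : ℤ → ℝ} {S n j : ℕ} {u u' : Tile} (hu : u ∈ Vt G N S n j) (hu' : u' ∈ Vt G N S n j)
    {x : ℤ} {s s' : ℕ} (h : Tm n u (tl N x s)) (h' : Tm n u' (tl N x s')) (hp : tl N x s ∈ Pj G N S n j)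
    (hp' : tl N x s' ∈ Pj G N S n j) : u = u' := by
  rcases le_total s s' with hs | hs
  · have k1 := Tm_fuz h (le_refl' _)
    have k2 := Tm_fuz h' (tl_le N x hs)
    exact Top_uniq (Vt_top G N S n j) hp hu hu' k1.1 k2.1 k1.2 k2.2
  · have k1 := Tm_fuz h' (le_refl' _)
    have k2 := Tm_fuz h (tl_le N x hs)
    exact Top_uniq (Vt_top G N S n j) hp' hu hu' k2.1 k1.1 k2.2 k1.2

lemma Qf_up {G : Finset ℤ} {N : ℤ → ℝ} {S n j : ℕ} {p : Tile} (h : p ∈ Qf G N S n j) : p ∈ up^[r1 n] (Pj G N S n j) :=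
  dn_iter_sub _ _ h
lemma Qf_Pj {G : Finset ℤ} {N : ℤ → ℝ} {S n j : ℕ} {p : Tile} (h : p ∈ Qf G N S n j) : p ∈ Pj G N S n j :=
  up_iter_sub _ _ (Qf_up h)

lemma Tm_sep {G : Finset ℤ} {N : ℤ → ℝ} {S n j : ℕ} {u u' p : Tile} (hu : u ∈ Vt G N S n j) (hu' : u' ∈ Vt G N S n j)
    (hne : u ≠ u') (hp : p ∈ Qf G N S n j) (h' : Tm n u' p) (h : sub p u) (hs : p.1 < u.1) :
    4 * 2 ^ r2 n ≤ 2 ^ p.1 * |cen u' - cen u| := by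
  obtain ⟨v, hv, hvp, hvs⟩ := dn_iter hp
  have k1 := Tm_fuz h' hvp
  by_contra! hcon
  apply hne
  refine Top_uniq (Vt_top G N S n j) (up_iter_sub _ _ hv) hu hu' ⟨sub_trans hvp.sub h, ?_⟩ k1.1 (lt_of_le_of_lt hvp.1 hs) k1.2
  have a1 := w_le' hvs
  have a2 := le_cen' hvp
  have a3 := h'.2.1
  have a4 := w_le hvp.1
  have hpp : (0:ℝ) < 2 ^ p.1 := by positivity
  have a5 : |cen u' - cen u| ≤ 4 * 2 ^ r2 n * w p := by
    unfold w; rw [mul_one_div, le_div_iff₀ hpp]; linarith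
  have t1 := abs_sub_le (cen v) (cen p) (cen u)
  have t2 := abs_sub_le (cen p) (cen u') (cen u)
  linarith [w_pos v]

lemma sel_int {G : Finset ℤ} {N : ℤ → ℝ} {S : ℕ} {Q : Finset Tile} {a b : ℤ → ℕ} (hQ : Cv G N Q) (hQS : ∀ p ∈ Q, 1 ≤ p.1 ∧ p.1 ≤ S)
    {x : ℤ} (hx : x ∈ G) (hne : (sel N Q a b x).Nonempty) : ∃ a' b', 1 ≤ a' ∧ a' ≤ b' ∧ b' ≤ S ∧ sel N Q a b x = Icc a' b' := by
  set A := sel N Q a b x with hA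
  have m1 := A.min'_mem hne
  have m2 := A.max'_mem hne
  have k1 := mem_sel.mp m1
  have k2 := mem_sel.mp m2
  refine ⟨A.min' hne, A.max' hne, (hQS _ k1.2).1, A.min'_le _ m2, (hQS _ k2.2).2, ?_⟩
  ext s
  rw [mem_Icc]
  constructor
  · exact fun h => ⟨A.min'_le _ h, A.le_max' _ h⟩
  · rintro ⟨h1, h2⟩
    exact mem_sel.mpr ⟨⟨k1.1.1.trans h1, h2.trans k2.1.2⟩, hQ x hx _ s _ h1 h2 k1.2 k2.2⟩

lemma level_forest {G G' : Finset ℤ} {N : ℤ → ℝ} {S n j : ℕ} (hj : j < 3 * n + 8) (hG : G' ⊆ G) (hN : ∀ x ∈ G, |N x| ≤ 1)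
    (hE : ∀ x ∈ G', x ∉ Ex G N S n) (a b : ℤ → ℕ) :
    ∃ (U : Finset Tile) (X : Tile → Finset ℤ),
      Forest S U X N (sel N (Qf G N S n j) a b) cen Ib (24 * 3 ^ 2 / 2 ^ n) (4 * 2 ^ r2 n) (Tn n) ∧
      U.biUnion X ⊆ G' ∧ (∀ x ∈ G', x ∉ U.biUnion X → sel N (Qf G N S n j) a b x = ∅) ∧ (∀ u ∈ U, (X u).Nonempty) ∧
      (∀ u ∈ U, ∀ x ∈ X u, (sel N (Qf G N S n j) a b x).Nonempty) := by
  classical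
  set A := sel N (Qf G N S n j) a b with hA
  set V := Vt G N S n j with hV
  have hVt := Vt_top G N S n j
  set X : Tile → Finset ℤ := fun u => G'.filter fun x => ∃ s ∈ A x, Tm n u (tl N x s) with hX
  set U := V.filter fun u => (X u).Nonempty with hU
  have hAQ : ∀ {x s}, s ∈ A x → tl N x s ∈ Qf G N S n j := fun h => (mem_sel.mp h).2
  have hUV : ∀ {u}, u ∈ U → u ∈ V := fun h => (mem_filter.mp h).1
  have hT : ∀ u ∈ V, ∀ x ∈ X u, ∀ s ∈ A x, Tm n u (tl N x s) := by
    intro u hu x hx s hs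
    obtain ⟨hxG, s', hs', ht⟩ := mem_filter.mp hx
    obtain ⟨u', hu', ht'⟩ := Tm_exists (Qf_up (hAQ hs))
    rw [Tm_eq hu hu' ht ht' (Qf_Pj (hAQ hs')) (Qf_Pj (hAQ hs))]
    exact ht'
  have hXG : ∀ u, X u ⊆ G' := fun u => filter_subset _ _
  have hne : ∀ u, ∀ x ∈ X u, (A x).Nonempty := fun u x hx => by
    obtain ⟨_, s, hs, _⟩ := mem_filter.mp hx
    exact ⟨s, hs⟩
  have hfreq : ∀ u ∈ V, ∀ x ∈ X u, ∀ s ∈ A x, |N x - cen u| ≤ 3 / 2 ^ s := by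
    intro u hu x hx s hs
    have h1 := (hT u hu x hx s hs).2.1
    have h2 := cen_near N x s
    have t := abs_sub_le (N x) (cen (tl N x s)) (cen u)
    have h0 : (0:ℝ) < 1 / 2 ^ s := by positivity
    have e1 : (1:ℝ) / 2 / 2 ^ s = 1 / 2 * (1 / 2 ^ s) := by ring
    have e2 : (3:ℝ) / 2 ^ s = 3 * (1 / 2 ^ s) := by ring
    change _ ≤ 2 * (1 / 2 ^ s) at h1
    rw [e1] at h2; rw [e2]
    linarith
  have hsupp : ∀ u ∈ V, ∀ x ∈ X u, ∀ s ∈ A x, ∀ y, |y - x| ≤ 8 * 2 ^ s → y ∈ Ib u := by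
    intro u hu x hx s hs y hy
    by_contra hyI
    obtain ⟨h1, h2, h3⟩ := hT u hu x hx s hs
    change s + r1 n ≤ u.1 at h3
    refine hE x (hXG u hx) (mem_union_right _ (mem_biUnion.mpr ⟨j, mem_range.mpr hj, mem_biUnion.mpr ⟨u, hu, ?_⟩⟩))
    rw [bd, mem_filter]
    refine ⟨sub_Ib h1 (mem_Ib_tl N x s), by omega, y, hyI, hy.trans ?_⟩
    have : (2:ℤ) ^ s ≤ 2 ^ (u.1 - r1 n) := pow_le_pow_right₀ (by norm_num) (by omega)
    linarith
  have hcen : ∀ u ∈ V, |cen u| ≤ 5 / 4 := by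
    intro u hu
    obtain ⟨x, hx, s, hs1, hs2, rfl⟩ := mem_PP.mp (mem_Pn.mp (Pj_Pn (hVt.1 hu))).1
    have h1 := cen_near N x s
    have h2 := hN x hx
    have h3 : (1:ℝ) / 2 / 2 ^ s ≤ 1 / 4 := by
      have : (2:ℝ) ^ 1 ≤ 2 ^ s := pow_le_pow_right₀ (by norm_num) hs1
      rw [div_le_iff₀ (by positivity)]; linarith
    rw [abs_le] at *
    constructor <;> linarith
  refine ⟨U, X, ⟨?_, ?_, ?_, ?_, ?_, ?_, by positivity, by positivity, ?_⟩, biUnion_subset.mpr fun u _ => hXG u, ?_,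
    fun u hu => (mem_filter.mp hu).2, fun u _ => hne u⟩
  · intro u hu
    refine ⟨fun x hx => ?_, hfreq u (hUV hu)⟩
    exact sel_int (Cv_dn_iter (Cv_up_iter (Cv_Pj G N S n j) _) _) (fun p hp => Pj_scale (Qf_Pj hp)) (hG (hXG u hx)) (hne u x hx)
  · intro u hu u' hu' huu
    rw [disjoint_left]
    intro x hx hx'
    obtain ⟨s, hs⟩ := hne u x hx
    exact huu (Tm_eq (hUV hu) (hUV hu') (hT u (hUV hu) x hx s hs) (hT u' (hUV hu') x hx' s hs) (Qf_Pj (hAQ hs)) (Qf_Pj (hAQ hs)))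
  · exact fun u hu => hsupp u (hUV hu)
  · intro u hu u' hu'
    have h1 := hcen u (hUV hu)
    have h2 := hcen u' (hUV hu')
    have := Real.pi_gt_three
    rw [abs_le] at *
    constructor <;> linarith
  · intro u hu u' hu' huu x' hx' s' hs' x hx s hs hss hxx
    have h1 := hsupp u (hUV hu) x hx s hs x' (by
      rw [abs_sub_comm]
      have : (2:ℤ) ^ s' ≤ 2 ^ s := pow_le_pow_right₀ (by norm_num) hss
      have : (0:ℤ) < 2 ^ s := by positivity
      omega)
    have h3 := (hT u (hUV hu) x hx s hs).2.2
    change s + r1 n ≤ u.1 at h3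
    have h4 : s' < u.1 := by unfold r1 at h3; omega
    exact Tm_sep (hUV hu) (hUV hu') huu (hAQ hs') (hT u' (hUV hu') x' hx' s' hs') (sub_of_mem h4.le (mem_Ib_tl N x' s') h1) h4
  · intro y
    rcases (U.filter fun u => y ∈ Ib u).eq_empty_or_nonempty with h | h
    · rw [h]; simp
    · obtain ⟨u, hu, hmin⟩ := exists_min_image _ (fun u : Tile => u.1) h
      obtain ⟨hu, hyu⟩ := mem_filter.mp hu
      obtain ⟨x, hx⟩ := (mem_filter.mp hu).2
      obtain ⟨s, hs⟩ := hne u x hx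
      have hxu : x ∈ Ib u := hsupp u (hUV hu) x hx s hs x (by simp)
      have h1 : (U.filter fun u => y ∈ Ib u) ⊆ V.filter fun u => x ∈ Ib u := by
        intro u' hu'
        have := hmin u' hu'
        obtain ⟨k1, k2⟩ := mem_filter.mp hu'
        exact mem_filter.mpr ⟨hUV k1, sub_Ib (sub_of_mem this hyu k2) hxu⟩
      have h2 : mult G N n x < Tn n := by
        by_contra h3
        exact hE x (hXG u hx) (mem_union_left _ (mem_filter.mpr ⟨hG (hXG u hx), by omega⟩))
      exact_mod_cast ((card_le_card h1).trans (Top_mult hVt x)).trans h2.le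
  · intro u hu
    refine tau_exists (by norm_num) ((hXG u).trans hG) (hne u) ?_ ?_ (hfreq u (hUV hu))
    · intro x hx s hs
      exact (Pj_scale (Qf_Pj (hAQ hs))).1
    · intro x hx s hs
      exact (mem_Pn.mp (Pj_Pn (Qf_Pj (hAQ hs)))).2.1
  · intro x hx hxU
    by_contra hcon
    obtain ⟨s, hs⟩ := nonempty_iff_ne_empty.mpr hcon
    obtain ⟨u, hu, ht⟩ := Tm_exists (Qf_up (hAQ hs))
    have : x ∈ X u := mem_filter.mpr ⟨hx, s, hs, ht⟩
    exact hxU (mem_biUnion.mpr ⟨u, mem_filter.mpr ⟨hu, x, this⟩, this⟩)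

end
end Carl

namespace Carl
noncomputable section
open Finset

lemma ups_exists {X F : Finset ℤ} {A : ℤ → Finset ℕ} {δ : ℝ} (hδ : 0 ≤ δ) (hX : X.Nonempty) (hA : ∀ x ∈ X, (A x).Nonempty)
    (hA1 : ∀ x ∈ X, ∀ s ∈ A x, 1 ≤ s)
    (hF : ∀ x ∈ X, ∀ ρ : ℕ, ((F.filter fun y => |y - x| ≤ ρ).card : ℝ) ≤ δ * (2 * ρ + 1)) :
    ∃ υ : ℤ → ℕ, DyP υ ∧ (∀ x ∈ X, ∀ s ∈ A x, ∀ y, |x - y| ≤ 4 * 2 ^ s → υ y ≤ s + 3) ∧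
    (∀ y, ((F.filter fun y' => y' / 2 ^ υ y = y / 2 ^ υ y).card : ℝ) ≤ (10 * δ) * 2 ^ υ y) := by
  classical
  set P : ℤ → ℕ → Prop := fun y v => ∃ x ∈ X, ∃ s ∈ A x, s ≤ v ∧ |x / 2 ^ v - y / 2 ^ v| ≤ 1 with hP
  have mono1 : ∀ y v, P y v → P y (v + 1) := by
    rintro y v ⟨x, hx, s, hs, h1, h2⟩
    refine ⟨x, hx, s, hs, by omega, ?_⟩
    rw [← ediv_pow_add x v 1, ← ediv_pow_add y v 1]
    rw [abs_le] at *
    constructor <;> omega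
  have mono : ∀ y v v', v ≤ v' → P y v → P y v' := by
    intro y v v' h hp
    induction v', h using Nat.le_induction with
    | base => exact hp
    | succ k _ ih => exact mono1 y k ih
  have near : ∀ x ∈ X, ∀ s ∈ A x, ∀ y v, s ≤ v → |x - y| ≤ 2 ^ v → P y v := by
    intro x hx s hs y v hv h
    refine ⟨x, hx, s, hs, hv, ?_⟩
    have hp : (0:ℤ) < 2 ^ v := by positivity
    set W : ℤ := 2 ^ v
    rw [abs_le] at h ⊢
    have e1 : x / W ≤ (y + W) / W := Int.ediv_le_ediv hp (by omega)
    have e2 : y / W ≤ (x + W) / W := Int.ediv_le_ediv hp (by omega)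
    rw [Int.add_ediv_of_dvd_right (dvd_refl W), Int.ediv_self hp.ne'] at e1 e2
    constructor <;> omega
  have ex : ∀ y, ∃ v, P y v := by
    intro y
    obtain ⟨x, hx⟩ := hX
    obtain ⟨s, hs⟩ := hA x hx
    refine ⟨s + (x - y).natAbs, near x hx s hs y _ (by omega) ?_⟩
    have h1 : (x - y).natAbs < 2 ^ (x - y).natAbs := Nat.lt_two_pow_self
    have h2 : (2:ℤ) ^ (x - y).natAbs ≤ 2 ^ (s + (x - y).natAbs) := pow_le_pow_right₀ (by norm_num) (by omega)
    have h3 : ((x - y).natAbs : ℤ) < 2 ^ (x - y).natAbs := by exact_mod_cast h1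
    rw [Int.abs_eq_natAbs]
    omega
  set ρ : ℤ → ℕ := fun y => Nat.find (ex y) with hρ
  have hspec : ∀ y, P y (ρ y) := fun y => Nat.find_spec (ex y)
  have hmin : ∀ y v, P y v → ρ y ≤ v := fun y v h => Nat.find_min' (ex y) h
  have h1 : ∀ y, 1 ≤ ρ y := by
    intro y
    obtain ⟨x, hx, s, hs, h, _⟩ := hspec y
    exact (hA1 x hx s hs).trans h
  have cong : ∀ y y' v, y' / 2 ^ v = y / 2 ^ v → P y v → P y' v := by
    rintro y y' v h ⟨x, hx, s, hs, h1, h2⟩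
    exact ⟨x, hx, s, hs, h1, by rwa [h]⟩
  refine ⟨fun y => ρ y - 1, ?_, ?_, ?_⟩
  · intro y y' h
    simp only at *
    have a1 : ρ y' ≤ ρ y := hmin _ _ (cong y y' _ (dy_mono h (by omega)) (hspec y))
    have a2 : ¬ ρ y' ≤ ρ y - 1 := by
      intro h3
      have := hmin _ _ (cong y' y _ h.symm (mono _ _ _ h3 (hspec y')))
      have := h1 y
      omega
    omega
  · intro x hx s hs y hy
    have := hmin y (s + 2) (near x hx s hs y (s + 2) (by omega) (by rw [pow_add]; omega))
    simp only
    omega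
  · intro y
    simp only
    obtain ⟨x, hx, s, hs, h, h2⟩ := hspec y
    have h3 : (F.filter fun y' => y' / 2 ^ (ρ y - 1) = y / 2 ^ (ρ y - 1)) ⊆ F.filter fun y' => |y' - x| ≤ ((4 * 2 ^ (ρ y - 1) : ℕ) : ℤ) := by
      intro y' hy'
      obtain ⟨k1, k2⟩ := mem_filter.mp hy'
      refine mem_filter.mpr ⟨k1, ?_⟩
      have k3 : y' / 2 ^ ρ y = y / 2 ^ ρ y := dy_mono k2 (by omega)
      rw [← k3] at h2
      have e : (2:ℤ) ^ ρ y = 2 * 2 ^ (ρ y - 1) := by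
        rw [← pow_succ']; congr 1; have := h1 y; omega
      have hp : (0:ℤ) < 2 ^ ρ y := by positivity
      have b1 := Int.mul_ediv_add_emod x (2 ^ ρ y)
      have b2 := Int.mul_ediv_add_emod y' (2 ^ ρ y)
      have b3 := Int.emod_nonneg x hp.ne'
      have b4 := Int.emod_nonneg y' hp.ne'
      have b5 := Int.emod_lt_of_pos x hp
      have b6 := Int.emod_lt_of_pos y' hp
      push_cast
      have e4 : (4:ℤ) * 2 ^ (ρ y - 1) = 2 * 2 ^ ρ y := by rw [e]; ring
      rw [e4]
      set W : ℤ := 2 ^ ρ y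
      rw [abs_le] at h2 ⊢
      constructor <;> nlinarith
    have h4 : ((F.filter fun y' => y' / 2 ^ (ρ y - 1) = y / 2 ^ (ρ y - 1)).card : ℝ) ≤ _ :=
      le_trans (by exact_mod_cast card_le_card h3) (hF x hx (4 * 2 ^ (ρ y - 1)))
    refine h4.trans ?_
    push_cast
    have : (1:ℝ) ≤ 2 ^ (ρ y - 1) := one_le_pow₀ (by norm_num)
    nlinarith

/-- the `ℓ²` norm -/
def nrm (X : Finset ℤ) (t : ℤ → ℂ) : ℝ := Real.sqrt (∑ x ∈ X, ‖t x‖ ^ 2)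

lemma nrm_eq (X : Finset ℤ) (t : ℤ → ℂ) : nrm X t = ‖(WithLp.toLp 2 (fun x : X => t x) : EuclideanSpace ℂ X)‖ := by
  rw [EuclideanSpace.norm_eq, nrm, ← Finset.sum_coe_sort X]

lemma nrm_add (X : Finset ℤ) (t t' : ℤ → ℂ) : nrm X (fun x => t x + t' x) ≤ nrm X t + nrm X t' := by
  rw [nrm_eq, nrm_eq, nrm_eq]
  exact norm_add_le (WithLp.toLp 2 (fun x : X => t x) : EuclideanSpace ℂ X) (WithLp.toLp 2 (fun x : X => t' x))

lemma nrm_sum {ι : Type*} (X : Finset ℤ) (U : Finset ι) (t : ι → ℤ → ℂ) {B : ℝ} (hB : ∀ u ∈ U, nrm X (t u) ≤ B) :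
    nrm X (fun x => ∑ u ∈ U, t u x) ≤ U.card * B := by
  classical
  induction U using Finset.induction_on with
  | empty => simp [nrm]
  | insert u U hu ih =>
    have h1 := ih fun v hv => hB v (mem_insert_of_mem hv)
    have h2 := hB u (mem_insert_self u U)
    have h3 := nrm_add X (t u) fun x => ∑ u ∈ U, t u x
    rw [card_insert_of_notMem hu]
    simp only [Finset.sum_insert hu]
    push_cast; linarith

lemma nrm_sum' (X : Finset ℤ) (n : ℕ) (t : ℕ → ℤ → ℂ) (B : ℕ → ℝ) (hB : ∀ u ∈ range n, nrm X (t u) ≤ B u) :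
    nrm X (fun x => ∑ u ∈ range n, t u x) ≤ ∑ u ∈ range n, B u := by
  induction n with
  | zero => simp [nrm]
  | succ n ih =>
    have h1 := ih fun v hv => hB v (mem_range.mpr (by have := mem_range.mp hv; omega))
    have h2 := hB n (mem_range.mpr (by omega))
    have h3 := nrm_add X (fun x => ∑ u ∈ range n, t u x) (t n)
    simp only [Finset.sum_range_succ]
    linarith

lemma nrm_congr {X : Finset ℤ} {t t' : ℤ → ℂ} (h : ∀ x ∈ X, t x = t' x) : nrm X t = nrm X t' := by
  unfold nrm; congr 1; exact Finset.sum_congr rfl fun x hx => by rw [h x hx]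

/-- partial operator -/
def op (N : ℤ → ℝ) (a b : ℤ → ℕ) (F : Finset ℤ) (f : ℤ → ℂ) (Q : Finset Tile) (x : ℤ) : ℂ :=
  ∑ y ∈ F, ker N (sel N Q a b) x y * f y

lemma op_split {N : ℤ → ℝ} {a b : ℤ → ℕ} {F : Finset ℤ} {f : ℤ → ℂ} {Q : Finset Tile} {x : ℤ} (J : ℕ) (Qj : ℕ → Finset Tile)
    (h1 : ∀ s, a x ≤ s → s ≤ b x → tl N x s ∈ Q → ∃ j < J, tl N x s ∈ Qj j) (h2 : ∀ j p, p ∈ Qj j → p ∈ Q)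
    (h3 : ∀ j j' p, p ∈ Qj j → p ∈ Qj j' → j = j') : op N a b F f Q x = ∑ j ∈ range J, op N a b F f (Qj j) x := by
  classical
  unfold op
  rw [Finset.sum_comm]
  refine Finset.sum_congr rfl fun y _ => ?_
  rw [← Finset.sum_mul]
  congr 1
  unfold ker
  rw [← Finset.sum_mul]
  congr 1
  unfold sel
  simp only [Finset.sum_filter]
  rw [Finset.sum_comm]
  refine Finset.sum_congr rfl fun s hs => ?_
  rw [mem_Icc] at hs
  by_cases hQ : tl N x s ∈ Q
  · obtain ⟨j, hj, hj'⟩ := h1 s hs.1 hs.2 hQ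
    rw [if_pos hQ, Finset.sum_eq_single j]
    · rw [if_pos hj']
    · intro j' _ hne
      exact if_neg fun h => hne (h3 _ _ _ h hj')
    · intro h; exact absurd (mem_range.mpr hj) h
  · rw [if_neg hQ]
    exact (Finset.sum_eq_zero fun j _ => if_neg fun h => hQ (h2 j _ h)).symm

lemma op_sdiff {N : ℤ → ℝ} {a b : ℤ → ℕ} {F : Finset ℤ} {f : ℤ → ℂ} {Q Q' : Finset Tile} (h : Q' ⊆ Q) (x : ℤ) :
    op N a b F f Q x = op N a b F f Q' x + op N a b F f (Q \ Q') x := by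
  have := op_split (N := N) (a := a) (b := b) (F := F) (f := f) (Q := Q) (x := x) 2 (fun j => if j = 0 then Q' else if j = 1 then Q \ Q' else ∅) ?_ ?_ ?_
  · rw [this]; simp [Finset.sum_range_succ]
  · intro s _ _ hs
    by_cases h' : tl N x s ∈ Q'
    · exact ⟨0, by norm_num, by simpa using h'⟩
    · exact ⟨1, by norm_num, by simp [hs, h']⟩
  · intro j p hp
    by_cases h0 : j = 0
    · simp [h0] at hp; exact h hp
    · by_cases h1 : j = 1
      · simp [h1] at hp; exact hp.1
      · simp [h0, h1] at hp
  · intro j j' p hp hp'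
    by_cases h0 : j = 0 <;> by_cases h0' : j' = 0 <;> by_cases h1 : j = 1 <;> by_cases h1' : j' = 1 <;> simp_all

lemma op_iter {N : ℤ → ℝ} {a b : ℤ → ℕ} {F : Finset ℤ} {f : ℤ → ℂ} {Q : Finset Tile} (g : Finset Tile → Finset Tile)
    (hg : ∀ Q, g Q ⊆ Q) (r : ℕ) (x : ℤ) :
    op N a b F f Q x = op N a b F f (g^[r] Q) x + ∑ i ∈ range r, op N a b F f (g^[i] Q \ g (g^[i] Q)) x := by
  induction r with
  | zero => simp
  | succ r ih =>
    rw [ih, Finset.sum_range_succ, op_sdiff (hg (g^[r] Q)), Function.iterate_succ_apply']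
    ring

end
end Carl

namespace Carl
noncomputable section
open Finset

lemma interp_min {t c α β κ : ℝ} (hc : 0 ≤ c) (hα : 0 < α) (hβ : 0 < β) (hκ : 0 < κ) (hκ1 : κ < 1) (h1 : t ≤ c * α) (h2 : t ≤ c * β) :
    t ≤ c * (α ^ κ * β ^ (1 - κ)) := by
  rcases le_total α β with h | h
  · refine h1.trans (mul_le_mul_of_nonneg_left ?_ hc)
    calc α = α ^ κ * α ^ (1 - κ) := by rw [← Real.rpow_add hα]; simp
      _ ≤ _ := mul_le_mul_of_nonneg_left (Real.rpow_le_rpow hα.le h (by linarith)) (by positivity)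
  · refine h2.trans (mul_le_mul_of_nonneg_left ?_ hc)
    calc β = β ^ κ * β ^ (1 - κ) := by rw [← Real.rpow_add hβ]; simp
      _ ≤ _ := mul_le_mul_of_nonneg_right (Real.rpow_le_rpow hβ.le h (by linarith)) (by positivity)

/-- the decay factor -/
def dec (κ : ℝ) (n : ℕ) (δ : ℝ) : ℝ := ((2:ℝ) ^ (-(n:ℝ) / 6)) ^ κ * (δ ^ (1 - κ)) ^ (1 - κ)

lemma sq_nrm (X : Finset ℤ) (t : ℤ → ℂ) : nrm X t ^ 2 = ∑ x ∈ X, ‖t x‖ ^ 2 :=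
  Real.sq_sqrt (Finset.sum_nonneg fun _ _ => by positivity)

lemma op_empty {N : ℤ → ℝ} {a b : ℤ → ℕ} {F : Finset ℤ} {f : ℤ → ℂ} {Q : Finset Tile} {x : ℤ} (h : sel N Q a b x = ∅) :
    op N a b F f Q x = 0 := by
  unfold op ker; rw [h]; simp

lemma piece_anti (κ : ℝ) (hκ : 0 < κ) (hκ1 : κ < 1) : ∃ C : ℝ, 0 < C ∧ ∀ (G G' : Finset ℤ) (N : ℤ → ℝ) (S n : ℕ) (a b : ℤ → ℕ),
    G' ⊆ G → (∀ x ∈ G, |N x| ≤ 1) → ∀ (F : Finset ℤ) (δ : ℝ), 0 < δ → δ ≤ 1 →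
    (∀ x ∈ G', ∀ ρ : ℕ, ((F.filter fun y => |y - x| ≤ ρ).card : ℝ) ≤ δ * (2 * ρ + 1)) → ∀ (f : ℤ → ℂ) (Q : Finset Tile),
    Ac N Q → (∀ p ∈ Q, p ∈ Pn G N S n) →
    nrm G' (op N a b F f Q) ^ 2 ≤ C * dec κ n δ * ∑ y ∈ F, ‖f y‖ ^ 2 := by
  obtain ⟨C1, hC1, H1⟩ := anti_a
  obtain ⟨C2, hC2, H2⟩ := anti_b κ hκ hκ1
  refine ⟨C1 + C2, by positivity, ?_⟩
  intro G G' N S n a b hG hN F δ hδ hδ1 hF f Q hQ hQP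
  classical
  set X := G'.filter fun x => (sel N Q a b x).Nonempty with hX
  have : ∀ x, ∃ s, x ∈ X → sel N Q a b x = {s} := by
    intro x
    by_cases hx : x ∈ X
    · obtain ⟨s, hs⟩ := (mem_filter.mp hx).2
      refine ⟨s, fun _ => ?_⟩
      ext t
      rw [mem_singleton]
      refine ⟨fun ht => hQ x t s (mem_sel.mp ht).2 (mem_sel.mp hs).2, fun ht => by rwa [ht]⟩
    · exact ⟨0, fun h => absurd h hx⟩
  choose s hs using this
  have hXG : X ⊆ G' := filter_subset _ _
  have hsQ : ∀ x ∈ X, tl N x (s x) ∈ Q := fun x hx => (mem_sel.mp (by rw [hs x hx]; exact mem_singleton_self _)).2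
  set E := ∑ y ∈ F, ‖f y‖ ^ 2 with hEE
  have hE0 : 0 ≤ E := Finset.sum_nonneg fun _ _ => by positivity
  have e : nrm G' (op N a b F f Q) ^ 2 = ∑ x ∈ X, ‖∑ y ∈ F, ker N (fun x => {s x}) x y * f y‖ ^ 2 := by
    rw [sq_nrm]
    symm
    rw [← Finset.sum_subset hXG]
    · refine Finset.sum_congr rfl fun x hx => ?_
      unfold op ker
      rw [hs x hx]
    · intro x hx hxX
      rw [op_empty]; · simp
      by_contra hne
      exact hxX (mem_filter.mpr ⟨hx, nonempty_iff_ne_empty.mpr hne⟩)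
  have b1 := H1 G X N s n (hXG.trans hG) (fun x hx => (Pn_scale (hQP _ (hsQ x hx))).1) (fun x hx => hN x (hG (hXG hx)))
    (fun x hx => (mem_Pn.mp (hQP _ (hsQ x hx))).2.1) F f
  have b2 := H2 X N s F δ hδ.le (fun x hx => hF x (hXG hx)) f
  rw [← e] at b1 b2
  set α := (2:ℝ) ^ (-(n:ℝ) / 6) with hα
  have hα0 : 0 < α := by positivity
  set β := δ ^ (1 - κ) with hβ
  have hβ0 : 0 < β := by positivity
  have := interp_min (t := nrm G' (op N a b F f Q) ^ 2) (c := (C1 + C2) * E) (by positivity) hα0 hβ0 hκ hκ1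
    (b1.trans (by nlinarith [mul_nonneg hα0.le hE0])) (b2.trans (by nlinarith [mul_nonneg hβ0.le hE0]))
  refine this.trans (le_of_eq ?_)
  unfold dec; ring

lemma piece_forest (κ : ℝ) (hκ : 0 < κ) (hκ1 : κ < 1) : ∃ C : ℝ, 0 < C ∧ ∀ (G G' : Finset ℤ) (N : ℤ → ℝ) (S n j : ℕ) (a b : ℤ → ℕ),
    j < 3 * n + 8 → G' ⊆ G → (∀ x ∈ G, |N x| ≤ 1) → (∀ x ∈ G', x ∉ Ex G N S n) → ∀ (F : Finset ℤ) (δ : ℝ), 0 < δ → δ ≤ 1 →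
    (∀ x ∈ G', ∀ ρ : ℕ, ((F.filter fun y => |y - x| ≤ ρ).card : ℝ) ≤ δ * (2 * ρ + 1)) → ∀ (f : ℤ → ℂ),
    nrm G' (op N a b F f (Qf G N S n j)) ^ 2 ≤ C * ((n:ℝ) + 1) ^ 2 * dec κ n δ * ∑ y ∈ F, ‖f y‖ ^ 2 := by
  obtain ⟨C1, hC1, H1⟩ := forest_a
  obtain ⟨C2, hC2, H2⟩ := forest_b
  refine ⟨C1 * 217 + C2 * 276480, by positivity, ?_⟩
  intro G G' N S n j a b hj hG hN hE F δ hδ hδ1 hF f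
  obtain ⟨U, X, HF, hU1, hU2, hU3, hU4⟩ := level_forest hj hG hN hE a b
  set E := ∑ y ∈ F, ‖f y‖ ^ 2 with hEE
  have hE0 : 0 ≤ E := Finset.sum_nonneg fun _ _ => by positivity
  have e : nrm G' (op N a b F f (Qf G N S n j)) ^ 2 = ∑ x ∈ U.biUnion X, ‖∑ y ∈ F, ker N (sel N (Qf G N S n j) a b) x y * f y‖ ^ 2 := by
    rw [sq_nrm]
    symm
    rw [← Finset.sum_subset hU1]
    · rfl
    · intro x hx hxX
      rw [op_empty (hU2 x hx hxX)]; simp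
  have b1 := H1 HF F f
  have b2 := H2 HF F (10 * δ) (by positivity) (fun u hu => ups_exists hδ.le (hU3 u hu) (hU4 u hu) ?_ ?_) f
  rotate_left
  · intro x hx s hs
    exact (Pj_scale (Qf_Pj (mem_sel.mp hs).2)).1
  · intro x hx
    exact hF x (hU1 (mem_biUnion.mpr ⟨u, hu, hx⟩))
  rw [← e] at b1 b2
  set α := (2:ℝ) ^ (-(n:ℝ) / 6) with hα
  have hα0 : 0 < α := by positivity
  set β := δ ^ (1 - κ) with hβ
  have hβ0 : 0 < β := by positivity
  have hn1 : (1:ℝ) ≤ ((n:ℝ) + 1) ^ 2 := by nlinarith [(Nat.cast_nonneg n : (0:ℝ) ≤ n)]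
  have t2 : (0:ℝ) < 2 ^ n := by positivity
  have hα1 : 1 / (2:ℝ) ^ n ≤ α := by
    rw [hα, one_div, ← Real.rpow_natCast, ← Real.rpow_neg (by norm_num)]
    refine Real.rpow_le_rpow_of_exponent_le (by norm_num) ?_
    linarith [(Nat.cast_nonneg n : (0:ℝ) ≤ n)]
  have hβ1 : δ ≤ β := by
    conv_lhs => rw [← Real.rpow_one δ]
    exact Real.rpow_le_rpow_of_exponent_ge hδ hδ1 (by linarith)
  have c1 : 24 * 3 ^ 2 / (2:ℝ) ^ n + (1 + (Tn n : ℝ)) / (4 * 2 ^ r2 n) ≤ 217 * (1 / 2 ^ n) := by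
    have hT : (Tn n : ℝ) ≤ 2 ^ (3 * n + 7) := by exact_mod_cast Tn_le n
    have h1 : (1:ℝ) ≤ 2 ^ (3 * n + 7) := one_le_pow₀ (by norm_num)
    have h2 : (1 + (Tn n : ℝ)) / (4 * 2 ^ r2 n) ≤ 1 / 2 ^ n := by
      rw [div_le_div_iff₀ (by positivity) t2, one_mul]
      have e1 : (2:ℝ) ^ (3 * n + 7) * 2 ^ n * 8 = 2 ^ r2 n := by
        unfold r2
        rw [show (8:ℝ) = 2 ^ 3 by norm_num, ← pow_add, ← pow_add]; congr 1; ring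
      have e3 : (0:ℝ) < 2 ^ r2 n := by positivity
      nlinarith
    have e2 : 24 * 3 ^ 2 / (2:ℝ) ^ n = 216 * (1 / 2 ^ n) := by ring
    rw [e2]; linarith
  have c2 : (Tn n : ℝ) * (24 * 3 ^ 2 / 2 ^ n) * (10 * δ) = 276480 * ((n:ℝ) + 1) ^ 2 * δ := by
    unfold Tn; push_cast; rw [pow_succ]; field_simp; ring
  rw [c2] at b2
  set c := (C1 * 217 + C2 * 276480) * ((n:ℝ) + 1) ^ 2 * E with hc
  have hc0 : 0 ≤ c := by positivity
  have d1 : nrm G' (op N a b F f (Qf G N S n j)) ^ 2 ≤ c * α := by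
    refine b1.trans ?_
    calc C1 * (24 * 3 ^ 2 / (2:ℝ) ^ n + (1 + (Tn n : ℝ)) / (4 * 2 ^ r2 n)) * E ≤ C1 * (217 * α) * E :=
          mul_le_mul_of_nonneg_right (mul_le_mul_of_nonneg_left (c1.trans (by linarith)) hC1.le) hE0
      _ = (C1 * 217) * 1 * (E * α) := by ring
      _ ≤ (C1 * 217 + C2 * 276480) * ((n:ℝ) + 1) ^ 2 * (E * α) := by
        refine mul_le_mul_of_nonneg_right ?_ (by positivity)
        exact mul_le_mul (by linarith) hn1 zero_le_one (by positivity)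
      _ = _ := by rw [hc]; ring
  have d2 : nrm G' (op N a b F f (Qf G N S n j)) ^ 2 ≤ c * β := by
    refine b2.trans ?_
    calc C2 * (276480 * ((n:ℝ) + 1) ^ 2 * δ) * E = (C2 * 276480) * ((n:ℝ) + 1) ^ 2 * E * δ := by ring
      _ ≤ (C1 * 217 + C2 * 276480) * ((n:ℝ) + 1) ^ 2 * E * β := by
        refine mul_le_mul ?_ hβ1 hδ.le (by positivity)
        refine mul_le_mul_of_nonneg_right (mul_le_mul_of_nonneg_right ?_ (by positivity)) hE0
        linarith [mul_pos hC1 (by norm_num : (0:ℝ) < 217)]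
  refine (interp_min hc0 hα0 hβ0 hκ hκ1 d1 d2).trans (le_of_eq ?_)
  unfold dec; rw [hc]; ring

lemma level_bound (κ : ℝ) (hκ : 0 < κ) (hκ1 : κ < 1) : ∃ C : ℝ, 0 < C ∧ ∀ (G G' : Finset ℤ) (N : ℤ → ℝ) (S n : ℕ) (a b : ℤ → ℕ),
    G' ⊆ G → (∀ x ∈ G, |N x| ≤ 1) → (∀ x ∈ G', x ∉ Ex G N S n) → ∀ (F : Finset ℤ) (δ : ℝ), 0 < δ → δ ≤ 1 →
    (∀ x ∈ G', ∀ ρ : ℕ, ((F.filter fun y => |y - x| ≤ ρ).card : ℝ) ≤ δ * (2 * ρ + 1)) → ∀ (f : ℤ → ℂ),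
    nrm G' (op N a b F f (Pn G N S n)) ≤ C * ((n:ℝ) + 1) ^ 3 * Real.sqrt (dec κ n δ * ∑ y ∈ F, ‖f y‖ ^ 2) := by
  obtain ⟨C1, hC1, H1⟩ := piece_anti κ hκ hκ1
  obtain ⟨C2, hC2, H2⟩ := piece_forest κ hκ hκ1
  refine ⟨Real.sqrt (C1 + C2) * 300, by positivity, ?_⟩
  intro G G' N S n a b hG hN hE F δ hδ hδ1 hF f
  set E := ∑ y ∈ F, ‖f y‖ ^ 2 with hEE
  have hE0 : 0 ≤ E := Finset.sum_nonneg fun _ _ => by positivity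
  have hd0 : 0 ≤ dec κ n δ := by unfold dec; positivity
  set B := Real.sqrt (C1 + C2) * ((n:ℝ) + 1) * Real.sqrt (dec κ n δ * E) with hB
  have hn0 : (0:ℝ) ≤ n := Nat.cast_nonneg n
  have hB0 : 0 ≤ B := by positivity
  have hB2 : B ^ 2 = (C1 + C2) * ((n:ℝ) + 1) ^ 2 * (dec κ n δ * E) := by
    rw [hB, mul_pow, mul_pow, Real.sq_sqrt (by positivity), Real.sq_sqrt (by positivity)]
  have hdE : 0 ≤ dec κ n δ * E := by positivity
  have hn1 : (1:ℝ) ≤ ((n:ℝ) + 1) ^ 2 := by nlinarith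
  have anti : ∀ Q, Ac N Q → (∀ p ∈ Q, p ∈ Pn G N S n) → nrm G' (op N a b F f Q) ≤ B := by
    intro Q h1 h2
    refine abs_le_of_sq_le_sq' ?_ hB0 |>.2
    refine (H1 G G' N S n a b hG hN F δ hδ hδ1 hF f Q h1 h2).trans ?_
    rw [hB2, mul_assoc]
    refine mul_le_mul_of_nonneg_right ?_ hdE
    nlinarith
  have forest : ∀ j < 3 * n + 8, nrm G' (op N a b F f (Qf G N S n j)) ≤ B := by
    intro j hj
    refine abs_le_of_sq_le_sq' ?_ hB0 |>.2
    refine (H2 G G' N S n j a b hj hG hN hE F δ hδ hδ1 hF f).trans ?_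
    rw [hB2, mul_assoc]
    refine mul_le_mul_of_nonneg_right ?_ hdE
    nlinarith
  have hPj : ∀ j < 3 * n + 8, nrm G' (op N a b F f (Pj G N S n j)) ≤ (7 * n + 26) * B := by
    intro j hj
    set P := Pj G N S n j with hP
    have e : ∀ x ∈ G', op N a b F f P x = (op N a b F f (Qf G N S n j) x + ∑ i ∈ range (r2 n), op N a b F f (dn^[i] (up^[r1 n] P) \ dn (dn^[i] (up^[r1 n] P))) x)
        + ∑ i ∈ range (r1 n), op N a b F f (up^[i] P \ up (up^[i] P)) x := by
      intro x _
      rw [op_iter up up_sub (r1 n), op_iter (Q := up^[r1 n] P) dn dn_sub (r2 n)]; rfl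
    rw [nrm_congr e]
    refine (nrm_add _ _ _).trans ?_
    have h1 := nrm_add G' (op N a b F f (Qf G N S n j)) (fun x => ∑ i ∈ range (r2 n), op N a b F f (dn^[i] (up^[r1 n] P) \ dn (dn^[i] (up^[r1 n] P))) x)
    have h2 := nrm_sum G' (range (r2 n)) (fun i => op N a b F f (dn^[i] (up^[r1 n] P) \ dn (dn^[i] (up^[r1 n] P)))) (B := B)
      (fun i _ => anti _ (Ac_dn N _) fun p hp => Pj_Pn (up_iter_sub _ _ (dn_iter_sub _ _ (mem_sdiff.mp hp).1)))
    have h3 := nrm_sum G' (range (r1 n)) (fun i => op N a b F f (up^[i] P \ up (up^[i] P))) (B := B)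
      (fun i _ => anti _ (Ac_up N _) fun p hp => Pj_Pn (up_iter_sub _ _ (mem_sdiff.mp hp).1))
    have h4 := forest j hj
    rw [card_range] at h2 h3
    have e1 : ((r1 n : ℕ) : ℝ) = 3 * n + 15 := by unfold r1; push_cast; ring
    have e2 : ((r2 n : ℕ) : ℝ) = 4 * n + 10 := by unfold r2; push_cast; ring
    rw [e2] at h2; rw [e1] at h3
    linarith
  set P := Pn G N S n with hP
  have e : ∀ x ∈ G', op N a b F f P x = (∑ j ∈ range (3 * n + 8), op N a b F f (Pj G N S n j) x)
      + ∑ i ∈ range (n + 1), op N a b F f (up^[i] P \ up (up^[i] P)) x := by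
    intro x hx
    rw [op_iter up up_sub (n + 1)]
    congr 1
    refine op_split _ _ ?_ (fun j p hp => (mem_Pj.mp hp).1) (fun j j' p hp hp' => Pj_disj hp hp')
    intro s _ _ hs
    refine exists_Pj hs (mem_Ib_tl N x s) (lt_of_lt_of_le ?_ ((Tn_le n).trans (Nat.pow_le_pow_right (by norm_num) (by omega))))
    by_contra h3
    exact hE x hx (mem_union_left _ (mem_filter.mpr ⟨hG hx, by omega⟩))
  rw [nrm_congr e]
  refine (nrm_add _ _ _).trans ?_
  have h2 := nrm_sum G' (range (3 * n + 8)) (fun j => op N a b F f (Pj G N S n j)) (B := (7 * n + 26) * B)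
    (fun j hj => hPj j (mem_range.mp hj))
  have h3 := nrm_sum G' (range (n + 1)) (fun i => op N a b F f (up^[i] P \ up (up^[i] P))) (B := B)
      (fun i _ => anti _ (Ac_up N _) fun p hp => up_iter_sub _ _ (mem_sdiff.mp hp).1)
  rw [card_range] at h2 h3
  push_cast at h2 h3
  have : (3 * (n:ℝ) + 8) * ((7 * n + 26) * B) + (n + 1) * B ≤ 300 * ((n:ℝ) + 1) ^ 2 * B := by
    rw [← mul_assoc, ← add_mul]
    refine mul_le_mul_of_nonneg_right ?_ hB0
    nlinarith
  calc _ ≤ 300 * ((n:ℝ) + 1) ^ 2 * B := by linarith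
    _ = _ := by rw [hB]; ring

end
end Carl

namespace Carl
noncomputable section
open Finset

/-- exceptional set, all levels -/
def Exx (G : Finset ℤ) (N : ℤ → ℝ) (S : ℕ) : Finset ℤ := (range (S + 1)).biUnion fun n => Ex G N S n

lemma card_Exx (G : Finset ℤ) (N : ℤ → ℝ) (S : ℕ) : ((Exx G N S).card : ℝ) ≤ G.card / 2 := by
  have h1 : ((Exx G N S).card : ℝ) ≤ ∑ n ∈ range (S + 1), ((Ex G N S n).card : ℝ) := by
    exact_mod_cast card_biUnion_le
  have s1 : ∀ m : ℕ, ∑ n ∈ range (m + 1), 1 / (64 * ((n:ℝ) + 1) ^ 2) ≤ (2 - 1 / ((m:ℝ) + 1)) / 64 := by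
    intro m
    induction m with
    | zero => norm_num
    | succ m ih =>
      rw [Finset.sum_range_succ]
      have hm : (0:ℝ) ≤ m := Nat.cast_nonneg m
      have : 1 / (64 * (((m + 1 : ℕ) : ℝ) + 1) ^ 2) ≤ (1 / ((m:ℝ) + 1) - 1 / ((m:ℝ) + 1 + 1)) / 64 := by
        push_cast
        rw [div_sub_div _ _ (by positivity) (by positivity), div_div, div_le_div_iff₀ (by positivity) (by positivity)]
        nlinarith
      push_cast at *
      linarith
  have s2 : ∀ m : ℕ, ∑ n ∈ range m, 1 / (128 * (2:ℝ) ^ n) ≤ (2 - 2 / 2 ^ m) / 128 := by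
    intro m
    induction m with
    | zero => norm_num
    | succ m ih =>
      rw [Finset.sum_range_succ]
      refine (add_le_add_left ih _).trans (le_of_eq ?_)
      rw [pow_succ]; field_simp; ring
  have a1 := s1 S
  have a2 := s2 (S + 1)
  have p1 : (0:ℝ) < 1 / ((S:ℝ) + 1) := by positivity
  have p2 : (0:ℝ) < 2 / 2 ^ (S + 1) := by positivity
  calc ((Exx G N S).card : ℝ) ≤ _ := h1
    _ ≤ ∑ n ∈ range (S + 1), (G.card : ℝ) * (1 / (64 * ((n:ℝ) + 1) ^ 2) + 1 / (128 * 2 ^ n)) :=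
      Finset.sum_le_sum fun n _ => card_Ex G N S n
    _ = G.card * (∑ n ∈ range (S + 1), 1 / (64 * ((n:ℝ) + 1) ^ 2) + ∑ n ∈ range (S + 1), 1 / (128 * (2:ℝ) ^ n)) := by
      rw [← Finset.mul_sum, Finset.sum_add_distrib]
    _ ≤ G.card * (1 / 2) := mul_le_mul_of_nonneg_left (by linarith) (Nat.cast_nonneg _)
    _ = _ := by ring

lemma poly_geom {r : ℝ} (h0 : 0 < r) (h1 : r < 1) : ∃ C : ℝ, 0 < C ∧ ∀ S : ℕ, ∑ n ∈ range S, ((n:ℝ) + 1) ^ 3 * r ^ n ≤ C := by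
  have hs : Summable fun n : ℕ => (n:ℝ) ^ 3 * r ^ n :=
    summable_pow_mul_geometric_of_norm_lt_one 3 (by rw [Real.norm_eq_abs, abs_of_pos h0]; exact h1)
  have hs2 : Summable fun n : ℕ => ((n:ℝ) + 1) ^ 3 * r ^ n := by
    have := ((summable_nat_add_iff 1).mpr hs).mul_left (r⁻¹)
    refine this.congr fun n => ?_
    push_cast; rw [pow_succ]; field_simp; ring
  refine ⟨∑' n : ℕ, ((n:ℝ) + 1) ^ 3 * r ^ n + 1, ?_, fun S => ?_⟩
  · have : 0 ≤ ∑' n : ℕ, ((n:ℝ) + 1) ^ 3 * r ^ n := tsum_nonneg fun n => by positivity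
    linarith
  · have := hs2.sum_le_tsum (range S) (fun n _ => by positivity)
    linarith

theorem thmA (κ : ℝ) (hκ : 0 < κ) (hκ1 : κ < 1) : ∃ C : ℝ, 0 < C ∧ ∀ (G : Finset ℤ) (N : ℤ → ℝ) (S : ℕ) (a b : ℤ → ℕ),
    (∀ x ∈ G, |N x| ≤ 1) → (∀ x ∈ G, 1 ≤ a x ∧ b x ≤ S) → ∃ G' ⊆ G, (G.card : ℝ) ≤ 2 * G'.card ∧
    ∀ (F : Finset ℤ) (δ : ℝ), 0 < δ → δ ≤ 1 →
    (∀ x ∈ G', ∀ ρ : ℕ, ((F.filter fun y => |y - x| ≤ ρ).card : ℝ) ≤ δ * (2 * ρ + 1)) → ∀ (f : ℤ → ℂ),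
    nrm G' (fun x => ∑ y ∈ F, ker N (fun x => Icc (a x) (b x)) x y * f y) ≤ C * Real.sqrt (δ ^ ((1 - κ) ^ 2) * ∑ y ∈ F, ‖f y‖ ^ 2) := by
  obtain ⟨C1, hC1, H1⟩ := level_bound κ hκ hκ1
  set r : ℝ := (2:ℝ) ^ (-κ / 12) with hr
  have hr0 : 0 < r := by positivity
  have hr1 : r < 1 := Real.rpow_lt_one_of_one_lt_of_neg (by norm_num) (by linarith)
  obtain ⟨C2, hC2, H2⟩ := poly_geom hr0 hr1
  refine ⟨C1 * C2, by positivity, ?_⟩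
  intro G N S a b hN hab
  have hcard : (G.card : ℝ) ≤ 2 * (G \ Exx G N S).card := by
    have h1 := card_Exx G N S
    have h2 : (G.card : ℝ) ≤ (G \ Exx G N S).card + (Exx G N S).card := by
      have := le_card_sdiff (Exx G N S) G
      exact_mod_cast (by omega : G.card ≤ (G \ Exx G N S).card + (Exx G N S).card)
    linarith
  refine ⟨G \ Exx G N S, sdiff_subset, hcard, ?_⟩
  intro F δ hδ hδ1 hF f
  set G' := G \ Exx G N S with hG'
  have hG : G' ⊆ G := sdiff_subset
  set E := ∑ y ∈ F, ‖f y‖ ^ 2 with hEE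
  have hE0 : 0 ≤ E := Finset.sum_nonneg fun _ _ => by positivity
  have e : ∀ x ∈ G', ∑ y ∈ F, ker N (fun x => Icc (a x) (b x)) x y * f y = ∑ n ∈ range (S + 1), op N a b F f (Pn G N S n) x := by
    intro x hx
    have h1 : ∑ y ∈ F, ker N (fun x => Icc (a x) (b x)) x y * f y = op N a b F f (PP G N S) x := by
      unfold op ker
      have : sel N (PP G N S) a b x = Icc (a x) (b x) := by
        ext s
        rw [mem_sel, mem_Icc]
        refine ⟨fun h => h.1, fun h => ⟨h, mem_PP.mpr ⟨x, hG hx, s, ?_, ?_, rfl⟩⟩⟩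
        · have := (hab x (hG hx)).1; omega
        · have := (hab x (hG hx)).2; omega
      rw [this]
    rw [h1]
    refine op_split _ _ ?_ (fun n p hp => (mem_Pn.mp hp).1) (fun n m p h h' => Pn_disj h h')
    intro s h1 h2 _
    obtain ⟨n, hn, h⟩ := exists_Pn (N := N) (S := S) (hG hx) (s := s) (by have := (hab x (hG hx)).1; omega) (by have := (hab x (hG hx)).2; omega)
    exact ⟨n, by omega, h⟩
  rw [nrm_congr e]
  set Y := Real.sqrt (δ ^ ((1 - κ) ^ 2) * E) with hY
  have hY0 : 0 ≤ Y := Real.sqrt_nonneg _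
  have hdec : ∀ n : ℕ, Real.sqrt (dec κ n δ * E) = r ^ n * Y := by
    intro n
    have e1 : dec κ n δ = (r ^ n) ^ 2 * δ ^ ((1 - κ) ^ 2) := by
      have e2 : (r ^ n) ^ 2 = (2:ℝ) ^ (-(n:ℝ) / 6 * κ) := by
        rw [hr, ← pow_mul, ← Real.rpow_natCast, ← Real.rpow_mul (by norm_num)]
        congr 1; push_cast; ring
      unfold dec
      rw [← Real.rpow_mul (by norm_num), ← Real.rpow_mul hδ.le, e2]
      congr 2
      ring
    rw [e1, mul_assoc, Real.sqrt_mul (by positivity), Real.sqrt_sq (by positivity)]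
  refine (nrm_sum' G' (S + 1) (fun n => op N a b F f (Pn G N S n)) (fun n => C1 * ((n:ℝ) + 1) ^ 3 * (r ^ n * Y)) ?_).trans ?_
  · intro n hn
    rw [← hdec n]
    refine H1 G G' N S n a b hG hN (fun x hx hx' => ?_) F δ hδ hδ1 hF f
    exact (mem_sdiff.mp hx).2 (mem_biUnion.mpr ⟨n, hn, hx'⟩)
  · calc ∑ n ∈ range (S + 1), C1 * ((n:ℝ) + 1) ^ 3 * (r ^ n * Y) = C1 * (∑ n ∈ range (S + 1), ((n:ℝ) + 1) ^ 3 * r ^ n) * Y := by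
          rw [Finset.mul_sum, Finset.sum_mul]; exact Finset.sum_congr rfl fun n _ => by ring
      _ ≤ C1 * C2 * Y := mul_le_mul_of_nonneg_right (mul_le_mul_of_nonneg_left (H2 _) hC1.le) hY0

end
end Carl

namespace Carl
noncomputable section
open Finset

lemma lev_exists (v : ℝ) : ∃ k : ℕ, v ≤ 2 ^ k ∧ (1 ≤ k → (2:ℝ) ^ k < 2 * v) := by
  classical
  have h : ∃ k : ℕ, v ≤ 2 ^ k := by
    obtain ⟨k, hk⟩ := pow_unbounded_of_one_lt v (by norm_num : (1:ℝ) < 2)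
    exact ⟨k, hk.le⟩
  refine ⟨Nat.find h, Nat.find_spec h, fun h1 => ?_⟩
  have := Nat.find_min h (m := Nat.find h - 1) (by omega)
  push Not at this
  have e : (2:ℝ) ^ Nat.find h = 2 * 2 ^ (Nat.find h - 1) := by
    rw [← pow_succ']; congr 1; omega
  rw [e]; linarith

theorem weak_one (q : ℝ) (hq : 1 < q) (hq2 : q < 2) : ∃ C : ℝ, 0 < C ∧ ∀ (G : Finset ℤ) (N : ℤ → ℝ) (S : ℕ) (a b : ℤ → ℕ),
    (∀ x ∈ G, |N x| ≤ 1) → (∀ x ∈ G, 1 ≤ a x ∧ b x ≤ S) → ∀ (Z : Finset ℤ) (f : ℤ → ℂ),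
    (∀ x ∈ G, 1 < ‖∑ y ∈ Z, ker N (fun x => Icc (a x) (b x)) x y * f y‖) →
    (G.card : ℝ) ≤ C * ∑ y ∈ Z, ‖f y‖ ^ q := by
  classical
  set κ : ℝ := 1 - q ^ (-(1/2) : ℝ) with hκ
  have hq0 : 0 < q := by linarith
  have hk1 : κ < 1 := by have : 0 < q ^ (-(1/2) : ℝ) := by positivity
                         linarith
  have hk0 : 0 < κ := by
    have : q ^ (-(1/2) : ℝ) < 1 := Real.rpow_lt_one_of_one_lt_of_neg hq (by norm_num)
    linarith
  have hkc : (1 - κ) ^ 2 = q⁻¹ := by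
    rw [hκ, sub_sub_cancel, ← Real.rpow_natCast, ← Real.rpow_mul hq0.le, ← Real.rpow_neg_one]; norm_num
  obtain ⟨C1, hC1, HA⟩ := thmA κ hk0 hk1
  rw [hkc] at HA
  set r : ℝ := (2:ℝ) ^ (-(q - 1) / 2) with hr
  have hr0 : 0 < r := by positivity
  have hr1 : r < 1 := Real.rpow_lt_one_of_one_lt_of_neg (by norm_num) (by linarith)
  set D : ℝ := C1 * (1 - r)⁻¹ with hD
  have hD0 : 0 < D := by have : 0 < 1 - r := by linarith
                         positivity
  refine ⟨20 + 2 * D ^ 2, by positivity, ?_⟩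
  intro G N S a b hN hab Z f hG
  choose k hk hk' using fun y => lev_exists ‖f y‖
  set E := ∑ y ∈ Z, ‖f y‖ ^ q with hE
  have hE0 : 0 ≤ E := Finset.sum_nonneg fun _ _ => by positivity
  set L := Z.sup k + 1 with hL
  have hmap : ∀ y ∈ Z, k y ∈ range L := fun y hy => mem_range.mpr (by have := Finset.le_sup (f := k) hy; omega)
  set F : ℕ → Finset ℤ := fun j => Z.filter fun y => k y = j with hF
  have hsum : ∀ (g : ℤ → ℝ), ∑ j ∈ range L, ∑ y ∈ F j, g y = ∑ y ∈ Z, g y := fun g => sum_fiberwise_of_maps_to hmap g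
  have hsumC : ∀ (g : ℤ → ℂ), ∑ j ∈ range L, ∑ y ∈ F j, g y = ∑ y ∈ Z, g y := fun g => sum_fiberwise_of_maps_to hmap g
  set δ : ℕ → ℝ := fun j => ((2:ℝ) ^ j) ^ (-q) with hδ
  have hδ0 : ∀ j, 0 < δ j := fun j => by positivity
  have hδ1 : ∀ j, δ j ≤ 1 := fun j => Real.rpow_le_one_of_one_le_of_nonpos (one_le_pow₀ (by norm_num)) (by linarith)
  set Ω : ℕ → Finset ℤ := fun j => G.filter fun x => 1 ≤ j ∧ δ j < M (F j) (fun _ => 1) x with hΩ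
  have hΩc : ∀ j, ((Ω j).card : ℝ) ≤ 20 * ∑ y ∈ F j, ‖f y‖ ^ q := by
    intro j
    by_cases h1 : 1 ≤ j
    · have := M_weak (Z := F j) (h := fun _ => 1) (fun _ => by norm_num) (hδ0 j).le (Ω j) (fun x hx => (mem_filter.mp hx).2.2)
      have h2 : ((Ω j).card : ℝ) ≤ 5 * ∑ y ∈ F j, (δ j)⁻¹ := by
        rw [mul_comm, ← le_div_iff₀ (hδ0 j)] at this
        refine this.trans (le_of_eq ?_)
        rw [div_eq_mul_inv, mul_assoc, Finset.sum_mul, ]; simp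
      refine h2.trans ?_
      rw [Finset.mul_sum, Finset.mul_sum]
      refine Finset.sum_le_sum fun y hy => ?_
      have hy2 := (mem_filter.mp hy).2
      have h3 := hk' y (by omega)
      rw [hy2] at h3
      have h4 : (δ j)⁻¹ = ((2:ℝ) ^ j) ^ q := by rw [hδ]; simp only []; rw [Real.rpow_neg (by positivity), inv_inv]
      rw [h4]
      have h5 : ((2:ℝ) ^ j) ^ q ≤ (2 * ‖f y‖) ^ q := Real.rpow_le_rpow (by positivity) h3.le hq0.le
      rw [Real.mul_rpow (by norm_num) (norm_nonneg _)] at h5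
      have h6 : (2:ℝ) ^ q ≤ 4 := by
        calc (2:ℝ) ^ q ≤ 2 ^ (2:ℝ) := Real.rpow_le_rpow_of_exponent_le (by norm_num) hq2.le
          _ = 4 := by norm_num
      have h7 : 0 ≤ ‖f y‖ ^ q := by positivity
      nlinarith
    · have : Ω j = ∅ := filter_eq_empty_iff.mpr fun x _ h => h1 h.1
      rw [this]; simp
      exact Finset.sum_nonneg fun _ _ => by positivity
  set W := (range L).biUnion Ω with hW
  have hWc : (W.card : ℝ) ≤ 20 * E := by
    have h1 : (W.card : ℝ) ≤ ∑ j ∈ range L, ((Ω j).card : ℝ) := by exact_mod_cast card_biUnion_le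
    refine h1.trans ((Finset.sum_le_sum fun j _ => hΩc j).trans ?_)
    rw [← Finset.mul_sum, hsum]
  obtain ⟨G', hG', hcard, HG⟩ := HA (G \ W) N S a b (fun x hx => hN x (mem_sdiff.mp hx).1) (fun x hx => hab x (mem_sdiff.mp hx).1)
  have hpiece : ∀ j ∈ range L, nrm G' (fun x => ∑ y ∈ F j, ker N (fun x => Icc (a x) (b x)) x y * f y) ≤ C1 * Real.sqrt E * r ^ j := by
    intro j hj
    refine (HG (F j) (δ j) (hδ0 j) (hδ1 j) ?_ f).trans ?_
    · intro x hx ρ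
      by_cases h1 : 1 ≤ j
      · have hx' := mem_sdiff.mp (hG' hx)
        have hM : M (F j) (fun _ => 1) x ≤ δ j := by
          by_contra h
          push Not at h
          exact hx'.2 (mem_biUnion.mpr ⟨j, hj, mem_filter.mpr ⟨hx'.1, h1, h⟩⟩)
        have := le_M (Z := F j) (h := fun _ => 1) (fun _ => by norm_num) (x := x) (a := x - ρ) (b := x + ρ)
          (T := (F j).filter fun y => |y - x| ≤ ρ) (filter_subset _ _)
          (fun y hy => by have := abs_le.mp (mem_filter.mp hy).2; omega) (by omega) (by omega)
        simp only [sum_const, nsmul_eq_mul, mul_one] at this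
        refine this.trans ?_
        push_cast
        have : (0:ℝ) ≤ ρ := Nat.cast_nonneg _
        nlinarith
      · have h0 : j = 0 := by omega
        have : δ j = 1 := by rw [hδ, h0]; simp
        rw [this, one_mul]
        have h2 : ((F j).filter fun y => |y - x| ≤ ρ) ⊆ Icc (x - ρ) (x + ρ) := by
          intro y hy
          have := abs_le.mp (mem_filter.mp hy).2
          rw [mem_Icc]; omega
        have h3 := card_le_card h2
        rw [Int.card_Icc] at h3
        have h4 : (x + ρ + 1 - (x - ρ)).toNat = 2 * ρ + 1 := by omega
        rw [h4] at h3
        exact_mod_cast h3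
    · have e1 : δ j ^ q⁻¹ = ((2:ℝ) ^ j)⁻¹ := by
        rw [hδ]; simp only []
        rw [← Real.rpow_mul (by positivity), show -q * q⁻¹ = -1 by field_simp, Real.rpow_neg_one]
      have e2 : ∑ y ∈ F j, ‖f y‖ ^ 2 ≤ ((2:ℝ) ^ j) ^ (2 - q) * E := by
        calc ∑ y ∈ F j, ‖f y‖ ^ 2 ≤ ∑ y ∈ F j, ((2:ℝ) ^ j) ^ (2 - q) * ‖f y‖ ^ q := by
              refine Finset.sum_le_sum fun y hy => ?_
              have hy2 := (mem_filter.mp hy).2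
              have h3 := hk y
              rw [hy2] at h3
              have : ‖f y‖ ^ 2 = ‖f y‖ ^ (2 - q) * ‖f y‖ ^ q := by
                rw [← Real.rpow_add_of_nonneg (norm_nonneg _) (by linarith) hq0.le, ← Real.rpow_natCast]; congr 1; push_cast; ring
              rw [this]
              exact mul_le_mul_of_nonneg_right (Real.rpow_le_rpow (norm_nonneg _) h3 (by linarith)) (by positivity)
          _ = ((2:ℝ) ^ j) ^ (2 - q) * ∑ y ∈ F j, ‖f y‖ ^ q := by rw [Finset.mul_sum]
          _ ≤ _ := mul_le_mul_of_nonneg_left (Finset.sum_le_sum_of_subset_of_nonneg (filter_subset _ _) fun _ _ _ => by positivity) (by positivity)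
      have e3 : ((2:ℝ) ^ j)⁻¹ * ((2:ℝ) ^ j) ^ (2 - q) = (r ^ j) ^ 2 := by
        rw [← Real.rpow_neg_one, ← Real.rpow_add (by positivity), hr, ← pow_mul, ← Real.rpow_natCast, ← Real.rpow_mul (by norm_num),
          ← Real.rpow_natCast, ← Real.rpow_mul (by norm_num)]
        congr 1; push_cast; ring
      have e4 : Real.sqrt (δ j ^ q⁻¹ * ∑ y ∈ F j, ‖f y‖ ^ 2) ≤ r ^ j * Real.sqrt E := by
        calc _ ≤ Real.sqrt ((r ^ j) ^ 2 * E) := by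
              apply Real.sqrt_le_sqrt
              rw [e1, ← e3, mul_assoc]
              exact mul_le_mul_of_nonneg_left e2 (by positivity)
          _ = _ := by rw [Real.sqrt_mul (by positivity), Real.sqrt_sq (by positivity)]
      calc _ ≤ C1 * (r ^ j * Real.sqrt E) := mul_le_mul_of_nonneg_left e4 hC1.le
        _ = _ := by ring
  have htot : nrm G' (fun x => ∑ y ∈ Z, ker N (fun x => Icc (a x) (b x)) x y * f y) ≤ D * Real.sqrt E := by
    rw [nrm_congr (t' := fun x => ∑ j ∈ range L, ∑ y ∈ F j, ker N (fun x => Icc (a x) (b x)) x y * f y)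
      (fun x _ => (hsumC fun y => ker N (fun x => Icc (a x) (b x)) x y * f y).symm)]
    refine (nrm_sum' G' L (fun j x => ∑ y ∈ F j, ker N (fun x => Icc (a x) (b x)) x y * f y) _ hpiece).trans ?_
    rw [← Finset.mul_sum, hD]
    have hg : ∑ j ∈ range L, r ^ j ≤ (1 - r)⁻¹ := by
      rw [← tsum_geometric_of_lt_one hr0.le hr1]
      exact (summable_geometric_of_lt_one hr0.le hr1).sum_le_tsum _ fun _ _ => by positivity
    calc _ ≤ C1 * Real.sqrt E * (1 - r)⁻¹ := mul_le_mul_of_nonneg_left hg (by positivity)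
      _ = _ := by ring
  have hlow : (G'.card : ℝ) ≤ D ^ 2 * E := by
    have h1 : (G'.card : ℝ) ≤ nrm G' (fun x => ∑ y ∈ Z, ker N (fun x => Icc (a x) (b x)) x y * f y) ^ 2 := by
      rw [sq_nrm]
      have : (G'.card : ℝ) = ∑ x ∈ G', (1:ℝ) := by simp
      rw [this]
      refine Finset.sum_le_sum fun x hx => ?_
      have := hG x (mem_sdiff.mp (hG' hx)).1
      nlinarith
    refine h1.trans ((pow_le_pow_left₀ (Real.sqrt_nonneg _) htot 2).trans (le_of_eq ?_))
    rw [mul_pow, Real.sq_sqrt hE0]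
  have h2 : (G.card : ℝ) ≤ (G \ W).card + W.card := by
    have := le_card_sdiff W G
    exact_mod_cast (by omega : G.card ≤ (G \ W).card + W.card)
  nlinarith

theorem weak (q : ℝ) (hq : 1 < q) (hq2 : q < 2) : ∃ C : ℝ, 0 < C ∧ ∀ (G : Finset ℤ) (N : ℤ → ℝ) (S : ℕ) (a b : ℤ → ℕ),
    (∀ x ∈ G, |N x| ≤ 1) → (∀ x ∈ G, 1 ≤ a x ∧ b x ≤ S) → ∀ (Z : Finset ℤ) (f : ℤ → ℂ) (l : ℝ), 0 < l →
    (∀ x ∈ G, l < ‖∑ y ∈ Z, ker N (fun x => Icc (a x) (b x)) x y * f y‖) →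
    l ^ q * G.card ≤ C * ∑ y ∈ Z, ‖f y‖ ^ q := by
  obtain ⟨C, hC, H⟩ := weak_one q hq hq2
  refine ⟨C, hC, fun G N S a b hN hab Z f l hl hG => ?_⟩
  have := H G N S a b hN hab Z (fun y => f y / (l:ℂ)) (fun x hx => by
    have e : ∑ y ∈ Z, ker N (fun x => Icc (a x) (b x)) x y * (f y / (l:ℂ)) = (∑ y ∈ Z, ker N (fun x => Icc (a x) (b x)) x y * f y) / l := by
      rw [Finset.sum_div]; exact Finset.sum_congr rfl fun y _ => by ring
    rw [e, norm_div, Complex.norm_real, Real.norm_eq_abs, abs_of_pos hl, lt_div_iff₀ hl, one_mul]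
    exact hG x hx)
  have e : ∑ y ∈ Z, ‖f y / (l:ℂ)‖ ^ q = (∑ y ∈ Z, ‖f y‖ ^ q) / l ^ q := by
    rw [Finset.sum_div]
    refine Finset.sum_congr rfl fun y _ => ?_
    rw [norm_div, Complex.norm_real, Real.norm_eq_abs, abs_of_pos hl, Real.div_rpow (norm_nonneg _) hl.le]
  rw [e, ← mul_div_assoc, le_div_iff₀ (by positivity)] at this
  linarith

end
end Carl

namespace Carl
noncomputable section
open Finset

def To (Z : Finset ℤ) (f : ℤ → ℂ) (θ : ℝ) (a b : ℕ) (x : ℤ) : ℂ :=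
  ∑ y ∈ Z, ((∑ s ∈ Icc a b, (K s (x - y) : ℂ)) * ee (θ * y)) * f y

/-- discrete maximal operator over a finite family of frequencies -/
def Ts (Θ : Finset ℝ) (S : ℕ) (Z : Finset ℤ) (f : ℤ → ℂ) (x : ℤ) : ℝ :=
  (((Θ ×ˢ (Icc 1 S ×ˢ range (S + 1))).sup fun p => ‖To Z f p.1 p.2.1 p.2.2 x‖₊ : NNReal) : ℝ)

lemma Ts_nonneg (Θ : Finset ℝ) (S : ℕ) (Z : Finset ℤ) (f : ℤ → ℂ) (x : ℤ) : 0 ≤ Ts Θ S Z f x := NNReal.coe_nonneg _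

lemma le_Ts {Θ : Finset ℝ} {S : ℕ} (Z : Finset ℤ) (f : ℤ → ℂ) (x : ℤ) {θ : ℝ} (hθ : θ ∈ Θ) {a b : ℕ} (ha : 1 ≤ a) (hb : b ≤ S) :
    ‖To Z f θ a b x‖ ≤ Ts Θ S Z f x := by
  by_cases h : a ≤ b
  · have h1 : (θ, a, b) ∈ Θ ×ˢ (Icc 1 S ×ˢ range (S + 1)) :=
      mem_product.mpr ⟨hθ, mem_product.mpr ⟨mem_Icc.mpr ⟨ha, by simp only []; omega⟩, mem_range.mpr (by simp only []; omega)⟩⟩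
    have := Finset.le_sup (f := fun p : ℝ × ℕ × ℕ => ‖To Z f p.1 p.2.1 p.2.2 x‖₊) h1
    exact_mod_cast this
  · have : To Z f θ a b x = 0 := by
      unfold To
      rw [Icc_eq_empty h]; simp
    rw [this, norm_zero]; exact Ts_nonneg _ _ _ _ _

lemma lt_Ts {Θ : Finset ℝ} {S : ℕ} {Z : Finset ℤ} {f : ℤ → ℂ} {x : ℤ} {l : ℝ} (hl : 0 ≤ l) (h : l < Ts Θ S Z f x) :
    ∃ θ ∈ Θ, ∃ a b : ℕ, 1 ≤ a ∧ b ≤ S ∧ l < ‖To Z f θ a b x‖ := by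
  lift l to NNReal using hl
  unfold Ts at h
  rw [NNReal.coe_lt_coe, Finset.lt_sup_iff] at h
  obtain ⟨⟨θ, a, b⟩, hp, h⟩ := h
  simp only [mem_product, mem_Icc, mem_range] at hp
  exact ⟨θ, hp.1, a, b, hp.2.1.1, by omega, by exact_mod_cast h⟩

lemma pow2_le {s S : ℕ} (h : s ≤ S) : (2:ℤ) ^ s ≤ 2 ^ S := pow_le_pow_right₀ (by norm_num) h

/-- support of the maximal operator -/
def spt (S : ℕ) (Z : Finset ℤ) : Finset ℤ := Z.biUnion fun y => Icc (y - 2 ^ S) (y + 2 ^ S)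

lemma Ts_spt {Θ : Finset ℝ} {S : ℕ} {Z : Finset ℤ} {f : ℤ → ℂ} {x : ℤ} (h : x ∉ spt S Z) : Ts Θ S Z f x = 0 := by
  by_contra h0
  obtain ⟨θ, -, a, b, -, hb, h1⟩ := lt_Ts le_rfl (lt_of_le_of_ne (Ts_nonneg Θ S Z f x) (Ne.symm h0))
  rw [norm_pos_iff] at h1
  apply h1
  unfold To
  refine Finset.sum_eq_zero fun y hy => ?_
  have : ∑ s ∈ Icc a b, (K s (x - y) : ℂ) = 0 := by
    refine Finset.sum_eq_zero fun s hs => ?_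
    rw [K_supp s (x - y), Complex.ofReal_zero]
    have h2 := pow2_le ((mem_Icc.mp hs).2.trans hb)
    by_contra h3
    push Not at h3
    have := abs_lt.mp h3
    exact h (mem_biUnion.mpr ⟨y, hy, mem_Icc.mpr ⟨by omega, by omega⟩⟩)
  rw [this]; simp

lemma hi_diff (Z : Finset ℤ) (f : ℤ → ℂ) (θ : ℝ) {a b m : ℕ} {x x0 : ℤ} (ha : m + 1 ≤ a) (hx : |x - x0| ≤ 2 * 2 ^ m) :
    ‖To Z f θ a b x - To Z f θ a b x0‖ ≤ 560 * M Z (fun y => ‖f y‖) x := by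
  have hM : 0 ≤ M Z (fun y => ‖f y‖) x := M_nonneg (fun _ => norm_nonneg _) x
  have e : To Z f θ a b x - To Z f θ a b x0 = ∑ s ∈ Icc a b, ∑ y ∈ Z, (((K s (x - y) - K s (x0 - y) : ℝ) : ℂ) * ee (θ * y)) * f y := by
    unfold To
    rw [Finset.sum_comm, ← Finset.sum_sub_distrib]
    refine Finset.sum_congr rfl fun y _ => ?_
    rw [← Finset.sum_mul, ← Finset.sum_mul]
    push_cast
    rw [Finset.sum_sub_distrib]; ring
  have hs : ∀ s ∈ Icc a b, ‖∑ y ∈ Z, (((K s (x - y) - K s (x0 - y) : ℝ) : ℂ) * ee (θ * y)) * f y‖ ≤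
      560 * M Z (fun y => ‖f y‖) x * 2 ^ m * (1 / 2 ^ s) := by
    intro s hs
    have hms : m + 1 ≤ s := ha.trans (mem_Icc.mp hs).1
    have hp := pow2_le hms
    rw [pow_succ] at hp
    have hxr : |(x:ℝ) - x0| ≤ 2 * 2 ^ m := by exact_mod_cast hx
    refine (norm_sum_le _ _).trans ?_
    calc ∑ y ∈ Z, ‖(((K s (x - y) - K s (x0 - y) : ℝ) : ℂ) * ee (θ * y)) * f y‖
        ≤ ∑ y ∈ Z.filter (fun y => |y - x| ≤ 3 * 2 ^ s), 40 / 4 ^ s * (2 * 2 ^ m) * ‖f y‖ := by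
          rw [Finset.sum_filter]
          refine Finset.sum_le_sum fun y _ => ?_
          rw [norm_mul, norm_mul, norm_ee, mul_one, Complex.norm_real, Real.norm_eq_abs]
          split_ifs with hy
          · refine mul_le_mul_of_nonneg_right ?_ (norm_nonneg _)
            refine (K_lip s (x - y) (x0 - y)).trans (mul_le_mul_of_nonneg_left ?_ (by positivity))
            push_cast
            rw [show (x:ℝ) - y - (x0 - y) = x - x0 by ring]; exact hxr
          · have h1 : K s (x - y) = 0 := K_supp s _ (by
              rw [abs_sub_comm]; push Not at hy
              have : (0:ℤ) < 2 ^ s := by positivity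
              linarith)
            have h2 : K s (x0 - y) = 0 := K_supp s _ (by
              push Not at hy
              have h3 : |y - x| ≤ |x0 - y| + |x - x0| := by
                have := abs_add_le (x0 - y) (x - x0)
                rw [abs_sub_comm y x]; simpa using this
              have : (0:ℤ) < 2 ^ s := by positivity
              linarith)
            rw [h1, h2]; simp
      _ = 40 / 4 ^ s * (2 * 2 ^ m) * ∑ y ∈ Z.filter (fun y => |y - x| ≤ 3 * 2 ^ s), ‖f y‖ := by rw [Finset.mul_sum]
      _ ≤ 40 / 4 ^ s * (2 * 2 ^ m) * ((2 * (3:ℕ) + 1) * 2 ^ s * M Z (fun y => ‖f y‖) x) := by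
          refine mul_le_mul_of_nonneg_left ?_ (by positivity)
          exact win_le_M (h := fun y => ‖f y‖) (fun _ => norm_nonneg _) x 3 s _ (filter_subset _ _) (fun y hy => by simpa using (mem_filter.mp hy).2)
      _ = _ := by
          rw [show (4:ℝ) ^ s = 2 ^ s * 2 ^ s by rw [← mul_pow]; norm_num]
          field_simp; push_cast; ring
  rw [e]
  refine (norm_sum_le _ _).trans ((Finset.sum_le_sum hs).trans ?_)
  rw [← Finset.mul_sum]
  have hg := geom_down (B := 1 / 2 ^ (m + 1)) (by positivity) (Icc a b) (fun k hk => by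
    apply one_div_le_one_div_of_le (by positivity)
    exact pow_le_pow_right₀ (by norm_num) (ha.trans (mem_Icc.mp hk).1))
  calc _ ≤ 560 * M Z (fun y => ‖f y‖) x * 2 ^ m * (2 * (1 / 2 ^ (m + 1))) := mul_le_mul_of_nonneg_left hg (by positivity)
    _ = _ := by rw [pow_succ]; field_simp

lemma To_split (Z : Finset ℤ) (f : ℤ → ℂ) (θ : ℝ) (a b m : ℕ) (x : ℤ) :
    To Z f θ a b x = To Z f θ a (min b m) x + To Z f θ (max a (m + 1)) b x := by
  unfold To
  rw [← Finset.sum_add_distrib]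
  refine Finset.sum_congr rfl fun y _ => ?_
  rw [← add_mul, ← add_mul]
  congr 2
  rw [← Finset.sum_union]
  · congr 1; ext s; simp only [mem_Icc, mem_union]; omega
  · rw [Finset.disjoint_left]; intro s; simp only [mem_Icc]; omega

lemma To_local (Z : Finset ℤ) (f : ℤ → ℂ) (θ : ℝ) (a b : ℕ) (x : ℤ) (P : ℤ → Prop) [DecidablePred P]
    (hP : ∀ y, |x - y| < 2 ^ b → P y) : To Z f θ a b x = To (Z.filter P) f θ a b x := by
  unfold To
  rw [Finset.sum_filter]
  refine Finset.sum_congr rfl fun y _ => ?_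
  split_ifs with h
  · rfl
  · have : ∑ s ∈ Icc a b, (K s (x - y) : ℂ) = 0 := by
      refine Finset.sum_eq_zero fun s hs => ?_
      rw [K_supp s (x - y), Complex.ofReal_zero]
      have h2 := pow2_le (mem_Icc.mp hs).2
      by_contra h3
      push Not at h3
      exact h (hP y (h3.trans_le h2))
    rw [this]; simp

lemma left_end (O : Finset ℤ) {x : ℤ} (hx : x ∈ O) : ∃ x0, x0 ∉ O ∧ x0 < x ∧ ∀ u, x0 < u → u ≤ x → u ∈ O := by
  classical
  have h : ∃ n : ℕ, x - n ∉ O := by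
    by_contra h
    push Not at h
    have : (Set.range fun n : ℕ => x - (n:ℤ)).Finite := O.finite_toSet.subset (by rintro _ ⟨n, rfl⟩; exact h n)
    exact Set.infinite_range_of_injective (fun a b hab => by simpa using hab) this
  refine ⟨x - Nat.find h, Nat.find_spec h, ?_, fun u h1 h2 => ?_⟩
  · rcases Nat.eq_zero_or_pos (Nat.find h) with h0 | h0
    · have := Nat.find_spec h
      rw [h0] at this; simp at this; exact absurd hx this
    · omega
  · have := Nat.find_min h (m := (x - u).toNat) (by omega)
    push Not at this
    rwa [show x - ((x - u).toNat : ℤ) = u by omega] at this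

lemma left_unique {O : Finset ℤ} {x x0 x1 : ℤ} (h0 : x0 ∉ O ∧ x0 < x ∧ ∀ u, x0 < u → u ≤ x → u ∈ O)
    (h1 : x1 ∉ O ∧ x1 < x ∧ ∀ u, x1 < u → u ≤ x → u ∈ O) : x0 = x1 := by
  rcases lt_trichotomy x0 x1 with h | h | h
  · exact absurd (h0.2.2 x1 h h1.2.1.le) h1.1
  · exact h
  · exact absurd (h1.2.2 x0 h h0.2.1.le) h0.1

theorem good_lambda (q : ℝ) (hq : 1 < q) (hq2 : q < 2) : ∃ C : ℝ, 0 < C ∧ ∀ (Θ : Finset ℝ) (S : ℕ) (Z : Finset ℤ) (f : ℤ → ℂ)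
    (W : Finset ℤ), (∀ θ ∈ Θ, |θ| ≤ 1) → spt S Z ⊆ W → ∀ (l γ : ℝ), 0 < l → 0 < γ → γ ≤ 1 / 560 → ∀ O B : Finset ℤ,
    O = W.filter (fun x => l < Ts Θ S Z f x) → (∀ x ∈ B, x ∈ W ∧ 4 * l < Ts Θ S Z f x ∧ M Z (fun y => ‖f y‖) x ≤ γ * l ∧
      M Z (fun y => ‖f y‖ ^ q) x ≤ (γ * l) ^ q) → (B.card : ℝ) ≤ C * γ ^ q * O.card := by
  classical
  obtain ⟨C, hC, HW⟩ := weak q hq hq2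
  refine ⟨4 * C, by positivity, ?_⟩
  intro Θ S Z f W hΘ hW l γ hl hγ hγ1 O B hO hB
  have hBO : B ⊆ O := fun x hx => by
    rw [hO, mem_filter]
    exact ⟨(hB x hx).1, by linarith [(hB x hx).2.1]⟩
  have hOc : ∀ x, x ∉ O → Ts Θ S Z f x ≤ l := by
    intro x hx
    by_cases h : x ∈ W
    · by_contra h1
      push Not at h1
      exact hx (by rw [hO, mem_filter]; exact ⟨h, h1⟩)
    · rw [Ts_spt (fun h' => h (hW h'))]; exact hl.le
  have hex : ∀ x : ℤ, ∃ x0, x ∈ O → (x0 ∉ O ∧ x0 < x ∧ ∀ u, x0 < u → u ≤ x → u ∈ O) := by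
    intro x
    by_cases h : x ∈ O
    · obtain ⟨x0, h0⟩ := left_end O h; exact ⟨x0, fun _ => h0⟩
    · exact ⟨0, fun h' => absurd h' h⟩
  choose L hL using hex
  set I := O.image L with hI
  have key : ∀ x0 ∈ I, (((B.filter fun x => L x = x0).card : ℕ) : ℝ) ≤ 4 * C * γ ^ q * (O.filter fun x => L x = x0).card := by
    intro x0 hx0
    set J := O.filter fun x => L x = x0 with hJ
    set BJ := B.filter fun x => L x = x0 with hBJ
    rcases BJ.eq_empty_or_nonempty with h | ⟨z, hz⟩
    · rw [h]; simp; positivity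
    have hBJO : ∀ x ∈ BJ, x ∈ J := fun x hx => mem_filter.mpr ⟨hBO (mem_filter.mp hx).1, (mem_filter.mp hx).2⟩
    have hlen : ∀ x ∈ J, x0 < x ∧ x ≤ x0 + J.card := by
      intro x hx
      obtain ⟨hx1, hx2⟩ := mem_filter.mp hx
      have h1 := hL x hx1
      rw [hx2] at h1
      refine ⟨h1.2.1, ?_⟩
      have hsub : Ioc x0 x ⊆ J := by
        intro u hu
        obtain ⟨hu1, hu2⟩ := mem_Ioc.mp hu
        have hu3 := h1.2.2 u hu1 hu2
        exact mem_filter.mpr ⟨hu3, left_unique (hL u hu3) ⟨h1.1, hu1, fun v hv hv' => h1.2.2 v hv (hv'.trans hu2)⟩⟩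
      have := card_le_card hsub
      rw [Int.card_Ioc] at this
      omega
    have hx0O : x0 ∉ O := by
      have h1 := hL z (mem_filter.mp (hBJO z hz)).1
      rw [(mem_filter.mp hz).2] at h1; exact h1.1
    set ℓ := J.card with hℓ
    have hℓ1 : 1 ≤ ℓ := card_pos.mpr ⟨z, hBJO z hz⟩
    set m := Nat.log 2 ℓ with hm
    have hm1 : 2 ^ m ≤ ℓ := Nat.pow_log_le_self 2 (by omega)
    have hm2 : ℓ < 2 ^ (m + 1) := Nat.lt_pow_succ_log_self (by norm_num) ℓ
    have hm1' : (2:ℤ) ^ m ≤ ℓ := by exact_mod_cast hm1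
    have hm2' : (ℓ:ℤ) < 2 * 2 ^ m := by rw [pow_succ] at hm2; push_cast [← @Nat.cast_lt ℤ] at hm2; linarith
    have hpt : ∀ x ∈ BJ, ∃ p : ℝ × ℕ × ℕ, |p.1| ≤ 1 ∧ 1 ≤ p.2.1 ∧ p.2.2 ≤ S ∧
        l < ‖To (Z.filter fun y => x0 - ℓ ≤ y ∧ y ≤ x0 + 2 * ℓ) f p.1 p.2.1 p.2.2 x‖ := by
      intro x hx
      have hb := hB x (mem_filter.mp hx).1
      obtain ⟨θ, hθ, a, b, ha, hbS, hlt⟩ := lt_Ts (by positivity) hb.2.1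
      have hxl := hlen x (hBJO x hx)
      refine ⟨(θ, a, min b m), hΘ θ hθ, ha, (min_le_left b m).trans hbS, ?_⟩
      rw [← To_local Z f θ a (min b m) x]
      · rw [To_split Z f θ a b m x] at hlt
        have h1 := hi_diff Z f θ (a := max a (m + 1)) (b := b) (m := m) (x := x) (x0 := x0) (le_max_right _ _)
          (by rw [abs_of_nonneg (by omega)]; omega)
        have h2 : ‖To Z f θ (max a (m + 1)) b x0‖ ≤ l := (le_Ts Z f x0 hθ (le_max_of_le_left ha) hbS).trans (hOc x0 hx0O)
        have h3 : 560 * M Z (fun y => ‖f y‖) x ≤ l := by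
          have := hb.2.2.1
          nlinarith
        have h4 : ‖To Z f θ (max a (m + 1)) b x‖ ≤ ‖To Z f θ (max a (m + 1)) b x - To Z f θ (max a (m + 1)) b x0‖ + ‖To Z f θ (max a (m + 1)) b x0‖ := by
          simpa using norm_add_le (To Z f θ (max a (m + 1)) b x - To Z f θ (max a (m + 1)) b x0) (To Z f θ (max a (m + 1)) b x0)
        have h5 := norm_add_le (To Z f θ a (min b m) x) (To Z f θ (max a (m + 1)) b x)
        linarith
      · intro y hy
        have h6 := pow2_le (min_le_right b m)
        have := abs_lt.mp hy
        constructor <;> omega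
    have hpt' : ∀ x, ∃ p : ℝ × ℕ × ℕ, x ∈ BJ → (|p.1| ≤ 1 ∧ 1 ≤ p.2.1 ∧ p.2.2 ≤ S ∧
        l < ‖To (Z.filter fun y => x0 - ℓ ≤ y ∧ y ≤ x0 + 2 * ℓ) f p.1 p.2.1 p.2.2 x‖) := by
      intro x
      by_cases h : x ∈ BJ
      · obtain ⟨p, hp⟩ := hpt x h; exact ⟨p, fun _ => hp⟩
      · exact ⟨0, fun h' => absurd h' h⟩
    choose P hP using hpt'
    have hw := HW BJ (fun x => (P x).1) S (fun x => (P x).2.1) (fun x => (P x).2.2) (fun x hx => (hP x hx).1)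
      (fun x hx => ⟨(hP x hx).2.1, (hP x hx).2.2.1⟩) (Z.filter fun y => x0 - ℓ ≤ y ∧ y ≤ x0 + 2 * ℓ) f l hl (fun x hx => (hP x hx).2.2.2)
    have hzl := hlen z (hBJO z hz)
    have hMz := le_M (Z := Z) (h := fun y => ‖f y‖ ^ q) (fun _ => by positivity) (x := z) (a := x0 - ℓ) (b := x0 + 2 * ℓ)
      (T := Z.filter fun y => x0 - ℓ ≤ y ∧ y ≤ x0 + 2 * ℓ) (filter_subset _ _) (fun y hy => (mem_filter.mp hy).2) (by omega) (by omega)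
    have hz2 := (hB z (mem_filter.mp hz).1).2.2.2
    rw [Real.mul_rpow hγ.le hl.le] at hz2
    push_cast at hMz
    have hlq : 0 < l ^ q := by positivity
    have hℓr : (1:ℝ) ≤ ℓ := by exact_mod_cast hℓ1
    have h7 : ∑ y ∈ Z.filter (fun y => x0 - ℓ ≤ y ∧ y ≤ x0 + 2 * ℓ), ‖f y‖ ^ q ≤ 4 * ℓ * (γ ^ q * l ^ q) := by
      refine hMz.trans ?_
      refine mul_le_mul (by linarith) hz2 (M_nonneg (fun _ => by positivity) z) (by positivity)
    have h8 : l ^ q * BJ.card ≤ l ^ q * (4 * C * γ ^ q * ℓ) := by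
      refine hw.trans ((mul_le_mul_of_nonneg_left h7 hC.le).trans (le_of_eq (by ring)))
    exact le_of_mul_le_mul_left h8 hlq
  have e1 : B.card = ∑ x0 ∈ I, (B.filter fun x => L x = x0).card :=
    card_eq_sum_card_fiberwise fun x hx => mem_image_of_mem L (hBO hx)
  have e2 : O.card = ∑ x0 ∈ I, (O.filter fun x => L x = x0).card :=
    card_eq_sum_card_fiberwise fun x hx => mem_image_of_mem L hx
  rw [e1, e2]
  push_cast
  rw [Finset.mul_sum]
  exact Finset.sum_le_sum key

end
end Carl

namespace Carl
noncomputable section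
open Finset

theorem strong (p : ℝ) (hp : 1 < p) : ∃ C : ℝ, 0 < C ∧ ∀ (Θ : Finset ℝ) (S : ℕ) (Z : Finset ℤ) (f : ℤ → ℂ) (A : Finset ℤ),
    (∀ θ ∈ Θ, |θ| ≤ 1) → ∑ x ∈ A, Ts Θ S Z f x ^ p ≤ C * ∑ y ∈ Z, ‖f y‖ ^ p := by
  classical
  obtain ⟨q, hq, hq2, hqp⟩ : ∃ q : ℝ, 1 < q ∧ q < 2 ∧ q < p := by
    obtain ⟨q, h1, h2⟩ := exists_between (lt_min (by norm_num : (1:ℝ) < 2) hp)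
    exact ⟨q, h1, h2.trans_le (min_le_left _ _), h2.trans_le (min_le_right _ _)⟩
  have hp0 : 0 < p := by linarith
  have hq0 : 0 < q := by linarith
  obtain ⟨C1, hC1, HG⟩ := good_lambda q hq hq2
  obtain ⟨C2, hC2, HM1⟩ := M_strong p hp
  obtain ⟨C3, hC3, HM2⟩ := M_strong (p / q) (by rw [lt_div_iff₀ hq0]; linarith)
  set c : ℝ := (1 - ((4:ℝ) ^ p)⁻¹)⁻¹ with hc
  have h4p : 1 < (4:ℝ) ^ p := Real.one_lt_rpow (by norm_num) hp0
  have hc0 : 0 < c := by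
    have : ((4:ℝ) ^ p)⁻¹ < 1 := inv_lt_one_of_one_lt₀ h4p
    have : 0 < 1 - ((4:ℝ) ^ p)⁻¹ := by linarith
    positivity
  set Q : ℝ := (4:ℝ) ^ p * 4 ^ p with hQ
  have hQ0 : 0 < Q := by positivity
  set γ : ℝ := 1 / (560 + 2 * Q * C1 * c) with hγ
  have hγ0 : 0 < γ := by positivity
  have hγ1 : γ ≤ 1 / 560 := one_div_le_one_div_of_le (by norm_num) (by linarith [show 0 < 2 * Q * C1 * c by positivity])
  have hγq : Q * C1 * γ ^ q * c ≤ 1 / 2 := by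
    have h1 : γ ^ q ≤ γ := by
      calc γ ^ q ≤ γ ^ (1:ℝ) := Real.rpow_le_rpow_of_exponent_ge hγ0 (by linarith) hq.le
        _ = γ := Real.rpow_one _
    have h2 : γ * (560 + 2 * Q * C1 * c) = 1 := by rw [hγ]; field_simp
    have h3 : Q * C1 * γ ^ q * c ≤ Q * C1 * γ * c := by
      refine mul_le_mul_of_nonneg_right (mul_le_mul_of_nonneg_left h1 (by positivity)) hc0.le
    nlinarith
  set R : ℝ := Q * (c * (C2 / γ ^ p + C3 / γ ^ p)) with hR
  refine ⟨2 * R, by positivity, ?_⟩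
  intro Θ S Z f A hΘ
  set W := A ∪ spt S Z with hW
  set v := Ts Θ S Z f with hv
  have hv0 : ∀ x, 0 ≤ v x := Ts_nonneg _ _ _ _
  set V := ∑ x ∈ W, v x ^ p with hV
  have hAV : ∑ x ∈ A, v x ^ p ≤ V := Finset.sum_le_sum_of_subset_of_nonneg subset_union_left fun x _ _ => Real.rpow_nonneg (hv0 x) _
  refine hAV.trans ?_
  set E := ∑ y ∈ Z, ‖f y‖ ^ p with hE
  set u1 : ℤ → ℝ := fun x => M Z (fun y => ‖f y‖) x / γ with hu1
  set u2 : ℤ → ℝ := fun x => (M Z (fun y => ‖f y‖ ^ q) x) ^ q⁻¹ / γ with hu2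
  have hM1 : ∀ x, 0 ≤ M Z (fun y => ‖f y‖) x := M_nonneg fun _ => norm_nonneg _
  have hM2 : ∀ x, 0 ≤ M Z (fun y => ‖f y‖ ^ q) x := M_nonneg fun _ => by positivity
  have hu10 : ∀ x, 0 ≤ u1 x := fun x => div_nonneg (hM1 x) hγ0.le
  have hu20 : ∀ x, 0 ≤ u2 x := fun x => div_nonneg (Real.rpow_nonneg (hM2 x) _) hγ0.le
  have hU1 : ∑ x ∈ W, u1 x ^ p ≤ C2 / γ ^ p * E := by
    have e : ∑ x ∈ W, u1 x ^ p = (∑ x ∈ W, M Z (fun y => ‖f y‖) x ^ p) / γ ^ p := by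
      rw [Finset.sum_div]; exact Finset.sum_congr rfl fun x _ => Real.div_rpow (hM1 x) hγ0.le _
    rw [e, div_mul_eq_mul_div]
    exact div_le_div_of_nonneg_right (HM1 Z _ (fun _ => norm_nonneg _) W) (by positivity)
  have hU2 : ∑ x ∈ W, u2 x ^ p ≤ C3 / γ ^ p * E := by
    have e : ∑ x ∈ W, u2 x ^ p = (∑ x ∈ W, M Z (fun y => ‖f y‖ ^ q) x ^ (p / q)) / γ ^ p := by
      rw [Finset.sum_div]
      refine Finset.sum_congr rfl fun x _ => ?_
      simp only [hu2]
      rw [Real.div_rpow (Real.rpow_nonneg (hM2 x) _) hγ0.le, ← Real.rpow_mul (hM2 x)]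
      congr 2; field_simp
    rw [e, div_mul_eq_mul_div]
    refine div_le_div_of_nonneg_right ((HM2 Z _ (fun _ => by positivity) W).trans (le_of_eq ?_)) (by positivity)
    congr 1
    refine Finset.sum_congr rfl fun y _ => ?_
    rw [← Real.rpow_mul (norm_nonneg _)]; congr 1; field_simp
  obtain ⟨T, hT⟩ := layer_up (b := 4) (p := p) (by norm_num) hp0 W v hv0
  have hstep : ∀ k : ℤ, ((4:ℝ) ^ k) ^ p * (W.filter fun x => (4:ℝ) ^ k < v x).card ≤
      (4:ℝ) ^ p * (C1 * γ ^ q * (((4:ℝ) ^ (k - 1)) ^ p * (W.filter fun x => (4:ℝ) ^ (k - 1) < v x).card)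
      + ((4:ℝ) ^ (k - 1)) ^ p * (W.filter fun x => (4:ℝ) ^ (k - 1) < u1 x).card
      + ((4:ℝ) ^ (k - 1)) ^ p * (W.filter fun x => (4:ℝ) ^ (k - 1) < u2 x).card) := by
    intro k
    set l : ℝ := (4:ℝ) ^ (k - 1) with hl
    have hl0 : 0 < l := by positivity
    have e4 : (4:ℝ) ^ k = 4 * l := by
      rw [hl, zpow_sub_one₀ (by norm_num)]; field_simp
    rw [e4, Real.mul_rpow (by norm_num) hl0.le]
    set B := W.filter fun x => 4 * l < v x ∧ M Z (fun y => ‖f y‖) x ≤ γ * l ∧ M Z (fun y => ‖f y‖ ^ q) x ≤ (γ * l) ^ q with hB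
    have hb := HG Θ S Z f W hΘ subset_union_right l γ hl0 hγ0 hγ1 _ B rfl (fun x hx => by
      have := mem_filter.mp hx
      exact this)
    have hsub : (W.filter fun x => 4 * l < v x) ⊆ (B ∪ (W.filter fun x => l < u1 x)) ∪ (W.filter fun x => l < u2 x) := by
      intro x hx
      obtain ⟨h1, h2⟩ := mem_filter.mp hx
      rw [mem_union, mem_union]
      by_cases h3 : M Z (fun y => ‖f y‖) x ≤ γ * l
      · by_cases h4 : M Z (fun y => ‖f y‖ ^ q) x ≤ (γ * l) ^ q
        · exact Or.inl (Or.inl (mem_filter.mpr ⟨h1, h2, h3, h4⟩))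
        · push Not at h4
          refine Or.inr (mem_filter.mpr ⟨h1, ?_⟩)
          simp only [hu2]
          rw [lt_div_iff₀ hγ0, mul_comm]
          have := Real.rpow_lt_rpow (by positivity) h4 (by positivity : 0 < q⁻¹)
          rwa [← Real.rpow_mul (by positivity), mul_inv_cancel₀ hq0.ne', Real.rpow_one] at this
      · push Not at h3
        refine Or.inl (Or.inr (mem_filter.mpr ⟨h1, ?_⟩))
        simp only [hu1]
        rw [lt_div_iff₀ hγ0, mul_comm]; exact h3
    have hcard : ((W.filter fun x => 4 * l < v x).card : ℝ) ≤ B.card + (W.filter fun x => l < u1 x).card + (W.filter fun x => l < u2 x).card := by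
      exact_mod_cast (card_le_card hsub).trans ((card_union_le _ _).trans (Nat.add_le_add_right (card_union_le _ _) _))
    have hlp : 0 < l ^ p := by positivity
    calc (4:ℝ) ^ p * l ^ p * (W.filter fun x => 4 * l < v x).card
        ≤ (4:ℝ) ^ p * l ^ p * (C1 * γ ^ q * (W.filter fun x => l < v x).card + (W.filter fun x => l < u1 x).card + (W.filter fun x => l < u2 x).card) :=
          mul_le_mul_of_nonneg_left (by linarith) (by positivity)
      _ = _ := by ring
  set T' := T.image (fun k => k - 1) with hT'
  have hre : ∀ g : ℤ → ℝ, ∑ k ∈ T, g (k - 1) = ∑ k ∈ T', g k := fun g => by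
    rw [hT', Finset.sum_image]; intro a _ b _ hab; simpa using hab
  have d0 := layer_down (b := 4) (p := p) (by norm_num) hp0 W v hv0 T'
  have d1 := layer_down (b := 4) (p := p) (by norm_num) hp0 W u1 hu10 T'
  have d2 := layer_down (b := 4) (p := p) (by norm_num) hp0 W u2 hu20 T'
  have hmain : V ≤ Q * (C1 * γ ^ q * (c * V) + c * (C2 / γ ^ p * E) + c * (C3 / γ ^ p * E)) := by
    refine hT.trans ?_
    rw [hQ, mul_assoc]
    refine mul_le_mul_of_nonneg_left ?_ (by positivity)
    refine (Finset.sum_le_sum fun k _ => hstep k).trans ?_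
    rw [← Finset.mul_sum]
    refine mul_le_mul_of_nonneg_left ?_ (by positivity)
    rw [Finset.sum_add_distrib, Finset.sum_add_distrib, ← Finset.mul_sum,
      hre fun j => ((4:ℝ) ^ j) ^ p * (W.filter fun x => (4:ℝ) ^ j < v x).card,
      hre fun j => ((4:ℝ) ^ j) ^ p * (W.filter fun x => (4:ℝ) ^ j < u1 x).card,
      hre fun j => ((4:ℝ) ^ j) ^ p * (W.filter fun x => (4:ℝ) ^ j < u2 x).card]
    refine add_le_add (add_le_add ?_ ?_) ?_
    · exact mul_le_mul_of_nonneg_left d0 (by positivity)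
    · exact d1.trans (mul_le_mul_of_nonneg_left hU1 hc0.le)
    · exact d2.trans (mul_le_mul_of_nonneg_left hU2 hc0.le)
  have hV0 : 0 ≤ V := Finset.sum_nonneg fun x _ => Real.rpow_nonneg (hv0 x) _
  have h5 : Q * C1 * γ ^ q * c * V ≤ 1 / 2 * V := mul_le_mul_of_nonneg_right hγq hV0
  have h6 : Q * (C1 * γ ^ q * (c * V) + c * (C2 / γ ^ p * E) + c * (C3 / γ ^ p * E)) = Q * C1 * γ ^ q * c * V + R * E := by
    rw [hR]; ring
  linarith

end
end Carl

namespace Carl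
noncomputable section
open Finset

/-- roughly truncated discrete operator -/
def Ro (Z : Finset ℤ) (F : ℤ → ℂ) (θ e r : ℝ) (m : ℤ) : ℂ :=
  ∑ y ∈ Z, if e < |(m:ℝ) - y| ∧ |(m:ℝ) - y| < r then ee (θ * y) * F y / ((m:ℂ) - y) else 0

lemma rough_pt {e r : ℝ} {a b : ℕ} (hab : a ≤ b) (ha : (2:ℝ) ^ a ≤ e) (ha' : e < 2 ^ (a + 1)) (hb : (2:ℝ) ^ b ≤ r) (hb' : r < 2 ^ (b + 1))
    (t : ℤ) : |(if e < |(t:ℝ)| ∧ |(t:ℝ)| < r then 1 / (t:ℝ) else 0) - ∑ s ∈ Icc (a + 1) b, K s t| ≤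
      (if |t| ≤ 2 * 2 ^ a then 2 / (2:ℝ) ^ a else 0) + (if |t| ≤ 2 * 2 ^ b then 2 / (2:ℝ) ^ b else 0) := by
  have e0 : Icc (a + 1) b = Ioc a b := by ext s; simp only [mem_Icc, mem_Ioc]; omega
  rw [e0, K_sum a b hab t]
  have hpa : (0:ℝ) < 2 ^ a := by positivity
  have hpb : (0:ℝ) < 2 ^ b := by positivity
  have hab' : (2:ℝ) ^ a ≤ 2 ^ b := pow_le_pow_right₀ (by norm_num) hab
  rw [pow_succ] at ha' hb'
  have hta : (|t| ≤ 2 * 2 ^ a) ↔ |(t:ℝ)| ≤ 2 * 2 ^ a := by rw [← @Int.cast_le ℝ]; push_cast; rfl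
  have htb : (|t| ≤ 2 * 2 ^ b) ↔ |(t:ℝ)| ≤ 2 * 2 ^ b := by rw [← @Int.cast_le ℝ]; push_cast; rfl
  simp only [hta, htb]
  set τ : ℝ := |(t:ℝ)| with hτ
  have habs : ∀ n : ℕ, |(t:ℝ) / 2 ^ n| = τ / 2 ^ n := fun n => by rw [abs_div, abs_of_pos (by positivity : (0:ℝ) < 2 ^ n)]
  have one : ∀ n : ℕ, τ ≤ 2 ^ n / 2 → phi ((t:ℝ) / 2 ^ n) = 1 := fun n hn => phi_one (by
    rw [habs, div_le_iff₀ (by positivity)]; linarith)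
  have zer : ∀ n : ℕ, 2 ^ n ≤ τ → phi ((t:ℝ) / 2 ^ n) = 0 := fun n hn => phi_zero (by
    rw [habs, le_div_iff₀ (by positivity)]; linarith)
  have n1 : (0:ℝ) ≤ (if τ ≤ 2 * 2 ^ a then 2 / (2:ℝ) ^ a else 0) := by split_ifs <;> positivity
  have n2 : (0:ℝ) ≤ (if τ ≤ 2 * 2 ^ b then 2 / (2:ℝ) ^ b else 0) := by split_ifs <;> positivity
  set A := phi ((t:ℝ) / 2 ^ b) with hA
  set B := phi ((t:ℝ) / 2 ^ a) with hB
  have hA0 : 0 ≤ A := phi_nonneg _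
  have hA1 : A ≤ 1 := phi_le_one _
  have hB0 : 0 ≤ B := phi_nonneg _
  have hB1 : B ≤ 1 := phi_le_one _
  -- crude bound
  have crude : |(if e < τ ∧ τ < r then 1 / (t:ℝ) else 0) - (A - B) / t| ≤ 1 / τ := by
    have h0 : B ≤ A := by
      by_cases h : τ ≤ 2 ^ b / 2
      · rw [hA, one b h]; exact hB1
      · push Not at h
        by_cases h2 : 2 ^ a ≤ τ
        · rw [hB, zer a h2]; exact hA0
        · push Not at h2
          rcases Nat.lt_or_ge a b with h3 | h3
          · have : (2:ℝ) ^ (a + 1) ≤ 2 ^ b := pow_le_pow_right₀ (by norm_num) h3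
            rw [pow_succ] at this; linarith
          · have : a = b := by omega
            rw [hA, hB, this]
    have : (if e < τ ∧ τ < r then 1 / (t:ℝ) else 0) - (A - B) / t = ((if e < τ ∧ τ < r then 1 else 0) - (A - B)) / t := by
      split_ifs <;> ring
    rw [this, abs_div]
    refine div_le_div_of_nonneg_right ?_ (abs_nonneg _)
    split_ifs <;> rw [abs_le] <;> constructor <;> linarith
  by_cases c1 : τ < 2 ^ a / 2
  · rw [if_neg (fun h => by linarith [h.1]), hA, hB, one a c1.le, one b (by linarith)]
    simp; linarith
  push Not at c1
  by_cases c2 : τ ≤ 2 * 2 ^ a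
  · have : 1 / τ ≤ 2 / 2 ^ a := by
      rw [div_le_div_iff₀ (by linarith) (by positivity)]; linarith
    rw [if_pos c2]; linarith
  push Not at c2
  by_cases c3 : τ ≤ 2 ^ b / 2
  · rw [if_pos ⟨by linarith, by linarith⟩, hA, hB, one b c3, zer a (by linarith)]
    simp; linarith
  push Not at c3
  by_cases c4 : τ ≤ 2 * 2 ^ b
  · have : 1 / τ ≤ 2 / 2 ^ b := by
      rw [div_le_div_iff₀ (by linarith) (by positivity)]; linarith
    rw [if_pos c4]; linarith
  push Not at c4
  rw [if_neg (fun h => by linarith [h.2]), hA, hB, zer b (by linarith), zer a (by linarith)]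
  simp; linarith

lemma rough_le (Z : Finset ℤ) (F : ℤ → ℂ) (θ e r : ℝ) (he : 1 ≤ e) (her : e < r) (m : ℤ) :
    ∃ a b : ℕ, 1 ≤ a ∧ (b:ℝ) ≤ r ∧ ‖Ro Z F θ e r m‖ ≤ ‖To Z F θ a b m‖ + 20 * M Z (fun y => ‖F y‖) m := by
  obtain ⟨a, ha, ha'⟩ := exists_nat_pow_near he (by norm_num : (1:ℝ) < 2)
  obtain ⟨b, hb, hb'⟩ := exists_nat_pow_near (he.trans her.le) (by norm_num : (1:ℝ) < 2)
  have hab : a ≤ b := by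
    by_contra h
    have : (2:ℝ) ^ (b + 1) ≤ 2 ^ a := pow_le_pow_right₀ (by norm_num) (by omega)
    linarith
  refine ⟨a + 1, b, by omega, ?_, ?_⟩
  · have : (b:ℝ) ≤ 2 ^ b := by exact_mod_cast (Nat.lt_two_pow_self).le
    linarith
  have hd : Ro Z F θ e r m = To Z F θ (a + 1) b m + ∑ y ∈ Z,
      (((if e < |((m - y : ℤ):ℝ)| ∧ |((m - y : ℤ):ℝ)| < r then 1 / ((m - y : ℤ):ℝ) else 0) - ∑ s ∈ Icc (a + 1) b, K s (m - y) : ℝ) : ℂ) * (ee (θ * y) * F y) := by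
    unfold Ro To
    rw [← Finset.sum_add_distrib]
    refine Finset.sum_congr rfl fun y _ => ?_
    push_cast
    split_ifs <;> push_cast <;> ring
  have hM : ∀ c : ℕ, ∑ y ∈ Z, (if |m - y| ≤ 2 * 2 ^ c then 2 / (2:ℝ) ^ c else 0) * ‖F y‖ ≤ 10 * M Z (fun y => ‖F y‖) m := by
    intro c
    calc ∑ y ∈ Z, (if |m - y| ≤ 2 * 2 ^ c then 2 / (2:ℝ) ^ c else 0) * ‖F y‖
        = 2 / (2:ℝ) ^ c * ∑ y ∈ Z.filter (fun y => |y - m| ≤ (2:ℕ) * 2 ^ c), ‖F y‖ := by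
          rw [Finset.sum_filter, Finset.mul_sum]
          refine Finset.sum_congr rfl fun y _ => ?_
          rw [abs_sub_comm]; push_cast
          split_ifs <;> ring
      _ ≤ 2 / (2:ℝ) ^ c * ((2 * (2:ℕ) + 1) * 2 ^ c * M Z (fun y => ‖F y‖) m) := by
          refine mul_le_mul_of_nonneg_left ?_ (by positivity)
          exact win_le_M (h := fun y => ‖F y‖) (fun _ => norm_nonneg _) m 2 c _ (filter_subset _ _) (fun y hy => (mem_filter.mp hy).2)
      _ = _ := by field_simp; push_cast; ring
  rw [hd]
  refine (norm_add_le _ _).trans (add_le_add_right ?_ _)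
  refine (norm_sum_le _ _).trans ?_
  calc _ ≤ ∑ y ∈ Z, ((if |m - y| ≤ 2 * 2 ^ a then 2 / (2:ℝ) ^ a else 0) * ‖F y‖ + (if |m - y| ≤ 2 * 2 ^ b then 2 / (2:ℝ) ^ b else 0) * ‖F y‖) := by
        refine Finset.sum_le_sum fun y _ => ?_
        rw [norm_mul, norm_mul, norm_ee, one_mul, Complex.norm_real, Real.norm_eq_abs, ← add_mul]
        exact mul_le_mul_of_nonneg_right (rough_pt hab ha ha' hb hb' (m - y)) (norm_nonneg _)
    _ ≤ _ := by
        rw [Finset.sum_add_distrib]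
        linarith [hM a, hM b]

theorem disc (p : ℝ) (hp : 1 < p) : ∃ C : ℝ, 0 < C ∧ ∀ (A Z : Finset ℤ) (F : ℤ → ℂ) (v : ℤ → ℝ), (∀ m, 0 ≤ v m) →
    (∀ m ∈ A, ∃ θ e r : ℝ, |θ| ≤ 1 ∧ 1 ≤ e ∧ e < r ∧ v m ≤ ‖Ro Z F θ e r m‖) → ∑ m ∈ A, v m ^ p ≤ C * ∑ y ∈ Z, ‖F y‖ ^ p := by
  classical
  obtain ⟨C1, hC1, H1⟩ := strong p hp
  obtain ⟨C2, hC2, H2⟩ := M_strong p hp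
  have hp0 : 0 < p := by linarith
  refine ⟨2 ^ p * (C1 + 20 ^ p * C2), by positivity, ?_⟩
  intro A Z F v hv hA
  have hA' : ∀ m, ∃ (θ r : ℝ) (a b : ℕ), m ∈ A → (|θ| ≤ 1 ∧ 1 ≤ a ∧ v m ≤ ‖To Z F θ a b m‖ + 20 * M Z (fun y => ‖F y‖) m) := by
    intro m
    by_cases h : m ∈ A
    · obtain ⟨θ, e, r, h1, h2, h3, h4⟩ := hA m h
      obtain ⟨a, b, h5, h6, h7⟩ := rough_le Z F θ e r h2 h3 m
      exact ⟨θ, r, a, b, fun _ => ⟨h1, h5, h4.trans h7⟩⟩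
    · exact ⟨0, 0, 0, 0, fun h' => absurd h' h⟩
  choose θ r a b hh using hA'
  set S := A.sup b with hS
  set Θ := A.image θ with hΘ
  have hT : ∀ θ ∈ Θ, |θ| ≤ 1 := by
    intro t ht
    obtain ⟨m, hm, rfl⟩ := mem_image.mp ht
    exact (hh m hm).1
  have hM0 : ∀ x, 0 ≤ M Z (fun y => ‖F y‖) x := M_nonneg fun _ => norm_nonneg _
  have hpt : ∀ m ∈ A, v m ^ p ≤ 2 ^ p * (Ts Θ S Z F m ^ p + 20 ^ p * M Z (fun y => ‖F y‖) m ^ p) := by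
    intro m hm
    obtain ⟨_, h1, h2⟩ := hh m hm
    have h3 := le_Ts Z F m (mem_image_of_mem θ hm) h1 (Finset.le_sup (f := b) hm)
    have h4 := Ts_nonneg Θ S Z F m
    have h5 : 0 ≤ 20 * M Z (fun y => ‖F y‖) m := by linarith [hM0 m]
    have h6 : v m ≤ 2 * max (Ts Θ S Z F m) (20 * M Z (fun y => ‖F y‖) m) := by
      have := le_max_left (Ts Θ S Z F m) (20 * M Z (fun y => ‖F y‖) m)
      have := le_max_right (Ts Θ S Z F m) (20 * M Z (fun y => ‖F y‖) m)
      linarith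
    refine (Real.rpow_le_rpow (hv m) h6 hp0.le).trans ?_
    rw [Real.mul_rpow (by norm_num) (le_max_of_le_left h4), ← Real.mul_rpow (by norm_num) (hM0 m)]
    refine mul_le_mul_of_nonneg_left ?_ (by positivity)
    have q1 : 0 ≤ Ts Θ S Z F m ^ p := Real.rpow_nonneg h4 _
    have q2 : 0 ≤ (20 * M Z (fun y => ‖F y‖) m) ^ p := Real.rpow_nonneg h5 _
    rcases max_choice (Ts Θ S Z F m) (20 * M Z (fun y => ‖F y‖) m) with h | h <;> rw [h] <;> linarith
  refine (Finset.sum_le_sum hpt).trans ?_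
  rw [← Finset.mul_sum, Finset.sum_add_distrib, ← Finset.mul_sum, mul_assoc]
  refine mul_le_mul_of_nonneg_left ?_ (by positivity)
  have k1 := H1 Θ S Z F A hT
  have k2 := mul_le_mul_of_nonneg_left (H2 Z (fun y => ‖F y‖) (fun _ => norm_nonneg _) A) (by positivity : (0:ℝ) ≤ 20 ^ p)
  linarith

end
end Carl

namespace Carl
noncomputable section
open Finset MeasureTheory Filter Topology

lemma floor_tendsto (t : ℝ) : Tendsto (fun n : ℕ => (⌊(n:ℝ) * t⌋ : ℝ) / n) atTop (𝓝 t) := by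
  have h0 : Tendsto (fun n : ℕ => (1:ℝ) / n) atTop (𝓝 0) := tendsto_one_div_atTop_nhds_zero_nat
  have h1 : Tendsto (fun n : ℕ => t - (1:ℝ) / n) atTop (𝓝 t) := by simpa using h0.const_sub t
  refine tendsto_of_tendsto_of_tendsto_of_le_of_le' h1 tendsto_const_nhds ?_ ?_
  · filter_upwards [eventually_ge_atTop 1] with n hn
    have hn0 : (0:ℝ) < n := by exact_mod_cast hn
    rw [le_div_iff₀ hn0, sub_mul, one_div, inv_mul_cancel₀ hn0.ne']
    linarith [Int.sub_one_lt_floor ((n:ℝ) * t)]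
  · filter_upwards [eventually_ge_atTop 1] with n hn
    have hn0 : (0:ℝ) < n := by exact_mod_cast hn
    rw [div_le_iff₀ hn0]
    linarith [Int.floor_le ((n:ℝ) * t)]

/-- step function -/
def stp (G : ℝ → ℂ) (J : ℕ) (n : ℕ) (t : ℝ) : ℂ :=
  ∑ j ∈ Icc (-((n * J : ℕ) : ℤ)) (n * J : ℕ), (Set.Ico ((j:ℝ) / n) ((j + 1) / n)).indicator (fun _ => G (j / n)) t

lemma stp_eq (G : ℝ → ℂ) (J n : ℕ) (hn : 1 ≤ n) (hG : ∀ t, (J:ℝ) < |t| → G t = 0) (t : ℝ) :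
    stp G J n t = G (⌊(n:ℝ) * t⌋ / n) := by
  have hn0 : (0:ℝ) < n := by exact_mod_cast hn
  have hmem : ∀ j : ℤ, t ∈ Set.Ico ((j:ℝ) / n) ((j + 1) / n) ↔ ⌊(n:ℝ) * t⌋ = j := by
    intro j
    rw [Int.floor_eq_iff, Set.mem_Ico, div_le_iff₀ hn0, lt_div_iff₀ hn0, mul_comm t]
  unfold stp
  rw [Finset.sum_congr rfl (g := fun j : ℤ => if ⌊(n:ℝ) * t⌋ = j then G (j / n) else 0)
    (fun j _ => by rw [Set.indicator_apply]; simp only [hmem])]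
  rw [Finset.sum_ite_eq]
  split_ifs with h
  · rfl
  · rw [hG]
    rw [abs_div, abs_of_pos hn0, lt_div_iff₀ hn0]
    by_contra h1
    apply h
    rw [mem_Icc, ← abs_le]
    push Not at h1
    have : ((|⌊(n:ℝ) * t⌋| : ℤ) : ℝ) ≤ ((n * J : ℕ) : ℤ) := by push_cast; linarith
    exact_mod_cast this

lemma stp_int (G : ℝ → ℂ) (J n : ℕ) (hn : 1 ≤ n) :
    ∫ t, stp G J n t = ∑ j ∈ Icc (-((n * J : ℕ) : ℤ)) (n * J : ℕ), ((1 / (n:ℝ) : ℝ) : ℂ) * G ((j:ℝ) / n) := by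
  have hn0 : (0:ℝ) < n := by exact_mod_cast hn
  unfold stp
  rw [integral_finset_sum]
  · refine Finset.sum_congr rfl fun j _ => ?_
    rw [integral_indicator_const _ measurableSet_Ico, Complex.real_smul]
    congr 2
    rw [Real.volume_real_Ico_of_le (by gcongr; linarith)]; ring
  · intro j _
    refine (integrable_indicator_iff measurableSet_Ico).mpr ?_
    exact integrableOn_const (by rw [Real.volume_Ico]; exact ENNReal.ofReal_ne_top)

lemma stp_meas (G : ℝ → ℂ) (J n : ℕ) : Measurable (stp G J n) := by
  unfold stp
  exact Finset.measurable_fun_sum _ fun j _ => measurable_const.indicator measurableSet_Ico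

theorem riemann (G : ℝ → ℂ) (J : ℕ) (B : ℝ) (hB : ∀ t, ‖G t‖ ≤ B) (hG : ∀ t, (J:ℝ) < |t| → G t = 0)
    (hc : ∀ᵐ t : ℝ, ContinuousAt G t) :
    Tendsto (fun n : ℕ => ∑ j ∈ Icc (-((n * J : ℕ) : ℤ)) (n * J : ℕ), ((1 / (n:ℝ) : ℝ) : ℂ) * G ((j:ℝ) / n)) atTop (𝓝 (∫ t, G t)) := by
  have hB0 : 0 ≤ B := (norm_nonneg _).trans (hB 0)
  have key : Tendsto (fun n : ℕ => ∫ t, stp G J n t) atTop (𝓝 (∫ t, G t)) := by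
    refine tendsto_integral_filter_of_dominated_convergence ((Set.Icc (-((J:ℝ) + 1)) (J + 1)).indicator fun _ => B) ?_ ?_ ?_ ?_
    · exact Eventually.of_forall fun n => (stp_meas G J n).aestronglyMeasurable
    · filter_upwards [eventually_ge_atTop 1] with n hn
      refine Eventually.of_forall fun t => ?_
      have hn0 : (0:ℝ) < n := by exact_mod_cast hn
      have hn1 : (1:ℝ) ≤ n := by exact_mod_cast hn
      rw [stp_eq G J n hn hG t, Set.indicator_apply]
      split_ifs with h
      · exact hB _
      · rw [hG, norm_zero]
        rw [Set.mem_Icc, ← abs_le] at h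
        push Not at h
        have h1 := Int.floor_le ((n:ℝ) * t)
        have h2 := Int.lt_floor_add_one ((n:ℝ) * t)
        have h3 : |t - ⌊(n:ℝ) * t⌋ / n| ≤ 1 := by
          rw [show t - (⌊(n:ℝ) * t⌋:ℝ) / n = (n * t - ⌊(n:ℝ) * t⌋) / n by field_simp, abs_div, abs_of_pos hn0, div_le_one hn0, abs_le]
          constructor <;> linarith
        have h4 : |t| ≤ |t - ⌊(n:ℝ) * t⌋ / n| + |(⌊(n:ℝ) * t⌋:ℝ) / n| := by
          simpa using abs_add_le (t - (⌊(n:ℝ) * t⌋:ℝ) / n) ((⌊(n:ℝ) * t⌋:ℝ) / n)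
        linarith
    · refine (integrable_indicator_iff measurableSet_Icc).mpr ?_
      exact integrableOn_const (by rw [Real.volume_Icc]; exact ENNReal.ofReal_ne_top)
    · filter_upwards [hc] with t ht
      refine (ht.tendsto.comp (floor_tendsto t)).congr' ?_
      filter_upwards [eventually_ge_atTop 1] with n hn
      exact (stp_eq G J n hn hG t).symm
  refine key.congr' ?_
  filter_upwards [eventually_ge_atTop 1] with n hn
  exact stp_int G J n hn

/-- truncated integrand -/
def Gt (h : ℝ → ℂ) (N ε R x t : ℝ) : ℂ := if ε < |t| ∧ |t| < R then h (x - t) * ee (N * t) / t else 0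

/-- Riemann sum -/
def Rn (h : ℝ → ℂ) (J n : ℕ) (N ε R x : ℝ) : ℂ :=
  ∑ j ∈ Icc (-((n * J : ℕ) : ℤ)) (n * J : ℕ), ((1 / (n:ℝ) : ℝ) : ℂ) * Gt h N ε R x ((j:ℝ) / n)

/-- continuous operator -/
def Tc (h : ℝ → ℂ) (N ε R x : ℝ) : ℂ := ∫ t, Gt h N ε R x t

lemma annulus_open (ε R : ℝ) : IsOpen {t : ℝ | ε < |t| ∧ |t| < R} :=
  (isOpen_lt continuous_const continuous_abs).inter (isOpen_lt continuous_abs continuous_const)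

lemma Gt_bound {h : ℝ → ℂ} (hh : Continuous h) (ε R x : ℝ) (hε : 0 < ε) : ∃ B, ∀ N t, ‖Gt h N ε R x t‖ ≤ B := by
  obtain ⟨B, hB⟩ := (isCompact_Icc (a := x - |R|) (b := x + |R|)).exists_bound_of_continuousOn hh.continuousOn
  have hB0 : 0 ≤ B := (norm_nonneg _).trans (hB x ⟨by linarith [abs_nonneg R], by linarith [abs_nonneg R]⟩)
  refine ⟨B / ε, fun N t => ?_⟩
  unfold Gt
  split_ifs with ht
  · rw [norm_div, norm_mul, norm_ee, mul_one, Complex.norm_real, Real.norm_eq_abs]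
    refine div_le_div₀ hB0 (hB _ ?_) hε ht.1.le
    have h1 := abs_lt.mp ht.2
    have h2 := le_abs_self R
    exact ⟨by linarith, by linarith⟩
  · rw [norm_zero]; positivity

lemma Gt_ae {h : ℝ → ℂ} (hh : Continuous h) (N ε R x : ℝ) (hε : 0 < ε) : ∀ᵐ t : ℝ, ContinuousAt (Gt h N ε R x) t := by
  have hfin : ({ε, -ε, R, -R} : Set ℝ).Finite := by simp
  have : ∀ᵐ t : ℝ, t ∉ ({ε, -ε, R, -R} : Set ℝ) := by
    exact compl_mem_ae_iff.mpr (hfin.measure_zero volume)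
  filter_upwards [this] with t ht
  simp only [Set.mem_insert_iff, Set.mem_singleton_iff, not_or] at ht
  by_cases h1 : ε < |t| ∧ |t| < R
  · have ht0 : t ≠ 0 := by
      intro h0; rw [h0, abs_zero] at h1; linarith [h1.1]
    have hc : ContinuousAt (fun t : ℝ => h (x - t) * ee (N * t) / t) t := by
      refine ContinuousAt.div ?_ ?_ (by exact_mod_cast ht0)
      · have := ee_cont
        exact (by fun_prop : Continuous fun t : ℝ => h (x - t) * ee (N * t)).continuousAt
      · exact Complex.continuous_ofReal.continuousAt
    refine hc.congr ?_
    filter_upwards [(annulus_open ε R).mem_nhds h1] with u hu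
    unfold Gt; rw [if_pos hu]
  · have h2 : |t| < ε ∨ R < |t| := by
      by_contra h3
      push Not at h3
      have e1 : ε ≠ |t| := by
        intro h; rcases abs_choice t with h' | h' <;> rw [h'] at h
        · exact ht.1 h.symm
        · exact ht.2.1 (by linarith)
      have e2 : |t| ≠ R := by
        intro h; rcases abs_choice t with h' | h' <;> rw [h'] at h
        · exact ht.2.2.1 h
        · exact ht.2.2.2 (by linarith)
      exact h1 ⟨lt_of_le_of_ne h3.1 e1, lt_of_le_of_ne h3.2 e2⟩
    have h4 : Gt h N ε R x =ᶠ[𝓝 t] fun _ => 0 := by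
      rcases h2 with h2 | h2
      · filter_upwards [(isOpen_lt continuous_abs continuous_const).mem_nhds h2] with u hu
        unfold Gt; rw [if_neg (fun h => by have : |u| < ε := hu; linarith [h.1])]
      · filter_upwards [(isOpen_lt continuous_const continuous_abs).mem_nhds h2] with u hu
        unfold Gt; rw [if_neg (fun h => by have : R < |u| := hu; linarith [h.2])]
    exact continuousAt_const.congr h4.symm

lemma Rn_tendsto {h : ℝ → ℂ} (hh : Continuous h) (J : ℕ) (N ε R x : ℝ) (hε : 0 < ε) (hR : R ≤ J) :
    Tendsto (fun n => Rn h J n N ε R x) atTop (𝓝 (Tc h N ε R x)) := by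
  obtain ⟨B, hB⟩ := Gt_bound hh ε R x hε
  refine riemann _ J B (hB N) (fun t ht => ?_) (Gt_ae hh N ε R x hε)
  unfold Gt; rw [if_neg (fun h => by linarith [h.2])]

lemma Rn_cont {h : ℝ → ℂ} (hh : Continuous h) (J n : ℕ) (N ε R : ℝ) : Continuous (Rn h J n N ε R) := by
  unfold Rn
  refine continuous_finset_sum _ fun j _ => continuous_const.mul ?_
  unfold Gt
  split_ifs
  · have : Continuous fun x : ℝ => h (x - (j:ℝ) / n) := by fun_prop
    exact (this.mul continuous_const).div_const _
  · exact continuous_const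

lemma Rn_Ro (h : ℝ → ℂ) (J n : ℕ) (hn : 1 ≤ n) (N ε R x : ℝ) (hR : R ≤ J) (L : ℕ) (m : ℤ) (hm : m ∈ Icc (-(L:ℤ)) L) :
    ‖Rn h J n N ε R (x + m / n)‖ =
      ‖Ro (Icc (-((L + n * J : ℕ) : ℤ)) (L + n * J : ℕ)) (fun k => h (x + k / n)) (-N / n) (ε * n) (R * n) m‖ := by
  have hn0 : (0:ℝ) < n := by exact_mod_cast hn
  have hnC : (n:ℂ) ≠ 0 := by exact_mod_cast hn0.ne'
  set φ : ℤ → ℂ := fun j => ((1 / (n:ℝ) : ℝ) : ℂ) * Gt h N ε R (x + m / n) ((j:ℝ) / n) with hφ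
  have hφ0 : ∀ j : ℤ, ((n * J : ℕ) : ℤ) < |j| → φ j = 0 := by
    intro j hj
    simp only [hφ]
    unfold Gt
    rw [if_neg, mul_zero]
    rintro ⟨-, h2⟩
    rw [abs_div, abs_of_pos hn0, div_lt_iff₀ hn0] at h2
    have : (((n * J : ℕ) : ℤ) : ℝ) < ((|j| : ℤ) : ℝ) := by exact_mod_cast hj
    push_cast at this
    nlinarith
  have e1 : Rn h J n N ε R (x + m / n) = ∑ y ∈ Icc (-((L + n * J : ℕ) : ℤ)) (L + n * J : ℕ), φ (m - y) := by
    have s1 : Rn h J n N ε R (x + m / n) = ∑ y ∈ Icc (m - (n * J : ℕ)) (m + (n * J : ℕ)), φ (m - y) := by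
      unfold Rn
      refine Finset.sum_nbij' (fun j => m - j) (fun y => m - y) ?_ ?_ ?_ ?_ ?_
      · intro j hj; rw [mem_Icc] at *; omega
      · intro j hj; rw [mem_Icc] at *; omega
      · intro j _; simp
      · intro j _; simp
      · intro j _; simp [hφ]
    rw [s1]
    rw [mem_Icc] at hm
    refine Finset.sum_subset ?_ ?_
    · intro y hy; rw [mem_Icc] at *; push_cast at *; constructor <;> linarith
    · intro y _ hy
      apply hφ0
      rw [mem_Icc, not_and_or] at hy
      rw [lt_abs]
      omega
  have e2 : Ro (Icc (-((L + n * J : ℕ) : ℤ)) (L + n * J : ℕ)) (fun k => h (x + k / n)) (-N / n) (ε * n) (R * n) m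
      = ee (-N / n * m) * ∑ y ∈ Icc (-((L + n * J : ℕ) : ℤ)) (L + n * J : ℕ), φ (m - y) := by
    unfold Ro
    rw [Finset.mul_sum]
    refine Finset.sum_congr rfl fun y _ => ?_
    simp only [hφ]
    unfold Gt
    push_cast
    simp only [abs_div, abs_of_pos hn0, lt_div_iff₀ hn0, div_lt_iff₀ hn0]
    split_ifs with hc
    · rw [show x + (m:ℝ) / n - ((m:ℝ) - y) / n = x + y / n by ring,
        show -N / n * (y:ℝ) = -N / n * m + N * (((m:ℝ) - y) / n) by ring, ee_add]
      field_simp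
    · ring
  rw [e1, e2, norm_mul, norm_ee, one_mul]

end
end Carl

namespace Carl
noncomputable section
open Finset MeasureTheory Filter Topology
open scoped ENNReal

lemma trans (p : ℝ) (hp : 1 < p) : ∃ C : ℝ, 0 < C ∧ ∀ (h : ℝ → ℂ), Continuous h → ∀ (P : Finset (ℝ × ℝ × ℝ)) (J n : ℕ), 1 ≤ n →
    (∀ q ∈ P, |q.1| ≤ n ∧ 1 ≤ q.2.1 * n ∧ q.2.1 < q.2.2 ∧ q.2.2 ≤ J) →
    ∫⁻ x, (P.sup fun q => ‖Rn h J n q.1 q.2.1 q.2.2 x‖ₑ) ^ p ≤ ENNReal.ofReal C * ∫⁻ x, ‖h x‖ₑ ^ p := by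
  obtain ⟨C, hC, H⟩ := disc p hp
  have hp0 : 0 < p := by linarith
  refine ⟨C * 2, by positivity, ?_⟩
  intro h hh P J n hn hP
  have hn0 : (0:ℝ) < n := by exact_mod_cast hn
  set Φ : ℝ → ℝ≥0∞ := fun x => (P.sup fun q => ‖Rn h J n q.1 q.2.1 q.2.2 x‖ₑ) with hΦ
  have hΦc : Continuous Φ := by
    refine Continuous.finset_sup_apply fun q _ => ?_
    exact (Rn_cont hh J n _ _ _).enorm
  have hΦtop : ∀ x, Φ x ≠ ⊤ := fun x => by
    rw [← lt_top_iff_ne_top]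
    exact (Finset.sup_lt_iff (by simp)).mpr fun q _ => enorm_lt_top
  set L := n * J with hL
  set A := Icc (-(L:ℤ)) L with hA
  set Z := Icc (-((L + n * J : ℕ) : ℤ)) (L + n * J : ℕ) with hZ
  have pt : ∀ x, ∑ m ∈ A, Φ (x + m / n) ^ p ≤ ENNReal.ofReal C * ∑ y ∈ Z, ‖h (x + y / n)‖ₑ ^ p := by
    intro x
    rcases P.eq_empty_or_nonempty with h0 | hne
    · have : ∀ x, Φ x = 0 := fun x => by simp only [hΦ, h0, Finset.sup_empty]; rfl
      simp [this, ENNReal.zero_rpow_of_pos hp0]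
    have := H A Z (fun k => h (x + k / n)) (fun m => (Φ (x + m / n)).toReal) (fun _ => ENNReal.toReal_nonneg) (by
      intro m hm
      obtain ⟨q, hq, hq2⟩ := Finset.exists_mem_eq_sup P hne (fun q => ‖Rn h J n q.1 q.2.1 q.2.2 (x + m / n)‖ₑ)
      obtain ⟨h1, h2, h3, h4⟩ := hP q hq
      refine ⟨-q.1 / n, q.2.1 * n, q.2.2 * n, ?_, h2, mul_lt_mul_of_pos_right h3 hn0, ?_⟩
      · rw [abs_div, abs_neg, abs_of_pos hn0, div_le_one hn0]; exact h1
      · rw [← Rn_Ro h J n hn q.1 q.2.1 q.2.2 x h4 L m hm]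
        simp only [hΦ]
        rw [hq2, toReal_enorm])
    have h2 := ENNReal.ofReal_le_ofReal this
    rw [ENNReal.ofReal_mul hC.le, ENNReal.ofReal_sum_of_nonneg (fun _ _ => Real.rpow_nonneg ENNReal.toReal_nonneg _),
      ENNReal.ofReal_sum_of_nonneg (fun _ _ => by positivity)] at h2
    convert h2 using 2
    · rw [← ENNReal.ofReal_rpow_of_nonneg ENNReal.toReal_nonneg hp0.le, ENNReal.ofReal_toReal (hΦtop _)]
    · refine Finset.sum_congr rfl fun y _ => ?_
      rw [← ENNReal.ofReal_rpow_of_nonneg (norm_nonneg _) hp0.le, ofReal_norm]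
  have hmeas : Measurable fun x => Φ x ^ p := hΦc.measurable.pow_const p
  have hmeas2 : Measurable fun x => ‖h x‖ₑ ^ p := hh.enorm.measurable.pow_const p
  have tr : ∀ (u : ℝ → ℝ≥0∞) (c : ℝ), ∫⁻ x, u (x + c) = ∫⁻ x, u x := fun u c => lintegral_add_right_eq_self u c
  have i1 : ∫⁻ x, ∑ m ∈ A, Φ (x + m / n) ^ p = (A.card : ℝ≥0∞) * ∫⁻ x, Φ x ^ p := by
    rw [lintegral_finset_sum A (f := fun (m : ℤ) x => Φ (x + m / n) ^ p) (fun m _ => hmeas.comp (measurable_id.add_const _))]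
    rw [Finset.sum_congr rfl fun (m : ℤ) _ => tr (fun x => Φ x ^ p) ((m:ℝ) / n)]
    simp
  have i2 : ∫⁻ x, ∑ m ∈ Z, ‖h (x + m / n)‖ₑ ^ p = (Z.card : ℝ≥0∞) * ∫⁻ x, ‖h x‖ₑ ^ p := by
    rw [lintegral_finset_sum Z (f := fun (m : ℤ) x => ‖h (x + m / n)‖ₑ ^ p) (fun m _ => hmeas2.comp (measurable_id.add_const _))]
    rw [Finset.sum_congr rfl fun (m : ℤ) _ => tr (fun x => ‖h x‖ₑ ^ p) ((m:ℝ) / n)]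
    simp
  have i3 := lintegral_mono (μ := volume) pt
  rw [lintegral_const_mul' _ _ ENNReal.ofReal_ne_top, i1, i2] at i3
  have cA : A.card = 2 * L + 1 := by rw [hA, Int.card_Icc]; omega
  have cZ : Z.card ≤ 2 * A.card := by rw [cA, hZ, Int.card_Icc, ← hL]; omega
  have i4 : (A.card : ℝ≥0∞) * ∫⁻ x, Φ x ^ p ≤ (A.card : ℝ≥0∞) * (ENNReal.ofReal (C * 2) * ∫⁻ x, ‖h x‖ₑ ^ p) := by
    refine i3.trans ?_
    have : (Z.card : ℝ≥0∞) ≤ 2 * A.card := by exact_mod_cast cZ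
    rw [ENNReal.ofReal_mul hC.le]
    calc ENNReal.ofReal C * ((Z.card : ℝ≥0∞) * ∫⁻ x, ‖h x‖ₑ ^ p) ≤ ENNReal.ofReal C * ((2 * A.card) * ∫⁻ x, ‖h x‖ₑ ^ p) := by gcongr
      _ = _ := by rw [show ENNReal.ofReal 2 = 2 by simp]; ring
  exact (ENNReal.mul_le_mul_iff_right (by rw [cA]; simp) (ENNReal.natCast_ne_top _)).mp i4

lemma fin_bound (p : ℝ) (hp : 1 < p) : ∃ C : ℝ, 0 < C ∧ ∀ (h : ℝ → ℂ), Continuous h → ∀ (P : Finset (ℝ × ℝ × ℝ)),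
    (∀ q ∈ P, 0 < q.2.1 ∧ q.2.1 < q.2.2) →
    ∫⁻ x, (P.sup fun q => ‖Tc h q.1 q.2.1 q.2.2 x‖ₑ) ^ p ≤ ENNReal.ofReal C * ∫⁻ x, ‖h x‖ₑ ^ p := by
  obtain ⟨C, hC, H⟩ := trans p hp
  refine ⟨C, hC, fun h hh P hP => ?_⟩
  set J := P.sup fun q => ⌈q.2.2⌉₊ with hJ
  have hJ' : ∀ q ∈ P, q.2.2 ≤ J := fun q hq => (Nat.le_ceil _).trans (by exact_mod_cast Finset.le_sup (f := fun q : ℝ × ℝ × ℝ => ⌈q.2.2⌉₊) hq)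
  have hlim : ∀ x, Tendsto (fun n => (P.sup fun q => ‖Rn h J n q.1 q.2.1 q.2.2 x‖ₑ) ^ p) atTop (𝓝 ((P.sup fun q => ‖Tc h q.1 q.2.1 q.2.2 x‖ₑ) ^ p)) := by
    intro x
    refine (ENNReal.continuous_rpow_const.tendsto _).comp ?_
    refine Filter.Tendsto.finset_sup_nhds_apply fun q hq => ?_
    exact (Rn_tendsto hh J _ _ _ x (hP q hq).1 (hJ' q hq)).enorm
  have hev : ∀ᶠ n : ℕ in atTop, 1 ≤ n ∧ ∀ q ∈ P, |q.1| ≤ n ∧ 1 ≤ q.2.1 * n ∧ q.2.1 < q.2.2 ∧ q.2.2 ≤ J := by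
    refine (eventually_ge_atTop 1).and ?_
    rw [Filter.eventually_all_finset]
    intro q hq
    obtain ⟨h1, h2⟩ := hP q hq
    filter_upwards [eventually_ge_atTop ⌈|q.1|⌉₊, eventually_ge_atTop ⌈1 / q.2.1⌉₊] with n n1 n2
    refine ⟨Nat.ceil_le.mp n1, ?_, h2, hJ' q hq⟩
    have := Nat.ceil_le.mp n2
    rwa [div_le_iff₀ h1, mul_comm] at this
  calc ∫⁻ x, (P.sup fun q => ‖Tc h q.1 q.2.1 q.2.2 x‖ₑ) ^ p
      = ∫⁻ x, liminf (fun n => (P.sup fun q => ‖Rn h J n q.1 q.2.1 q.2.2 x‖ₑ) ^ p) atTop :=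
        lintegral_congr fun x => (hlim x).liminf_eq.symm
    _ ≤ liminf (fun n => ∫⁻ x, (P.sup fun q => ‖Rn h J n q.1 q.2.1 q.2.2 x‖ₑ) ^ p) atTop := by
        refine lintegral_liminf_le fun n => ?_
        refine Measurable.pow_const (Continuous.measurable ?_) p
        exact Continuous.finset_sup_apply fun q _ => (Rn_cont hh J n _ _ _).enorm
    _ ≤ ENNReal.ofReal C * ∫⁻ x, ‖h x‖ₑ ^ p := by
        refine liminf_le_of_frequently_le' (Eventually.frequently ?_)
        filter_upwards [hev] with n hn
        exact H h hh P J n hn.1 hn.2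

lemma Tc_meas {h : ℝ → ℂ} (hh : Continuous h) (N ε R : ℝ) (hε : 0 < ε) : Measurable (Tc h N ε R) := by
  refine measurable_of_tendsto_metrizable (f := fun n => Rn h ⌈R⌉₊ n N ε R) (fun n => (Rn_cont hh _ n N ε R).measurable) ?_
  rw [tendsto_pi_nhds]
  exact fun x => Rn_tendsto hh _ N ε R x hε (Nat.le_ceil R)

lemma Gt_meas {h : ℝ → ℂ} (hh : Continuous h) (N ε R x : ℝ) : Measurable (Gt h N ε R x) := by
  unfold Gt
  refine Measurable.ite (annulus_open ε R).measurableSet ?_ measurable_const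
  have h1 : Measurable fun t : ℝ => h (x - t) := hh.measurable.comp (measurable_const.sub measurable_id)
  have h2 : Measurable fun t : ℝ => ee (N * t) := ee_cont.measurable.comp (measurable_const.mul measurable_id)
  exact (h1.mul h2).div Complex.measurable_ofReal

/-- rational parameters suffice -/
lemma Tc_rat {h : ℝ → ℂ} (hh : Continuous h) (N ε R x : ℝ) (hε : 0 < ε) (hR : ε < R) :
    ‖Tc h N ε R x‖ₑ ≤ ⨆ q : {q : ℚ × ℚ × ℚ // 0 < q.2.1 ∧ q.2.1 < q.2.2}, ‖Tc h q.1.1 q.1.2.1 q.1.2.2 x‖ₑ := by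
  have hd : Dense (Set.range ((↑) : ℚ → ℝ)) := Rat.denseRange_cast
  obtain ⟨uN, -, hN', hN⟩ := hd.exists_seq_strictMono_tendsto N
  obtain ⟨uε, -, hε', hεt⟩ := hd.exists_seq_strictAnti_tendsto ε
  obtain ⟨uR, -, hR', hRt⟩ := hd.exists_seq_strictMono_tendsto R
  have hNr := fun n => (hN' n).2
  have hεl : ∀ n, ε < uε n := fun n => (hε' n).1
  have hεr := fun n => (hε' n).2
  have hRl : ∀ n, uR n < R := fun n => (hR' n).1
  have hRr := fun n => (hR' n).2
  obtain ⟨B, hB⟩ := Gt_bound hh ε R x hε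
  have hlim : Tendsto (fun n => Tc h (uN n) (uε n) (uR n) x) atTop (𝓝 (Tc h N ε R x)) := by
    refine tendsto_integral_of_dominated_convergence ((Set.Icc (-R) R).indicator fun _ => B)
      (fun n => (Gt_meas hh _ _ _ x).aestronglyMeasurable) ?_ ?_ ?_
    · refine (integrable_indicator_iff measurableSet_Icc).mpr ?_
      exact integrableOn_const (by rw [Real.volume_Icc]; exact ENNReal.ofReal_ne_top)
    · intro n
      refine Eventually.of_forall fun t => ?_
      by_cases hc : uε n < |t| ∧ |t| < uR n
      · have hc' : ε < |t| ∧ |t| < R := ⟨(hεl n).trans hc.1, hc.2.trans (hRl n)⟩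
        have := hB (uN n) t
        unfold Gt at this ⊢
        rw [if_pos hc'] at this
        rw [if_pos hc, Set.indicator_of_mem (by rw [Set.mem_Icc, ← abs_le]; exact hc'.2.le)]
        exact this
      · unfold Gt; rw [if_neg hc, norm_zero]
        exact Set.indicator_nonneg (fun _ _ => (norm_nonneg _).trans (hB 0 0)) _
    · refine Eventually.of_forall fun t => ?_
      by_cases hc : ε < |t| ∧ |t| < R
      · have e1 : ∀ᶠ n in atTop, uε n < |t| := hεt.eventually_lt_const hc.1
        have e2 : ∀ᶠ n in atTop, |t| < uR n := hRt.eventually_const_lt hc.2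
        have e3 : Tendsto (fun n => h (x - t) * ee (uN n * t) / t) atTop (𝓝 (h (x - t) * ee (N * t) / t)) := by
          refine Tendsto.div_const (Tendsto.const_mul _ ?_) _
          exact (ee_cont.tendsto _).comp (hN.mul_const t)
        have e4 : Gt h N ε R x t = h (x - t) * ee (N * t) / t := by unfold Gt; rw [if_pos hc]
        rw [e4]
        refine e3.congr' ?_
        filter_upwards [e1, e2] with n n1 n2
        unfold Gt; rw [if_pos ⟨n1, n2⟩]
      · have e4 : Gt h N ε R x t = 0 := by unfold Gt; rw [if_neg hc]
        rw [e4]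
        refine tendsto_const_nhds.congr fun n => ?_
        unfold Gt; rw [if_neg (fun h => hc ⟨(hεl n).trans h.1, h.2.trans (hRl n)⟩)]
  refine le_of_tendsto hlim.enorm ?_
  have e5 : ∀ᶠ n in atTop, uε n < (ε + R) / 2 := hεt.eventually_lt_const (by linarith)
  have e6 : ∀ᶠ n in atTop, (ε + R) / 2 < uR n := hRt.eventually_const_lt (by linarith)
  filter_upwards [e5, e6] with n n1 n2
  obtain ⟨a, ha⟩ := hNr n
  obtain ⟨b, hb⟩ := hεr n
  obtain ⟨c, hc⟩ := hRr n
  have hb0 : 0 < b := by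
    have := hεl n
    rw [← hb] at this
    exact_mod_cast hε.trans this
  have hbc : b < c := by
    have : (b:ℝ) < c := by rw [hb, hc]; linarith
    exact_mod_cast this
  rw [← ha, ← hb, ← hc]
  exact le_iSup (fun q : {q : ℚ × ℚ × ℚ // 0 < q.2.1 ∧ q.2.1 < q.2.2} => ‖Tc h q.1.1 q.1.2.1 q.1.2.2 x‖ₑ) ⟨(a, b, c), hb0, hbc⟩

end
end Carl

namespace Carl
noncomputable section
open Finset MeasureTheory Filter Topology
open scoped ENNReal

lemma contin (p : ℝ) (hp : 1 < p) : ∃ C : ℝ, 0 < C ∧ ∀ (h : ℝ → ℂ), Continuous h →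
    ∫⁻ x, (⨆ q : {q : ℚ × ℚ × ℚ // 0 < q.2.1 ∧ q.2.1 < q.2.2}, ‖Tc h q.1.1 q.1.2.1 q.1.2.2 x‖ₑ) ^ p ≤
      ENNReal.ofReal C * ∫⁻ x, ‖h x‖ₑ ^ p := by
  classical
  obtain ⟨C, hC, H⟩ := fin_bound p hp
  have hp0 : 0 < p := by linarith
  refine ⟨C, hC, fun h hh => ?_⟩
  set ι := {q : ℚ × ℚ × ℚ // 0 < q.2.1 ∧ q.2.1 < q.2.2}
  set F : ι → ℝ → ℝ≥0∞ := fun q x => ‖Tc h q.1.1 q.1.2.1 q.1.2.2 x‖ₑ with hF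
  have hFm : ∀ q, Measurable (F q) := fun q => (Tc_meas hh _ _ _ (by exact_mod_cast q.2.1)).enorm
  have e : ∀ x, (⨆ q, F q x) ^ p = ⨆ t : Finset ι, (t.sup fun q => F q x) ^ p := by
    intro x
    rw [iSup_eq_iSup_finset]
    have := (ENNReal.orderIsoRpow p hp0).map_iSup (fun t : Finset ι => ⨆ q ∈ t, F q x)
    simp only [ENNReal.orderIsoRpow_apply] at this
    rw [this]
    simp only [Finset.sup_eq_iSup]
  change ∫⁻ x, (⨆ q, F q x) ^ p ≤ _
  rw [lintegral_congr e, lintegral_iSup_directed]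
  · refine iSup_le fun t => ?_
    have := H h hh (t.image fun q => ((q.1.1 : ℝ), (q.1.2.1 : ℝ), (q.1.2.2 : ℝ))) (by
      intro q hq
      obtain ⟨r, -, rfl⟩ := mem_image.mp hq
      exact ⟨Rat.cast_pos.mpr r.2.1, Rat.cast_lt.mpr r.2.2⟩)
    simp only [Finset.sup_image] at this
    exact this
  · intro t
    refine (Measurable.pow_const ?_ p).aemeasurable
    simp only [Finset.sup_eq_iSup]
    exact Measurable.biSup _ t.countable_toSet fun q _ => hFm q
  · intro t t'
    refine ⟨t ∪ t', fun x => ?_, fun x => ?_⟩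
    · exact ENNReal.rpow_le_rpow (Finset.sup_mono subset_union_left) hp0.le
    · exact ENNReal.rpow_le_rpow (Finset.sup_mono subset_union_right) hp0.le

lemma twist (f : ℝ → ℂ) (a N ε R x : ℝ) :
    ‖∫ t in {t : ℝ | ε < |t| ∧ |t| < R}, f (x - t) * Complex.exp (Complex.I * ((N * t + a * t ^ 2 : ℝ) : ℂ)) / (t : ℂ)‖ₑ
      = ‖Tc (fun y => f y * ee (a * y ^ 2)) (N + 2 * a * x) ε R x‖ₑ := by
  have h1 : ∀ t : ℝ, f (x - t) * Complex.exp (Complex.I * ((N * t + a * t ^ 2 : ℝ) : ℂ)) / (t : ℂ) =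
      ee (-(a * x ^ 2)) * (f (x - t) * ee (a * (x - t) ^ 2) * ee ((N + 2 * a * x) * t) / t) := by
    intro t
    have : Complex.exp (Complex.I * ((N * t + a * t ^ 2 : ℝ) : ℂ)) = ee (-(a * x ^ 2)) * ee (a * (x - t) ^ 2) * ee ((N + 2 * a * x) * t) := by
      rw [← ee_add, ← ee_add]; unfold ee; congr 1; rw [mul_comm]; congr 2; ring
    rw [this]; ring
  rw [← integral_indicator (annulus_open ε R).measurableSet]
  have h2 : ∀ t : ℝ, ({t : ℝ | ε < |t| ∧ |t| < R}).indicator (fun t : ℝ => f (x - t) * Complex.exp (Complex.I * ((N * t + a * t ^ 2 : ℝ) : ℂ)) / (t : ℂ)) t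
      = ee (-(a * x ^ 2)) * Gt (fun y => f y * ee (a * y ^ 2)) (N + 2 * a * x) ε R x t := by
    intro t
    rw [Set.indicator_apply]
    unfold Gt
    simp only [Set.mem_setOf_eq]
    split_ifs
    · exact h1 t
    · simp
  rw [integral_congr_ae (Eventually.of_forall h2), integral_const_mul, enorm_mul]
  have : ‖ee (-(a * x ^ 2))‖ₑ = 1 := by rw [← ofReal_norm, norm_ee]; simp
  rw [this, one_mul]; rfl

theorem carleson_final (p : ℝ) (hp : 1 < p) : ∃ C : ℝ, 0 < C ∧ ∀ (a : ℝ) (f : ℝ → ℂ), Continuous f →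
    (∫⁻ x, (⨆ (N : ℝ) (ε : ℝ) (R : ℝ) (_ : 0 < ε) (_ : ε < R),
      ‖∫ t in {t : ℝ | ε < |t| ∧ |t| < R}, f (x - t) * Complex.exp (Complex.I * ((N * t + a * t ^ 2 : ℝ) : ℂ)) / (t : ℂ)‖ₑ) ^ p) ^ p⁻¹
      ≤ ENNReal.ofReal C * eLpNorm f (ENNReal.ofReal p) volume := by
  obtain ⟨C, hC, H⟩ := contin p hp
  have hp0 : 0 < p := by linarith
  refine ⟨C ^ p⁻¹, by positivity, fun a f hf => ?_⟩
  set h : ℝ → ℂ := fun y => f y * ee (a * y ^ 2) with hh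
  have hc : Continuous h := hf.mul (ee_cont.comp (by fun_prop))
  have h1 := H h hc
  have h2 : ∀ x, ‖h x‖ₑ = ‖f x‖ₑ := fun x => by
    simp only [hh]
    rw [enorm_mul, show ‖ee (a * x ^ 2)‖ₑ = 1 by rw [← ofReal_norm, norm_ee]; simp, mul_one]
  simp only [h2] at h1
  have h3 : eLpNorm f (ENNReal.ofReal p) volume = (∫⁻ x, ‖f x‖ₑ ^ p) ^ p⁻¹ := by
    rw [eLpNorm_eq_lintegral_rpow_enorm_toReal (by simpa using hp0) ENNReal.ofReal_ne_top, ENNReal.toReal_ofReal hp0.le, one_div]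
  rw [h3, ← ENNReal.ofReal_rpow_of_pos hC, ← ENNReal.mul_rpow_of_nonneg _ _ (by positivity)]
  refine ENNReal.rpow_le_rpow (le_trans (lintegral_mono fun x => ?_) h1) (by positivity)
  refine ENNReal.rpow_le_rpow ?_ hp0.le
  refine iSup_le fun N => iSup_le fun ε => iSup_le fun R => iSup_le fun hε => iSup_le fun hR => ?_
  rw [twist]
  exact Tc_rat hc _ _ _ x hε hR

end
end Carl

open MeasureTheory Complex
open scoped ENNReal NNReal

/-- **Uniform quadratic Carleson bounds.** For every `1 < p < ∞` there is a constant `C = C(p)`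
such that for every quadratic coefficient `a ∈ ℝ` and every Schwartz function `f`, the
(maximally truncated) operator
`C_a f(x) = sup_{N, 0<ε<R} |∫_{ε<|t|<R} f(x-t) e^{i(Nt+at²)} dt/t|`
is bounded on `L^p` with a constant independent of `a`. -/
theorem statement4 (p : ℝ) (hp : 1 < p) :
    ∃ C : ℝ, 0 < C ∧
      ∀ a : ℝ, ∀ f : SchwartzMap ℝ ℂ,
        (∫⁻ x : ℝ,
            (⨆ (N : ℝ) (ε : ℝ) (R : ℝ) (_ : 0 < ε) (_ : ε < R),
              (‖∫ t in {t : ℝ | ε < |t| ∧ |t| < R},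
                  f (x - t) * Complex.exp (Complex.I * ((N * t + a * t ^ 2 : ℝ) : ℂ))
                    / (t : ℂ)‖₊ : ℝ≥0∞)) ^ p) ^ p⁻¹
          ≤ ENNReal.ofReal C * eLpNorm (f : ℝ → ℂ) (ENNReal.ofReal p) volume := by
  obtain ⟨C, hC, H⟩ := Carl.carleson_final p hp
  exact ⟨C, hC, fun a f => H a f f.continuous⟩
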